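/- Let δ₃ = 0.074267, δ₄ = 0.103974, δ_ℓ = 0.124821 for ℓ ≥ 5, and θ_ℓ = ℓ − δ_ℓ. For every integer ℓ ≥ 3, setting α = 16θ_ℓ/(17θ_ℓ − 16), the triple (ℓ; α, α) is admissible: for every ε > 0 there exists M such that for every integer m ≥ M and every integer a with gcd(a,m) = 1, there exist a prime p ≤ m^{α+ε} and a positive integer s ≤ m^{α+ε} which is a product of at most ℓ primes (counted with multiplicity), such that p·s ≡ a (mod m). -/

import Mathlib

/-- The Greaves sieve constants δ_ℓ. -/
noncomputable def greavesDelta (l : ℕ) : ℝ :=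
  if l ≤ 2 then 0.044560
  else if l = 3 then 0.074267
  else if l = 4 then 0.103974
  else 0.124821

/-- θ_ℓ = ℓ - δ_ℓ. -/
noncomputable def greavesTheta (l : ℕ) : ℝ := l - greavesDelta l


open Finset

set_option linter.unusedSectionVars false
set_option linter.unusedSimpArgs false
set_option linter.unusedVariables false

/-! # Part 1: basics -/

theorem divisor_bound (ε : ℝ) (hε : 0 < ε) :
    ∃ C : ℝ, 1 ≤ C ∧ ∀ n : ℕ, n ≠ 0 → ((n.divisors.card : ℕ) : ℝ) ≤ C * (n : ℝ) ^ ε := by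
  -- constant for small primes
  obtain ⟨C1, hC1, hC1'⟩ : ∃ C1 : ℝ, 1 ≤ C1 ∧ ∀ a : ℕ, ((a : ℝ) + 1) ≤ C1 * (2 : ℝ) ^ (ε * a) := by
    refine ⟨1 + 1 / (ε * Real.log 2), ?_, ?_⟩
    · have : 0 < ε * Real.log 2 := mul_pos hε (Real.log_pos (by norm_num))
      have := one_div_pos.mpr this
      linarith
    · intro a
      have h2 : 0 < ε * Real.log 2 := mul_pos hε (Real.log_pos (by norm_num))
      have h3 : (2 : ℝ) ^ (ε * a) = Real.exp ((ε * Real.log 2) * a) := by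
        rw [Real.rpow_def_of_pos (by norm_num)]; ring_nf
      have h4 := Real.add_one_le_exp ((ε * Real.log 2) * a)
      rw [h3]
      set c := ε * Real.log 2
      have h5 : (1 + 1 / c) * (c * a + 1) ≤ (1 + 1 / c) * Real.exp (c * a) :=
        mul_le_mul_of_nonneg_left h4 (by positivity)
      have h6 : (1 + 1 / c) * (c * a + 1) = c * a + 1 + a + 1 / c := by
        field_simp
        ring
      have : 0 ≤ c * a := by positivity
      have : 0 < 1 / c := by positivity
      linarith
  set B : ℕ := ⌈(2 : ℝ) ^ (1 / ε)⌉₊ with hB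
  refine ⟨C1 ^ B, one_le_pow₀ hC1, ?_⟩
  intro n hn
  rw [Nat.card_divisors hn]
  have hnprod : (n : ℝ) ^ ε = ∏ p ∈ n.primeFactors, ((p : ℝ) ^ (ε * (n.factorization p : ℝ))) := by
    conv_lhs => rw [← Nat.prod_factorization_pow_eq_self hn]
    rw [Finsupp.prod, Nat.support_factorization]
    push_cast
    rw [← Real.finsetProd_rpow _ _ (fun i _ => by positivity)]
    apply Finset.prod_congr rfl
    intro p _
    rw [mul_comm, Real.rpow_mul (by positivity), Real.rpow_natCast]
  rw [hnprod]
  push_cast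
  have key : ∀ p ∈ n.primeFactors, ((n.factorization p : ℝ) + 1) ≤
      (if p < B then C1 else 1) * ((p : ℝ) ^ (ε * (n.factorization p : ℝ))) := by
    intro p hp
    have hpp := Nat.prime_of_mem_primeFactors hp
    have hp2 : (2 : ℝ) ≤ p := by exact_mod_cast hpp.two_le
    split_ifs with h
    · refine (hC1' _).trans ?_
      gcongr
    · push Not at h
      have h1 : (2 : ℝ) ^ (1 / ε) ≤ p := (Nat.le_ceil _).trans (by exact_mod_cast h)
      have h2 : (2 : ℝ) ≤ (p : ℝ) ^ ε := by
        calc (2 : ℝ) = ((2 : ℝ) ^ (1 / ε)) ^ ε := by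
              rw [← Real.rpow_mul (by norm_num)]; field_simp; norm_num
          _ ≤ _ := by gcongr
      rw [one_mul, Real.rpow_mul (by positivity), Real.rpow_natCast]
      calc ((n.factorization p : ℝ) + 1) ≤ 2 ^ (n.factorization p) := by
            exact_mod_cast Nat.lt_two_pow_self
        _ ≤ _ := by gcongr
  refine (Finset.prod_le_prod (fun i _ => by positivity) key).trans ?_
  rw [Finset.prod_mul_distrib]
  refine mul_le_mul_of_nonneg_right ?_ (Finset.prod_nonneg fun i _ => by positivity)
  rw [Finset.prod_ite]
  simp only [prod_const, one_pow, mul_one]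
  apply pow_le_pow_right₀ hC1
  calc _ ≤ (Finset.range B).card := Finset.card_le_card (by intro x; simp)
    _ = B := by simp

/-- `Q` dominates all relevant divisor counts. -/
structure Good (m : ℕ) (Q : ℝ) : Prop where
  hm : 16 ≤ m
  tau : ∀ n : ℕ, n ≠ 0 → n ≤ m ^ 12 → ((n.divisors.card : ℕ) : ℝ) ≤ Q
  log : Real.log m ≤ Q

theorem Good.two_le {m : ℕ} {Q : ℝ} (h : Good m Q) : 2 ≤ Q := by
  have := h.tau 2 (by norm_num) (by
    have := h.hm
    calc 2 ≤ m := by omega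
      _ = m ^ 1 := by simp
      _ ≤ m ^ 12 := Nat.pow_le_pow_right (by omega) (by norm_num))
  have h2 : (Nat.divisors 2).card = 2 := by decide
  rw [h2] at this
  exact_mod_cast this

theorem good_eventually (ε : ℝ) (hε : 0 < ε) :
    ∃ M : ℕ, ∀ m : ℕ, M ≤ m → Good m ((m : ℝ) ^ ε) := by
  obtain ⟨C, hC, hC'⟩ := divisor_bound (ε / 24) (by positivity)
  have h1 : ∀ᶠ x : ℝ in Filter.atTop, ‖Real.log x‖ ≤ 1 * ‖x ^ ε‖ :=
    (isLittleO_log_rpow_atTop hε).bound one_pos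
  have h2 : ∀ᶠ x : ℝ in Filter.atTop, C ≤ x ^ (ε / 2) :=
    (tendsto_rpow_atTop (by positivity)).eventually_ge_atTop C
  have h3 := tendsto_natCast_atTop_atTop (R := ℝ) |>.eventually (h1.and h2)
  obtain ⟨M, hM⟩ := Filter.eventually_atTop.mp (h3.and (Filter.eventually_ge_atTop 16))
  refine ⟨M, fun m hm => ?_⟩
  obtain ⟨⟨ha, hb⟩, hc⟩ := hM m hm
  have hm0 : (0 : ℝ) < m := by exact_mod_cast (show 0 < m by omega)
  refine ⟨hc, ?_, ?_⟩
  · intro n hn hnm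
    refine (hC' n hn).trans ?_
    have : (n : ℝ) ^ (ε / 24) ≤ (m : ℝ) ^ (ε / 2) := by
      calc (n : ℝ) ^ (ε / 24) ≤ ((m : ℝ) ^ 12) ^ (ε / 24) := by
            gcongr; exact_mod_cast hnm
        _ = _ := by
            rw [← Real.rpow_natCast, ← Real.rpow_mul hm0.le]; congr 1; push_cast; ring
    calc C * (n : ℝ) ^ (ε / 24) ≤ (m : ℝ) ^ (ε / 2) * (m : ℝ) ^ (ε / 2) := by gcongr
      _ = _ := by rw [← Real.rpow_add hm0]; congr 1; ring
  · have h := ha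
    rw [one_mul, Real.norm_of_nonneg (Real.log_natCast_nonneg m),
      Real.norm_of_nonneg (by positivity)] at h
    exact h

/-- dyadic summation -/
theorem dyadic_le (F : ℕ → ℝ) (hF : ∀ n, 0 ≤ F n) (N : ℕ) (B : ℝ) (hB0 : 0 ≤ B)
    (hB : ∀ H : ℕ, 1 ≤ H → H ≤ N → ∑ h ∈ (Icc 1 N).filter (fun h => H ≤ h ∧ h < 2 * H), F h ≤ B) :
    ∑ h ∈ Icc 1 N, F h ≤ (Nat.log 2 N + 1) * B := by
  have h1 : ∑ h ∈ Icc 1 N, F h = ∑ j ∈ range (Nat.log 2 N + 1),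
      ∑ h ∈ (Icc 1 N).filter (fun h => Nat.log 2 h = j), F h := by
    rw [Finset.sum_fiberwise_of_maps_to]
    intro x hx
    simp only [Finset.mem_Icc] at hx
    simp only [Finset.mem_range]
    have := Nat.log_mono_right (b := 2) hx.2
    omega
  rw [h1]
  have h2 : ∀ j ∈ range (Nat.log 2 N + 1),
      ∑ h ∈ (Icc 1 N).filter (fun h => Nat.log 2 h = j), F h ≤ B := by
    intro j _
    by_cases hj : 2 ^ j ≤ N
    · refine le_trans (Finset.sum_le_sum_of_subset_of_nonneg ?_ fun i _ _ => hF i)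
        (hB (2 ^ j) Nat.one_le_two_pow hj)
      intro x
      simp only [Finset.mem_filter, Finset.mem_Icc]
      rintro ⟨⟨hx1, hx2⟩, hx3⟩
      refine ⟨⟨hx1, hx2⟩, ?_, ?_⟩
      · rw [← hx3]; exact Nat.pow_log_le_self 2 (by omega)
      · have := Nat.lt_pow_succ_log_self (b := 2) (by norm_num) x
        rw [hx3, pow_succ] at this; omega
    · rw [Finset.sum_eq_zero]
      · exact hB0
      · intro x
        simp only [Finset.mem_filter, Finset.mem_Icc]
        rintro ⟨⟨hx1, hx2⟩, hx3⟩
        exfalso; apply hj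
        rw [← hx3]
        exact (Nat.pow_log_le_self 2 (by omega)).trans hx2
  calc _ ≤ ∑ j ∈ range (Nat.log 2 N + 1), B := Finset.sum_le_sum h2
    _ = _ := by simp

theorem natlog_le {m N : ℕ} {Q : ℝ} (h : Good m Q) (hN : N ≤ m) : ((Nat.log 2 N : ℝ) + 1) ≤ 2 * Q := by
  have h0 : ((Nat.log 2 N : ℕ) : ℝ) ≤ Real.logb 2 m := by
    have h1 : Nat.log 2 N ≤ Nat.log 2 m := Nat.log_mono_right hN
    have h2 := Real.natLog_le_logb m 2
    calc ((Nat.log 2 N : ℕ) : ℝ) ≤ (Nat.log 2 m : ℕ) := by exact_mod_cast h1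
      _ ≤ _ := by exact_mod_cast h2
  have hm : (1 : ℝ) ≤ m := by exact_mod_cast (by have := h.hm; omega)
  have hl2 : 0.69 < Real.log 2 := by have := Real.log_two_gt_d9; linarith
  have : Real.logb 2 m ≤ 1.5 * Real.log m := by
    rw [Real.logb, div_le_iff₀ (by linarith)]
    nlinarith [Real.log_nonneg hm]
  have := h.log
  have := h.two_le
  linarith

theorem dyadic_good {m : ℕ} {Q : ℝ} (hg : Good m Q) (F : ℕ → ℝ) (hF : ∀ n, 0 ≤ F n) (N : ℕ)
    (hN : N ≤ m) (B : ℝ) (hB0 : 0 ≤ B)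
    (hB : ∀ H : ℕ, 1 ≤ H → H ≤ N → ∑ h ∈ (Icc 1 N).filter (fun h => H ≤ h ∧ h < 2 * H), F h ≤ B) :
    ∑ h ∈ Icc 1 N, F h ≤ 2 * Q * B :=
  (dyadic_le F hF N B hB0 hB).trans (mul_le_mul_of_nonneg_right (natlog_le hg hN) hB0)



/-! # Part 2: additive characters -/

noncomputable def ee {m : ℕ} [NeZero m] (x : ZMod m) : ℂ := ZMod.stdAddChar x

section chars
variable {m : ℕ} [NeZero m]

theorem ee_add (x y : ZMod m) : ee (x + y) = ee x * ee y := by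
  simp [ee, AddChar.map_add_eq_mul]

theorem ee_zero : ee (0 : ZMod m) = 1 := by simp [ee]

theorem norm_ee (x : ZMod m) : ‖ee x‖ = 1 := by
  rw [ee, ZMod.stdAddChar_apply]; exact Circle.norm_coe _

theorem conj_ee (x : ZMod m) : (starRingEnd ℂ) (ee x) = ee (-x) := by
  unfold ee
  rw [AddChar.map_neg_eq_conj]

theorem sum_ee (b : ZMod m) : ∑ w : ZMod m, ee (w * b) = if b = 0 then (m : ℂ) else 0 := by
  have := AddChar.sum_mulShift b (ZMod.isPrimitive_stdAddChar m)
  simp only [ZMod.card] at this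
  simpa [ee] using this

theorem parseval {ι : Type*} (s : Finset ι) (β : ι → ℂ) (φ : ι → ZMod m) :
    ∑ w : ZMod m, ‖∑ i ∈ s, β i * ee (w * φ i)‖ ^ 2 =
      m * ∑ c : ZMod m, ‖∑ i ∈ s.filter (fun i => φ i = c), β i‖ ^ 2 := by
  have e1 : ∀ z : ℂ, ((‖z‖ ^ 2 : ℝ) : ℂ) = z * (starRingEnd ℂ) z := by
    intro z; rw [Complex.mul_conj, Complex.normSq_eq_norm_sq]
  have : ((∑ w : ZMod m, ‖∑ i ∈ s, β i * ee (w * φ i)‖ ^ 2 : ℝ) : ℂ) =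
      ((m * ∑ c : ZMod m, ‖∑ i ∈ s.filter (fun i => φ i = c), β i‖ ^ 2 : ℝ) : ℂ) := by
    push_cast [-Complex.ofReal_pow]
    simp_rw [e1]
    simp_rw [map_sum, Finset.sum_mul_sum, map_mul, conj_ee]
    have l1 : ∑ w : ZMod m, ∑ i ∈ s, ∑ j ∈ s, β i * ee (w * φ i) *
        ((starRingEnd ℂ) (β j) * ee (-(w * φ j))) =
        ∑ i ∈ s, ∑ j ∈ s, β i * (starRingEnd ℂ) (β j) *
          (if φ i - φ j = 0 then (m : ℂ) else 0) := by
      rw [Finset.sum_comm]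
      refine Finset.sum_congr rfl fun i _ => ?_
      rw [Finset.sum_comm]
      refine Finset.sum_congr rfl fun j _ => ?_
      rw [← sum_ee, Finset.mul_sum]
      refine Finset.sum_congr rfl fun w _ => ?_
      rw [mul_sub, sub_eq_add_neg, ee_add]; ring
    rw [l1]
    have l2 : ∀ c : ZMod m, ∑ i ∈ s.filter (fun i => φ i = c), ∑ j ∈ s.filter (fun i => φ i = c),
        β i * (starRingEnd ℂ) (β j) = ∑ i ∈ s, ∑ j ∈ s,
          if φ i = c then (if φ j = c then β i * (starRingEnd ℂ) (β j) else 0) else 0 := by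
      intro c
      rw [Finset.sum_filter]
      refine Finset.sum_congr rfl fun i _ => ?_
      rw [Finset.sum_filter]
      split_ifs <;> simp
    simp_rw [l2]
    conv_rhs => rw [Finset.sum_comm, Finset.mul_sum]
    refine Finset.sum_congr rfl fun i _ => ?_
    conv_rhs => rw [Finset.sum_comm, Finset.mul_sum]
    refine Finset.sum_congr rfl fun j _ => ?_
    have : ∑ x : ZMod m, (if φ i = x then (if φ j = x then β i * (starRingEnd ℂ) (β j) else 0) else 0)
      = if φ j = φ i then β i * (starRingEnd ℂ) (β j) else 0 := by
      rw [Finset.sum_ite_eq]; simp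
    rw [this]
    simp only [Finset.mem_univ, if_true, sub_eq_zero, eq_comm (a := φ i)]
    split_ifs <;> ring
  exact_mod_cast this

theorem parseval_le {ι : Type*} (s : Finset ι) (β : ι → ℂ) (φ : ι → ZMod m) (b : ℝ)
    (hβ : ∀ i ∈ s, ‖β i‖ ≤ b) :
    ∑ w : ZMod m, ‖∑ i ∈ s, β i * ee (w * φ i)‖ ^ 2 ≤
      m * b ^ 2 * ∑ c : ZMod m, ((s.filter (fun i => φ i = c)).card : ℝ) ^ 2 := by
  rw [parseval, mul_assoc]
  refine mul_le_mul_of_nonneg_left ?_ (by positivity)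
  rw [Finset.mul_sum]
  refine Finset.sum_le_sum fun c _ => ?_
  rw [← mul_pow]
  refine pow_le_pow_left₀ (norm_nonneg _) ?_ 2
  refine (norm_sum_le _ _).trans ?_
  calc _ ≤ ∑ i ∈ s.filter (fun i => φ i = c), b :=
        Finset.sum_le_sum fun i hi => hβ i (Finset.mem_filter.mp hi).1
    _ = _ := by simp [mul_comm]

/-- number of `1 ≤ k ≤ K` in a residue class -/
def cnt (m : ℕ) (K : ℕ) (b : ZMod m) : ℕ := ((Icc 1 K).filter (fun k : ℕ => (k : ZMod m) = b)).card

noncomputable def DD (K : ℕ) (h : ZMod m) : ℂ := ∑ k ∈ Icc 1 K, ee (h * (k : ZMod m))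

theorem DD_zero (K : ℕ) : DD K (0 : ZMod m) = K := by
  simp [DD, ee_zero]

theorem cnt_eq (K : ℕ) (b : ZMod m) :
    (m : ℂ) * (cnt m K b : ℂ) = ∑ h : ZMod m, ee (-(h * b)) * DD K h := by
  unfold DD cnt
  simp_rw [Finset.mul_sum]
  rw [Finset.sum_comm]
  have : ∀ k ∈ Icc 1 K, ∑ h : ZMod m, ee (-(h * b)) * ee (h * (k : ZMod m)) =
      if (k : ZMod m) = b then (m : ℂ) else 0 := by
    intro k _
    rw [show ((if (k : ZMod m) = b then (m : ℂ) else 0)) =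
      (if (k : ZMod m) - b = 0 then (m : ℂ) else 0) by simp only [sub_eq_zero], ← sum_ee]
    refine Finset.sum_congr rfl fun h _ => ?_
    rw [← ee_add]; congr 1; ring
  rw [Finset.sum_congr rfl this, Finset.card_filter]
  push_cast
  rw [Finset.mul_sum]
  refine Finset.sum_congr rfl fun k _ => ?_
  split_ifs <;> simp

theorem cnt_sub (K : ℕ) (b : ZMod m) :
    (m : ℂ) * ((cnt m K b : ℂ) - K / m) = ∑ h ∈ univ.erase (0 : ZMod m), ee (-(h * b)) * DD K h := by
  have hm : (m : ℂ) ≠ 0 := by exact_mod_cast NeZero.ne m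
  rw [mul_sub, cnt_eq, ← Finset.add_sum_erase _ _ (mem_univ (0 : ZMod m)), DD_zero]
  simp only [zero_mul, neg_zero, ee_zero, one_mul]
  field_simp
  ring

theorem norm_DD_le (K : ℕ) (h : ZMod m) : ‖DD K h‖ ≤ K := by
  unfold DD
  refine (norm_sum_le _ _).trans ?_
  simp [norm_ee]

theorem ee_natCast (k : ℕ) : ee (k : ZMod m) = Complex.exp (2 * Real.pi * Complex.I * (k / m : ℝ)) := by
  unfold ee
  have := ZMod.stdAddChar_coe (N := m) (k : ℤ)
  simp only [Int.cast_natCast] at this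
  rw [this]
  congr 1
  push_cast
  ring

theorem norm_ee_sub_one (h : ℕ) (h1 : 1 ≤ h) (h2 : 2 * h ≤ m) :
    4 * (h : ℝ) / m ≤ ‖ee (h : ZMod m) - 1‖ := by
  have hm : (0 : ℝ) < m := by exact_mod_cast NeZero.pos m
  rw [ee_natCast]
  have e : (2 * Real.pi * Complex.I * ((h / m : ℝ) : ℂ)) = Complex.I * ((2 * Real.pi * (h / m) : ℝ) : ℂ) := by
    push_cast; ring
  rw [e, Complex.norm_exp_I_mul_ofReal_sub_one]
  have hx : 2 * Real.pi * ((h : ℝ) / m) / 2 = Real.pi * (h / m) := by ring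
  rw [hx]
  have h3 : (h : ℝ) / m ≤ 1 / 2 := by
    rw [div_le_div_iff₀ hm (by norm_num)]
    have : ((2 * h : ℕ) : ℝ) ≤ m := by exact_mod_cast h2
    push_cast at this; linarith
  have h4 : 0 ≤ (h : ℝ) / m := by positivity
  have := Real.mul_le_sin (x := Real.pi * (h / m)) (by positivity) (by nlinarith [Real.pi_pos])
  have hpi := Real.pi_pos
  have h5 : 2 / Real.pi * (Real.pi * ((h : ℝ) / m)) = 2 * (h / m) := by field_simp
  rw [h5] at this
  rw [Real.norm_eq_abs]
  refine le_trans ?_ (le_abs_self _)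
  have : 4 * (h : ℝ) / m = 2 * (2 * (h / m)) := by ring
  linarith

theorem norm_DD_le' (K h : ℕ) (h1 : 1 ≤ h) (h2 : 2 * h ≤ m) : ‖DD K (h : ZMod m)‖ ≤ m / (2 * h) := by
  have hm : (0 : ℝ) < m := by exact_mod_cast NeZero.pos m
  have hh : (0 : ℝ) < h := by exact_mod_cast h1
  have key : DD K (h : ZMod m) * (ee (h : ZMod m) - 1) = ee (h : ZMod m) * (ee ((h : ZMod m) * (K : ZMod m)) - 1) := by
    unfold DD
    induction K with
    | zero => simp [ee_zero]
    | succ K ih =>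
      rw [Finset.sum_Icc_succ_top (by omega), add_mul, ih]
      push_cast
      rw [mul_add, mul_one, ee_add]
      ring
  have h3 : ‖DD K (h : ZMod m)‖ * ‖ee (h : ZMod m) - 1‖ ≤ 2 := by
    rw [← norm_mul, key, norm_mul, norm_ee, one_mul]
    refine (norm_sub_le _ _).trans ?_
    rw [norm_ee]; norm_num
  have h4 := norm_ee_sub_one (m := m) h h1 h2
  rw [le_div_iff₀ (by positivity)]
  have h5 : ‖DD K (h : ZMod m)‖ * (4 * (h : ℝ) / m) ≤ 2 :=
    (mul_le_mul_of_nonneg_left h4 (norm_nonneg _)).trans h3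
  rw [mul_div_assoc', div_le_iff₀ hm] at h5
  linarith

theorem DD_neg (K : ℕ) (h : ZMod m) : ‖DD K (-h)‖ = ‖DD K h‖ := by
  rw [← Complex.norm_conj]
  unfold DD
  rw [map_sum]
  simp_rw [conj_ee]
  congr 1
  refine Finset.sum_congr rfl fun k _ => ?_
  congr 1; ring

/-- sum over nonzero classes, folded to `1 ≤ h ≤ m/2` with both signs -/
theorem sum_erase_le (F : ZMod m → ℝ) (hF : ∀ x, 0 ≤ F x) :
    ∑ h ∈ univ.erase (0 : ZMod m), F h ≤
      ∑ h ∈ Icc 1 (m / 2), (F (h : ZMod m) + F (-(h : ZMod m))) := by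
  rw [Finset.sum_add_distrib]
  have hinj : ∀ a ∈ univ.erase (0 : ZMod m), ∀ b ∈ univ.erase (0 : ZMod m), a.val = b.val → a = b :=
    fun a _ b _ h => ZMod.val_injective m h
  rw [← Finset.sum_filter_add_sum_filter_not _ (fun h : ZMod m => h.val ≤ m / 2)]
  refine add_le_add ?_ ?_
  · rw [show ∑ h ∈ (univ.erase (0 : ZMod m)).filter (fun h : ZMod m => h.val ≤ m / 2), F h =
      ∑ h ∈ ((univ.erase (0 : ZMod m)).filter (fun h : ZMod m => h.val ≤ m / 2)).image ZMod.val, F (h : ZMod m) by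
        rw [Finset.sum_image (fun a _ b _ h => ZMod.val_injective m h)]
        refine Finset.sum_congr rfl fun x _ => by rw [ZMod.natCast_zmod_val]]
    refine Finset.sum_le_sum_of_subset_of_nonneg ?_ fun i _ _ => hF _
    intro x
    simp only [Finset.mem_image, Finset.mem_filter, Finset.mem_erase, Finset.mem_univ, Finset.mem_Icc]
    rintro ⟨y, ⟨⟨hy, _⟩, hy2⟩, rfl⟩
    refine ⟨?_, hy2⟩
    have := (ZMod.val_ne_zero y).mpr hy
    omega
  · have e1 : ∀ y : ZMod m, y ≠ 0 → (-((( m - y.val : ℕ)) : ZMod m)) = y := by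
      intro y _
      rw [Nat.cast_sub (ZMod.val_lt y).le]; simp
    rw [show ∑ h ∈ (univ.erase (0 : ZMod m)).filter (fun h : ZMod m => ¬ h.val ≤ m / 2), F h =
      ∑ h ∈ ((univ.erase (0 : ZMod m)).filter (fun h : ZMod m => ¬ h.val ≤ m / 2)).image
        (fun y => m - y.val), F (-(h : ZMod m)) by
        rw [Finset.sum_image]
        · refine Finset.sum_congr rfl fun x hx => ?_
          rw [e1]
          simp only [Finset.mem_filter, Finset.mem_erase] at hx
          exact hx.1.1
        · intro a _ b _ h
          apply ZMod.val_injective m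
          have := ZMod.val_lt a
          have := ZMod.val_lt b
          simp only at h
          omega]
    refine Finset.sum_le_sum_of_subset_of_nonneg ?_ fun i _ _ => hF _
    intro x
    simp only [Finset.mem_image, Finset.mem_filter, Finset.mem_erase, Finset.mem_univ, Finset.mem_Icc]
    rintro ⟨y, ⟨⟨hy, _⟩, hy2⟩, rfl⟩
    have := ZMod.val_lt y
    omega

/-- harmonic sum bound for the kernel: `∑_h ‖D_K(h)‖ ≤ m (K/m + 2 log)`. -/
theorem sum_norm_DD_le {Q : ℝ} (hg : Good m Q) (K : ℕ) (hK : K ≤ m) :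
    ∑ h : ZMod m, ‖DD K h‖ ≤ 3 * Q * m := by
  have hm : (0 : ℝ) < m := by exact_mod_cast NeZero.pos m
  rw [← Finset.add_sum_erase _ _ (mem_univ (0 : ZMod m))]
  have h1 : ‖DD K (0 : ZMod m)‖ ≤ m := (norm_DD_le K 0).trans (by exact_mod_cast hK)
  have h2 := sum_erase_le (m := m) (fun h => ‖DD K h‖) (fun _ => norm_nonneg _)
  have h3 : ∑ h ∈ Icc 1 (m / 2), (‖DD K (h : ZMod m)‖ + ‖DD K (-(h : ZMod m))‖) ≤
      ∑ h ∈ Icc 1 (m / 2), (m : ℝ) * ((h : ℝ)⁻¹) := by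
    refine Finset.sum_le_sum fun h hh => ?_
    simp only [Finset.mem_Icc] at hh
    rw [DD_neg]
    have := norm_DD_le' (m := m) K h hh.1 (by omega)
    have hh0 : (0 : ℝ) < h := by exact_mod_cast hh.1
    calc _ ≤ (m : ℝ) / (2 * h) + m / (2 * h) := add_le_add this this
      _ = _ := by field_simp; ring
  rw [← Finset.mul_sum] at h3
  have h4 : ∑ h ∈ Icc 1 (m / 2), ((h : ℝ)⁻¹) ≤ 1 + Real.log m := by
    have := harmonic_le_one_add_log m
    rw [harmonic_eq_sum_Icc] at this
    push_cast at this
    refine le_trans (Finset.sum_le_sum_of_subset_of_nonneg ?_ fun i _ _ => by positivity) this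
    exact Finset.Icc_subset_Icc_right (Nat.div_le_self _ _)
  have h5 := hg.log
  have h6 := hg.two_le
  have h7 : (m : ℝ) * ∑ h ∈ Icc 1 (m / 2), ((h : ℝ)⁻¹) ≤ m * (1 + Q) :=
    mul_le_mul_of_nonneg_left (by linarith) hm.le
  nlinarith

/-- two Cauchy–Schwarz applications -/
theorem holder2 {ι κ : Type*} [Fintype κ] [DecidableEq κ] (s : Finset ι) (φ : ι → κ) (F : κ → ℝ) :
    (∑ i ∈ s, F (φ i)) ^ 2 ≤
      (((s ×ˢ s).filter (fun p => φ p.1 = φ p.2)).card : ℝ) * ∑ w, F w ^ 2 := by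
  have h1 : ∑ i ∈ s, F (φ i) = ∑ w : κ, ((s.filter (fun i => φ i = w)).card : ℝ) * F w := by
    rw [← Finset.sum_fiberwise_of_maps_to (t := univ) (g := φ) (fun _ _ => mem_univ _)]
    refine Finset.sum_congr rfl fun w _ => ?_
    rw [Finset.sum_congr rfl (fun i hi => by rw [(Finset.mem_filter.mp hi).2])]
    simp
  have h2 : (((s ×ˢ s).filter (fun p => φ p.1 = φ p.2)).card : ℝ) =
      ∑ w : κ, ((s.filter (fun i => φ i = w)).card : ℝ) ^ 2 := by
    rw [Finset.card_eq_sum_card_fiberwise (t := univ) (f := fun p => φ p.1) (fun _ _ => mem_univ _)]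
    push_cast
    refine Finset.sum_congr rfl fun w _ => ?_
    rw [sq, ← Nat.cast_mul, ← Finset.card_product]
    congr 2
    ext ⟨x, y⟩
    simp only [Finset.mem_filter, Finset.mem_product]
    constructor
    · rintro ⟨⟨⟨a, b⟩, c⟩, d⟩; exact ⟨⟨a, d⟩, b, c ▸ d⟩
    · rintro ⟨⟨a, d⟩, b, c⟩; exact ⟨⟨⟨a, b⟩, d.trans c.symm⟩, d⟩
  rw [h1, h2]
  exact Finset.sum_mul_sq_le_sq_mul_sq _ _ _

theorem holder4 {ι κ : Type*} [Fintype κ] [DecidableEq κ] (s : Finset ι) (φ : ι → κ) (F : κ → ℝ) :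
    (∑ i ∈ s, F (φ i)) ^ 4 ≤
      (s.card : ℝ) ^ 2 * (((s ×ˢ s).filter (fun p => φ p.1 = φ p.2)).card : ℝ) * ∑ w, F w ^ 4 := by
  have h1 : (∑ i ∈ s, F (φ i)) ^ 2 ≤ s.card * ∑ i ∈ s, F (φ i) ^ 2 := by
    exact sq_sum_le_card_mul_sum_sq
  have h2 := holder2 s φ (fun w => F w ^ 2)
  have h3 : ((∑ i ∈ s, F (φ i)) ^ 2) ^ 2 ≤ (s.card * ∑ i ∈ s, F (φ i) ^ 2) ^ 2 :=
    pow_le_pow_left₀ (by positivity) h1 2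
  calc _ = ((∑ i ∈ s, F (φ i)) ^ 2) ^ 2 := by ring
    _ ≤ _ := h3
    _ = (s.card : ℝ) ^ 2 * (∑ i ∈ s, F (φ i) ^ 2) ^ 2 := by ring
    _ ≤ (s.card : ℝ) ^ 2 * ((((s ×ˢ s).filter (fun p => φ p.1 = φ p.2)).card : ℝ) * ∑ w, (F w ^ 2) ^ 2) := by gcongr
    _ = _ := by rw [mul_assoc]; congr 2; refine Finset.sum_congr rfl fun w _ => by ring

end chars




/-! # Part 3: collisions, reduction to exponential sums, case A -/

section part3
variable {m : ℕ} [NeZero m]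

theorem cnt_le (K : ℕ) (b : ZMod m) : cnt m K b ≤ K / m + 1 := by
  unfold cnt
  rw [← Finset.card_range (K / m + 1)]
  apply Finset.card_le_card_of_injOn (fun k => k / m)
  · intro k hk
    simp only [Finset.coe_filter, Finset.mem_Icc, Set.mem_ofPred_eq] at hk
    simp only [Finset.coe_range, Set.mem_Iio]
    have := Nat.div_le_div_right (c := m) hk.1.2
    omega
  · intro k hk l hl hkl
    simp only [Finset.coe_filter, Finset.mem_Icc, Set.mem_ofPred_eq] at hk hl
    simp only at hkl
    have : (k : ZMod m) = (l : ZMod m) := hk.2.trans hl.2.symm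
    rw [ZMod.natCast_eq_natCast_iff'] at this
    rw [← Nat.div_add_mod k m, ← Nat.div_add_mod l m, hkl, this]

theorem cnt_le_real (K : ℕ) (b : ZMod m) : (cnt m K b : ℝ) ≤ K / m + 1 := by
  have h1 := cnt_le (m := m) K b
  have h2 : ((K / m : ℕ) : ℝ) ≤ (K : ℝ) / m := Nat.cast_div_le
  have h3 : (cnt m K b : ℝ) ≤ ((K / m : ℕ) : ℝ) + 1 := by exact_mod_cast h1
  linarith

theorem unit_of_coprime {n : ℕ} (h : n.Coprime m) : (n : ZMod m) * (n : ZMod m)⁻¹ = 1 :=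
  ZMod.coe_mul_inv_eq_one n h

/-- pairs congruent mod m, first divisible by `g` -/
def congPairs (m N g : ℕ) : Finset (ℕ × ℕ) :=
  (Icc 1 N ×ˢ Icc 1 N).filter (fun p => (p.1 : ZMod m) = (p.2 : ZMod m) ∧ g ∣ p.1)

theorem card_congPairs (N g : ℕ) :
    ((congPairs m N g).card : ℝ) ≤ (N / g : ℝ) * ((N : ℝ) / m + 1) := by
  have h1 : (congPairs m N g).card = ∑ s ∈ (Icc 1 N).filter (fun s => g ∣ s), cnt m N (s : ZMod m) := by
    unfold congPairs cnt
    rw [Finset.card_eq_sum_card_fiberwise (f := Prod.fst) (t := (Icc 1 N).filter (fun s => g ∣ s))]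
    · refine Finset.sum_congr rfl fun s hs => ?_
      simp only [Finset.mem_filter] at hs
      apply Finset.card_bij (fun p _ => p.2)
      · rintro ⟨x, y⟩ h
        simp only [Finset.mem_filter, Finset.mem_product] at h ⊢
        obtain ⟨⟨⟨h1, h2⟩, h3, h4⟩, rfl⟩ := h
        exact ⟨h2, h3.symm⟩
      · rintro ⟨x, y⟩ h ⟨x', y'⟩ h' hh
        simp only [Finset.mem_filter, Finset.mem_product] at h h' hh
        rw [h.2, h'.2, hh]
      · intro b hb
        simp only [Finset.mem_filter] at hb
        refine ⟨(s, b), ?_, rfl⟩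
        simp only [Finset.mem_filter, Finset.mem_product]
        exact ⟨⟨⟨hs.1, hb.1⟩, hb.2.symm, hs.2⟩, trivial⟩
    · rintro ⟨x, y⟩ h
      simp only [Finset.coe_filter, Set.mem_ofPred_eq, Finset.mem_product] at h ⊢
      exact ⟨h.1.1, h.2.2⟩
  rw [h1]
  push_cast
  calc _ ≤ ∑ s ∈ (Icc 1 N).filter (fun s => g ∣ s), ((N : ℝ) / m + 1) :=
        Finset.sum_le_sum fun s _ => cnt_le_real N _
    _ = ((((Icc 1 N).filter (fun s => g ∣ s)).card : ℕ) : ℝ) * ((N : ℝ) / m + 1) := by rw [Finset.sum_const, nsmul_eq_mul]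
    _ ≤ _ := by
      refine mul_le_mul_of_nonneg_right ?_ (by positivity)
      have : ((Icc 1 N).filter (fun s => g ∣ s)).card = N / g := by
        have := Nat.Ioc_filter_dvd_card_eq_div N g
        rw [← this]; congr 1
      rw [this]
      exact Nat.cast_div_le

theorem Good.tauN {Q : ℝ} (hg : Good m Q) {n : ℕ} (hn : n ≠ 0) (hn2 : n ≤ m ^ 12) :
    n.divisors.card ≤ ⌊Q⌋₊ := Nat.le_floor (hg.tau n hn hn2)

/-- collision count for `a h / (e u)` -/
theorem coll3 {Q : ℝ} (hg : Good m Q) (a : ZMod m) (ha : IsUnit a) (A B C : ℕ) (hN : A * B * C ≤ m ^ 12)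
    (s : Finset (ℕ × ℕ × ℕ))
    (hs : ∀ x ∈ s, x.1 ∈ Icc 1 A ∧ x.2.1 ∈ Icc 1 B ∧ x.2.2 ∈ Icc 1 C ∧
      x.2.1.Coprime m ∧ x.2.2.Coprime m) :
    (((s ×ˢ s).filter (fun p => a * p.1.1 * (p.1.2.1 : ZMod m)⁻¹ * (p.1.2.2 : ZMod m)⁻¹ =
      a * p.2.1 * (p.2.2.1 : ZMod m)⁻¹ * (p.2.2.2 : ZMod m)⁻¹)).card : ℝ) ≤
      Q ^ 4 * ((A * B * C : ℕ) * (((A * B * C : ℕ) : ℝ) / m + 1)) := by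
  set N := A * B * C with hNdef
  set P := (s ×ˢ s).filter (fun p => a * p.1.1 * (p.1.2.1 : ZMod m)⁻¹ * (p.1.2.2 : ZMod m)⁻¹ =
      a * p.2.1 * (p.2.2.1 : ZMod m)⁻¹ * (p.2.2.2 : ZMod m)⁻¹) with hP
  set f : (ℕ × ℕ × ℕ) × (ℕ × ℕ × ℕ) → ℕ × ℕ :=
    fun p => (p.1.1 * p.2.2.1 * p.2.2.2, p.2.1 * p.1.2.1 * p.1.2.2) with hf
  have bnd : ∀ x y z : ℕ, x ∈ Icc 1 A → y ∈ Icc 1 B → z ∈ Icc 1 C → x * y * z ∈ Icc 1 N := by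
    intro x y z hx hy hz
    simp only [Finset.mem_Icc] at *
    refine ⟨?_, Nat.mul_le_mul (Nat.mul_le_mul hx.2 hy.2) hz.2⟩
    have := Nat.mul_le_mul (Nat.mul_le_mul hx.1 hy.1) hz.1
    simpa using this
  have maps : ∀ p ∈ P, f p ∈ congPairs m N 1 := by
    rintro ⟨⟨h, e, u⟩, ⟨h', e', u'⟩⟩ hp
    simp only [hP, Finset.mem_filter, Finset.mem_product] at hp
    obtain ⟨⟨h1, h2⟩, h3⟩ := hp
    obtain ⟨a1, a2, a3, a4, a5⟩ := hs _ h1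
    obtain ⟨b1, b2, b3, b4, b5⟩ := hs _ h2
    simp only at *
    simp only [hf, congPairs, Finset.mem_filter, Finset.mem_product]
    refine ⟨⟨bnd _ _ _ a1 b2 b3, bnd _ _ _ b1 a2 a3⟩, ?_, one_dvd _⟩
    push_cast
    have e1 := unit_of_coprime a4
    have e2 := unit_of_coprime a5
    have e3 := unit_of_coprime b4
    have e4 := unit_of_coprime b5
    apply ha.mul_left_cancel
    generalize (e : ZMod m)⁻¹ = ei at *
    generalize (u : ZMod m)⁻¹ = ui at *
    generalize (e' : ZMod m)⁻¹ = ei' at *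
    generalize (u' : ZMod m)⁻¹ = ui' at *
    calc a * ((h : ZMod m) * e' * u') = (a * h * ei * ui) * (e * u * e' * u') := by
          linear_combination (-(a * h * e' * u') * (u * ui)) * e1 - (a * h * e' * u') * e2
      _ = (a * h' * ei' * ui') * (e * u * e' * u') := by rw [h3]
      _ = _ := by
          linear_combination ((a * h' * e * u) * (u' * ui')) * e3 + (a * h' * e * u) * e4
  have fib : ∀ b ∈ congPairs m N 1, (P.filter (fun p => f p = b)).card ≤ ⌊Q⌋₊ ^ 4 := by
    rintro ⟨x, y⟩ hb
    simp only [congPairs, Finset.mem_filter, Finset.mem_product, Finset.mem_Icc] at hb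
    have hx0 : x ≠ 0 := by omega
    have hy0 : y ≠ 0 := by omega
    have tx := hg.tauN hx0 (by omega)
    have ty := hg.tauN hy0 (by omega)
    calc (P.filter (fun p => f p = (x, y))).card ≤
        ((x.divisors ×ˢ x.divisors) ×ˢ (y.divisors ×ˢ y.divisors)).card := by
          apply Finset.card_le_card_of_injOn
            (fun p => ((p.1.1, p.2.2.1), (p.2.1, p.1.2.1)))
          · rintro ⟨⟨h, e, u⟩, ⟨h', e', u'⟩⟩ hp
            simp only [hf, Finset.coe_filter, Set.mem_ofPred_eq, Prod.mk.injEq] at hp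
            obtain ⟨_, rfl, rfl⟩ := hp
            simp only [Finset.coe_product, Set.mem_prod, Finset.mem_coe, Nat.mem_divisors]
            refine ⟨⟨⟨?_, hx0⟩, ?_, hx0⟩, ⟨?_, hy0⟩, ?_, hy0⟩
            · exact ⟨e' * u', by ring⟩
            · exact ⟨h * u', by ring⟩
            · exact ⟨e * u, by ring⟩
            · exact ⟨h' * u, by ring⟩
          · rintro ⟨⟨h, e, u⟩, ⟨h', e', u'⟩⟩ hp ⟨⟨k, d, v⟩, ⟨k', d', v'⟩⟩ hp' heq
            simp only [hf, Finset.coe_filter, Set.mem_ofPred_eq, Prod.mk.injEq] at hp hp' heq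
            obtain ⟨_, p1, p2⟩ := hp
            obtain ⟨_, q1, q2⟩ := hp'
            obtain ⟨⟨rfl, rfl⟩, rfl, rfl⟩ := heq
            have n1 : h * e' ≠ 0 := by
              rintro h0; rw [h0] at p1; omega
            have n2 : h' * e ≠ 0 := by
              rintro h0; rw [h0] at p2; omega
            have u1 : u' = v' := Nat.eq_of_mul_eq_mul_left (Nat.pos_of_ne_zero n1) (p1.trans q1.symm)
            have u2 : u = v := Nat.eq_of_mul_eq_mul_left (Nat.pos_of_ne_zero n2) (p2.trans q2.symm)
            rw [u1, u2]
      _ ≤ _ := by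
          simp only [Finset.card_product]
          calc _ ≤ (⌊Q⌋₊ * ⌊Q⌋₊) * (⌊Q⌋₊ * ⌊Q⌋₊) := by gcongr
            _ = _ := by ring
  have h := Finset.card_le_mul_card_image_of_maps_to maps _ fib
  have h2 := card_congPairs (m := m) N 1
  have hQ : (⌊Q⌋₊ : ℝ) ≤ Q := Nat.floor_le (by have := hg.two_le; linarith)
  calc (P.card : ℝ) ≤ (⌊Q⌋₊ : ℝ) ^ 4 * (congPairs m N 1).card := by exact_mod_cast h
    _ ≤ Q ^ 4 * ((N / (1 : ℕ) : ℝ) * ((N : ℝ) / m + 1)) := by gcongr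
    _ = _ := by simp

/-- inverse exponential sum -/
noncomputable def SS (f : ℕ → ℝ) (X : ℕ) (w : ZMod m) : ℂ :=
  ∑ n ∈ (Icc 1 X).filter (fun n => n.Coprime m), (f n : ℂ) * ee (w * (n : ZMod m)⁻¹)

/-- discrepancy -/
noncomputable def EE (f : ℕ → ℝ) (X : ℕ) (a : ZMod m) (e : ℕ) : ℝ :=
  ∑ n ∈ (Icc 1 X).filter (fun n => n.Coprime m),
    f n * ((cnt m (X / e) (a * (n : ZMod m)⁻¹ * (e : ZMod m)⁻¹) : ℝ) - ((X / e : ℕ) : ℝ) / m)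

theorem EE_le (f : ℕ → ℝ) (X : ℕ) (a : ZMod m) (e : ℕ) :
    |EE f X a e| ≤ ∑ h ∈ Icc 1 (m / 2), (‖DD (X / e) (h : ZMod m)‖ / m) *
      (‖SS f X (-a * (h : ZMod m) * (e : ZMod m)⁻¹)‖ + ‖SS f X (a * (h : ZMod m) * (e : ZMod m)⁻¹)‖) := by
  have hm : (0 : ℝ) < m := by exact_mod_cast NeZero.pos m
  have h1 : ((m : ℂ) * (EE f X a e : ℂ)) =
      ∑ h ∈ univ.erase (0 : ZMod m), DD (X / e) h * SS f X (-a * (h : ZMod m) * (e : ZMod m)⁻¹) := by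
    unfold EE SS
    push_cast
    rw [Finset.mul_sum]
    have : ∀ n : ℕ, (m : ℂ) * ((f n : ℂ) * ((cnt m (X / e) (a * (n : ZMod m)⁻¹ * (e : ZMod m)⁻¹) : ℂ) -
        ((X / e : ℕ) : ℂ) / m)) = ∑ h ∈ univ.erase (0 : ZMod m),
          DD (X / e) h * ((f n : ℂ) * ee (-a * (h : ZMod m) * (e : ZMod m)⁻¹ * (n : ZMod m)⁻¹)) := by
      intro n
      rw [mul_left_comm, cnt_sub, Finset.mul_sum]
      refine Finset.sum_congr rfl fun h _ => ?_
      rw [show -a * (h : ZMod m) * (e : ZMod m)⁻¹ * (n : ZMod m)⁻¹ = -(h * (a * (n : ZMod m)⁻¹ * (e : ZMod m)⁻¹)) by ring]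
      ring
    rw [Finset.sum_congr rfl fun n _ => this n, Finset.sum_comm]
    refine Finset.sum_congr rfl fun h _ => ?_
    rw [Finset.mul_sum]
  have h2 : m * |EE f X a e| ≤ ∑ h ∈ univ.erase (0 : ZMod m),
      ‖DD (X / e) h‖ * ‖SS f X (-a * (h : ZMod m) * (e : ZMod m)⁻¹)‖ := by
    have : m * |EE f X a e| = ‖((m : ℂ) * (EE f X a e : ℂ))‖ := by
      rw [norm_mul, Complex.norm_real, Complex.norm_natCast, Real.norm_eq_abs]
    rw [this, h1]
    refine (norm_sum_le _ _).trans (le_of_eq ?_)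
    refine Finset.sum_congr rfl fun h _ => norm_mul _ _
  have h3 := h2.trans (sum_erase_le _ (fun x => by positivity))
  have h4 : |EE f X a e| ≤ (1 / m : ℝ) * ∑ h ∈ Icc 1 (m / 2),
      (‖DD (X / e) (h : ZMod m)‖ * ‖SS f X (-a * (h : ZMod m) * (e : ZMod m)⁻¹)‖ +
       ‖DD (X / e) (-(h : ZMod m))‖ * ‖SS f X (-a * -(h : ZMod m) * (e : ZMod m)⁻¹)‖) := by
    rw [one_div, ← div_eq_inv_mul, le_div_iff₀ hm, mul_comm]
    exact h3
  refine h4.trans (le_of_eq ?_)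
  rw [Finset.mul_sum]
  refine Finset.sum_congr rfl fun h _ => ?_
  rw [DD_neg, neg_mul_neg]
  ring

/-- block of coprime integers -/
def blk (m D E : ℕ) : Finset ℕ := (Icc 1 D).filter (fun e => (E ≤ e ∧ e < 2 * E) ∧ e.Coprime m)
def blk0 (D E : ℕ) : Finset ℕ := (Icc 1 D).filter (fun e => E ≤ e ∧ e < 2 * E)

theorem LD_reduce {Q : ℝ} (hg : Good m Q) (f : ℕ → ℝ) (X D : ℕ) (hD : D ≤ m) (B : ℝ) (hB0 : 0 ≤ B)
    (hB : ∀ a : ZMod m, IsUnit a → ∀ E H : ℕ, 1 ≤ E → E ≤ D → 1 ≤ H → H ≤ m / 2 →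
      min ((X : ℝ) / (E * m)) (1 / H) *
        ∑ h ∈ blk0 (m / 2) H, ∑ e ∈ blk m D E, ‖SS f X (a * (h : ZMod m) * (e : ZMod m)⁻¹)‖ ≤ B)
    (a : ZMod m) (ha : IsUnit a) :
    ∑ e ∈ (Icc 1 D).filter (fun e => e.Coprime m), |EE f X a e| ≤ 8 * Q ^ 2 * B := by
  have hm : (0 : ℝ) < m := by exact_mod_cast NeZero.pos m
  have hQ := hg.two_le
  have h1 : ∑ e ∈ (Icc 1 D).filter (fun e => e.Coprime m), |EE f X a e| ≤
    ∑ e ∈ Icc 1 D, ∑ h ∈ Icc 1 (m / 2), (if e.Coprime m then (‖DD (X / e) (h : ZMod m)‖ / m) *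
      (‖SS f X (-a * (h : ZMod m) * (e : ZMod m)⁻¹)‖ + ‖SS f X (a * (h : ZMod m) * (e : ZMod m)⁻¹)‖) else 0) := by
    rw [Finset.sum_filter]
    refine Finset.sum_le_sum fun e _ => ?_
    split_ifs with he
    · exact EE_le f X a e
    · simp
  refine h1.trans ?_
  have h2 : ∑ e ∈ Icc 1 D, ∑ h ∈ Icc 1 (m / 2), (if e.Coprime m then (‖DD (X / e) (h : ZMod m)‖ / m) *
      (‖SS f X (-a * (h : ZMod m) * (e : ZMod m)⁻¹)‖ + ‖SS f X (a * (h : ZMod m) * (e : ZMod m)⁻¹)‖) else 0) ≤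
      2 * Q * (2 * Q * (2 * B)) := by
    refine dyadic_good hg _ (fun e => Finset.sum_nonneg fun h _ => by split_ifs <;> positivity) D hD _
      (by positivity) ?_
    intro E hE hED
    rw [Finset.sum_comm]
    refine dyadic_good hg _ (fun e => Finset.sum_nonneg fun h _ => by split_ifs <;> positivity) (m / 2)
      (Nat.div_le_self _ _) _ (by positivity) ?_
    intro H hH hHm
    have b1 := hB (-a) ha.neg E H hE hED hH hHm
    have b2 := hB a ha E H hE hED hH hHm
    have : ∑ h ∈ (Icc 1 (m / 2)).filter (fun h => H ≤ h ∧ h < 2 * H),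
        ∑ e ∈ (Icc 1 D).filter (fun e => E ≤ e ∧ e < 2 * E),
        (if e.Coprime m then (‖DD (X / e) (h : ZMod m)‖ / m) *
        (‖SS f X (-a * (h : ZMod m) * (e : ZMod m)⁻¹)‖ + ‖SS f X (a * (h : ZMod m) * (e : ZMod m)⁻¹)‖) else 0) ≤
        ∑ h ∈ blk0 (m / 2) H, ∑ e ∈ blk m D E, min ((X : ℝ) / (E * m)) (1 / H) *
          (‖SS f X (-a * (h : ZMod m) * (e : ZMod m)⁻¹)‖ + ‖SS f X (a * (h : ZMod m) * (e : ZMod m)⁻¹)‖) := by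
      refine Finset.sum_le_sum fun h hh => ?_
      simp only [Finset.mem_filter, Finset.mem_Icc] at hh
      have hbl : blk m D E = ((Icc 1 D).filter (fun e => E ≤ e ∧ e < 2 * E)).filter
          (fun e => e.Coprime m) := by rw [Finset.filter_filter]; rfl
      rw [hbl]
      conv_rhs => rw [Finset.sum_filter]
      refine Finset.sum_le_sum fun e he => ?_
      simp only [Finset.mem_filter, Finset.mem_Icc] at he
      split_ifs
      · refine mul_le_mul_of_nonneg_right ?_ (by positivity)
        have hE0 : (0 : ℝ) < E := by exact_mod_cast hE
        have he0 : (E : ℝ) ≤ e := by exact_mod_cast he.2.1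
        have hH0 : (0 : ℝ) < H := by exact_mod_cast hH
        have hh0 : (H : ℝ) ≤ h := by exact_mod_cast hh.2.1
        refine le_min ?_ ?_
        · rw [div_le_iff₀ hm]
          refine (norm_DD_le _ _).trans ?_
          refine Nat.cast_div_le.trans ?_
          calc (X : ℝ) / e ≤ X / E := by gcongr
            _ = _ := by field_simp
        · rw [div_le_iff₀ hm]
          refine (norm_DD_le' _ _ hh.1.1 (by omega)).trans ?_
          rw [div_mul_eq_mul_div, one_mul]
          refine div_le_div_of_nonneg_left hm.le hH0 (by linarith)
      · exact le_refl _
    refine this.trans ?_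
    simp_rw [← Finset.mul_sum, Finset.sum_add_distrib]
    rw [mul_add]
    linarith
  calc _ ≤ _ := h2
    _ = _ := by ring

end part3




section part4
variable {m : ℕ} [NeZero m]

theorem eq_of_inv_eq {n n' : ℕ} (h : n.Coprime m) (h' : n'.Coprime m)
    (hh : (n : ZMod m)⁻¹ = (n' : ZMod m)⁻¹) : (n : ZMod m) = n' := by
  have e1 := unit_of_coprime h
  have e2 := unit_of_coprime h'
  rw [hh] at e1
  calc (n : ZMod m) = n * (n' * (n' : ZMod m)⁻¹) := by rw [e2, mul_one]
    _ = n' * (n * (n' : ZMod m)⁻¹) := by ring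
    _ = n' := by rw [e1, mul_one]

theorem fiber_inv_le (X : ℕ) (c : ZMod m) :
    ((((Icc 1 X).filter (fun n => n.Coprime m)).filter (fun n : ℕ => (n : ZMod m)⁻¹ = c)).card : ℝ) ≤
      X / m + 1 := by
  by_cases hne : (((Icc 1 X).filter (fun n => n.Coprime m)).filter (fun n : ℕ => (n : ZMod m)⁻¹ = c)).Nonempty
  · obtain ⟨n0, hn0⟩ := hne
    simp only [Finset.mem_filter] at hn0
    refine le_trans ?_ (cnt_le_real (m := m) X (n0 : ZMod m))
    norm_cast
    unfold cnt
    apply Finset.card_le_card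
    intro n hn
    simp only [Finset.mem_filter] at hn ⊢
    exact ⟨hn.1.1, eq_of_inv_eq hn.1.2 hn0.1.2 (hn.2.trans hn0.2.symm)⟩
  · rw [Finset.not_nonempty_iff_eq_empty.mp hne]
    simp
    positivity

theorem SS_sq_sum (f : ℕ → ℝ) (X : ℕ) (b : ℝ) (hf : ∀ n ∈ Icc 1 X, |f n| ≤ b) :
    ∑ w : ZMod m, ‖SS f X w‖ ^ 2 ≤ m * b ^ 2 * (X * (X / m + 1)) := by
  unfold SS
  refine (parseval_le _ _ _ b ?_).trans ?_
  · intro i hi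
    rw [Complex.norm_real]
    exact hf i (Finset.mem_filter.mp hi).1
  · refine mul_le_mul_of_nonneg_left ?_ (by positivity)
    have h1 : ∑ c : ZMod m, ((((Icc 1 X).filter (fun n => n.Coprime m)).filter
        (fun n : ℕ => (n : ZMod m)⁻¹ = c)).card : ℝ) ≤ X := by
      rw [← Nat.cast_sum, ← Finset.card_eq_sum_card_fiberwise (fun _ _ => by simp)]
      calc _ ≤ (((Icc 1 X).card : ℕ) : ℝ) := by exact_mod_cast Finset.card_filter_le _ _
        _ = X := by simp
    calc _ ≤ ∑ c : ZMod m, ((((Icc 1 X).filter (fun n => n.Coprime m)).filter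
        (fun n : ℕ => (n : ZMod m)⁻¹ = c)).card : ℝ) * (X / m + 1) := by
          refine Finset.sum_le_sum fun c _ => ?_
          rw [sq]
          exact mul_le_mul_of_nonneg_left (fiber_inv_le X c) (by positivity)
      _ ≤ _ := by
          rw [← Finset.sum_mul]
          exact mul_le_mul_of_nonneg_right h1 (by positivity)

theorem mem_blk {D E e : ℕ} (h : e ∈ blk m D E) : 1 ≤ e ∧ e ≤ D ∧ E ≤ e ∧ e < 2 * E ∧ e.Coprime m := by
  simp only [blk, Finset.mem_filter, Finset.mem_Icc] at h
  tauto

theorem mem_blk0 {D E e : ℕ} (h : e ∈ blk0 D E) : 1 ≤ e ∧ e ≤ D ∧ E ≤ e ∧ e < 2 * E := by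
  simp only [blk0, Finset.mem_filter, Finset.mem_Icc] at h
  tauto

theorem caseA_block {Q : ℝ} (hg : Good m Q) (f : ℕ → ℝ) (X D : ℕ) (hXm : m ≤ X)
    (hf : ∀ n ∈ Icc 1 X, |f n| ≤ 2 * Q) (hD : D ≤ m) (a : ZMod m) (ha : IsUnit a) (E H : ℕ)
    (hE : 1 ≤ E) (hED : E ≤ D) (hH : 1 ≤ H) (hHm : H ≤ m / 2) :
    (min ((X : ℝ) / (E * m)) (1 / H) *
        ∑ h ∈ blk0 (m / 2) H, ∑ e ∈ blk m D E, ‖SS f X (a * (h : ZMod m) * (e : ZMod m)⁻¹)‖) ^ 2 ≤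
      32 * Q ^ 6 * (X : ℝ) ^ 2 * (X / m + 4 * E ^ 2 / m) := by
  have hm : (0 : ℝ) < m := by exact_mod_cast NeZero.pos m
  have hQ := hg.two_le
  have hE0 : (0 : ℝ) < E := by exact_mod_cast hE
  have hH0 : (0 : ℝ) < H := by exact_mod_cast hH
  have hX0 : (m : ℝ) ≤ X := by exact_mod_cast hXm
  set s : Finset (ℕ × ℕ × ℕ) := blk0 (m / 2) H ×ˢ (blk m D E ×ˢ {1}) with hs
  have hsum : ∑ h ∈ blk0 (m / 2) H, ∑ e ∈ blk m D E, ‖SS f X (a * (h : ZMod m) * (e : ZMod m)⁻¹)‖ =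
      ∑ x ∈ s, ‖SS f X (a * (x.1 : ZMod m) * (x.2.1 : ZMod m)⁻¹ * (x.2.2 : ZMod m)⁻¹)‖ := by
    rw [hs, Finset.sum_product]
    refine Finset.sum_congr rfl fun h _ => ?_
    rw [Finset.sum_product]
    refine Finset.sum_congr rfl fun e _ => ?_
    have : (1 : ZMod m)⁻¹ = 1 := by
      have := unit_of_coprime (m := m) (n := 1) (Nat.coprime_one_left m)
      simpa using this
    simp [this]
  have h1 := holder2 s (fun x => a * (x.1 : ZMod m) * (x.2.1 : ZMod m)⁻¹ * (x.2.2 : ZMod m)⁻¹) (fun w => ‖SS f X w‖)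
  have hcoll := coll3 hg a ha (2 * H) (2 * E) 1 (by
      have := hg.hm
      calc 2 * H * (2 * E) * 1 ≤ m * (m * m) := by
            have : 2 * H ≤ m := by omega
            have : 2 * E ≤ m * m := by nlinarith
            rw [mul_one]; gcongr
        _ = m ^ 3 := by ring
        _ ≤ _ := Nat.pow_le_pow_right (by omega) (by norm_num)) s (by
      rintro ⟨h, e, u⟩ hx
      simp only [hs, Finset.mem_product, Finset.mem_singleton] at hx
      have a1 := mem_blk0 hx.1
      have a2 := mem_blk hx.2.1
      simp only [Finset.mem_Icc, hx.2.2]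
      refine ⟨⟨a1.1, by omega⟩, ⟨a2.1, by omega⟩, ⟨le_refl _, le_refl _⟩, a2.2.2.2.2, Nat.coprime_one_left m⟩)
  have h2 := SS_sq_sum (m := m) f X (2 * Q) hf
  rw [hsum, mul_pow]
  set g := min ((X : ℝ) / (E * m)) (1 / H) with hgdef
  have hg0 : 0 ≤ g := le_min (by positivity) (by positivity)
  have g1 : g * H ≤ 1 := by
    have : g ≤ 1 / H := min_le_right _ _
    rwa [le_div_iff₀ hH0] at this
  have g2 : g * E ≤ X / m := by
    have : g ≤ X / (E * m) := min_le_left _ _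
    calc g * E ≤ X / (E * m) * E := by gcongr
      _ = _ := by field_simp
  have h3 : (m : ℝ) * (2 * Q) ^ 2 * (X * (X / m + 1)) ≤ 8 * Q ^ 2 * X ^ 2 := by
    have : (m : ℝ) * (2 * Q) ^ 2 * (X * (X / m + 1)) = 4 * Q ^ 2 * X * (X + m) := by field_simp; ring
    rw [this]
    have : 4 * Q ^ 2 * X * (X + m) ≤ 4 * Q ^ 2 * X * (X + X) := by gcongr
    linarith
  set N : ℝ := (H : ℝ) * E with hN
  have h4 : (((2 * H * (2 * E) * 1 : ℕ)) : ℝ) = 4 * N := by push_cast; ring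
  rw [h4] at hcoll
  calc g ^ 2 * (∑ x ∈ s, ‖SS f X (a * (x.1 : ZMod m) * (x.2.1 : ZMod m)⁻¹ * (x.2.2 : ZMod m)⁻¹)‖) ^ 2
      ≤ g ^ 2 * ((Q ^ 4 * (4 * N * (4 * N / m + 1))) * (8 * Q ^ 2 * X ^ 2)) := by
        refine mul_le_mul_of_nonneg_left (h1.trans ?_) (by positivity)
        exact mul_le_mul hcoll (h2.trans h3) (Finset.sum_nonneg fun w _ => by positivity) (by positivity)
    _ = 32 * Q ^ 6 * X ^ 2 * ((g * H) * (g * E) + 4 * ((g * H) ^ 2 * E ^ 2 / m)) := by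
        rw [hN]; field_simp; ring
    _ ≤ 32 * Q ^ 6 * X ^ 2 * (1 * (X / m) + 4 * (1 ^ 2 * E ^ 2 / m)) := by gcongr
    _ = _ := by ring

end part4




section part5
variable {m : ℕ} [NeZero m]

/-- pairs with given sum of inverses -/
def rhoSet (s : Finset ℕ) (c : ZMod m) : Finset (ℕ × ℕ) :=
  (s ×ˢ s).filter (fun p => (p.1 : ZMod m)⁻¹ + (p.2 : ZMod m)⁻¹ = c)

theorem rho_cong {v1 v2 : ℕ} (h1 : v1.Coprime m) (h2 : v2.Coprime m) (c : ZMod m)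
    (h : (v1 : ZMod m)⁻¹ + (v2 : ZMod m)⁻¹ = c) : (v1 : ZMod m) + v2 = c * v1 * v2 := by
  have e1 := unit_of_coprime h1
  have e2 := unit_of_coprime h2
  rw [← h]
  linear_combination (-(v2 : ZMod m)) * e1 - (v1 : ZMod m) * e2

theorem rho_good {Q : ℝ} (hg : Good m Q) (B : ℕ) (hB : B < m) (s : Finset ℕ)
    (hs : ∀ v ∈ s, 1 ≤ v ∧ v ≤ B ∧ v.Coprime m) (c : ZMod m) (t : ℕ) (ht1 : 1 ≤ t) (htm : t < m)
    (c' : ℤ) (hc0 : c' ≠ 0) (hcm : |c'| ≤ m) (hcc : (t : ZMod m) * c = (c' : ZMod m)) (K : ℕ)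
    (hK : ∀ k : ℤ, |(m : ℤ) * k| ≤ |c'| * B ^ 2 + 2 * t * B → |k| ≤ K) :
    (rhoSet s c).card ≤ 2 * ⌊Q⌋₊ * (2 * K + 1) := by
  have hm0 : (m : ℤ) ≠ 0 := by exact_mod_cast NeZero.ne m
  -- divisibility
  have hdiv : ∀ p ∈ rhoSet s c, (m : ℤ) ∣ c' * p.1 * p.2 - t * (p.1 + p.2) := by
    rintro ⟨v1, v2⟩ hp
    simp only [rhoSet, Finset.mem_filter, Finset.mem_product] at hp
    have a1 := hs _ hp.1.1
    have a2 := hs _ hp.1.2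
    have := rho_cong a1.2.2 a2.2.2 c hp.2
    rw [← ZMod.intCast_zmod_eq_zero_iff_dvd] <;> try exact inferInstance
    push_cast
    rw [this, ← hcc]
    ring
  have hne : ∀ v1 v2 : ℕ, v1 ∈ s → v2 ∈ s → (v1 : ZMod m)⁻¹ + (v2 : ZMod m)⁻¹ = c →
      c' * v1 - t ≠ 0 := by
    intro v1 v2 h1 h2 h h0
    have e1 := unit_of_coprime (hs v1 h1).2.2
    have e2 := unit_of_coprime (hs v2 h2).2.2
    have h3 : ((c' * v1 - t : ℤ) : ZMod m) = 0 := by rw [h0]; simp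
    push_cast at h3
    rw [← hcc, ← h] at h3
    have h4 : (t : ZMod m) = 0 := by
      have h5 : (t : ZMod m) * (v2 : ZMod m)⁻¹ * v1 = 0 := by
        linear_combination h3 - (t : ZMod m) * e1
      linear_combination ((v2 : ZMod m) * (v1 : ZMod m)⁻¹) * h5 -
        (t : ZMod m) * ((v1 : ZMod m) * (v1 : ZMod m)⁻¹) * e2 - (t : ZMod m) * e1
    rw [ZMod.natCast_eq_zero_iff] at h4
    exact absurd (Nat.le_of_dvd ht1 h4) (by omega)
  have maps : ∀ p ∈ rhoSet s c, (c' * p.1 * p.2 - t * (p.1 + p.2)) / m ∈ Icc (-(K : ℤ)) K := by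
    rintro ⟨v1, v2⟩ hp
    obtain ⟨k, hk⟩ := hdiv _ hp
    simp only [rhoSet, Finset.mem_filter, Finset.mem_product] at hp
    simp only at hk ⊢
    have a1 := hs _ hp.1.1
    have a2 := hs _ hp.1.2
    rw [hk, Int.mul_ediv_cancel_left _ hm0, Finset.mem_Icc, ← abs_le]
    apply hK
    rw [← hk]
    have b1 : (0 : ℤ) ≤ v1 := by positivity
    have b2 : (0 : ℤ) ≤ v2 := by positivity
    have b3 : (v1 : ℤ) ≤ B := by exact_mod_cast a1.2.1
    have b4 : (v2 : ℤ) ≤ B := by exact_mod_cast a2.2.1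
    calc |c' * v1 * v2 - t * (v1 + v2)| ≤ |c' * v1 * v2| + |(t : ℤ) * (v1 + v2)| := abs_sub _ _
      _ = |c'| * (v1 * v2) + t * (v1 + v2) := by
          rw [mul_assoc, abs_mul, abs_of_nonneg (mul_nonneg b1 b2),
            abs_of_nonneg (mul_nonneg (by positivity) (add_nonneg b1 b2))]
      _ ≤ |c'| * (B * B) + t * (B + B) := by gcongr
      _ = _ := by ring
  have fib : ∀ k ∈ Icc (-(K : ℤ)) K, ((rhoSet s c).filter
      (fun p => (c' * p.1 * p.2 - t * (p.1 + p.2)) / m = k)).card ≤ 2 * ⌊Q⌋₊ := by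
    intro k _
    by_cases hne' : ((rhoSet s c).filter
      (fun p => (c' * p.1 * p.2 - t * (p.1 + p.2)) / m = k)).Nonempty
    swap
    · rw [Finset.not_nonempty_iff_eq_empty.mp hne']; simp
    have eqn : ∀ p ∈ (rhoSet s c).filter
      (fun p => (c' * p.1 * p.2 - t * (p.1 + p.2)) / m = k),
        (c' * p.1 - t) * (c' * p.2 - t) = c' * (m * k) + t ^ 2 ∧ c' * p.1 - t ≠ 0 ∧ c' * p.2 - t ≠ 0
        ∧ p.1 ≤ B ∧ p.2 ≤ B := by
      rintro ⟨v1, v2⟩ hp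
      rw [Finset.mem_filter] at hp
      obtain ⟨k', hk'⟩ := hdiv _ hp.1
      have h2 := hp.2
      simp only at hk' h2
      rw [hk', Int.mul_ediv_cancel_left _ hm0] at h2
      have h3 := hp.1
      simp only [rhoSet, Finset.mem_filter, Finset.mem_product] at h3
      refine ⟨?_, hne v1 v2 h3.1.1 h3.1.2 h3.2, hne v2 v1 h3.1.2 h3.1.1 ?_, (hs _ h3.1.1).2.1, (hs _ h3.1.2).2.1⟩
      · rw [← h2, ← hk']; simp only; ring
      · rw [add_comm]; exact h3.2
    set Δ : ℤ := c' * (m * k) + t ^ 2 with hΔ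
    have hΔ0 : Δ ≠ 0 ∧ Δ.natAbs ≤ m ^ 12 := by
      obtain ⟨p, hp⟩ := hne'
      obtain ⟨h1, h2, h3, h4, h5⟩ := eqn p hp
      refine ⟨by rw [← h1]; exact mul_ne_zero h2 h3, ?_⟩
      have b : ∀ v : ℕ, v ≤ B → |c' * v - t| ≤ (m : ℤ) ^ 2 * 2 := by
        intro v hv
        have hv' : (v : ℤ) ≤ m := by exact_mod_cast (by omega)
        have ht' : (t : ℤ) ≤ m := by exact_mod_cast (by omega)
        have hm1 : (1 : ℤ) ≤ m := by exact_mod_cast NeZero.pos m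
        calc |c' * v - t| ≤ |c' * v| + |(t : ℤ)| := abs_sub _ _
          _ = |c'| * v + t := by rw [abs_mul, Nat.abs_cast, Nat.abs_cast]
          _ ≤ m * m + m := by gcongr
          _ ≤ _ := by nlinarith
      have : (Δ.natAbs : ℤ) ≤ (m : ℤ) ^ 12 := by
        rw [Int.natCast_natAbs, ← h1, abs_mul]
        have h16 : (16 : ℤ) ≤ m := by exact_mod_cast hg.hm
        calc _ ≤ ((m : ℤ) ^ 2 * 2) * ((m : ℤ) ^ 2 * 2) := mul_le_mul (b _ h4) (b _ h5) (abs_nonneg _) (by positivity)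
          _ = (m : ℤ) ^ 4 * 4 := by ring
          _ ≤ (m : ℤ) ^ 4 * (m : ℤ) ^ 8 := by
              gcongr
              calc (4 : ℤ) ≤ m := by linarith
                _ = (m : ℤ) ^ 1 := by ring
                _ ≤ _ := pow_le_pow_right₀ (by linarith) (by norm_num)
          _ = _ := by ring
      exact_mod_cast this
    have tΔ := hg.tauN (n := Δ.natAbs) (by simpa using hΔ0.1) hΔ0.2
    calc _ ≤ (Δ.natAbs.divisors ×ˢ (univ : Finset Bool)).card := by
          apply Finset.card_le_card_of_injOn
            (fun p => ((c' * p.1 - t).natAbs, decide (0 ≤ c' * p.1 - t)))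
          · intro p hp
            obtain ⟨h1, h2, h3, _⟩ := eqn p hp
            simp only [Finset.coe_product, Set.mem_prod, Finset.mem_coe, Nat.mem_divisors, Finset.mem_univ, and_true]
            refine ⟨?_, by simpa using hΔ0.1⟩
            rw [Int.natAbs_dvd_natAbs]
            exact ⟨_, h1.symm⟩
          · intro p hp q hq hpq
            obtain ⟨h1, h2, h3, _⟩ := eqn p hp
            obtain ⟨g1, g2, g3, _⟩ := eqn q hq
            simp only [Prod.mk.injEq, decide_eq_decide] at hpq
            have e : c' * p.1 - t = c' * q.1 - t := by
              obtain ⟨x1, x2⟩ := hpq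
              omega
            have e1 : (p.1 : ℤ) = q.1 := mul_left_cancel₀ hc0 (by linarith)
            rw [e] at h1
            have e2 : c' * p.2 - t = c' * q.2 - t := mul_left_cancel₀ g2 (h1.trans g1.symm)
            have e3 : (p.2 : ℤ) = q.2 := mul_left_cancel₀ hc0 (by linarith)
            ext
            · exact_mod_cast e1
            · exact_mod_cast e3
      _ ≤ _ := by
          simp only [Finset.card_product, Finset.card_univ, Fintype.card_bool]
          omega
  have := Finset.card_le_mul_card_image_of_maps_to maps _ fib
  refine this.trans (le_of_eq ?_)
  congr 1
  rw [Int.card_Icc]; omega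



theorem rho_le_card (B : ℕ) (hB : B < m) (s : Finset ℕ)
    (hs : ∀ v ∈ s, 1 ≤ v ∧ v ≤ B ∧ v.Coprime m) (c : ZMod m) : (rhoSet s c).card ≤ B := by
  calc (rhoSet s c).card ≤ (Icc 1 B).card := by
        apply Finset.card_le_card_of_injOn (fun p => p.1)
        · intro p hp
          simp only [rhoSet, Finset.coe_filter, Finset.mem_product, Set.mem_ofPred_eq] at hp
          have := hs _ hp.1.1
          simp only [Finset.coe_Icc, Set.mem_Icc]
          exact ⟨this.1, this.2.1⟩
        · intro p hp q hq hpq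
          simp only [rhoSet, Finset.coe_filter, Finset.mem_product, Set.mem_ofPred_eq] at hp hq
          simp only at hpq
          have h1 := hs _ hp.1.2
          have h2 := hs _ hq.1.2
          have e : (p.2 : ZMod m)⁻¹ = (q.2 : ZMod m)⁻¹ := by
            have := hp.2.trans hq.2.symm
            rw [hpq] at this
            exact add_left_cancel this
          have e2 : (p.2 : ZMod m) = (q.2 : ZMod m) := eq_of_inv_eq h1.2.2 h2.2.2 e
          rw [ZMod.natCast_eq_natCast_iff'] at e2
          rw [Nat.mod_eq_of_lt (by omega), Nat.mod_eq_of_lt (by omega)] at e2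
          ext
          · exact hpq
          · exact e2
    _ = B := by simp

def badP (m : ℕ) (s : Finset ℕ) (T : ℕ) : Finset (ℕ × ℕ) :=
  (s ×ˢ s).filter (fun p => ∃ t ∈ Icc 1 T, m ∣ t * (p.1 + p.2))

theorem card_badP {Q : ℝ} (hg : Good m Q) (B : ℕ) (hB : B < m) (s : Finset ℕ)
    (hs : ∀ v ∈ s, 1 ≤ v ∧ v ≤ B ∧ v.Coprime m) (T : ℕ) (hT : T ≤ m) :
    (badP m s T).card ≤ B * (2 * B * T / m * ⌊Q⌋₊) := by
  have hm0 : 0 < m := NeZero.pos m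
  calc (badP m s T).card ≤ ((Icc 1 B) ×ˢ ((Icc 1 (2 * B * T / m)).biUnion (fun k => (m * k).divisors))).card := by
        apply Finset.card_le_card_of_injOn (fun p => (p.1, p.1 + p.2))
        · rintro ⟨v1, v2⟩ hp
          simp only [badP, Finset.coe_filter, Finset.mem_product, Set.mem_ofPred_eq] at hp
          obtain ⟨⟨h1, h2⟩, t, ht, k, hk⟩ := hp
          have a1 := hs _ h1
          have a2 := hs _ h2
          rw [Finset.mem_Icc] at ht
          have hk0 : k ≠ 0 := by
            rintro rfl
            have : 0 < t * (v1 + v2) := Nat.mul_pos (by omega) (by omega)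
            omega
          simp only [Finset.coe_product, Set.mem_prod, Finset.mem_coe, Finset.mem_Icc, Finset.mem_biUnion, Nat.mem_divisors]
          refine ⟨⟨a1.1, a1.2.1⟩, k, ⟨by omega, ?_⟩, ⟨t, by rw [← hk]; ring⟩, by positivity⟩
          rw [Nat.le_div_iff_mul_le hm0]
          calc k * m = t * (v1 + v2) := by rw [hk]; ring
            _ ≤ T * (B + B) := by gcongr <;> omega
            _ = _ := by ring
        · rintro ⟨v1, v2⟩ hp ⟨w1, w2⟩ hq h
          simp only [Prod.mk.injEq] at h ⊢
          omega
    _ = B * ((Icc 1 (2 * B * T / m)).biUnion (fun k => (m * k).divisors)).card := by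
        rw [Finset.card_product]; simp
    _ ≤ _ := by
        apply Nat.mul_le_mul_left
        refine (Finset.card_biUnion_le_card_mul _ _ ⌊Q⌋₊ ?_).trans (by simp)
        intro k hk
        rw [Finset.mem_Icc] at hk
        apply hg.tauN
        · have : 0 < m * k := Nat.mul_pos hm0 (by omega)
          omega
        · have h16 := hg.hm
          have : k ≤ 2 * m := by
            refine hk.2.trans ?_
            rw [Nat.div_le_iff_le_mul_add_pred hm0]
            calc 2 * B * T ≤ 2 * m * m := by gcongr
              _ ≤ _ := by nlinarith
          calc m * k ≤ m * (2 * m) := by gcongr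
            _ ≤ m * (m * m) := by gcongr; omega
            _ = m ^ 3 := by ring
            _ ≤ m ^ 12 := Nat.pow_le_pow_right hm0 (by norm_num)

theorem energy {Q : ℝ} (hg : Good m Q) (B : ℕ) (hB1 : 1 ≤ B) (hB : B < m) (s : Finset ℕ)
    (hs : ∀ v ∈ s, 1 ≤ v ∧ v ≤ B ∧ v.Coprime m) :
    ∑ c : ZMod m, ((rhoSet s c).card : ℝ) ^ 2 ≤ Q * B ^ 2 * (2 + 14 * (B * Real.sqrt (B / m))) := by
  have hm0 : 0 < m := NeZero.pos m
  have hmR : (0 : ℝ) < m := by exact_mod_cast hm0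
  have hBR : (0 : ℝ) < B := by exact_mod_cast hB1
  have hQ := hg.two_le
  set T := Nat.sqrt (m * B) with hTdef
  set r : ℝ := B * Real.sqrt (B / m) with hr
  have hr0 : 0 ≤ r := by positivity
  have hT1 : 1 ≤ T := by
    rw [hTdef, Nat.le_sqrt]; nlinarith
  have hTm : T < m := by
    rw [hTdef, Nat.sqrt_lt]; nlinarith
  have hTr : (T : ℝ) * B / m ≤ r := by
    have h1 : (T : ℝ) ≤ Real.sqrt (m * B) := by
      have := Real.nat_sqrt_le_real_sqrt (a := m * B)
      push_cast at this; exact this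
    have h2 : Real.sqrt (m * B) = m * Real.sqrt (B / m) := by
      rw [show (m : ℝ) * B = m ^ 2 * (B / m) by field_simp, Real.sqrt_mul (by positivity), Real.sqrt_sq hmR.le]
    rw [h2] at h1
    calc (T : ℝ) * B / m ≤ (m * Real.sqrt (B / m)) * B / m := by gcongr
      _ = r := by rw [hr]; field_simp
  have hTr2 : (B : ℝ) ^ 2 / (T + 1) ≤ r := by
    have h1 : Real.sqrt (m * B) ≤ T + 1 := by
      have := Real.real_sqrt_le_nat_sqrt_succ (a := m * B)
      push_cast at this; exact this
    have h2 : (B : ℝ) / Real.sqrt (m * B) = Real.sqrt (B / m) := by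
      rw [Real.sqrt_mul hmR.le, Real.sqrt_div hBR.le]
      have e := Real.mul_self_sqrt hBR.le
      have : 0 < Real.sqrt B := Real.sqrt_pos.mpr hBR
      have : 0 < Real.sqrt m := Real.sqrt_pos.mpr hmR
      field_simp
      nlinarith
    have h3 : 0 < Real.sqrt (m * B) := Real.sqrt_pos.mpr (by positivity)
    calc (B : ℝ) ^ 2 / (T + 1) ≤ (B : ℝ) ^ 2 / Real.sqrt (m * B) := by gcongr
      _ = B * (B / Real.sqrt (m * B)) := by ring
      _ = r := by rw [h2]
  -- every c is good or bad
  have key : ∀ c : ZMod m, ((rhoSet s c).card : ℝ) ^ 2 ≤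
      (2 * Q * (6 * r + 1)) * (rhoSet s c).card + B * ((badP m s T).filter (fun p => (p.1 : ZMod m)⁻¹ + (p.2 : ZMod m)⁻¹ = c)).card := by
    intro c
    obtain ⟨j, k, hk0, hkT, hjk⟩ := Real.exists_int_int_abs_mul_sub_le ((c.val : ℝ) / m) (n := T) (by omega)
    obtain ⟨t, rfl⟩ := Int.eq_ofNat_of_zero_le hk0.le
    have ht1 : 1 ≤ t := by exact_mod_cast hk0
    have htT : t ≤ T := by exact_mod_cast hkT
    set c' : ℤ := t * c.val - j * m with hc'
    have hcc : (t : ZMod m) * c = (c' : ZMod m) := by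
      rw [hc']; push_cast; simp
    have hcb : |(c' : ℝ)| ≤ m / (T + 1) := by
      have e : (c' : ℝ) = m * (t * ((c.val : ℝ) / m) - j) := by
        rw [hc']; push_cast; field_simp
      rw [e, abs_mul, abs_of_pos hmR]
      calc (m : ℝ) * |(t : ℝ) * ((c.val : ℝ) / m) - j| ≤ m * (1 / (T + 1)) := by
            gcongr; exact_mod_cast hjk
        _ = _ := by ring
    by_cases hc0 : c' = 0
    · have hsub : rhoSet s c ⊆ (badP m s T).filter (fun p => (p.1 : ZMod m)⁻¹ + (p.2 : ZMod m)⁻¹ = c) := by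
        rintro ⟨v1, v2⟩ hp
        simp only [rhoSet, Finset.mem_filter, Finset.mem_product] at hp
        simp only [badP, Finset.mem_filter, Finset.mem_product]
        refine ⟨⟨hp.1, t, by simp; omega, ?_⟩, hp.2⟩
        have := rho_cong (hs _ hp.1.1).2.2 (hs _ hp.1.2).2.2 c hp.2
        rw [← ZMod.natCast_eq_zero_iff]
        push_cast
        rw [this, ← mul_assoc, ← mul_assoc, hcc, hc0]; simp
      have h1 : ((rhoSet s c).card : ℝ) ≤ ((badP m s T).filter (fun p => (p.1 : ZMod m)⁻¹ + (p.2 : ZMod m)⁻¹ = c)).card := by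
        exact_mod_cast Finset.card_le_card hsub
      have h2 : ((rhoSet s c).card : ℝ) ≤ B := by exact_mod_cast rho_le_card B hB s hs c
      have h3 : 0 ≤ (2 * Q * (6 * r + 1)) * (rhoSet s c).card := by positivity
      have h4 : (0 : ℝ) ≤ (rhoSet s c).card := by positivity
      nlinarith [mul_le_mul h2 h1 h4 hBR.le]
    · have hcm : |c'| ≤ m := by
        have : |(c' : ℝ)| ≤ m := hcb.trans (div_le_self hmR.le (by linarith [show (0 : ℝ) ≤ T by positivity]))
        exact_mod_cast this
      have h := rho_good hg B hB s hs c t ht1 (by omega) c' hc0 hcm hcc ⌊3 * r⌋₊ ?_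
      · have h1 : ((rhoSet s c).card : ℝ) ≤ 2 * Q * (6 * r + 1) := by
          calc ((rhoSet s c).card : ℝ) ≤ ((2 * ⌊Q⌋₊ * (2 * ⌊3 * r⌋₊ + 1) : ℕ) : ℝ) := by exact_mod_cast h
            _ = 2 * (⌊Q⌋₊ : ℝ) * (2 * (⌊3 * r⌋₊ : ℝ) + 1) := by push_cast; ring
            _ ≤ 2 * Q * (2 * (3 * r) + 1) := by
                gcongr
                · exact Nat.floor_le (by linarith)
                · exact Nat.floor_le (by positivity)
            _ = _ := by ring
        have h4 : (0 : ℝ) ≤ (rhoSet s c).card := by positivity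
        have h5 : (0 : ℝ) ≤ B * ((badP m s T).filter (fun p => (p.1 : ZMod m)⁻¹ + (p.2 : ZMod m)⁻¹ = c)).card := by positivity
        nlinarith
      · intro k hk
        have hkR : (m : ℝ) * |(k : ℝ)| ≤ |(c' : ℝ)| * B ^ 2 + 2 * t * B := by
          have : ((|(m : ℤ) * k| : ℤ) : ℝ) ≤ ((|c'| * B ^ 2 + 2 * t * B : ℤ) : ℝ) := by exact_mod_cast hk
          push_cast at this
          rwa [abs_mul, abs_of_pos hmR] at this
        have h1 : |(k : ℝ)| ≤ 3 * r := by
          have e1 : |(c' : ℝ)| * B ^ 2 ≤ m * r := by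
            calc |(c' : ℝ)| * (B : ℝ) ^ 2 ≤ (m : ℝ) / (T + 1) * (B : ℝ) ^ 2 := by gcongr
              _ = (m : ℝ) * ((B : ℝ) ^ 2 / (T + 1)) := by ring
              _ ≤ m * r := by gcongr
          have e2 : 2 * (t : ℝ) * B ≤ 2 * (m * r) := by
            have : (t : ℝ) ≤ T := by exact_mod_cast htT
            have h9 : (T : ℝ) * B ≤ m * r := by
              rw [div_le_iff₀ hmR] at hTr; linarith
            nlinarith
          have : (m : ℝ) * |(k : ℝ)| ≤ m * (3 * r) := by linarith
          exact le_of_mul_le_mul_left this hmR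
        have h2 : k.natAbs ≤ ⌊3 * r⌋₊ := by
          apply Nat.le_floor
          rw [Nat.cast_natAbs]; push_cast; exact h1
        have := Int.natCast_natAbs k
        omega
  have sum1 : ∑ c : ZMod m, ((rhoSet s c).card : ℝ) ≤ B ^ 2 := by
    have e : ∑ c : ZMod m, (rhoSet s c).card = (s ×ˢ s).card := by
      rw [Finset.card_eq_sum_card_fiberwise (f := fun p : ℕ × ℕ => (p.1 : ZMod m)⁻¹ + (p.2 : ZMod m)⁻¹) (t := univ) (by simp)]
      rfl
    have h2 : s.card ≤ B := by
      have : s ⊆ Icc 1 B := fun v hv => by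
        have := hs v hv
        rw [Finset.mem_Icc]; exact ⟨this.1, this.2.1⟩
      simpa using Finset.card_le_card this
    have h3 : (s ×ˢ s).card ≤ B ^ 2 := by rw [Finset.card_product, sq]; gcongr
    rw [← e] at h3
    exact_mod_cast h3
  have sum2 : ∑ c : ZMod m, (((badP m s T).filter (fun p => (p.1 : ZMod m)⁻¹ + (p.2 : ZMod m)⁻¹ = c)).card : ℝ) ≤ B * (2 * r * Q) := by
    have e : ∑ c : ZMod m, ((badP m s T).filter (fun p => (p.1 : ZMod m)⁻¹ + (p.2 : ZMod m)⁻¹ = c)).card = (badP m s T).card := by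
      rw [Finset.card_eq_sum_card_fiberwise (s := badP m s T) (f := fun p : ℕ × ℕ => (p.1 : ZMod m)⁻¹ + (p.2 : ZMod m)⁻¹) (t := univ) (by simp)]
    have h := card_badP hg B hB s hs T hTm.le
    rw [← e] at h
    calc _ ≤ ((B * (2 * B * T / m * ⌊Q⌋₊) : ℕ) : ℝ) := by exact_mod_cast h
      _ = (B : ℝ) * (((2 * B * T / m : ℕ) : ℝ) * ⌊Q⌋₊) := by push_cast; ring
      _ ≤ B * (2 * r * Q) := by
          gcongr
          · calc ((2 * B * T / m : ℕ) : ℝ) ≤ ((2 * B * T : ℕ) : ℝ) / m := Nat.cast_div_le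
              _ = 2 * (T * B / m) := by push_cast; ring
              _ ≤ 2 * r := by gcongr
          · exact Nat.floor_le (by linarith)
  calc ∑ c : ZMod m, ((rhoSet s c).card : ℝ) ^ 2 ≤ ∑ c : ZMod m, ((2 * Q * (6 * r + 1)) * (rhoSet s c).card + B * ((badP m s T).filter (fun p => (p.1 : ZMod m)⁻¹ + (p.2 : ZMod m)⁻¹ = c)).card) :=
        Finset.sum_le_sum (fun c _ => key c)
    _ = (2 * Q * (6 * r + 1)) * ∑ c : ZMod m, ((rhoSet s c).card : ℝ) + B * ∑ c : ZMod m, (((badP m s T).filter (fun p => (p.1 : ZMod m)⁻¹ + (p.2 : ZMod m)⁻¹ = c)).card : ℝ) := by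
        rw [Finset.sum_add_distrib, Finset.mul_sum, Finset.mul_sum]
    _ ≤ (2 * Q * (6 * r + 1)) * B ^ 2 + B * (B * (2 * r * Q)) := by gcongr
    _ = _ := by ring

/-- fourth moment of short sums over inverses -/
theorem fourth_moment {Q : ℝ} (hg : Good m Q) (B : ℕ) (hB1 : 1 ≤ B) (hB : B < m) (s : Finset ℕ)
    (hs : ∀ v ∈ s, 1 ≤ v ∧ v ≤ B ∧ v.Coprime m) (β : ℕ → ℂ) (b : ℝ) (hb : 0 ≤ b) (hβ : ∀ v ∈ s, ‖β v‖ ≤ b) :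
    ∑ w : ZMod m, ‖∑ v ∈ s, β v * ee (w * (v : ZMod m)⁻¹)‖ ^ 4 ≤
      m * b ^ 4 * (Q * B ^ 2 * (2 + 14 * (B * Real.sqrt (B / m)))) := by
  have h := parseval_le (s ×ˢ s) (fun p : ℕ × ℕ => β p.1 * β p.2) (fun p => (p.1 : ZMod m)⁻¹ + (p.2 : ZMod m)⁻¹) (b ^ 2) (by
    rintro ⟨v1, v2⟩ hp
    rw [Finset.mem_product] at hp
    rw [norm_mul, sq]
    exact mul_le_mul (hβ _ hp.1) (hβ _ hp.2) (norm_nonneg _) hb)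
  calc _ = ∑ w : ZMod m, ‖∑ i ∈ s ×ˢ s, β i.1 * β i.2 * ee (w * ((i.1 : ZMod m)⁻¹ + (i.2 : ZMod m)⁻¹))‖ ^ 2 := by
        apply Finset.sum_congr rfl
        intro w _
        rw [show 4 = 2 * 2 by norm_num, pow_mul, ← norm_pow, sq (∑ v ∈ s, _), Finset.sum_mul_sum, Finset.sum_product]
        congr 2
        apply Finset.sum_congr rfl; intro v1 _
        apply Finset.sum_congr rfl; intro v2 _
        rw [mul_add, ee_add]; ring
    _ ≤ _ := h
    _ ≤ _ := by
        rw [show m * (b ^ 2) ^ 2 = m * b ^ 4 by ring]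
        gcongr
        exact energy hg B hB1 hB s hs

end part5




section part6
variable {m : ℕ} [NeZero m]

/-- uniform majorant for the Dirichlet kernels -/
noncomputable def GG (j : ZMod m) : ℝ :=
  (range (m + 1)).sup' ⟨0, by simp⟩ (fun y => ‖DD y j‖)

theorem norm_DD_le_GG (y : ℕ) (hy : y ≤ m) (j : ZMod m) : ‖DD y j‖ ≤ GG j :=
  Finset.le_sup' (fun y => ‖DD y j‖) (Finset.mem_range.mpr (by omega))

theorem GG_nonneg (j : ZMod m) : 0 ≤ GG j := (norm_nonneg _).trans (norm_DD_le_GG 0 (by omega) j)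

theorem GG_le (h : ℕ) (h1 : 1 ≤ h) (h2 : 2 * h ≤ m) : GG (h : ZMod m) ≤ m / (2 * h) := by
  apply Finset.sup'_le
  intro y _
  exact norm_DD_le' y h h1 h2

theorem GG_neg_le (h : ℕ) (h1 : 1 ≤ h) (h2 : 2 * h ≤ m) : GG (-(h : ZMod m)) ≤ m / (2 * h) := by
  apply Finset.sup'_le
  intro y _
  rw [DD_neg]
  exact norm_DD_le' y h h1 h2

theorem GG_zero_le : GG (0 : ZMod m) ≤ m := by
  apply Finset.sup'_le
  intro y hy
  rw [Finset.mem_range] at hy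
  exact (norm_DD_le y 0).trans (by exact_mod_cast (by omega))

theorem sum_GG_le {Q : ℝ} (hg : Good m Q) : ∑ h : ZMod m, GG h ≤ 3 * Q * m := by
  have hm : (0 : ℝ) < m := by exact_mod_cast NeZero.pos m
  rw [← Finset.add_sum_erase _ _ (mem_univ (0 : ZMod m))]
  have h1 : GG (0 : ZMod m) ≤ m := GG_zero_le
  have h2 := sum_erase_le (m := m) (fun h => GG h) (fun _ => GG_nonneg _)
  have h3 : ∑ h ∈ Icc 1 (m / 2), (GG (h : ZMod m) + GG (-(h : ZMod m))) ≤
      ∑ h ∈ Icc 1 (m / 2), (m : ℝ) * ((h : ℝ)⁻¹) := by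
    refine Finset.sum_le_sum fun h hh => ?_
    simp only [Finset.mem_Icc] at hh
    have := GG_le (m := m) h hh.1 (by omega)
    have := GG_neg_le (m := m) h hh.1 (by omega)
    have hh0 : (0 : ℝ) < h := by exact_mod_cast hh.1
    calc _ ≤ (m : ℝ) / (2 * h) + m / (2 * h) := by linarith
      _ = _ := by field_simp; ring
  rw [← Finset.mul_sum] at h3
  have h4 : ∑ h ∈ Icc 1 (m / 2), ((h : ℝ)⁻¹) ≤ 1 + Real.log m := by
    have := harmonic_le_one_add_log m
    rw [harmonic_eq_sum_Icc] at this
    push_cast at this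
    refine le_trans (Finset.sum_le_sum_of_subset_of_nonneg ?_ fun i _ _ => by positivity) this
    exact Finset.Icc_subset_Icc_right (Nat.div_le_self _ _)
  have h5 := hg.log
  have h6 := hg.two_le
  have h7 : (m : ℝ) * ∑ h ∈ Icc 1 (m / 2), ((h : ℝ)⁻¹) ≤ m * (1 + Q) :=
    mul_le_mul_of_nonneg_left (by linarith) hm.le
  nlinarith

/-- bilinear sum over a finite set of short variables -/
noncomputable def TT (α β : ℕ → ℝ) (X : ℕ) (s : Finset ℕ) (w : ZMod m) : ℂ :=
  ∑ v ∈ s, ∑ u ∈ (Icc 1 (X / v)).filter (fun u => u.Coprime m),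
    ((β v : ℂ) * (α u : ℂ)) * ee (w * (u : ZMod m)⁻¹ * (v : ZMod m)⁻¹)

/-- separated inner sum -/
noncomputable def FF (β : ℕ → ℝ) (s : Finset ℕ) (j w : ZMod m) : ℂ :=
  ∑ v ∈ s, ((β v : ℂ) * ee (-(j * (v : ZMod m)))) * ee (w * (v : ZMod m)⁻¹)

theorem cnt_ind (y v : ℕ) (hy : y < m) (hv : v < m) (hv1 : 1 ≤ v) :
    cnt m y (v : ZMod m) = if v ≤ y then 1 else 0 := by
  unfold cnt
  split_ifs with h
  · rw [Finset.card_eq_one]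
    refine ⟨v, ?_⟩
    ext k
    simp only [Finset.mem_filter, Finset.mem_Icc, Finset.mem_singleton]
    constructor
    · rintro ⟨⟨h1, h2⟩, h3⟩
      rw [ZMod.natCast_eq_natCast_iff', Nat.mod_eq_of_lt (by omega), Nat.mod_eq_of_lt (by omega)] at h3
      exact h3
    · rintro rfl; exact ⟨⟨hv1, h⟩, rfl⟩
  · rw [Finset.card_eq_zero, Finset.filter_eq_empty_iff]
    intro k hk h3
    rw [Finset.mem_Icc] at hk
    rw [ZMod.natCast_eq_natCast_iff', Nat.mod_eq_of_lt (by omega), Nat.mod_eq_of_lt (by omega)] at h3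
    omega

theorem inner_sep (β : ℕ → ℝ) (s : Finset ℕ) (r y : ℕ) (hr : r < m) (hs : ∀ v ∈ s, 1 ≤ v ∧ v ≤ r)
    (w : ZMod m) :
    ‖∑ v ∈ s.filter (fun v => v ≤ y), (β v : ℂ) * ee (w * (v : ZMod m)⁻¹)‖ ≤
      (1 / m : ℝ) * ∑ j : ZMod m, GG j * ‖FF β s j w‖ := by
  have hm : (0 : ℝ) < m := by exact_mod_cast NeZero.pos m
  have hmC : (m : ℂ) ≠ 0 := by exact_mod_cast NeZero.ne m
  set y' := min y r with hy'
  have e : (m : ℂ) * ∑ v ∈ s.filter (fun v => v ≤ y), (β v : ℂ) * ee (w * (v : ZMod m)⁻¹) =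
      ∑ j : ZMod m, DD y' j * FF β s j w := by
    rw [Finset.sum_filter, Finset.mul_sum]
    simp only [FF, Finset.mul_sum]
    rw [Finset.sum_comm]
    apply Finset.sum_congr rfl
    intro v hv
    have h1 := hs v hv
    have h2 := cnt_ind (m := m) y' v (by omega) (by omega) h1.1
    have h3 := cnt_eq (m := m) y' (v : ZMod m)
    rw [h2] at h3
    have h4 : (if v ≤ y then (β v : ℂ) * ee (w * (v : ZMod m)⁻¹) else 0) =
        ((if v ≤ y' then 1 else 0 : ℕ) : ℂ) * ((β v : ℂ) * ee (w * (v : ZMod m)⁻¹)) := by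
      by_cases h : v ≤ y
      · rw [if_pos h, if_pos (by omega)]; simp
      · rw [if_neg h, if_neg (by omega)]; simp
    rw [h4, ← mul_assoc, h3, Finset.sum_mul]
    apply Finset.sum_congr rfl
    intro j _
    ring
  have e2 : ∑ v ∈ s.filter (fun v => v ≤ y), (β v : ℂ) * ee (w * (v : ZMod m)⁻¹) =
      (1 / m : ℂ) * ∑ j : ZMod m, DD y' j * FF β s j w := by
    rw [← e]; field_simp
  rw [e2, norm_mul]
  have : ‖(1 / m : ℂ)‖ = 1 / m := by simp
  rw [this]
  gcongr
  refine (norm_sum_le _ _).trans ?_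
  gcongr with j
  rw [norm_mul]
  gcongr
  exact norm_DD_le_GG _ (by omega) j

theorem TT_le (α β : ℕ → ℝ) (X : ℕ) (s : Finset ℕ) (r V : ℕ) (hV : 1 ≤ V) (hr : r < m)
    (hs : ∀ v ∈ s, 1 ≤ v ∧ v ≤ r ∧ V ≤ v) (b : ℝ) (hb : 0 ≤ b) (hα : ∀ u ∈ Icc 1 X, |α u| ≤ b) (w : ZMod m) :
    ‖TT α β X s w‖ ≤ b * (1 / m : ℝ) * ∑ j : ZMod m, GG j *
      ∑ u ∈ (Icc 1 (X / V)).filter (fun u => u.Coprime m), ‖FF β s j (w * (u : ZMod m)⁻¹)‖ := by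
  have e : TT α β X s w = ∑ u ∈ (Icc 1 (X / V)).filter (fun u => u.Coprime m),
      (α u : ℂ) * ∑ v ∈ s.filter (fun v => v ≤ X / u), (β v : ℂ) * ee (w * (u : ZMod m)⁻¹ * (v : ZMod m)⁻¹) := by
    unfold TT
    simp only [Finset.mul_sum]
    rw [Finset.sum_comm' (t' := (Icc 1 (X / V)).filter (fun u => u.Coprime m)) (s' := fun u => s.filter (fun v => v ≤ X / u))]
    · refine Finset.sum_congr rfl fun u _ => Finset.sum_congr rfl fun v _ => by ring
    · intro v u
      simp only [Finset.mem_filter, Finset.mem_Icc]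
      constructor
      · rintro ⟨hv, ⟨hu1, hu2⟩, hu3⟩
        have h := hs v hv
        rw [Nat.le_div_iff_mul_le (by omega)] at hu2
        refine ⟨⟨hv, ?_⟩, ⟨hu1, ?_⟩, hu3⟩
        · rw [Nat.le_div_iff_mul_le (by omega)]; linarith
        · rw [Nat.le_div_iff_mul_le (by omega)]; nlinarith
      · rintro ⟨⟨hv, h1⟩, ⟨hu1, hu2⟩, hu3⟩
        have h := hs v hv
        rw [Nat.le_div_iff_mul_le (by omega)] at h1
        refine ⟨hv, ⟨hu1, ?_⟩, hu3⟩
        rw [Nat.le_div_iff_mul_le (by omega)]; linarith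
  rw [e]
  refine (norm_sum_le _ _).trans ?_
  calc ∑ u ∈ (Icc 1 (X / V)).filter (fun u => u.Coprime m), ‖(α u : ℂ) * ∑ v ∈ s.filter (fun v => v ≤ X / u), (β v : ℂ) * ee (w * (u : ZMod m)⁻¹ * (v : ZMod m)⁻¹)‖
      ≤ ∑ u ∈ (Icc 1 (X / V)).filter (fun u => u.Coprime m), b * ((1 / m : ℝ) * ∑ j : ZMod m, GG j * ‖FF β s j (w * (u : ZMod m)⁻¹)‖) := by
        refine Finset.sum_le_sum fun u hu => ?_
        simp only [Finset.mem_filter, Finset.mem_Icc] at hu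
        rw [norm_mul]
        refine mul_le_mul ?_ (inner_sep β s r (X / u) hr (fun v hv => ⟨(hs v hv).1, (hs v hv).2.1⟩) _) (norm_nonneg _) hb
        rw [Complex.norm_real]
        exact hα u (by rw [Finset.mem_Icc]; exact ⟨hu.1.1, hu.1.2.trans (Nat.div_le_self _ _)⟩)
    _ = _ := by
        simp only [Finset.mul_sum]
        rw [Finset.sum_comm]
        refine Finset.sum_congr rfl fun u _ => Finset.sum_congr rfl fun v _ => by ring

theorem typeII_block {Q : ℝ} (hg : Good m Q) (α β : ℕ → ℝ) (X D r V : ℕ) (hX : X ≤ m) (hD : D ≤ m)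
    (hV1 : 1 ≤ V) (hVm : 2 * V < m) (hr : r < m)
    (hα : ∀ u ∈ Icc 1 X, |α u| ≤ Q) (hβ : ∀ u ∈ Icc 1 r, |β u| ≤ Q)
    (a : ZMod m) (ha : IsUnit a) (E H : ℕ)
    (hE : 1 ≤ E) (hED : E ≤ D) (hH : 1 ≤ H) (hHm : H ≤ m / 2) :
    (min ((X : ℝ) / (E * m)) (1 / H) *
        ∑ h ∈ blk0 (m / 2) H, ∑ e ∈ blk m D E, ‖TT α β X (blk m r V) (a * (h : ZMod m) * (e : ZMod m)⁻¹)‖) ^ 4 ≤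
      81 * 40960 * Q ^ 17 * (X : ℝ) ^ 4 * ((E : ℝ) ^ 4 / V ^ 2 + (E : ℝ) ^ 2 / V) * (1 + V * Real.sqrt (V / m)) := by
  have hm : (0 : ℝ) < m := by exact_mod_cast NeZero.pos m
  have hQ := hg.two_le
  have hE0 : (0 : ℝ) < E := by exact_mod_cast hE
  have hH0 : (0 : ℝ) < H := by exact_mod_cast hH
  have hV0 : (0 : ℝ) < V := by exact_mod_cast hV1
  set U := X / V with hU
  have hUX : (U : ℝ) ≤ X / V := by rw [hU]; exact Nat.cast_div_le
  set s : Finset (ℕ × ℕ × ℕ) := blk0 (m / 2) H ×ˢ (blk m D E ×ˢ (Icc 1 U).filter (fun u => u.Coprime m)) with hs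
  set φ : ℕ × ℕ × ℕ → ZMod m := fun x => a * (x.1 : ZMod m) * (x.2.1 : ZMod m)⁻¹ * (x.2.2 : ZMod m)⁻¹ with hφ
  have hsmem : ∀ x ∈ s, x.1 ∈ Icc 1 (2 * H) ∧ x.2.1 ∈ Icc 1 (2 * E) ∧ x.2.2 ∈ Icc 1 U ∧
      x.2.1.Coprime m ∧ x.2.2.Coprime m := by
    rintro ⟨h, e, u⟩ hx
    simp only [hs, Finset.mem_product, Finset.mem_filter, Finset.mem_Icc] at hx
    have a1 := mem_blk0 hx.1
    have a2 := mem_blk hx.2.1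
    simp only [Finset.mem_Icc]
    exact ⟨⟨a1.1, by omega⟩, ⟨a2.1, by omega⟩, hx.2.2.1, a2.2.2.2.2, hx.2.2.2⟩
  have hUm : U ≤ m := (Nat.div_le_self _ _).trans hX
  have hcoll := coll3 hg a ha (2 * H) (2 * E) U (by
      have := hg.hm
      calc 2 * H * (2 * E) * U ≤ m * (m * m) * m := by
            have : 2 * H ≤ m := by omega
            have : 2 * E ≤ m * m := by nlinarith
            gcongr
        _ = m ^ 4 := by ring
        _ ≤ _ := Nat.pow_le_pow_right (by omega) (by norm_num)) s hsmem
  set N : ℝ := 4 * (H * E * U) with hN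
  have h4 : (((2 * H * (2 * E) * U : ℕ)) : ℝ) = N := by push_cast; ring
  rw [h4] at hcoll
  have hcard : (s.card : ℝ) ≤ N := by
    have : s ⊆ (Icc 1 (2 * H)) ×ˢ (Icc 1 (2 * E)) ×ˢ (Icc 1 U) := by
      intro x hx
      have := hsmem x hx
      simp only [Finset.mem_product]
      exact ⟨this.1, this.2.1, this.2.2.1⟩
    have := Finset.card_le_card this
    simp only [Finset.card_product, Nat.card_Icc, Nat.add_sub_cancel] at this
    rw [← h4]
    rw [← mul_assoc] at this
    exact_mod_cast this
  have hN0 : 0 ≤ N := by positivity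
  -- fourth moment bound for each j
  set W4 : ℝ := m * Q ^ 4 * (Q * ((2 * V : ℕ) : ℝ) ^ 2 * (2 + 14 * (((2 * V : ℕ) : ℝ) * Real.sqrt (((2 * V : ℕ) : ℝ) / m)))) with hW4
  have hFj : ∀ j : ZMod m, ∑ w : ZMod m, ‖FF β (blk m r V) j w‖ ^ 4 ≤ W4 := by
    intro j
    refine fourth_moment hg (2 * V) (by omega) hVm (blk m r V) ?_ (fun v => (β v : ℂ) * ee (-(j * (v : ZMod m)))) Q (by linarith) ?_
    · intro v hv
      have := mem_blk hv
      exact ⟨this.1, by omega, this.2.2.2.2⟩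
    · intro v hv
      have := mem_blk hv
      rw [norm_mul, norm_ee, mul_one, Complex.norm_real]
      exact hβ v (by rw [Finset.mem_Icc]; omega)
  set W : ℝ := N ^ 2 * (Q ^ 4 * (N * (N / m + 1))) * W4 with hW
  have hW40 : 0 ≤ W4 := by positivity
  have hW0 : 0 ≤ W := by positivity
  have hj : ∀ j : ZMod m, ∑ x ∈ s, ‖FF β (blk m r V) j (φ x)‖ ≤ W ^ (1 / 4 : ℝ) := by
    intro j
    have h1 := holder4 s φ (fun w => ‖FF β (blk m r V) j w‖)
    have h2 : (∑ x ∈ s, ‖FF β (blk m r V) j (φ x)‖) ^ 4 ≤ W := by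
      refine h1.trans ?_
      rw [hW]
      have := hFj j
      gcongr
    calc ∑ x ∈ s, ‖FF β (blk m r V) j (φ x)‖ = ((∑ x ∈ s, ‖FF β (blk m r V) j (φ x)‖) ^ 4) ^ (1 / 4 : ℝ) := by
          rw [← Real.rpow_natCast, ← Real.rpow_mul (Finset.sum_nonneg fun _ _ => norm_nonneg _)]
          norm_num
      _ ≤ _ := by gcongr
  have htot : ∑ h ∈ blk0 (m / 2) H, ∑ e ∈ blk m D E, ‖TT α β X (blk m r V) (a * (h : ZMod m) * (e : ZMod m)⁻¹)‖ ≤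
      3 * Q ^ 2 * W ^ (1 / 4 : ℝ) := by
    calc _ ≤ ∑ h ∈ blk0 (m / 2) H, ∑ e ∈ blk m D E, Q * (1 / m : ℝ) * ∑ j : ZMod m, GG j *
          ∑ u ∈ (Icc 1 U).filter (fun u => u.Coprime m), ‖FF β (blk m r V) j (a * (h : ZMod m) * (e : ZMod m)⁻¹ * (u : ZMod m)⁻¹)‖ := by
          refine Finset.sum_le_sum fun h _ => Finset.sum_le_sum fun e _ => ?_
          refine TT_le α β X _ r V hV1 hr ?_ Q (by linarith) hα _
          intro v hv
          have := mem_blk hv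
          exact ⟨this.1, this.2.1, this.2.2.1⟩
      _ = Q * (1 / m : ℝ) * ∑ j : ZMod m, GG j * ∑ x ∈ s, ‖FF β (blk m r V) j (φ x)‖ := by
          have e1 : ∀ j : ZMod m, ∑ x ∈ s, ‖FF β (blk m r V) j (φ x)‖ = ∑ h ∈ blk0 (m / 2) H, ∑ e ∈ blk m D E,
              ∑ u ∈ (Icc 1 U).filter (fun u => u.Coprime m), ‖FF β (blk m r V) j (a * (h : ZMod m) * (e : ZMod m)⁻¹ * (u : ZMod m)⁻¹)‖ := by
            intro j
            rw [hs, Finset.sum_product]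
            refine Finset.sum_congr rfl fun h _ => ?_
            rw [Finset.sum_product]
          simp only [e1]
          rw [Finset.mul_sum]
          conv_rhs => 
            enter [2, j]
            rw [Finset.mul_sum, Finset.mul_sum]
            enter [2, h]
            rw [Finset.mul_sum, Finset.mul_sum]
          conv_rhs => rw [Finset.sum_comm]
          refine Finset.sum_congr rfl fun h _ => ?_
          conv_rhs => rw [Finset.sum_comm]
          refine Finset.sum_congr rfl fun e _ => ?_
          rw [Finset.mul_sum]
      _ ≤ Q * (1 / m : ℝ) * ∑ j : ZMod m, GG j * W ^ (1 / 4 : ℝ) := by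
          gcongr with j
          · exact GG_nonneg j
          · exact hj j
      _ = Q * (1 / m : ℝ) * ((∑ j : ZMod m, GG j) * W ^ (1 / 4 : ℝ)) := by rw [Finset.sum_mul]
      _ ≤ Q * (1 / m : ℝ) * ((3 * Q * m) * W ^ (1 / 4 : ℝ)) := by
          have := sum_GG_le hg
          gcongr
      _ = _ := by field_simp
  set g := min ((X : ℝ) / (E * m)) (1 / H) with hgdef
  have hg0 : 0 ≤ g := le_min (by positivity) (by positivity)
  have g1 : g * H ≤ 1 := by
    have : g ≤ 1 / H := min_le_right _ _
    rwa [le_div_iff₀ hH0] at this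
  have g2 : g * E ≤ X / m := by
    have : g ≤ X / (E * m) := min_le_left _ _
    calc g * E ≤ X / (E * m) * E := by gcongr
      _ = _ := by field_simp
  have hsq : Real.sqrt (((2 * V : ℕ) : ℝ) / m) ≤ 1.42 * Real.sqrt (V / m) := by
    push_cast
    rw [mul_div_assoc, Real.sqrt_mul (by norm_num)]
    gcongr
    rw [Real.sqrt_le_left (by norm_num)]
    norm_num
  set q := Real.sqrt ((V : ℝ) / m) with hq
  have hq0 : 0 ≤ q := Real.sqrt_nonneg _
  have hW4' : W4 ≤ m * Q ^ 5 * (4 * V ^ 2) * (40 * (1 + V * q)) := by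
    calc W4 ≤ m * Q ^ 4 * (Q * ((2 * V : ℕ) : ℝ) ^ 2 * (2 + 14 * (((2 * V : ℕ) : ℝ) * (1.42 * q)))) := by
          rw [hW4]; gcongr
      _ = m * Q ^ 5 * (4 * V ^ 2) * (2 + 39.76 * (V * q)) := by push_cast; ring
      _ ≤ _ := by
          have : 0 ≤ V * q := by positivity
          have h2 : 2 + 39.76 * (V * q) ≤ 40 * (1 + V * q) := by linarith
          gcongr
  have hgN : g ^ 4 * (N ^ 3 * (N + m)) ≤ X ^ 4 * (256 * E ^ 4 / V ^ 4 + 256 * E ^ 2 / V ^ 3) := by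
    have e1 : g ^ 4 * (N ^ 3 * (N + m)) = 256 * (g * H) ^ 4 * (E * U) ^ 4 + 64 * (g * H) ^ 3 * (g * E) * E ^ 2 * U ^ 3 * m := by
      rw [hN]; ring
    rw [e1]
    have e2 : 256 * (g * H) ^ 4 * (E * U) ^ 4 + 64 * (g * H) ^ 3 * (g * E) * E ^ 2 * U ^ 3 * m ≤
        256 * 1 ^ 4 * (E * (X / V)) ^ 4 + 64 * 1 ^ 3 * (X / m) * E ^ 2 * (X / V) ^ 3 * m := by gcongr
    refine e2.trans ?_
    have e3 : 256 * 1 ^ 4 * (E * (X / V)) ^ 4 + 64 * 1 ^ 3 * (X / m) * E ^ 2 * (X / V) ^ 3 * m =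
      X ^ 4 * (256 * E ^ 4 / V ^ 4 + 64 * E ^ 2 / (V : ℝ) ^ 3) := by field_simp
    rw [e3]
    gcongr; norm_num
  calc (g * ∑ h ∈ blk0 (m / 2) H, ∑ e ∈ blk m D E, ‖TT α β X (blk m r V) (a * (h : ZMod m) * (e : ZMod m)⁻¹)‖) ^ 4
      ≤ (g * (3 * Q ^ 2 * W ^ (1 / 4 : ℝ))) ^ 4 := by gcongr
    _ = 81 * Q ^ 8 * g ^ 4 * (W ^ (1 / 4 : ℝ)) ^ 4 := by ring
    _ = 81 * Q ^ 8 * g ^ 4 * W := by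
        congr 1
        rw [← Real.rpow_natCast, ← Real.rpow_mul hW0]; norm_num
    _ = 81 * Q ^ 12 * (g ^ 4 * (N ^ 3 * (N + m))) * (W4 / m) := by rw [hW]; field_simp
    _ ≤ 81 * Q ^ 12 * (X ^ 4 * (256 * E ^ 4 / V ^ 4 + 256 * E ^ 2 / V ^ 3)) * (m * Q ^ 5 * (4 * V ^ 2) * (40 * (1 + V * q)) / m) := by
        gcongr
    _ = _ := by field_simp; ring

end part6




section part7
variable {m : ℕ} [NeZero m]

def hyp (X : ℕ) : Finset (ℕ × ℕ) := ((Icc 1 X) ×ˢ (Icc 1 X)).filter (fun p => p.1 * p.2 ≤ X)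

theorem mem_hyp {X : ℕ} {p : ℕ × ℕ} : p ∈ hyp X ↔ 1 ≤ p.1 ∧ 1 ≤ p.2 ∧ p.1 * p.2 ≤ X := by
  simp only [hyp, Finset.mem_filter, Finset.mem_product, Finset.mem_Icc]
  constructor
  · tauto
  · rintro ⟨h1, h2, h3⟩
    refine ⟨⟨⟨h1, ?_⟩, h2, ?_⟩, h3⟩ <;> nlinarith

theorem conv_sum {M : Type*} [AddCommMonoid M] (X : ℕ) (G : ℕ → ℕ → M) :
    ∑ n ∈ Icc 1 X, ∑ p ∈ n.divisorsAntidiagonal, G p.1 p.2 = ∑ p ∈ hyp X, G p.1 p.2 := by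
  rw [← Finset.sum_fiberwise_of_maps_to (s := hyp X) (t := Icc 1 X) (g := fun p => p.1 * p.2)]
  · refine Finset.sum_congr rfl fun n hn => Finset.sum_congr ?_ fun _ _ => rfl
    ext p
    rw [Finset.mem_Icc] at hn
    simp only [Nat.mem_divisorsAntidiagonal, Finset.mem_filter, mem_hyp]
    constructor
    · rintro ⟨h1, h2⟩
      refine ⟨⟨?_, ?_, by omega⟩, h1⟩
      · rw [Nat.one_le_iff_ne_zero]; rintro h; rw [h] at h1; omega
      · rw [Nat.one_le_iff_ne_zero]; rintro h; rw [h] at h1; omega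
    · rintro ⟨_, h⟩; exact ⟨h, by omega⟩
  · intro p hp
    rw [mem_hyp] at hp
    rw [Finset.mem_Icc]
    exact ⟨Nat.mul_pos hp.1 hp.2.1, hp.2.2⟩

theorem hyp_sum {M : Type*} [AddCommMonoid M] (X : ℕ) (G : ℕ → ℕ → M) :
    ∑ p ∈ hyp X, G p.1 p.2 = ∑ v ∈ Icc 1 X, ∑ u ∈ Icc 1 (X / v), G u v := by
  rw [Finset.sum_sigma']
  refine Finset.sum_bij' (fun p _ => ⟨p.2, p.1⟩) (fun x _ => (x.2, x.1)) ?_ ?_ ?_ ?_ ?_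
  · rintro ⟨u, v⟩ hp
    rw [mem_hyp] at hp
    simp only [Finset.mem_sigma, Finset.mem_Icc]
    simp only at hp
    refine ⟨⟨hp.2.1, by nlinarith⟩, hp.1, ?_⟩
    rw [Nat.le_div_iff_mul_le (by omega)]; exact hp.2.2
  · rintro ⟨v, u⟩ hp
    simp only [Finset.mem_sigma, Finset.mem_Icc] at hp
    rw [mem_hyp]
    simp only
    refine ⟨hp.2.1, hp.1.1, ?_⟩
    have := hp.2.2
    rwa [Nat.le_div_iff_mul_le (by omega)] at this
  · intros; rfl
  · intros; rfl
  · intros; rfl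

theorem hyp_swap {M : Type*} [AddCommMonoid M] (X : ℕ) (G : ℕ → ℕ → M) :
    ∑ p ∈ hyp X, G p.1 p.2 = ∑ p ∈ hyp X, G p.2 p.1 := by
  refine Finset.sum_bij' (fun p _ => (p.2, p.1)) (fun p _ => (p.2, p.1)) ?_ ?_ ?_ ?_ ?_
  · rintro ⟨u, v⟩ hp
    rw [mem_hyp] at hp ⊢
    simp only at hp ⊢
    exact ⟨hp.2.1, hp.1, by rw [mul_comm]; exact hp.2.2⟩
  · rintro ⟨u, v⟩ hp
    rw [mem_hyp] at hp ⊢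
    simp only at hp ⊢
    exact ⟨hp.2.1, hp.1, by rw [mul_comm]; exact hp.2.2⟩
  · intros; rfl
  · intros; rfl
  · intros; rfl

/-- Dirichlet convolution of sequences -/
noncomputable def cv (A B : ℕ → ℝ) (n : ℕ) : ℝ := ∑ p ∈ n.divisorsAntidiagonal, A p.1 * B p.2

theorem inv_mul_cast {u v : ℕ} (hu : u.Coprime m) (hv : v.Coprime m) :
    ((u * v : ℕ) : ZMod m)⁻¹ = (u : ZMod m)⁻¹ * (v : ZMod m)⁻¹ := by
  have e1 := unit_of_coprime hu
  have e2 := unit_of_coprime hv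
  have e3 := unit_of_coprime (Nat.Coprime.mul_left hu hv)
  push_cast at e3 ⊢
  linear_combination (-((u : ZMod m) * v)⁻¹) * ((v : ZMod m) * (v : ZMod m)⁻¹ * e1 + e2) + ((u : ZMod m)⁻¹ * (v : ZMod m)⁻¹) * e3

theorem SS_cv (A B : ℕ → ℝ) (X : ℕ) (w : ZMod m) :
    SS (cv A B) X w = ∑ p ∈ hyp X, (if p.1.Coprime m ∧ p.2.Coprime m then
      ((B p.2 : ℂ) * (A p.1 : ℂ)) * ee (w * (p.1 : ZMod m)⁻¹ * (p.2 : ZMod m)⁻¹) else 0) := by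
  rw [← conv_sum X (fun u v => if u.Coprime m ∧ v.Coprime m then
      ((B v : ℂ) * (A u : ℂ)) * ee (w * (u : ZMod m)⁻¹ * (v : ZMod m)⁻¹) else 0)]
  unfold SS cv
  rw [Finset.sum_filter]
  refine Finset.sum_congr rfl fun n hn => ?_
  split_ifs with h
  · push_cast
    rw [Finset.sum_mul]
    refine Finset.sum_congr rfl fun p hp => ?_
    rw [Nat.mem_divisorsAntidiagonal] at hp
    rw [← hp.1, Nat.coprime_mul_iff_left] at h
    rw [if_pos h, ← hp.1, inv_mul_cast h.1 h.2]
    rw [← mul_assoc]; ring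
  · symm
    apply Finset.sum_eq_zero
    intro p hp
    rw [Nat.mem_divisorsAntidiagonal] at hp
    rw [← hp.1, Nat.coprime_mul_iff_left] at h
    rw [if_neg h]

theorem hyp_TT (A B : ℕ → ℝ) (X r : ℕ) (hr : r ≤ X) (w : ZMod m) (hB : ∀ v, r < v → B v = 0) :
    ∑ p ∈ hyp X, (if p.1.Coprime m ∧ p.2.Coprime m then
      ((B p.2 : ℂ) * (A p.1 : ℂ)) * ee (w * (p.1 : ZMod m)⁻¹ * (p.2 : ZMod m)⁻¹) else 0) =
    TT A B X ((Icc 1 r).filter (fun v => v.Coprime m)) w := by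
  rw [hyp_sum X (fun u v => if u.Coprime m ∧ v.Coprime m then
      ((B v : ℂ) * (A u : ℂ)) * ee (w * (u : ZMod m)⁻¹ * (v : ZMod m)⁻¹) else 0)]
  unfold TT
  rw [Finset.sum_filter]
  symm
  rw [Finset.sum_subset (Finset.Icc_subset_Icc_right hr)]
  · refine Finset.sum_congr rfl fun v _ => ?_
    split_ifs with h
    · rw [Finset.sum_filter]
      refine Finset.sum_congr rfl fun u _ => ?_
      by_cases h' : u.Coprime m
      · rw [if_pos h', if_pos ⟨h', h⟩]
      · rw [if_neg h', if_neg (fun x => h' x.1)]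
    · symm
      apply Finset.sum_eq_zero
      intro u _
      rw [if_neg (fun x => h x.2)]
  · intro v hv hv2
    rw [Finset.mem_Icc] at hv hv2
    have : B v = 0 := hB v (by omega)
    simp [this]

theorem SS_split (A B : ℕ → ℝ) (X : ℕ) (w : ZMod m) :
    SS (cv A B) X w =
      TT A (fun v => if v ≤ Nat.sqrt X then B v else 0) X ((Icc 1 (Nat.sqrt X)).filter (fun v => v.Coprime m)) w +
      TT (fun v => if v ≤ Nat.sqrt X then 0 else B v) A X ((Icc 1 (Nat.sqrt X)).filter (fun v => v.Coprime m)) w := by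
  set r := Nat.sqrt X with hr
  have hrX : r ≤ X := Nat.sqrt_le_self X
  have e2 : TT (fun v => if v ≤ r then 0 else B v) A X ((Icc 1 r).filter (fun v => v.Coprime m)) w =
     TT (fun v => if v ≤ r then 0 else B v) (fun v => if v ≤ r then A v else 0) X ((Icc 1 r).filter (fun v => v.Coprime m)) w := by
    unfold TT
    refine Finset.sum_congr rfl fun v hv => Finset.sum_congr rfl fun u hu => ?_
    rw [Finset.mem_filter, Finset.mem_Icc] at hv
    simp only [if_pos hv.1.2]
  rw [e2, ← hyp_TT _ _ X r hrX w (fun v hv => by rw [if_neg (by omega)]),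
    ← hyp_TT _ _ X r hrX w (fun v hv => by rw [if_neg (by omega)]), SS_cv,
    hyp_swap X (fun u v => if u.Coprime m ∧ v.Coprime m then
      ((((fun v => if v ≤ r then A v else 0) v : ℝ) : ℂ) * (((fun v => if v ≤ r then 0 else B v) u : ℝ) : ℂ)) * ee (w * (u : ZMod m)⁻¹ * (v : ZMod m)⁻¹) else 0),
    ← Finset.sum_add_distrib]
  refine Finset.sum_congr rfl ?_
  rintro ⟨u, v⟩ hp
  rw [mem_hyp] at hp
  simp only at hp ⊢
  by_cases h : u.Coprime m ∧ v.Coprime m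
  · rw [if_pos h, if_pos h, if_pos h.symm]
    by_cases hv : v ≤ r
    · simp [hv]
    · have hu : u ≤ r := by
        by_contra hu
        push Not at hu hv
        have : (r + 1) * (r + 1) ≤ u * v := Nat.mul_le_mul hu hv
        have := Nat.lt_succ_sqrt X
        rw [← hr] at this
        simp only [Nat.succ_eq_add_one] at this
        omega
      simp only [hv, hu, if_true, if_false]
      simp only [Complex.ofReal_zero, zero_mul, zero_add]
      rw [mul_assoc w, mul_comm (u : ZMod m)⁻¹, ← mul_assoc]; ring
  · rw [if_neg h, if_neg h, if_neg (fun h' => h h'.symm)]; simp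

theorem sum_comm3 {ι κ μ : Type*} (s : Finset ι) (t : Finset κ) (r : Finset μ) (f : ι → κ → μ → ℝ) :
    ∑ i ∈ s, ∑ j ∈ t, ∑ k ∈ r, f i j k = ∑ k ∈ r, ∑ i ∈ s, ∑ j ∈ t, f i j k := by
  conv_rhs => rw [Finset.sum_comm]
  refine Finset.sum_congr rfl fun h _ => ?_
  conv_rhs => rw [Finset.sum_comm]

theorem TT_dyadic (α β : ℕ → ℝ) (X r : ℕ) (w : ZMod m) :
    ‖TT α β X ((Icc 1 r).filter (fun v => v.Coprime m)) w‖ ≤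
      ∑ k ∈ range (Nat.log 2 r + 1), ‖TT α β X (blk m r (2 ^ k)) w‖ := by
  have e : TT α β X ((Icc 1 r).filter (fun v => v.Coprime m)) w =
      ∑ k ∈ range (Nat.log 2 r + 1), TT α β X (blk m r (2 ^ k)) w := by
    unfold TT
    rw [← Finset.sum_fiberwise_of_maps_to (s := (Icc 1 r).filter (fun v => v.Coprime m)) (t := range (Nat.log 2 r + 1)) (g := fun v => Nat.log 2 v)]
    · refine Finset.sum_congr rfl fun k _ => Finset.sum_congr ?_ fun _ _ => rfl
      ext v
      simp only [blk, Finset.mem_filter, Finset.mem_Icc]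
      constructor
      · rintro ⟨⟨⟨h1, h2⟩, h3⟩, h4⟩
        rw [Nat.log_eq_iff (Or.inr ⟨by norm_num, by omega⟩)] at h4
        refine ⟨⟨h1, h2⟩, ⟨h4.1, ?_⟩, h3⟩
        have := h4.2
        rw [pow_succ] at this; omega
      · rintro ⟨⟨h1, h2⟩, ⟨h4, h5⟩, h3⟩
        refine ⟨⟨⟨h1, h2⟩, h3⟩, ?_⟩
        rw [Nat.log_eq_iff (Or.inr ⟨by norm_num, by omega⟩)]
        refine ⟨h4, ?_⟩
        rw [pow_succ]; omega
    · intro v hv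
      simp only [Finset.mem_filter, Finset.mem_Icc] at hv
      rw [Finset.mem_range]
      have := Nat.log_mono_right (b := 2) hv.1.2
      omega
  rw [e]
  exact norm_sum_le _ _

theorem typeII_part {Q : ℝ} (hg : Good m Q) (α β : ℕ → ℝ) (X D r Y : ℕ) (hX : X ≤ m) (hD : D ≤ m)
    (hr : 2 * r < m)
    (hα : ∀ u ∈ Icc 1 X, |α u| ≤ Q) (hβ : ∀ u ∈ Icc 1 r, |β u| ≤ Q) (hβY : ∀ v, v ≤ Y → β v = 0)
    (a : ZMod m) (ha : IsUnit a) (E H : ℕ)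
    (hE : 1 ≤ E) (hED : E ≤ D) (hH : 1 ≤ H) (hHm : H ≤ m / 2) (B : ℝ) (hB0 : 0 ≤ B)
    (hB : ∀ V : ℕ, 1 ≤ V → Y < 2 * V → V ≤ r → 81 * 40960 * Q ^ 17 * (X : ℝ) ^ 4 *
      ((E : ℝ) ^ 4 / V ^ 2 + (E : ℝ) ^ 2 / V) * (1 + V * Real.sqrt (V / m)) ≤ B ^ 4) :
    min ((X : ℝ) / (E * m)) (1 / H) *
        ∑ h ∈ blk0 (m / 2) H, ∑ e ∈ blk m D E, ‖TT α β X ((Icc 1 r).filter (fun v => v.Coprime m)) (a * (h : ZMod m) * (e : ZMod m)⁻¹)‖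
      ≤ 2 * Q * B := by
  have hQ := hg.two_le
  set g := min ((X : ℝ) / (E * m)) (1 / H) with hgdef
  have hg0 : 0 ≤ g := le_min (by positivity) (by positivity)
  have hb : ∀ k ∈ range (Nat.log 2 r + 1), g * ∑ h ∈ blk0 (m / 2) H, ∑ e ∈ blk m D E, ‖TT α β X (blk m r (2 ^ k)) (a * (h : ZMod m) * (e : ZMod m)⁻¹)‖ ≤ B := by
    intro k hk
    have hzero : blk m r (2 ^ k) = ∅ ∨ 2 * 2 ^ k ≤ Y → g * ∑ h ∈ blk0 (m / 2) H, ∑ e ∈ blk m D E, ‖TT α β X (blk m r (2 ^ k)) (a * (h : ZMod m) * (e : ZMod m)⁻¹)‖ ≤ B := by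
      intro h
      have : ∀ w : ZMod m, TT α β X (blk m r (2 ^ k)) w = 0 := by
        intro w
        rcases h with h | h
        · rw [h]; simp [TT]
        · unfold TT
          apply Finset.sum_eq_zero
          intro v hv
          have := mem_blk hv
          have : β v = 0 := hβY v (by omega)
          simp [this]
      simp [this, hB0]
    by_cases h1 : 2 ^ k ≤ r
    · by_cases h2 : 2 * 2 ^ k ≤ Y
      · exact hzero (Or.inr h2)
      · have h := typeII_block hg α β X D r (2 ^ k) hX hD Nat.one_le_two_pow (by omega) (by omega) hα hβ a ha E H hE hED hH hHm
        have h3 := hB (2 ^ k) Nat.one_le_two_pow (by omega) h1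
        exact le_of_pow_le_pow_left₀ (by norm_num) hB0 (h.trans h3)
    · apply hzero
      left
      rw [blk, Finset.filter_eq_empty_iff]
      intro x hx
      rw [Finset.mem_Icc] at hx
      intro h
      omega
  calc _ ≤ g * ∑ h ∈ blk0 (m / 2) H, ∑ e ∈ blk m D E, ∑ k ∈ range (Nat.log 2 r + 1), ‖TT α β X (blk m r (2 ^ k)) (a * (h : ZMod m) * (e : ZMod m)⁻¹)‖ := by
        gcongr with h _ e _
        exact TT_dyadic _ _ _ _ _
    _ = ∑ k ∈ range (Nat.log 2 r + 1), g * ∑ h ∈ blk0 (m / 2) H, ∑ e ∈ blk m D E, ‖TT α β X (blk m r (2 ^ k)) (a * (h : ZMod m) * (e : ZMod m)⁻¹)‖ := by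
        rw [← Finset.mul_sum]
        refine congrArg (fun x => g * x) ?_
        exact sum_comm3 _ _ _ _
    _ ≤ ∑ k ∈ range (Nat.log 2 r + 1), B := Finset.sum_le_sum hb
    _ = (Nat.log 2 r + 1) * B := by simp
    _ ≤ 2 * Q * B := by
        have := natlog_le hg (N := r) (by omega)
        gcongr

theorem typeII {Q : ℝ} (hg : Good m Q) (A B : ℕ → ℝ) (X D Y : ℕ) (hX : X ≤ m) (hD : D ≤ m)
    (hA : ∀ u ∈ Icc 1 X, |A u| ≤ Q) (hB : ∀ u ∈ Icc 1 X, |B u| ≤ Q) (hAY : ∀ v, v ≤ Y → A v = 0) (hBY : ∀ v, v ≤ Y → B v = 0)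
    (a : ZMod m) (ha : IsUnit a) (E H : ℕ)
    (hE : 1 ≤ E) (hED : E ≤ D) (hH : 1 ≤ H) (hHm : H ≤ m / 2) (C : ℝ) (hC0 : 0 ≤ C)
    (hC : ∀ V : ℕ, 1 ≤ V → Y < 2 * V → V ≤ Nat.sqrt X → 81 * 40960 * Q ^ 17 * (X : ℝ) ^ 4 *
      ((E : ℝ) ^ 4 / V ^ 2 + (E : ℝ) ^ 2 / V) * (1 + V * Real.sqrt (V / m)) ≤ C ^ 4) :
    min ((X : ℝ) / (E * m)) (1 / H) *
        ∑ h ∈ blk0 (m / 2) H, ∑ e ∈ blk m D E, ‖SS (cv A B) X (a * (h : ZMod m) * (e : ZMod m)⁻¹)‖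
      ≤ 4 * Q * C := by
  have hQ := hg.two_le
  set g := min ((X : ℝ) / (E * m)) (1 / H) with hgdef
  have hg0 : 0 ≤ g := le_min (by positivity) (by positivity)
  set r := Nat.sqrt X with hr
  have hrX : r ≤ X := Nat.sqrt_le_self X
  have hr2 : 2 * r < m := by
    have h1 : r * r ≤ X := Nat.sqrt_le X
    have := hg.hm
    by_cases h : r ≤ 4
    · omega
    · nlinarith
  have p1 := typeII_part hg A (fun v => if v ≤ r then B v else 0) X D r Y hX hD hr2 hA (by
    intro u hu
    rw [Finset.mem_Icc] at hu
    beta_reduce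
    rw [if_pos hu.2]; exact hB u (by rw [Finset.mem_Icc]; omega)) (by
    intro v hv
    beta_reduce
    rw [hBY v hv]; simp) a ha E H hE hED hH hHm C hC0 hC
  have p2 := typeII_part hg (fun v => if v ≤ r then 0 else B v) A X D r Y hX hD hr2 (by
    intro u hu
    beta_reduce
    split_ifs
    · simp; linarith
    · exact hB u hu) (by
    intro u hu
    rw [Finset.mem_Icc] at hu
    exact hA u (by rw [Finset.mem_Icc]; omega)) hAY a ha E H hE hED hH hHm C hC0 hC
  calc _ ≤ g * ∑ h ∈ blk0 (m / 2) H, ∑ e ∈ blk m D E, (‖TT A (fun v => if v ≤ r then B v else 0) X ((Icc 1 r).filter (fun v => v.Coprime m)) (a * (h : ZMod m) * (e : ZMod m)⁻¹)‖ + ‖TT (fun v => if v ≤ r then 0 else B v) A X ((Icc 1 r).filter (fun v => v.Coprime m)) (a * (h : ZMod m) * (e : ZMod m)⁻¹)‖) := by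
        gcongr with h _ e _
        rw [SS_split]
        exact norm_add_le _ _
    _ ≤ 2 * Q * C + 2 * Q * C := by
        simp only [Finset.sum_add_distrib, mul_add]
        exact add_le_add p1 p2
    _ = _ := by ring

end part7




section part8
variable {m : ℕ} [NeZero m]

/-- Kloosterman sum -/
noncomputable def KK (y z : ZMod m) : ℂ :=
  ∑ x : (ZMod m)ˣ, ee (y * ((x⁻¹ : (ZMod m)ˣ) : ZMod m) + z * (x : ZMod m))

theorem KK_orbit (y z : ZMod m) (u : (ZMod m)ˣ) :
    KK (y * ((u⁻¹ : (ZMod m)ˣ) : ZMod m)) (z * (u : ZMod m)) = KK y z := by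
  unfold KK
  refine Fintype.sum_equiv (Equiv.mulLeft u) _ _ ?_
  intro x
  simp only [Equiv.coe_mulLeft, mul_inv_rev, Units.val_mul]
  congr 1; ring

theorem card_ker (A : ZMod m) : (univ.filter (fun x : ZMod m => A * x = 0)).card ≤ Nat.gcd A.val m := by
  have hm := NeZero.pos m
  set g := Nat.gcd A.val m with hg
  have hgm : g ∣ m := Nat.gcd_dvd_right _ _
  have hg0 : 0 < g := Nat.gcd_pos_of_pos_right _ hm
  obtain ⟨k, hk⟩ := hgm
  have hk0 : 0 < k := by
    rcases Nat.eq_zero_or_pos k with h | h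
    · rw [h] at hk; omega
    · exact h
  calc _ ≤ (range g).card := by
        apply Finset.card_le_card_of_injOn (fun x => x.val / k)
        · intro x hx
          simp only [Finset.coe_range, Set.mem_Iio]
          rw [Nat.div_lt_iff_lt_mul hk0, ← hk]
          exact ZMod.val_lt x
        · intro x hx y hy hxy
          have key : ∀ x : ZMod m, A * x = 0 → k ∣ x.val := by
            intro x hx
            have h1 : ((A.val * x.val : ℕ) : ZMod m) = 0 := by
              push_cast; simpa using hx
            rw [ZMod.natCast_eq_zero_iff] at h1
            obtain ⟨b, hb⟩ := Nat.gcd_dvd_left A.val m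
            rw [← hg] at hb
            have h2 : g * k ∣ g * (b * x.val) := by rw [← hk, ← mul_assoc, ← hb]; exact h1
            have h3 : k ∣ b * x.val := Nat.dvd_of_mul_dvd_mul_left hg0 h2
            have h4 : Nat.Coprime b k := by
              have : Nat.gcd (A.val / g) (m / g) = 1 := Nat.coprime_div_gcd_div_gcd hg0
              rw [hb] at this
              have e : m / g = k := by rw [hk]; exact Nat.mul_div_cancel_left _ hg0
              rw [e, Nat.mul_div_cancel_left _ hg0] at this
              exact this
            exact h4.symm.dvd_of_dvd_mul_left h3
          simp only [Finset.coe_filter, Finset.mem_univ, true_and, Set.mem_ofPred_eq] at hx hy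
          have a1 := Nat.div_mul_cancel (key x hx)
          have a2 := Nat.div_mul_cancel (key y hy)
          simp only at hxy
          rw [hxy, a2] at a1
          exact ZMod.val_injective m a1.symm
    _ = g := by simp

theorem card_lin (A B : ZMod m) : (univ.filter (fun x : ZMod m => A * x = B)).card ≤ Nat.gcd A.val m := by
  rcases (univ.filter (fun x : ZMod m => A * x = B)).eq_empty_or_nonempty with h | ⟨x0, h0⟩
  · rw [h]; simp
  · refine le_trans ?_ (card_ker A)
    apply Finset.card_le_card_of_injOn (fun x => x - x0)
    · intro x hx
      simp only [Finset.coe_filter, Finset.mem_univ, true_and, Set.mem_ofPred_eq, Finset.mem_filter] at hx h0 ⊢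
      rw [mul_sub, hx, h0, sub_self]
    · intro x _ y _ h
      simpa using h

theorem gcd_le_sum (n : ℕ) (hn : 0 < m) : Nat.gcd n m ≤ ∑ g ∈ m.divisors.filter (fun g => g ∣ n), g := by
  apply Finset.single_le_sum (f := fun g => g) (fun _ _ => Nat.zero_le _)
  simp only [Finset.mem_filter, Nat.mem_divisors]
  exact ⟨⟨Nat.gcd_dvd_right _ _, by omega⟩, Nat.gcd_dvd_left _ _⟩

theorem sum_gcd_le : ∑ a : ZMod m, Nat.gcd a.val m ≤ m * m.divisors.card := by
  have hm := NeZero.pos m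
  calc ∑ a : ZMod m, Nat.gcd a.val m ≤ ∑ a : ZMod m, ∑ g ∈ m.divisors.filter (fun g => g ∣ a.val), g :=
        Finset.sum_le_sum fun a _ => gcd_le_sum _ hm
    _ = ∑ g ∈ m.divisors, ∑ a ∈ univ.filter (fun a : ZMod m => g ∣ a.val), g := by
        simp only [Finset.sum_filter]
        rw [Finset.sum_comm]
    _ ≤ ∑ g ∈ m.divisors, m := by
        refine Finset.sum_le_sum fun g hg => ?_
        rw [Nat.mem_divisors] at hg
        obtain ⟨⟨k, hk⟩, _⟩ := hg
        have hg0 : 0 < g := by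
          rcases Nat.eq_zero_or_pos g with h | h
          · rw [h] at hk; omega
          · exact h
        rw [Finset.sum_const, smul_eq_mul]
        have : (univ.filter (fun a : ZMod m => g ∣ a.val)).card ≤ (range k).card := by
          apply Finset.card_le_card_of_injOn (fun x => x.val / g)
          · intro x hx
            simp only [Finset.coe_range, Set.mem_Iio]
            rw [Nat.div_lt_iff_lt_mul hg0, mul_comm, ← hk]
            exact ZMod.val_lt x
          · intro x hx y hy hxy
            simp only [Finset.coe_filter, Finset.mem_univ, true_and, Set.mem_ofPred_eq] at hx hy
            have a1 := Nat.div_mul_cancel hx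
            have a2 := Nat.div_mul_cancel hy
            simp only at hxy
            rw [hxy, a2] at a1
            exact ZMod.val_injective m a1.symm
        rw [Finset.card_range] at this
        calc _ ≤ k * g := by gcongr
          _ = m := by rw [hk]; ring
    _ = _ := by simp [mul_comm]

theorem val_mul_gcd (a b : ZMod m) : Nat.gcd (a * b).val m ≤ Nat.gcd a.val m * Nat.gcd b.val m := by
  have hm := NeZero.pos m
  rw [ZMod.val_mul]
  have : Nat.gcd (a.val * b.val % m) m = Nat.gcd (a.val * b.val) m := by
    rw [← Nat.gcd_rec, Nat.gcd_comm]
  rw [this]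
  apply Nat.le_of_dvd
  · exact Nat.mul_pos (Nat.gcd_pos_of_pos_right _ hm) (Nat.gcd_pos_of_pos_right _ hm)
  · exact Nat.gcd_mul_left_dvd_mul_gcd _ _ _

end part8




section part9
variable {m : ℕ} [NeZero m]

theorem KK_sq (y z : ZMod m) : KK y z ^ 2 = ∑ p : (ZMod m)ˣ × (ZMod m)ˣ,
    ee (y * (((p.1⁻¹ : (ZMod m)ˣ) : ZMod m) + ((p.2⁻¹ : (ZMod m)ˣ) : ZMod m))) *
      ee (z * ((p.1 : ZMod m) + (p.2 : ZMod m))) := by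
  unfold KK
  rw [sq, Finset.sum_mul_sum, ← Finset.univ_product_univ, Finset.sum_product]
  refine Finset.sum_congr rfl fun x _ => Finset.sum_congr rfl fun x' _ => ?_
  rw [← ee_add, ← ee_add]
  congr 1; ring

/-- additive quadruples -/
def quad (m : ℕ) [NeZero m] : Finset (((ZMod m)ˣ × (ZMod m)ˣ) × ((ZMod m)ˣ × (ZMod m)ˣ)) :=
  univ.filter (fun p => (p.1.1 : ZMod m) + (p.1.2 : ZMod m) = (p.2.1 : ZMod m) + (p.2.2 : ZMod m) ∧
    ((p.1.1⁻¹ : (ZMod m)ˣ) : ZMod m) + ((p.1.2⁻¹ : (ZMod m)ˣ) : ZMod m) =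
      ((p.2.1⁻¹ : (ZMod m)ˣ) : ZMod m) + ((p.2.2⁻¹ : (ZMod m)ˣ) : ZMod m))

theorem KK_fourth : ∑ y : ZMod m, ∑ z : ZMod m, ‖KK y z‖ ^ 4 = (m : ℝ) ^ 2 * ((quad m).card : ℝ) := by
  set f1 : (ZMod m)ˣ × (ZMod m)ˣ → ZMod m := fun p => (p.1 : ZMod m) + (p.2 : ZMod m) with hf1
  set f2 : (ZMod m)ˣ × (ZMod m)ˣ → ZMod m :=
    fun p => ((p.1⁻¹ : (ZMod m)ˣ) : ZMod m) + ((p.2⁻¹ : (ZMod m)ˣ) : ZMod m) with hf2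
  have h1 : ∀ y z : ZMod m, ‖KK y z‖ ^ 4 =
      ‖∑ p : (ZMod m)ˣ × (ZMod m)ˣ, ee (y * f2 p) * ee (z * f1 p)‖ ^ 2 := by
    intro y z
    rw [← KK_sq, norm_pow]; ring
  simp_rw [h1, parseval]
  rw [← Finset.mul_sum, Finset.sum_comm]
  have h2 : ∀ c : ZMod m, ∑ y : ZMod m, ‖∑ p ∈ univ.filter (fun p => f1 p = c), ee (y * f2 p)‖ ^ 2 =
      m * ∑ c' : ZMod m, (((univ.filter (fun p => f1 p = c)).filter (fun p => f2 p = c')).card : ℝ) ^ 2 := by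
    intro c
    have := parseval (univ.filter (fun p => f1 p = c)) (fun _ => (1 : ℂ)) f2
    simpa using this
  rw [Finset.sum_congr rfl fun c _ => h2 c, ← Finset.mul_sum, ← mul_assoc, ← sq]
  congr 1
  unfold quad
  rw [Finset.card_eq_sum_card_fiberwise (t := univ) (f := fun p => (f1 p.1, f2 p.1)) (fun _ _ => mem_univ _)]
  rw [Fintype.sum_prod_type]
  push_cast
  refine Finset.sum_congr rfl fun c _ => Finset.sum_congr rfl fun c' _ => ?_
  rw [sq, ← Nat.cast_mul, ← Finset.card_product]
  congr 2
  ext ⟨x, y⟩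
  simp only [Finset.mem_filter, Finset.mem_product, Finset.mem_univ, true_and, Prod.mk.injEq, hf1, hf2]
  constructor
  · rintro ⟨⟨a, b⟩, c, d⟩; exact ⟨⟨a.trans c.symm, b.trans d.symm⟩, a, b⟩
  · rintro ⟨⟨a, b⟩, c, d⟩; exact ⟨⟨c, d⟩, a.symm.trans c, b.symm.trans d⟩

theorem card_quad (hm2 : 2 < m) : (quad m).card ≤ 2 * (m * m.divisors.card) ^ 2 := by
  have key : ∀ p ∈ quad m, ((p.2.1 : ZMod m) - p.1.1, (p.2.1 : ZMod m) - p.1.2) ∈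
      (univ : Finset (ZMod m × ZMod m)) := fun _ _ => mem_univ _
  rw [Finset.card_eq_sum_card_fiberwise key]
  have h2 : Nat.gcd (2 : ZMod m).val m ≤ 2 := by
    have : (2 : ZMod m).val = 2 := by
      have := ZMod.val_natCast_of_lt hm2
      simpa using this
    rw [this]; exact Nat.gcd_le_left _ (by norm_num)
  calc _ ≤ ∑ ab : ZMod m × ZMod m, 2 * (Nat.gcd ab.1.val m * Nat.gcd ab.2.val m) := by
        refine Finset.sum_le_sum ?_
        rintro ⟨a, b⟩ _
        calc _ ≤ (univ.filter (fun x : ZMod m => (2 * (a * b)) * x = a * b * (a + b))).card := by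
              apply Finset.card_le_card_of_injOn (fun p => (p.2.1 : ZMod m))
              · rintro ⟨⟨x1, x2⟩, x3, x4⟩ hp
                simp only [quad, Finset.coe_filter, Finset.mem_filter, Set.mem_ofPred_eq, Finset.mem_univ, true_and,
                  Prod.mk.injEq] at hp ⊢
                obtain ⟨⟨h1, h2⟩, h3, h4⟩ := hp
                have e1 := Units.mul_inv x1
                have e2 := Units.mul_inv x2
                have e3 := Units.mul_inv x3
                have e4 := Units.mul_inv x4
                generalize ((x1⁻¹ : (ZMod m)ˣ) : ZMod m) = y1 at *
                generalize ((x2⁻¹ : (ZMod m)ˣ) : ZMod m) = y2 at *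
                generalize ((x3⁻¹ : (ZMod m)ˣ) : ZMod m) = y3 at *
                generalize ((x4⁻¹ : (ZMod m)ˣ) : ZMod m) = y4 at *
                generalize (x1 : ZMod m) = z1 at *
                generalize (x2 : ZMod m) = z2 at *
                generalize (x3 : ZMod m) = z3 at *
                generalize (x4 : ZMod m) = z4 at *
                subst h3 h4
                have h5 : z4 = z1 + z2 - z3 := by linear_combination -h1
                have h6 : (z1 + z2) * (z3 * z4) = (z3 + z4) * (z1 * z2) := by
                  have : (y1 + y2) * (z1 * z2 * z3 * z4) = (y3 + y4) * (z1 * z2 * z3 * z4) := by rw [h2]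
                  linear_combination this - (z2 * z3 * z4) * e1 - (z1 * z3 * z4) * e2 + (z1 * z2 * z4) * e3 + (z1 * z2 * z3) * e4
                rw [← h1, h5] at h6
                linear_combination (-1 : ZMod m) * h6
              · rintro ⟨⟨x1, x2⟩, x3, x4⟩ hp ⟨⟨y1, y2⟩, y3, y4⟩ hq heq
                simp only [quad, Finset.coe_filter, Finset.mem_filter, Set.mem_ofPred_eq, Finset.mem_univ, true_and,
                  Prod.mk.injEq] at hp hq heq
                obtain ⟨⟨h1, h2⟩, h3, h4⟩ := hp
                obtain ⟨⟨k1, k2⟩, k3, k4⟩ := hq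
                have a3 : x3 = y3 := Units.ext heq
                have a1 : x1 = y1 := Units.ext (by linear_combination k3 - h3 + heq)
                have a2 : x2 = y2 := Units.ext (by linear_combination k4 - h4 + heq)
                have a4 : x4 = y4 := Units.ext (by
                  subst a1 a2 a3
                  linear_combination k1 - h1)
                rw [a1, a2, a3, a4]
          _ ≤ Nat.gcd (2 * (a * b)).val m := card_lin _ _
          _ ≤ Nat.gcd (2 : ZMod m).val m * Nat.gcd (a * b).val m := val_mul_gcd _ _
          _ ≤ 2 * (Nat.gcd a.val m * Nat.gcd b.val m) := Nat.mul_le_mul h2 (val_mul_gcd _ _)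
    _ = 2 * ((∑ a : ZMod m, Nat.gcd a.val m) * (∑ b : ZMod m, Nat.gcd b.val m)) := by
        rw [← Finset.mul_sum, Finset.sum_mul_sum, ← Finset.univ_product_univ, Finset.sum_product]
    _ ≤ 2 * ((m * m.divisors.card) * (m * m.divisors.card)) := by
        gcongr <;> exact sum_gcd_le
    _ = _ := by ring

theorem KK_fourth_le {Q : ℝ} (hg : Good m Q) :
    ∑ w : ZMod m × ZMod m, ‖KK w.1 w.2‖ ^ 4 ≤ 2 * (m : ℝ) ^ 4 * Q ^ 2 := by
  have hm := hg.hm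
  rw [← Finset.univ_product_univ, Finset.sum_product, KK_fourth]
  have h1 := card_quad (m := m) (by omega)
  have h2 : ((quad m).card : ℝ) ≤ 2 * ((m : ℝ) * (m.divisors.card : ℝ)) ^ 2 := by exact_mod_cast h1
  have h3 := hg.tau m (by omega) (Nat.le_self_pow (by norm_num) m)
  calc (m : ℝ) ^ 2 * ((quad m).card : ℝ) ≤ (m : ℝ) ^ 2 * (2 * ((m : ℝ) * Q) ^ 2) := by
        refine mul_le_mul_of_nonneg_left (h2.trans ?_) (by positivity)
        gcongr
    _ = _ := by ring

theorem m_le_phi {Q : ℝ} (hg : Good m Q) : (m : ℝ) ≤ (m.totient : ℝ) * Q := by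
  have hm := hg.hm
  have h3 := hg.tau m (by omega) (Nat.le_self_pow (by norm_num) m)
  have h1 : m ≤ m.totient * m.divisors.card := by
    calc m = ∑ d ∈ m.divisors, d.totient := (Nat.sum_totient m).symm
      _ ≤ ∑ d ∈ m.divisors, m.totient := by
        refine Finset.sum_le_sum fun d hd => ?_
        exact Nat.le_of_dvd (Nat.totient_pos.mpr (by omega)) (Nat.totient_dvd_of_dvd (Nat.dvd_of_mem_divisors hd))
      _ = _ := by simp [mul_comm]
  calc (m : ℝ) ≤ (m.totient : ℝ) * (m.divisors.card : ℝ) := by exact_mod_cast h1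
    _ ≤ _ := by gcongr

end part9




section part10
variable {m : ℕ} [NeZero m]

/-- pairs of quadruples with `h' j' e d ≡ h j e' d'`, `g ∣ j'` -/
def RR (m : ℕ) (s : Finset (ℕ × ℕ × ℕ × ℕ)) (g : ℕ) : Finset ((ℕ × ℕ × ℕ × ℕ) × (ℕ × ℕ × ℕ × ℕ)) :=
  (s ×ˢ s).filter (fun p => ((p.2.1 * p.2.2.1 * p.1.2.2.1 * p.1.2.2.2 : ℕ) : ZMod m) =
    ((p.1.1 * p.1.2.1 * p.2.2.2.1 * p.2.2.2.2 : ℕ) : ZMod m) ∧ g ∣ p.2.2.1)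

theorem card_RR {Q : ℝ} (hg : Good m Q) (A J B C : ℕ) (hN : A * J * B * C ≤ m ^ 12)
    (s : Finset (ℕ × ℕ × ℕ × ℕ))
    (hs : ∀ x ∈ s, x.1 ∈ Icc 1 A ∧ x.2.1 ∈ Icc 1 J ∧ x.2.2.1 ∈ Icc 1 B ∧ x.2.2.2 ∈ Icc 1 C) (g : ℕ) :
    ((RR m s g).card : ℝ) ≤
      Q ^ 6 * (((A * J * B * C : ℕ) / g : ℝ) * (((A * J * B * C : ℕ) : ℝ) / m + 1)) := by
  set N := A * J * B * C with hNdef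
  set f : (ℕ × ℕ × ℕ × ℕ) × (ℕ × ℕ × ℕ × ℕ) → ℕ × ℕ :=
    fun p => (p.2.1 * p.2.2.1 * p.1.2.2.1 * p.1.2.2.2, p.1.1 * p.1.2.1 * p.2.2.2.1 * p.2.2.2.2) with hf
  have bnd : ∀ x w y z : ℕ, x ∈ Icc 1 A → w ∈ Icc 1 J → y ∈ Icc 1 B → z ∈ Icc 1 C → x * w * y * z ∈ Icc 1 N := by
    intro x w y z hx hw hy hz
    simp only [Finset.mem_Icc] at *
    refine ⟨?_, Nat.mul_le_mul (Nat.mul_le_mul (Nat.mul_le_mul hx.2 hw.2) hy.2) hz.2⟩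
    have := Nat.mul_le_mul (Nat.mul_le_mul (Nat.mul_le_mul hx.1 hw.1) hy.1) hz.1
    simpa using this
  have maps : ∀ p ∈ RR m s g, f p ∈ congPairs m N g := by
    rintro ⟨⟨h, j, e, u⟩, ⟨h', j', e', u'⟩⟩ hp
    simp only [RR, Finset.mem_filter, Finset.mem_product] at hp
    obtain ⟨⟨h1, h2⟩, h3, h4⟩ := hp
    obtain ⟨a1, a2, a3, a4⟩ := hs _ h1
    obtain ⟨b1, b2, b3, b4⟩ := hs _ h2
    simp only at *
    simp only [hf, congPairs, Finset.mem_filter, Finset.mem_product]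
    refine ⟨⟨bnd _ _ _ _ b1 b2 a3 a4, bnd _ _ _ _ a1 a2 b3 b4⟩, h3, ?_⟩
    obtain ⟨k, rfl⟩ := h4
    exact ⟨h' * k * e * u, by ring⟩
  have fib : ∀ b ∈ congPairs m N g, ((RR m s g).filter (fun p => f p = b)).card ≤ ⌊Q⌋₊ ^ 6 := by
    rintro ⟨x, y⟩ hb
    simp only [congPairs, Finset.mem_filter, Finset.mem_product, Finset.mem_Icc] at hb
    have hx0 : x ≠ 0 := by omega
    have hy0 : y ≠ 0 := by omega
    have tx := hg.tauN hx0 (by omega)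
    have ty := hg.tauN hy0 (by omega)
    calc ((RR m s g).filter (fun p => f p = (x, y))).card ≤
        ((x.divisors ×ˢ x.divisors ×ˢ x.divisors) ×ˢ (y.divisors ×ˢ y.divisors ×ˢ y.divisors)).card := by
          apply Finset.card_le_card_of_injOn
            (fun p => ((p.2.1, p.2.2.1, p.1.2.2.1), (p.1.1, p.1.2.1, p.2.2.2.1)))
          · rintro ⟨⟨h, j, e, u⟩, ⟨h', j', e', u'⟩⟩ hp
            simp only [hf, Finset.coe_filter, Set.mem_ofPred_eq, Prod.mk.injEq] at hp
            obtain ⟨_, rfl, rfl⟩ := hp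
            simp only [Finset.coe_product, Set.mem_prod, Finset.mem_coe, Nat.mem_divisors]
            refine ⟨⟨⟨?_, hx0⟩, ⟨?_, hx0⟩, ?_, hx0⟩, ⟨?_, hy0⟩, ⟨?_, hy0⟩, ?_, hy0⟩
            · exact ⟨j' * e * u, by ring⟩
            · exact ⟨h' * e * u, by ring⟩
            · exact ⟨h' * j' * u, by ring⟩
            · exact ⟨j * e' * u', by ring⟩
            · exact ⟨h * e' * u', by ring⟩
            · exact ⟨h * j * u', by ring⟩
          · rintro ⟨⟨h, j, e, u⟩, ⟨h', j', e', u'⟩⟩ hp ⟨⟨k, i, d, v⟩, ⟨k', i', d', v'⟩⟩ hp' heq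
            simp only [hf, Finset.coe_filter, Set.mem_ofPred_eq, Prod.mk.injEq] at hp hp' heq
            obtain ⟨_, p1, p2⟩ := hp
            obtain ⟨_, q1, q2⟩ := hp'
            obtain ⟨⟨rfl, rfl, rfl⟩, rfl, rfl, rfl⟩ := heq
            have n1 : h' * j' * e ≠ 0 := by
              rintro h0; rw [h0] at p1; omega
            have n2 : h * j * e' ≠ 0 := by
              rintro h0; rw [h0] at p2; omega
            have u1 : u = v := Nat.eq_of_mul_eq_mul_left (Nat.pos_of_ne_zero n1) (p1.trans q1.symm)
            have u2 : u' = v' := Nat.eq_of_mul_eq_mul_left (Nat.pos_of_ne_zero n2) (p2.trans q2.symm)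
            rw [u1, u2]
      _ ≤ _ := by
          simp only [Finset.card_product]
          calc _ ≤ (⌊Q⌋₊ * (⌊Q⌋₊ * ⌊Q⌋₊)) * (⌊Q⌋₊ * (⌊Q⌋₊ * ⌊Q⌋₊)) := by gcongr
            _ = _ := by ring
  have h := Finset.card_le_mul_card_image_of_maps_to maps _ fib
  have h2 := card_congPairs (m := m) N g
  have hQ : (⌊Q⌋₊ : ℝ) ≤ Q := Nat.floor_le (by have := hg.two_le; linarith)
  have hQ2 := hg.two_le
  calc ((RR m s g).card : ℝ) ≤ (⌊Q⌋₊ : ℝ) ^ 6 * (congPairs m N g).card := by exact_mod_cast h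
    _ ≤ Q ^ 6 * ((N / g : ℝ) * ((N : ℝ) / m + 1)) := by gcongr

theorem sum_RR {Q : ℝ} (hg : Good m Q) (A J B C : ℕ) (hN : A * J * B * C ≤ m ^ 12)
    (s : Finset (ℕ × ℕ × ℕ × ℕ))
    (hs : ∀ x ∈ s, x.1 ∈ Icc 1 A ∧ x.2.1 ∈ Icc 1 J ∧ x.2.2.1 ∈ Icc 1 B ∧ x.2.2.2 ∈ Icc 1 C) :
    (∑ p ∈ RR m s 1, (Nat.gcd p.2.2.1 m : ℝ)) ≤
      Q ^ 7 * (((A * J * B * C : ℕ) : ℝ) * (((A * J * B * C : ℕ) : ℝ) / m + 1)) := by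
  have hm := NeZero.pos m
  have hQ2 := hg.two_le
  set N := A * J * B * C with hNdef
  have h1 : ∑ p ∈ RR m s 1, Nat.gcd p.2.2.1 m ≤ ∑ g ∈ m.divisors, (RR m s g).card * g := by
    calc _ ≤ ∑ p ∈ RR m s 1, ∑ g ∈ m.divisors.filter (fun g => g ∣ p.2.2.1), g :=
          Finset.sum_le_sum fun p _ => gcd_le_sum _ hm
      _ = ∑ g ∈ m.divisors, ∑ p ∈ (RR m s 1).filter (fun p => g ∣ p.2.2.1), g := by
          simp only [Finset.sum_filter]
          rw [Finset.sum_comm]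
      _ ≤ _ := by
          refine Finset.sum_le_sum fun g _ => ?_
          rw [Finset.sum_const, smul_eq_mul]
          gcongr
          intro p
          simp only [RR, Finset.mem_filter, one_dvd, and_true]
          tauto
  have h3 := hg.tau m (by omega) (Nat.le_self_pow (by norm_num) m)
  calc (∑ p ∈ RR m s 1, (Nat.gcd p.2.2.1 m : ℝ)) ≤ ∑ g ∈ m.divisors, ((RR m s g).card : ℝ) * g := by
        exact_mod_cast h1
    _ ≤ ∑ g ∈ m.divisors, (Q ^ 6 * ((N : ℝ) * ((N : ℝ) / m + 1))) := by
        refine Finset.sum_le_sum fun g hgd => ?_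
        have hg0 : (0 : ℝ) < g := by exact_mod_cast Nat.pos_of_mem_divisors hgd
        calc _ ≤ Q ^ 6 * ((N / g : ℝ) * ((N : ℝ) / m + 1)) * g := by
              gcongr; exact card_RR hg A J B C hN s hs g
          _ = _ := by field_simp
    _ = (m.divisors.card : ℝ) * (Q ^ 6 * ((N : ℝ) * ((N : ℝ) / m + 1))) := by
        rw [Finset.sum_const, nsmul_eq_mul]
    _ ≤ Q * (Q ^ 6 * ((N : ℝ) * ((N : ℝ) / m + 1))) := by gcongr
    _ = _ := by ring

theorem KK_sum {Q : ℝ} (hg : Good m Q) (a b : ZMod m) (ha : IsUnit a) (hb : IsUnit b) (A J B C : ℕ)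
    (hN : A * J * B * C ≤ m ^ 12)
    (s : Finset (ℕ × ℕ × ℕ × ℕ))
    (hs : ∀ x ∈ s, x.1 ∈ Icc 1 A ∧ x.2.1 ∈ Icc 1 J ∧ x.2.2.1 ∈ Icc 1 B ∧ x.2.2.2 ∈ Icc 1 C)
    (hc : ∀ x ∈ s, x.2.2.1.Coprime m ∧ x.2.2.2.Coprime m) :
    (∑ x ∈ s, ‖KK (a * (x.1 : ZMod m) * (x.2.2.1 : ZMod m)⁻¹ * (x.2.2.2 : ZMod m)⁻¹) (b * (x.2.1 : ZMod m))‖) ^ 4 ≤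
      2 * Q ^ 10 * ((A * J * B * C : ℕ) : ℝ) ^ 3 * (((A * J * B * C : ℕ) : ℝ) / m + 1) * (m : ℝ) ^ 3 := by
  have hmR : (0 : ℝ) < m := by exact_mod_cast NeZero.pos m
  have hQ2 := hg.two_le
  set N := A * J * B * C with hNdef
  set Y : ℕ × ℕ × ℕ × ℕ → ZMod m :=
    fun x => a * (x.1 : ZMod m) * (x.2.2.1 : ZMod m)⁻¹ * (x.2.2.2 : ZMod m)⁻¹ with hY
  set Z : ℕ × ℕ × ℕ × ℕ → ZMod m := fun x => b * (x.2.1 : ZMod m) with hZ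
  set φ : (ℕ × ℕ × ℕ × ℕ) × (ZMod m)ˣ → ZMod m × ZMod m :=
    fun q => (Y q.1 * ((q.2⁻¹ : (ZMod m)ˣ) : ZMod m), Z q.1 * (q.2 : ZMod m)) with hφ
  have hcard : Fintype.card (ZMod m)ˣ = m.totient := ZMod.card_units_eq_totient m
  set P : ℝ := (m.totient : ℝ) with hP
  have hPpos : 0 < P := by
    have := m_le_phi hg
    by_contra h
    have : P * Q ≤ 0 := mul_nonpos_of_nonpos_of_nonneg (by linarith) (by linarith)
    linarith
  have e1 : P * ∑ x ∈ s, ‖KK (Y x) (Z x)‖ = ∑ q ∈ s ×ˢ univ, ‖KK (φ q).1 (φ q).2‖ := by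
    rw [Finset.sum_product, Finset.mul_sum]
    refine Finset.sum_congr rfl fun x _ => ?_
    simp only [hφ, KK_orbit]
    rw [Finset.sum_const, nsmul_eq_mul, Finset.card_univ, hcard]
  have h4 := holder4 (s ×ˢ univ) φ (fun w => ‖KK w.1 w.2‖)
  rw [← e1] at h4
  have hscard : ((s ×ˢ (univ : Finset (ZMod m)ˣ)).card : ℝ) ≤ N * P := by
    rw [Finset.card_product, Finset.card_univ, hcard]
    push_cast
    refine mul_le_mul_of_nonneg_right ?_ hPpos.le
    have : s.card ≤ (Icc 1 A ×ˢ Icc 1 J ×ˢ Icc 1 B ×ˢ Icc 1 C).card := by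
      refine Finset.card_le_card fun x hx => ?_
      simp only [Finset.mem_product]
      exact hs x hx
    simp only [Finset.card_product, Nat.card_Icc, Nat.add_sub_cancel] at this
    have h5 : s.card ≤ N := by rw [hNdef]; calc s.card ≤ _ := this
      _ = _ := by ring
    exact_mod_cast h5
  set CO := (((s ×ˢ (univ : Finset (ZMod m)ˣ)) ×ˢ (s ×ˢ (univ : Finset (ZMod m)ˣ))).filter (fun p => φ p.1 = φ p.2)) with hCO
  have hcoll : (CO.card : ℝ) ≤ P * (Q ^ 7 * ((N : ℝ) * ((N : ℝ) / m + 1))) := by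
    have maps : ∀ p ∈ CO, ((p.1.1, p.2.1), p.1.2) ∈ (RR m s 1) ×ˢ (univ : Finset (ZMod m)ˣ) := by
      rintro ⟨⟨⟨h, j, e, d⟩, u⟩, ⟨⟨h', j', e', d'⟩, u'⟩⟩ hp
      simp only [hCO, Finset.mem_filter, Finset.mem_product, Finset.mem_univ, and_true, hφ, hY, hZ, Prod.mk.injEq] at hp
      obtain ⟨⟨h1, h2⟩, h3, h4⟩ := hp
      simp only [RR, Finset.mem_product, Finset.mem_filter, Finset.mem_univ, and_true, one_dvd]
      refine ⟨⟨h1, h2⟩, ?_⟩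
      obtain ⟨a4, a5⟩ := hc _ h1
      obtain ⟨b4, b5⟩ := hc _ h2
      have e1 := unit_of_coprime a4
      have e2 := unit_of_coprime a5
      have e3 := unit_of_coprime b4
      have e4 := unit_of_coprime b5
      simp only at e1 e2 e3 e4
      have e5 := Units.mul_inv u
      have e6 := Units.mul_inv u'
      push_cast
      apply (ha.mul hb).mul_left_cancel
      generalize (e : ZMod m)⁻¹ = ei at *
      generalize (d : ZMod m)⁻¹ = di at *
      generalize (e' : ZMod m)⁻¹ = ei' at *
      generalize (d' : ZMod m)⁻¹ = di' at *
      generalize ((u⁻¹ : (ZMod m)ˣ) : ZMod m) = ui at *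
      generalize ((u'⁻¹ : (ZMod m)ˣ) : ZMod m) = ui' at *
      generalize (u : ZMod m) = u0 at *
      generalize (u' : ZMod m) = u0' at *
      have k1 : (a * h * ei * di) * (b * j) = (a * h' * ei' * di') * (b * j') := by
        have := congrArg₂ (· * ·) h3 h4
        linear_combination this - (a * h * ei * di) * (b * j) * e5 + (a * h' * ei' * di') * (b * j') * e6
      calc a * b * ((h' : ZMod m) * j' * e * d) = ((a * h' * ei' * di') * (b * j')) * (e * d * e' * d') := by
            linear_combination (-(a * b * h' * j' * e * d) * (d' * di')) * e3 - (a * b * h' * j' * e * d) * e4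
        _ = ((a * h * ei * di) * (b * j)) * (e * d * e' * d') := by rw [k1]
        _ = _ := by
            linear_combination ((a * b * h * j * e' * d') * (d * di)) * e1 + (a * b * h * j * e' * d') * e2
    have h1 : CO.card ≤ ∑ r ∈ (RR m s 1) ×ˢ (univ : Finset (ZMod m)ˣ), Nat.gcd r.1.2.2.1 m := by
      rw [Finset.card_eq_sum_card_fiberwise maps]
      refine Finset.sum_le_sum ?_
      rintro ⟨⟨x, x'⟩, u⟩ _
      have hgm : Nat.gcd x'.2.1 m = Nat.gcd (x'.2.1 : ZMod m).val m := by
        rw [ZMod.val_natCast, ← Nat.gcd_rec, Nat.gcd_comm]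
      rw [show ((x, x'), u).1.2.2.1 = x'.2.1 from rfl, hgm]
      refine le_trans ?_ (card_lin (x'.2.1 : ZMod m) ((x.2.1 : ZMod m) * (u : ZMod m)))
      apply Finset.card_le_card_of_injOn (fun p => (p.2.2 : ZMod m))
      · rintro ⟨⟨y, v⟩, ⟨y', v'⟩⟩ hp
        simp only [hCO, Finset.coe_filter, Finset.mem_filter, Finset.mem_product, Finset.mem_univ, and_true, hφ, hY, hZ,
          Prod.mk.injEq, Set.mem_ofPred_eq, true_and] at hp ⊢
        obtain ⟨⟨_, _, h4⟩, ⟨rfl, rfl⟩, rfl⟩ := hp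
        apply hb.mul_left_cancel
        linear_combination -h4
      · rintro ⟨⟨y, v⟩, ⟨y', v'⟩⟩ hp ⟨⟨w, t⟩, ⟨w', t'⟩⟩ hq heq
        simp only [Finset.coe_filter, Set.mem_ofPred_eq, Prod.mk.injEq] at hp hq heq
        obtain ⟨_, ⟨rfl, rfl⟩, rfl⟩ := hp
        obtain ⟨_, ⟨rfl, rfl⟩, rfl⟩ := hq
        rw [Units.ext heq]
    have h2 : (CO.card : ℝ) ≤ ∑ r ∈ (RR m s 1) ×ˢ (univ : Finset (ZMod m)ˣ), (Nat.gcd r.1.2.2.1 m : ℝ) := by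
      exact_mod_cast h1
    rw [Finset.sum_product] at h2
    simp only [Finset.sum_const, nsmul_eq_mul, Finset.card_univ, hcard] at h2
    rw [← Finset.mul_sum] at h2
    exact h2.trans (mul_le_mul_of_nonneg_left (sum_RR hg A J B C hN s hs) hPpos.le)
  have h8 := KK_fourth_le hg
  have h9 := m_le_phi hg
  set S := ∑ x ∈ s, ‖KK (Y x) (Z x)‖ with hS
  have h10 : (P * S) ^ 4 ≤ (N * P) ^ 2 * (P * (Q ^ 7 * ((N : ℝ) * ((N : ℝ) / m + 1)))) * (2 * (m : ℝ) ^ 4 * Q ^ 2) := by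
    refine h4.trans ?_
    gcongr
  have h11 : P ^ 4 * S ^ 4 ≤ P ^ 4 * (2 * Q ^ 10 * (N : ℝ) ^ 3 * ((N : ℝ) / m + 1) * (m : ℝ) ^ 3) := by
    calc P ^ 4 * S ^ 4 = (P * S) ^ 4 := by ring
      _ ≤ _ := h10
      _ = (P ^ 3 * (2 * Q ^ 9 * (N : ℝ) ^ 3 * ((N : ℝ) / m + 1) * (m : ℝ) ^ 3)) * m := by ring
      _ ≤ (P ^ 3 * (2 * Q ^ 9 * (N : ℝ) ^ 3 * ((N : ℝ) / m + 1) * (m : ℝ) ^ 3)) * (P * Q) := by gcongr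
      _ = _ := by ring
  exact le_of_mul_le_mul_left h11 (by positivity)

end part10




section part11
variable {m : ℕ} [NeZero m]

noncomputable def HG (g : ℕ → ℝ) (N : ℕ) (j : ZMod m) : ℂ := ∑ n ∈ Icc 1 N, (g n : ℂ) * ee (j * (n : ZMod m))

theorem HG_abel (g : ℕ → ℝ) (hg : Monotone g) (h0 : 0 ≤ g 0) (j : ZMod m) (M : ℝ) (N : ℕ)
    (hM : ∀ K ≤ N, ‖DD K j‖ ≤ M) : ‖HG g N j - (g N : ℂ) * DD N j‖ ≤ g N * M := by
  induction N with
  | zero =>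
    have : (0 : ℝ) ≤ M := (norm_nonneg _).trans (hM 0 le_rfl)
    simp only [HG, DD]
    simp
    positivity
  | succ N ih =>
    have h1 := ih (fun K hK => hM K (by omega))
    have e : HG g (N + 1) j - (g (N + 1) : ℂ) * DD (N + 1) j =
        (HG g N j - (g N : ℂ) * DD N j) - ((g (N + 1) - g N : ℝ) : ℂ) * DD N j := by
      unfold HG DD
      rw [Finset.sum_Icc_succ_top (by omega), Finset.sum_Icc_succ_top (by omega)]
      push_cast
      ring
    rw [e]
    have h2 : g N ≤ g (N + 1) := hg (by omega)
    calc _ ≤ ‖HG g N j - (g N : ℂ) * DD N j‖ + ‖((g (N + 1) - g N : ℝ) : ℂ) * DD N j‖ := norm_sub_le _ _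
      _ ≤ g N * M + (g (N + 1) - g N) * M := by
          refine add_le_add h1 ?_
          rw [norm_mul, Complex.norm_real, Real.norm_eq_abs, abs_of_nonneg (by linarith)]
          exact mul_le_mul_of_nonneg_left (hM N (by omega)) (by linarith)
      _ = _ := by ring

theorem HG_le (g : ℕ → ℝ) (hg : Monotone g) (h0 : 0 ≤ g 0) (j : ZMod m) (M : ℝ) (N : ℕ)
    (hM : ∀ K ≤ N, ‖DD K j‖ ≤ M) : ‖HG g N j‖ ≤ 2 * g N * M := by
  have h1 := HG_abel g hg h0 j M N hM
  have h2 : 0 ≤ g N := h0.trans (hg (Nat.zero_le _))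
  have h3 : ‖(g N : ℂ) * DD N j‖ ≤ g N * M := by
    rw [norm_mul, Complex.norm_real, Real.norm_eq_abs, abs_of_nonneg h2]
    exact mul_le_mul_of_nonneg_left (hM N le_rfl) h2
  have h4 := norm_add_le (HG g N j - (g N : ℂ) * DD N j) ((g N : ℂ) * DD N j)
  rw [sub_add_cancel] at h4
  linarith

theorem HG_zero (g : ℕ → ℝ) (hg : Monotone g) (h0 : 0 ≤ g 0) (N : ℕ) : ‖HG g N (0 : ZMod m)‖ ≤ g N * N := by
  unfold HG
  refine (norm_sum_le _ _).trans ?_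
  calc _ ≤ ∑ n ∈ Icc 1 N, g N := by
        refine Finset.sum_le_sum fun n hn => ?_
        rw [Finset.mem_Icc] at hn
        rw [norm_mul, norm_ee, mul_one, Complex.norm_real, Real.norm_eq_abs,
          abs_of_nonneg (h0.trans (hg (Nat.zero_le _)))]
        exact hg hn.2
    _ = _ := by simp [mul_comm]

theorem SS_complete (g : ℕ → ℝ) (N : ℕ) (w : ZMod m) :
    (m : ℂ) * SS g N w = ∑ j : ZMod m, HG g N j * KK w (-j) := by
  have h1 : ∀ n : ℕ, ∑ j : ZMod m, ee (j * (n : ZMod m)) * KK w (-j) =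
      if n.Coprime m then (m : ℂ) * ee (w * (n : ZMod m)⁻¹) else 0 := by
    intro n
    have : ∀ j : ZMod m, ee (j * (n : ZMod m)) * KK w (-j) =
        ∑ x : (ZMod m)ˣ, ee (w * ((x⁻¹ : (ZMod m)ˣ) : ZMod m)) * ee (j * ((n : ZMod m) - (x : ZMod m))) := by
      intro j
      unfold KK
      rw [Finset.mul_sum]
      refine Finset.sum_congr rfl fun x _ => ?_
      rw [← ee_add, ← ee_add]; congr 1; ring
    simp_rw [this]
    rw [Finset.sum_comm]
    simp_rw [← Finset.mul_sum, sum_ee]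
    split_ifs with hn
    · rw [Finset.sum_eq_single (ZMod.unitOfCoprime n hn)]
      · rw [if_pos (by simp)]
        rw [mul_comm]
        congr 3
      · intro x _ hx
        rw [if_neg, mul_zero]
        intro h
        apply hx
        apply Units.ext
        rw [ZMod.coe_unitOfCoprime]
        linear_combination -h
      · intro h; exact absurd (mem_univ _) h
    · refine Finset.sum_eq_zero fun x _ => ?_
      rw [if_neg, mul_zero]
      intro h
      apply hn
      rw [← ZMod.isUnit_iff_coprime]
      have : (n : ZMod m) = x := by linear_combination h
      rw [this]; exact x.isUnit
  unfold HG SS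
  simp_rw [Finset.sum_mul]
  rw [Finset.sum_comm, Finset.mul_sum, Finset.sum_filter]
  refine Finset.sum_congr rfl fun n _ => ?_
  simp_rw [mul_assoc, ← Finset.mul_sum]
  rw [h1 n]
  split_ifs <;> ring

theorem SS_complete_le (Q : ℝ) (g : ℕ → ℝ) (hg : Monotone g) (h0 : 0 ≤ g 0) (N : ℕ) (hQ : g N ≤ Q) (w : ZMod m) :
    (m : ℝ) * ‖SS g N w‖ ≤ Q * N * ‖KK w 0‖ + ∑ j ∈ Icc 1 (m / 2), 2 * Q * min (N : ℝ) (m / (2 * j)) *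
      (‖KK w (-1 * (j : ZMod m))‖ + ‖KK w (1 * (j : ZMod m))‖) := by
  have h1 : (m : ℝ) * ‖SS g N w‖ = ‖(m : ℂ) * SS g N w‖ := by rw [norm_mul, Complex.norm_natCast]
  have hQ0 : 0 ≤ Q := (h0.trans (hg (Nat.zero_le _))).trans hQ
  rw [h1, SS_complete, ← Finset.add_sum_erase _ _ (mem_univ (0 : ZMod m))]
  refine (norm_add_le _ _).trans (add_le_add ?_ ?_)
  · rw [norm_mul, neg_zero]
    refine mul_le_mul_of_nonneg_right ((HG_zero g hg h0 N).trans ?_) (norm_nonneg _)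
    gcongr
  · refine (norm_sum_le _ _).trans ?_
    refine (sum_erase_le (fun j => ‖HG g N j * KK w (-j)‖) (fun _ => norm_nonneg _)).trans ?_
    refine Finset.sum_le_sum fun j hj => ?_
    rw [Finset.mem_Icc] at hj
    have b1 : ∀ K ≤ N, ‖DD K (j : ZMod m)‖ ≤ min (N : ℝ) (m / (2 * j)) := fun K hK =>
      le_min ((norm_DD_le _ _).trans (by exact_mod_cast hK)) (norm_DD_le' K j hj.1 (by omega))
    have b2 : ∀ K ≤ N, ‖DD K (-(j : ZMod m))‖ ≤ min (N : ℝ) (m / (2 * j)) := fun K hK => by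
      rw [DD_neg]; exact b1 K hK
    have c1 := HG_le g hg h0 _ _ N b1
    have c2 := HG_le g hg h0 _ _ N b2
    have hmin : 0 ≤ min (N : ℝ) (m / (2 * j)) := by positivity
    have hle : 2 * g N * min (N : ℝ) (m / (2 * j)) ≤ 2 * Q * min (N : ℝ) (m / (2 * j)) := by gcongr
    rw [norm_mul, norm_mul, neg_neg, one_mul, neg_one_mul, mul_add]
    refine add_le_add ?_ ?_
    · exact mul_le_mul_of_nonneg_right (c1.trans hle) (norm_nonneg _)
    · exact mul_le_mul_of_nonneg_right (c2.trans hle) (norm_nonneg _)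

theorem KK_zero_sq (y : ZMod m) : ‖KK y 0‖ ^ 2 ≤ (Nat.gcd y.val m : ℝ) * m := by
  have hm := NeZero.pos m
  have hφ : (0 : ℝ) < Fintype.card (ZMod m)ˣ := by exact_mod_cast Fintype.card_pos
  have h1 : (Fintype.card (ZMod m)ˣ : ℝ) * ‖KK y 0‖ ^ 2 =
      ∑ u : (ZMod m)ˣ, ‖KK (y * (u : ZMod m)) 0‖ ^ 2 := by
    have : ∀ u : (ZMod m)ˣ, KK (y * (u : ZMod m)) 0 = KK y 0 := by
      intro u
      have := KK_orbit y 0 u⁻¹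
      simpa using this
    simp [this]
  have h2 : ∑ u : (ZMod m)ˣ, ‖KK (y * (u : ZMod m)) 0‖ ^ 2 ≤ (Nat.gcd y.val m : ℝ) * ∑ w : ZMod m, ‖KK w 0‖ ^ 2 := by
    rw [← Finset.sum_fiberwise_of_maps_to (t := univ) (g := fun u : (ZMod m)ˣ => y * (u : ZMod m)) (fun _ _ => mem_univ _), Finset.mul_sum]
    refine Finset.sum_le_sum fun w _ => ?_
    rw [Finset.sum_congr rfl (fun u hu => by rw [(Finset.mem_filter.mp hu).2]), Finset.sum_const, nsmul_eq_mul]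
    refine mul_le_mul_of_nonneg_right ?_ (by positivity)
    have : (univ.filter (fun u : (ZMod m)ˣ => y * (u : ZMod m) = w)).card ≤ Nat.gcd y.val m := by
      refine le_trans ?_ (card_lin y w)
      apply Finset.card_le_card_of_injOn (fun u : (ZMod m)ˣ => (u : ZMod m))
      · intro u hu
        simpa using hu
      · intro u _ v _ h
        exact Units.ext h
    exact_mod_cast this
  have h3 : ∑ w : ZMod m, ‖KK w 0‖ ^ 2 ≤ (m : ℝ) * Fintype.card (ZMod m)ˣ := by
    have := parseval_le (m := m) (univ : Finset (ZMod m)ˣ) (fun _ => 1) (fun x => ((x⁻¹ : (ZMod m)ˣ) : ZMod m)) 1 (by simp)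
    have e : ∀ w : ZMod m, KK w 0 = ∑ i : (ZMod m)ˣ, (fun _ => (1 : ℂ)) i * ee (w * ((i⁻¹ : (ZMod m)ˣ) : ZMod m)) := by
      intro w; unfold KK; simp
    simp_rw [e]
    refine this.trans ?_
    rw [one_pow, mul_one]
    refine mul_le_mul_of_nonneg_left ?_ (by positivity)
    have hle : ∀ c : ZMod m, (univ.filter (fun i : (ZMod m)ˣ => ((i⁻¹ : (ZMod m)ˣ) : ZMod m) = c)).card ≤ 1 := by
      intro c
      rw [Finset.card_le_one]
      intro u hu v hv
      simp only [Finset.mem_filter] at hu hv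
      exact inv_injective (Units.ext (hu.2.trans hv.2.symm))
    have hs : ∑ c : ZMod m, (univ.filter (fun i : (ZMod m)ˣ => ((i⁻¹ : (ZMod m)ˣ) : ZMod m) = c)).card = Fintype.card (ZMod m)ˣ := by
      rw [← Finset.card_eq_sum_card_fiberwise (f := fun i : (ZMod m)ˣ => ((i⁻¹ : (ZMod m)ˣ) : ZMod m)) (fun _ _ => mem_univ _), Finset.card_univ]
    calc _ ≤ ∑ c : ZMod m, ((univ.filter (fun i : (ZMod m)ˣ => ((i⁻¹ : (ZMod m)ˣ) : ZMod m) = c)).card : ℝ) := by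
          refine Finset.sum_le_sum fun c _ => ?_
          have := hle c
          have h' : ((univ.filter (fun i : (ZMod m)ˣ => ((i⁻¹ : (ZMod m)ˣ) : ZMod m) = c)).card : ℝ) ≤ 1 := by exact_mod_cast this
          nlinarith [Nat.cast_nonneg (α := ℝ) (univ.filter (fun i : (ZMod m)ˣ => ((i⁻¹ : (ZMod m)ˣ) : ZMod m) = c)).card]
      _ = _ := by exact_mod_cast hs
  have h4 : (Fintype.card (ZMod m)ˣ : ℝ) * ‖KK y 0‖ ^ 2 ≤ (Fintype.card (ZMod m)ˣ : ℝ) * ((Nat.gcd y.val m : ℝ) * m) := by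
    rw [h1]
    refine h2.trans ?_
    calc _ ≤ (Nat.gcd y.val m : ℝ) * ((m : ℝ) * Fintype.card (ZMod m)ˣ) := by gcongr
      _ = _ := by ring
  exact le_of_mul_le_mul_left h4 hφ

theorem gcd_unit_val (u : ZMod m) (hu : IsUnit u) : Nat.gcd u.val m = 1 := by
  rw [← Nat.coprime_iff_gcd_eq_one, ← ZMod.isUnit_iff_coprime]
  simpa using hu

theorem KK_zero_le (h : ℕ) (u : ZMod m) (hu : IsUnit u) :
    ‖KK ((h : ZMod m) * u) 0‖ ≤ (Nat.gcd h m : ℝ) * Real.sqrt m := by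
  have hm := NeZero.pos m
  have h1 := KK_zero_sq ((h : ZMod m) * u)
  have h2 : Nat.gcd ((h : ZMod m) * u).val m ≤ Nat.gcd h m := by
    refine (val_mul_gcd _ _).trans ?_
    rw [gcd_unit_val u hu, mul_one, ZMod.val_natCast, ← Nat.gcd_rec, Nat.gcd_comm]
  have h3 : 1 ≤ Nat.gcd h m := Nat.gcd_pos_of_pos_right _ hm
  have h4 : (Nat.gcd ((h : ZMod m) * u).val m : ℝ) ≤ (Nat.gcd h m : ℝ) := by exact_mod_cast h2
  have h5 : (1 : ℝ) ≤ (Nat.gcd h m : ℝ) := by exact_mod_cast h3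
  apply le_of_pow_le_pow_left₀ (n := 2) (by norm_num) (by positivity)
  rw [mul_pow, Real.sq_sqrt (by positivity)]
  refine h1.trans (mul_le_mul_of_nonneg_right ?_ (by positivity))
  nlinarith

theorem typeI_expand (Q : ℝ) (A g : ℕ → ℝ) (X Y : ℕ) (hYX : Y ≤ X) (hA : ∀ u ∈ Icc 1 X, |A u| ≤ Q)
    (hAY : ∀ v, Y < v → A v = 0) (w : ZMod m) :
    ‖SS (cv A g) X w‖ ≤ Q * ∑ d ∈ (Icc 1 Y).filter (fun d => d.Coprime m), ‖SS g (X / d) (w * (d : ZMod m)⁻¹)‖ := by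
  have e : SS (cv A g) X w = ∑ d ∈ Icc 1 X, (if d.Coprime m then (A d : ℂ) * SS g (X / d) (w * (d : ZMod m)⁻¹) else 0) := by
    rw [SS_cv]
    have h1 := hyp_swap X (fun u v => if u.Coprime m ∧ v.Coprime m then
      ((g v : ℂ) * (A u : ℂ)) * ee (w * (u : ZMod m)⁻¹ * (v : ZMod m)⁻¹) else 0)
    have h2 := hyp_sum X (fun v u => if u.Coprime m ∧ v.Coprime m then
      ((g v : ℂ) * (A u : ℂ)) * ee (w * (u : ZMod m)⁻¹ * (v : ZMod m)⁻¹) else 0)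
    rw [h1, h2]
    refine Finset.sum_congr rfl fun d _ => ?_
    unfold SS
    split_ifs with hd
    · rw [Finset.sum_filter, Finset.mul_sum]
      refine Finset.sum_congr rfl fun n _ => ?_
      by_cases hn : n.Coprime m
      · rw [if_pos ⟨hd, hn⟩, if_pos hn]; ring
      · simp [hn]
    · refine Finset.sum_eq_zero fun n _ => ?_
      rw [if_neg]; tauto
  rw [e]
  refine (norm_sum_le _ _).trans ?_
  rw [Finset.mul_sum, Finset.sum_filter, ← Finset.sum_subset (Finset.Icc_subset_Icc_right hYX) (s₁ := Icc 1 Y)]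
  · refine Finset.sum_le_sum fun d hd => ?_
    split_ifs with h
    · rw [norm_mul, Complex.norm_real, Real.norm_eq_abs]
      refine mul_le_mul_of_nonneg_right (hA d ?_) (norm_nonneg _)
      exact Finset.Icc_subset_Icc_right hYX hd
    · simp
  · intro d hd hd2
    rw [Finset.mem_Icc] at hd hd2
    rw [hAY d (by omega)]
    simp

end part11




section part12
variable {m : ℕ} [NeZero m]

theorem card_blk0 (D E : ℕ) : (blk0 D E).card ≤ 2 * E := by
  calc _ ≤ (Icc 1 (2 * E)).card := by
        refine Finset.card_le_card fun x hx => ?_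
        have := mem_blk0 hx
        rw [Finset.mem_Icc]; omega
    _ = _ := by simp

theorem blk_sub (D E : ℕ) : blk m D E ⊆ blk0 D E := by
  intro x hx
  have := mem_blk hx
  simp only [blk0, Finset.mem_filter, Finset.mem_Icc]; omega

theorem sum_gcd_blk {Q : ℝ} (hg : Good m Q) (D H : ℕ) :
    ∑ h ∈ blk0 D H, (Nat.gcd h m : ℝ) ≤ 2 * H * Q := by
  have hm := NeZero.pos m
  have h1 : ∑ h ∈ blk0 D H, Nat.gcd h m ≤ ∑ g ∈ m.divisors, 2 * H := by
    calc _ ≤ ∑ h ∈ blk0 D H, ∑ g ∈ m.divisors.filter (fun g => g ∣ h), g :=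
          Finset.sum_le_sum fun p _ => gcd_le_sum _ hm
      _ = ∑ g ∈ m.divisors, ∑ p ∈ (blk0 D H).filter (fun p => g ∣ p), g := by
          simp only [Finset.sum_filter]
          rw [Finset.sum_comm]
      _ ≤ _ := by
          refine Finset.sum_le_sum fun g _ => ?_
          rw [Finset.sum_const, smul_eq_mul]
          have : ((blk0 D H).filter (fun p => g ∣ p)).card ≤ 2 * H / g := by
            have := Nat.Ioc_filter_dvd_card_eq_div (2 * H) g
            rw [← this]
            refine Finset.card_le_card fun x hx => ?_
            simp only [Finset.mem_filter, Finset.mem_Ioc] at hx ⊢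
            have := mem_blk0 hx.1
            exact ⟨by omega, hx.2⟩
          calc _ ≤ (2 * H / g) * g := by gcongr
            _ ≤ _ := Nat.div_mul_le_self _ _
  have h3 := hg.tau m (by omega) (Nat.le_self_pow (by norm_num) m)
  calc ∑ h ∈ blk0 D H, (Nat.gcd h m : ℝ) ≤ ∑ g ∈ m.divisors, (2 * H : ℝ) := by exact_mod_cast h1
    _ = (m.divisors.card : ℝ) * (2 * H) := by rw [Finset.sum_const, nsmul_eq_mul]
    _ ≤ Q * (2 * H) := by gcongr
    _ = _ := by ring

theorem sum_inv_le {Q : ℝ} (hg : Good m Q) (Y : ℕ) (hY : Y ≤ m) : ∑ d ∈ Icc 1 Y, ((d : ℝ)⁻¹) ≤ 2 * Q := by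
  have := harmonic_le_one_add_log m
  rw [harmonic_eq_sum_Icc] at this
  push_cast at this
  have h5 := hg.log
  have h6 := hg.two_le
  refine (le_trans (Finset.sum_le_sum_of_subset_of_nonneg (Finset.Icc_subset_Icc_right hY) fun i _ _ => by positivity) this).trans ?_
  linarith

theorem typeI_block {Q : ℝ} (hg : Good m Q) (X D Y : ℕ) (hX : X ≤ m) (hD : D ≤ m) (hY : Y ≤ m)
    (a b : ZMod m) (ha : IsUnit a) (hb : IsUnit b) (E H D' J : ℕ)
    (hE : 1 ≤ E) (hED : E ≤ D) (hH : 1 ≤ H) (hHm : H ≤ m / 2) (hD' : 1 ≤ D') (hDY : D' ≤ Y) (hJ : 1 ≤ J) (hJm : J ≤ m / 2) :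
    (min ((X : ℝ) / (E * m)) (1 / H) * (2 * Q ^ 2 / m) * min ((X : ℝ) / D') (m / (2 * J)) *
      ∑ d ∈ blk m Y D', ∑ j ∈ blk0 (m / 2) J, ∑ h ∈ blk0 (m / 2) H, ∑ e ∈ blk m D E,
        ‖KK (a * (h : ZMod m) * (e : ZMod m)⁻¹ * (d : ZMod m)⁻¹) (b * (j : ZMod m))‖) ^ 4 ≤
      131072 * Q ^ 18 * ((E * Y : ℝ) ^ 4 * m ^ 2 + (X : ℝ) ^ 2 * m * (E * Y : ℝ) ^ 2) := by
  have hm : (0 : ℝ) < m := by exact_mod_cast NeZero.pos m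
  have hQ := hg.two_le
  have hE0 : (0 : ℝ) < E := by exact_mod_cast hE
  have hH0 : (0 : ℝ) < H := by exact_mod_cast hH
  have hD0 : (0 : ℝ) < D' := by exact_mod_cast hD'
  have hJ0 : (0 : ℝ) < J := by exact_mod_cast hJ
  set s : Finset (ℕ × ℕ × ℕ × ℕ) := blk0 (m / 2) H ×ˢ (blk0 (m / 2) J ×ˢ (blk m D E ×ˢ blk m Y D')) with hs
  have e1 : ∑ d ∈ blk m Y D', ∑ j ∈ blk0 (m / 2) J, ∑ h ∈ blk0 (m / 2) H, ∑ e ∈ blk m D E,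
        ‖KK (a * (h : ZMod m) * (e : ZMod m)⁻¹ * (d : ZMod m)⁻¹) (b * (j : ZMod m))‖ =
      ∑ x ∈ s, ‖KK (a * (x.1 : ZMod m) * (x.2.2.1 : ZMod m)⁻¹ * (x.2.2.2 : ZMod m)⁻¹) (b * (x.2.1 : ZMod m))‖ := by
    rw [hs, Finset.sum_product, Finset.sum_comm]
    simp_rw [Finset.sum_product]
    conv_rhs => rw [Finset.sum_comm]
    refine Finset.sum_congr rfl fun j _ => ?_
    rw [Finset.sum_comm]
    refine Finset.sum_congr rfl fun h _ => ?_
    rw [Finset.sum_comm]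
  rw [e1]
  have hsz : 2 * H * (2 * J) * (2 * E) * (2 * D') ≤ m ^ 12 := by
    have := hg.hm
    calc 2 * H * (2 * J) * (2 * E) * (2 * D') ≤ m * m * (m * m) * (m * m) := by
          have : 2 * H ≤ m := by omega
          have : 2 * J ≤ m := by omega
          have : 2 * E ≤ m * m := by nlinarith
          have : 2 * D' ≤ m * m := by nlinarith
          gcongr
      _ = m ^ 6 := by ring
      _ ≤ m ^ 12 := Nat.pow_le_pow_right (by omega) (by norm_num)
  have key := KK_sum hg a b ha hb (2 * H) (2 * J) (2 * E) (2 * D') hsz s (by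
      rintro ⟨h, j, e, d⟩ hx
      simp only [hs, Finset.mem_product] at hx
      have a1 := mem_blk0 hx.1
      have a2 := mem_blk0 hx.2.1
      have a3 := mem_blk hx.2.2.1
      have a4 := mem_blk hx.2.2.2
      simp only [Finset.mem_Icc]
      omega) (by
      rintro ⟨h, j, e, d⟩ hx
      simp only [hs, Finset.mem_product] at hx
      exact ⟨(mem_blk hx.2.2.1).2.2.2.2, (mem_blk hx.2.2.2).2.2.2.2⟩)
  set S := ∑ x ∈ s, ‖KK (a * (x.1 : ZMod m) * (x.2.2.1 : ZMod m)⁻¹ * (x.2.2.2 : ZMod m)⁻¹) (b * (x.2.1 : ZMod m))‖ with hS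
  push_cast at key
  set G := min ((X : ℝ) / (E * m)) (1 / H) with hG
  set μ := min ((X : ℝ) / D') (m / (2 * J)) with hμ
  have hG0 : 0 ≤ G := by positivity
  have hμ0 : 0 ≤ μ := by positivity
  have g1 : G * H ≤ 1 := by
    calc G * H ≤ (1 / H) * H := by gcongr; exact min_le_right _ _
      _ = 1 := by field_simp
  have g2 : G * E ≤ X / m := by
    calc G * E ≤ (X / (E * m)) * E := by gcongr; exact min_le_left _ _
      _ = _ := by field_simp
  have g3 : μ * (2 * J) ≤ m := by
    calc μ * (2 * J) ≤ (m / (2 * J)) * (2 * J) := by gcongr; exact min_le_right _ _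
      _ = _ := by field_simp
  have g4 : μ * D' ≤ X := by
    calc μ * D' ≤ (X / D') * D' := by gcongr; exact min_le_left _ _
      _ = _ := by field_simp
  have hDY' : (D' : ℝ) ≤ Y := by exact_mod_cast hDY
  calc (G * (2 * Q ^ 2 / m) * μ * S) ^ 4 = (G * (2 * Q ^ 2 / m) * μ) ^ 4 * S ^ 4 := by ring
    _ ≤ (G * (2 * Q ^ 2 / m) * μ) ^ 4 * (2 * Q ^ 10 * (2 * H * (2 * J) * (2 * E) * (2 * D')) ^ 3 * ((2 * H * (2 * J) * (2 * E) * (2 * D')) / m + 1) * m ^ 3) := by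
        gcongr
    _ = 32 * Q ^ 18 * (4096 * ((G * H) ^ 4 * (μ * (2 * J)) ^ 4 * (E * D') ^ 4) / m ^ 2 +
          512 * ((G * H) ^ 3 * (μ * (2 * J)) ^ 3 * (E * D') ^ 2 * (G * E) * (μ * D')) / m) := by
        field_simp
        ring
    _ ≤ 32 * Q ^ 18 * (4096 * (1 ^ 4 * (m : ℝ) ^ 4 * (E * Y) ^ 4) / m ^ 2 +
          512 * (1 ^ 3 * (m : ℝ) ^ 3 * (E * Y) ^ 2 * (X / m) * X) / m) := by
        gcongr
    _ = 131072 * Q ^ 18 * (E * Y : ℝ) ^ 4 * m ^ 2 + 16384 * Q ^ 18 * ((X : ℝ) ^ 2 * m * (E * Y : ℝ) ^ 2) := by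
        field_simp
        ring
    _ ≤ _ := by
        have : 0 ≤ Q ^ 18 * ((X : ℝ) ^ 2 * m * (E * Y : ℝ) ^ 2) := by positivity
        nlinarith

theorem typeI_sum {Q : ℝ} (hg : Good m Q) (X D Y : ℕ) (hX : X ≤ m) (hD : D ≤ m) (hY : Y ≤ m)
    (a b : ZMod m) (ha : IsUnit a) (hb : IsUnit b) (E H : ℕ)
    (hE : 1 ≤ E) (hED : E ≤ D) (hH : 1 ≤ H) (hHm : H ≤ m / 2) (C : ℝ) (hC0 : 0 ≤ C)
    (hC : 131072 * Q ^ 18 * ((E * Y : ℝ) ^ 4 * m ^ 2 + (X : ℝ) ^ 2 * m * (E * Y : ℝ) ^ 2) ≤ C ^ 4) :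
    ∑ d ∈ Icc 1 Y, ∑ j ∈ Icc 1 (m / 2), min ((X : ℝ) / (E * m)) (1 / H) * (2 * Q ^ 2 / m) * min ((X : ℝ) / d) (m / (2 * j)) *
      (if d.Coprime m then ∑ h ∈ blk0 (m / 2) H, ∑ e ∈ blk m D E,
        ‖KK (a * (h : ZMod m) * (e : ZMod m)⁻¹ * (d : ZMod m)⁻¹) (b * (j : ZMod m))‖ else 0) ≤ 4 * Q ^ 2 * C := by
  have hm : (0 : ℝ) < m := by exact_mod_cast NeZero.pos m
  have hQ := hg.two_le
  have hnn : ∀ d j : ℕ, 0 ≤ min ((X : ℝ) / (E * m)) (1 / H) * (2 * Q ^ 2 / m) * min ((X : ℝ) / d) (m / (2 * j)) *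
      (if d.Coprime m then ∑ h ∈ blk0 (m / 2) H, ∑ e ∈ blk m D E,
        ‖KK (a * (h : ZMod m) * (e : ZMod m)⁻¹ * (d : ZMod m)⁻¹) (b * (j : ZMod m))‖ else 0) := by
    intro d j
    split_ifs
    · have : 0 ≤ ∑ h ∈ blk0 (m / 2) H, ∑ e ∈ blk m D E,
        ‖KK (a * (h : ZMod m) * (e : ZMod m)⁻¹ * (d : ZMod m)⁻¹) (b * (j : ZMod m))‖ := by positivity
      positivity
    · simp
  calc _ ≤ 2 * Q * (2 * Q * C) := by
        refine dyadic_good hg _ (fun d => Finset.sum_nonneg fun j _ => hnn d j) Y hY _ (by positivity) ?_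
        intro D' hD' hDY
        rw [Finset.sum_comm]
        refine dyadic_good hg _ (fun j => Finset.sum_nonneg fun d _ => hnn d j) (m / 2) (Nat.div_le_self _ _) _ hC0 ?_
        intro J hJ hJm
        have hD0 : (0 : ℝ) < D' := by exact_mod_cast hD'
        have hJ0 : (0 : ℝ) < J := by exact_mod_cast hJ
        have hb' := typeI_block hg X D Y hX hD hY a b ha hb E H D' J hE hED hH hHm hD' hDY hJ hJm
        have h3 := le_of_pow_le_pow_left₀ (by norm_num) hC0 (hb'.trans hC)
        refine le_trans ?_ h3
        rw [Finset.mul_sum, Finset.sum_comm]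
        have hbl : blk m Y D' = ((Icc 1 Y).filter (fun e => D' ≤ e ∧ e < 2 * D')).filter
          (fun e => e.Coprime m) := by rw [Finset.filter_filter]; rfl
        rw [hbl]
        conv_rhs => rw [Finset.sum_filter]
        refine Finset.sum_le_sum fun d hd => ?_
        simp only [Finset.mem_filter, Finset.mem_Icc] at hd
        split_ifs with hdc
        · rw [Finset.mul_sum]
          refine Finset.sum_le_sum fun j hj => ?_
          simp only [Finset.mem_filter, Finset.mem_Icc] at hj
          have q1 : (D' : ℝ) ≤ d := by exact_mod_cast hd.2.1
          have q2 : (J : ℝ) ≤ j := by exact_mod_cast hj.2.1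
          gcongr
        · simp
    _ = _ := by ring

theorem typeI {Q : ℝ} (hg : Good m Q) (A g : ℕ → ℝ) (X D Y : ℕ) (hX : X ≤ m) (hD : D ≤ m) (hYX : Y ≤ X)
    (hA : ∀ u ∈ Icc 1 X, |A u| ≤ Q) (hAY : ∀ v, Y < v → A v = 0)
    (hgm : Monotone g) (hg0 : 0 ≤ g 0) (hgX : g X ≤ Q)
    (a : ZMod m) (ha : IsUnit a) (E H : ℕ)
    (hE : 1 ≤ E) (hED : E ≤ D) (hH : 1 ≤ H) (hHm : H ≤ m / 2) (C : ℝ) (hC0 : 0 ≤ C)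
    (hC : 131072 * Q ^ 18 * ((E * Y : ℝ) ^ 4 * m ^ 2 + (X : ℝ) ^ 2 * m * (E * Y : ℝ) ^ 2) ≤ C ^ 4) :
    min ((X : ℝ) / (E * m)) (1 / H) *
        ∑ h ∈ blk0 (m / 2) H, ∑ e ∈ blk m D E, ‖SS (cv A g) X (a * (h : ZMod m) * (e : ZMod m)⁻¹)‖
      ≤ 8 * Q ^ 2 * C + 8 * Q ^ 4 * X * E / Real.sqrt m := by
  have hm : (0 : ℝ) < m := by exact_mod_cast NeZero.pos m
  have hQ := hg.two_le
  have hE0 : (0 : ℝ) < E := by exact_mod_cast hE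
  have hH0 : (0 : ℝ) < H := by exact_mod_cast hH
  have hYm := hYX.trans hX
  set G := min ((X : ℝ) / (E * m)) (1 / H) with hG
  have hG0 : 0 ≤ G := by positivity
  have p1 := typeI_sum hg X D Y hX hD hYm a (-1) ha (isUnit_one.neg) E H hE hED hH hHm C hC0 hC
  have p2 := typeI_sum hg X D Y hX hD hYm a 1 ha isUnit_one E H hE hED hH hHm C hC0 hC
  rw [← hG] at p1 p2
  -- pointwise
  have pt : ∀ h ∈ blk0 (m / 2) H, ∀ e ∈ blk m D E, G * ‖SS (cv A g) X (a * (h : ZMod m) * (e : ZMod m)⁻¹)‖ ≤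
      ∑ d ∈ Icc 1 Y, (G * (Q ^ 2 / m) * (X * (d : ℝ)⁻¹) * ((Nat.gcd h m : ℝ) * Real.sqrt m) +
        (∑ j ∈ Icc 1 (m / 2), G * (2 * Q ^ 2 / m) * min ((X : ℝ) / d) (m / (2 * j)) *
          (if d.Coprime m then ‖KK (a * (h : ZMod m) * (e : ZMod m)⁻¹ * (d : ZMod m)⁻¹) (-1 * (j : ZMod m))‖ else 0) +
        ∑ j ∈ Icc 1 (m / 2), G * (2 * Q ^ 2 / m) * min ((X : ℝ) / d) (m / (2 * j)) *
          (if d.Coprime m then ‖KK (a * (h : ZMod m) * (e : ZMod m)⁻¹ * (d : ZMod m)⁻¹) (1 * (j : ZMod m))‖ else 0))) := by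
    intro h hh e he
    have h1 := typeI_expand Q A g X Y hYX hA hAY (a * (h : ZMod m) * (e : ZMod m)⁻¹)
    refine (mul_le_mul_of_nonneg_left h1 hG0).trans ?_
    rw [Finset.mul_sum, Finset.mul_sum, Finset.sum_filter]
    refine Finset.sum_le_sum fun d hd => ?_
    rw [Finset.mem_Icc] at hd
    have hd0 : (0 : ℝ) < d := by exact_mod_cast hd.1
    split_ifs with hdc
    · have h2 := SS_complete_le Q g hgm hg0 (X / d) ((hgm (Nat.div_le_self _ _)).trans hgX)
        (a * (h : ZMod m) * (e : ZMod m)⁻¹ * (d : ZMod m)⁻¹)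
      have hXd : ((X / d : ℕ) : ℝ) ≤ X / d := Nat.cast_div_le
      have hu : IsUnit (a * (e : ZMod m)⁻¹ * (d : ZMod m)⁻¹) := by
        refine (ha.mul ?_).mul ?_
        · exact IsUnit.of_mul_eq_one_right _ (unit_of_coprime (mem_blk he).2.2.2.2)
        · exact IsUnit.of_mul_eq_one_right _ (unit_of_coprime hdc)
      have h3 := KK_zero_le h _ hu
      rw [show (h : ZMod m) * (a * (e : ZMod m)⁻¹ * (d : ZMod m)⁻¹) = a * (h : ZMod m) * (e : ZMod m)⁻¹ * (d : ZMod m)⁻¹ by ring] at h3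
      set w := a * (h : ZMod m) * (e : ZMod m)⁻¹ * (d : ZMod m)⁻¹ with hw
      have h4 : (m : ℝ) * ‖SS g (X / d) w‖ ≤ Q * (X / d) * ((Nat.gcd h m : ℝ) * Real.sqrt m) +
          ∑ j ∈ Icc 1 (m / 2), 2 * Q * min ((X : ℝ) / d) (m / (2 * j)) *
      (‖KK w (-1 * (j : ZMod m))‖ + ‖KK w (1 * (j : ZMod m))‖) := by
        refine h2.trans (add_le_add ?_ (Finset.sum_le_sum fun j hj => ?_))
        · gcongr
        · gcongr
      have h5 : ‖SS g (X / d) w‖ ≤ (Q * (X / d) * ((Nat.gcd h m : ℝ) * Real.sqrt m) +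
          ∑ j ∈ Icc 1 (m / 2), 2 * Q * min ((X : ℝ) / d) (m / (2 * j)) *
      (‖KK w (-1 * (j : ZMod m))‖ + ‖KK w (1 * (j : ZMod m))‖)) / m := by
        rw [le_div_iff₀ hm, mul_comm]; exact h4
      calc G * (Q * ‖SS g (X / d) w‖) ≤ G * (Q * ((Q * (X / d) * ((Nat.gcd h m : ℝ) * Real.sqrt m) +
          ∑ j ∈ Icc 1 (m / 2), 2 * Q * min ((X : ℝ) / d) (m / (2 * j)) *
      (‖KK w (-1 * (j : ZMod m))‖ + ‖KK w (1 * (j : ZMod m))‖)) / m)) := by gcongr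
        _ = _ := by
          rw [← Finset.sum_add_distrib, add_div, mul_add, mul_add]
          congr 1
          · field_simp
          · rw [Finset.sum_div, Finset.mul_sum, Finset.mul_sum]
            refine Finset.sum_congr rfl fun j _ => ?_
            ring
    · simp only [mul_zero, Finset.sum_const_zero, add_zero]
      positivity
  rw [Finset.mul_sum]
  simp_rw [Finset.mul_sum]
  refine (Finset.sum_le_sum fun h hh => Finset.sum_le_sum fun e he => pt h hh e he).trans ?_
  rw [sum_comm3]
  simp_rw [Finset.sum_add_distrib]
  have q0 : ∑ d ∈ Icc 1 Y, ∑ h ∈ blk0 (m / 2) H, ∑ e ∈ blk m D E,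
      G * (Q ^ 2 / m) * (X * (d : ℝ)⁻¹) * ((Nat.gcd h m : ℝ) * Real.sqrt m) ≤ 8 * Q ^ 4 * X * E / Real.sqrt m := by
    have e1 : ∑ d ∈ Icc 1 Y, ∑ h ∈ blk0 (m / 2) H, ∑ e ∈ blk m D E,
      G * (Q ^ 2 / m) * (X * (d : ℝ)⁻¹) * ((Nat.gcd h m : ℝ) * Real.sqrt m) =
      G * (Q ^ 2 / m) * X * Real.sqrt m * ((blk m D E).card : ℝ) * (∑ d ∈ Icc 1 Y, (d : ℝ)⁻¹) * (∑ h ∈ blk0 (m / 2) H, (Nat.gcd h m : ℝ)) := by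
      rw [mul_assoc, Finset.sum_mul_sum, Finset.mul_sum]
      refine Finset.sum_congr rfl fun d _ => ?_
      rw [Finset.mul_sum]
      refine Finset.sum_congr rfl fun h _ => ?_
      rw [Finset.sum_const, nsmul_eq_mul]; ring
    rw [e1]
    have c1 : ((blk m D E).card : ℝ) ≤ 2 * E := by
      exact_mod_cast (Finset.card_le_card (blk_sub D E)).trans (card_blk0 D E)
    have c2 := sum_inv_le hg Y hYm
    have c3 := sum_gcd_blk hg (m / 2) H
    have c4 : G ≤ 1 / H := min_le_right _ _
    calc _ ≤ (1 / H) * (Q ^ 2 / m) * X * Real.sqrt m * (2 * E) * (2 * Q) * (2 * H * Q) := by gcongr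
      _ = 8 * Q ^ 4 * X * E * (Real.sqrt m / m) := by field_simp; ring
      _ = _ := by rw [Real.sqrt_div_self']; ring
  have sw : ∀ b : ZMod m, ∑ d ∈ Icc 1 Y, ∑ h ∈ blk0 (m / 2) H, ∑ e ∈ blk m D E, ∑ j ∈ Icc 1 (m / 2), G * (2 * Q ^ 2 / m) * min ((X : ℝ) / d) (m / (2 * j)) *
          (if d.Coprime m then ‖KK (a * (h : ZMod m) * (e : ZMod m)⁻¹ * (d : ZMod m)⁻¹) (b * (j : ZMod m))‖ else 0) =
      ∑ d ∈ Icc 1 Y, ∑ j ∈ Icc 1 (m / 2), G * (2 * Q ^ 2 / m) * min ((X : ℝ) / d) (m / (2 * j)) *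
      (if d.Coprime m then ∑ h ∈ blk0 (m / 2) H, ∑ e ∈ blk m D E,
        ‖KK (a * (h : ZMod m) * (e : ZMod m)⁻¹ * (d : ZMod m)⁻¹) (b * (j : ZMod m))‖ else 0) := by
    intro b
    refine Finset.sum_congr rfl fun d _ => ?_
    rw [sum_comm3]
    refine Finset.sum_congr rfl fun j _ => ?_
    simp_rw [← Finset.mul_sum]
    congr 1
    split_ifs <;> simp
  rw [sw (-1), sw 1]
  linarith

end part12



section part13
variable {m : ℕ} [NeZero m]

noncomputable def lpr (n : ℕ) : ℝ := if n.Prime then Real.log n else 0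

noncomputable def BL (X D E H : ℕ) (a : ZMod m) (f : ℕ → ℝ) : ℝ :=
  min ((X : ℝ) / (E * m)) (1 / H) *
        ∑ h ∈ blk0 (m / 2) H, ∑ e ∈ blk m D E, ‖SS f X (a * (h : ZMod m) * (e : ZMod m)⁻¹)‖

theorem BL_gnn (X E H : ℕ) : 0 ≤ min ((X : ℝ) / (E * m)) (1 / H) := by
  refine le_min ?_ ?_ <;> positivity

theorem BL_add (X D E H : ℕ) (a : ZMod m) (f g k : ℕ → ℝ) (h : ∀ n, k n = f n + g n) :
    BL X D E H a k ≤ BL X D E H a f + BL X D E H a g := by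
  unfold BL
  rw [← mul_add, ← Finset.sum_add_distrib]
  simp_rw [← Finset.sum_add_distrib]
  refine mul_le_mul_of_nonneg_left (Finset.sum_le_sum fun h' _ => Finset.sum_le_sum fun e _ => ?_) (BL_gnn X E H)
  have : ∀ w : ZMod m, SS k X w = SS f X w + SS g X w := by
    intro w
    unfold SS
    rw [← Finset.sum_add_distrib]
    refine Finset.sum_congr rfl fun n _ => ?_
    rw [h]; push_cast; ring
  rw [this]
  exact norm_add_le _ _

theorem BL_neg (X D E H : ℕ) (a : ZMod m) (f k : ℕ → ℝ) (h : ∀ n, k n = - f n) :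
    BL X D E H a k = BL X D E H a f := by
  unfold BL
  congr 1
  refine Finset.sum_congr rfl fun h' _ => Finset.sum_congr rfl fun e _ => ?_
  have : ∀ w : ZMod m, SS k X w = - SS f X w := by
    intro w
    unfold SS
    rw [← Finset.sum_neg_distrib]
    refine Finset.sum_congr rfl fun n _ => ?_
    rw [h]; push_cast; ring
  rw [this, norm_neg]

theorem BL_sub (X D E H : ℕ) (a : ZMod m) (f g k : ℕ → ℝ) (h : ∀ n, k n = f n - g n) :
    BL X D E H a k ≤ BL X D E H a f + BL X D E H a g := by
  rw [← BL_neg X D E H a g (fun n => - g n) (fun n => rfl)]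
  exact BL_add X D E H a f _ k (fun n => by rw [h]; ring)

theorem SS_norm_le (f : ℕ → ℝ) (X : ℕ) (w : ZMod m) : ‖SS f X w‖ ≤ ∑ n ∈ Icc 1 X, |f n| := by
  unfold SS
  refine (norm_sum_le _ _).trans ?_
  refine le_trans (Finset.sum_le_sum (fun n _ => ?_)) (Finset.sum_le_sum_of_subset_of_nonneg (Finset.filter_subset _ _) fun n _ _ => abs_nonneg (f n))
  rw [norm_mul, norm_ee, mul_one, Complex.norm_real, Real.norm_eq_abs]

theorem BL_triv (X D E H : ℕ) (hH : 1 ≤ H) (a : ZMod m) (f : ℕ → ℝ) :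
    BL X D E H a f ≤ 4 * E * ∑ n ∈ Icc 1 X, |f n| := by
  unfold BL
  have hH0 : (0 : ℝ) < H := by exact_mod_cast hH
  set S := ∑ n ∈ Icc 1 X, |f n| with hS
  have hS0 : 0 ≤ S := Finset.sum_nonneg fun n _ => abs_nonneg _
  have c1 : ((blk m D E).card : ℝ) ≤ 2 * E := by
    exact_mod_cast (Finset.card_le_card (blk_sub D E)).trans (card_blk0 D E)
  have c2 : ((blk0 (m / 2) H).card : ℝ) ≤ 2 * H := by
    exact_mod_cast (card_blk0 _ H)
  calc _ ≤ (1 / H : ℝ) * ∑ h ∈ blk0 (m / 2) H, ∑ e ∈ blk m D E, S := by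
        refine mul_le_mul (min_le_right _ _) (Finset.sum_le_sum fun h _ => Finset.sum_le_sum fun e _ => SS_norm_le _ _ _) ?_ (by positivity)
        exact Finset.sum_nonneg fun h _ => Finset.sum_nonneg fun e _ => norm_nonneg _
    _ = (1 / H : ℝ) * ((blk0 (m / 2) H).card * ((blk m D E).card * S)) := by
        simp only [Finset.sum_const, nsmul_eq_mul]
    _ ≤ (1 / H : ℝ) * ((2 * H) * ((2 * E) * S)) := by gcongr
    _ = _ := by field_simp; ring

/-- truncation of an arithmetic function -/
noncomputable def trL (f : ArithmeticFunction ℝ) (Y : ℕ) : ArithmeticFunction ℝ :=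
  ⟨fun n => if n ≤ Y then f n else 0, by simp⟩

theorem trL_apply (f : ArithmeticFunction ℝ) (Y n : ℕ) : trL f Y n = if n ≤ Y then f n else 0 := rfl

theorem trL_abs (f : ArithmeticFunction ℝ) (Y n : ℕ) : |trL f Y n| ≤ |f n| := by
  rw [trL_apply]; split_ifs
  · exact le_rfl
  · simp

theorem trG_apply (f : ArithmeticFunction ℝ) (Y n : ℕ) : (f - trL f Y) n = if n ≤ Y then 0 else f n := by
  rw [sub_eq_add_neg, ArithmeticFunction.add_apply, ArithmeticFunction.neg_apply, trL_apply]; split_ifs <;> simp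

theorem trG_abs (f : ArithmeticFunction ℝ) (Y n : ℕ) : |(f - trL f Y) n| ≤ |f n| := by
  rw [trG_apply]; split_ifs
  · simp
  · exact le_rfl

theorem cv_eq (f g : ArithmeticFunction ℝ) (n : ℕ) : (f * g) n = cv f g n := by
  rw [ArithmeticFunction.mul_apply]; rfl

/-- the prime log function minus von Mangoldt -/
theorem sum_lpr_sub (X : ℕ) (hX : 1 ≤ X) :
    ∑ n ∈ Icc 1 X, |lpr n - ArithmeticFunction.vonMangoldt n| ≤ 2 * Real.sqrt X * Real.log X := by
  have h := Chebyshev.psi_sub_theta_le (x := (X : ℝ)) (by exact_mod_cast hX)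
  rw [Chebyshev.psi, Chebyshev.theta, Nat.floor_natCast, Finset.sum_filter, ← Finset.sum_sub_distrib] at h
  refine le_trans (le_of_eq ?_) h
  refine Finset.sum_congr ?_ fun n _ => ?_
  · ext x; simp only [Finset.mem_Icc, Finset.mem_Ioc]; omega
  · unfold lpr
    split_ifs with hp
    · rw [ArithmeticFunction.vonMangoldt_apply_prime hp]; simp
    · rw [zero_sub, abs_neg, abs_of_nonneg ArithmeticFunction.vonMangoldt_nonneg, sub_zero]


theorem vaughan_id (Y : ℕ) (M Z V c : ArithmeticFunction ℝ) (h1 : M * Z = 1) (hc : c = trL M Y * trL V Y) :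
    V = trL V Y + trL M Y * (V * Z) - trL c Y * Z - (c - trL c Y) * trL Z Y - (c - trL c Y) * (Z - trL Z Y)
      + ((M - trL M Y) * Z) * (V - trL V Y) := by
  have : ∀ M' V' c' Z' : ArithmeticFunction ℝ, c = M' * V' → V = V' + M' * (V * Z) - c' * Z - (c - c') * Z' - (c - c') * (Z - Z')
      + ((M - M') * Z) * (V - V') := by
    intro M' V' c' Z' hc
    subst hc
    linear_combination (-(V - V')) * h1
  exact this _ _ _ _ hc

theorem mul_abs_le (f g : ArithmeticFunction ℝ) (n : ℕ) :
    |(f * g) n| ≤ ∑ p ∈ n.divisorsAntidiagonal, |f p.1| * |g p.2| := by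
  rw [ArithmeticFunction.mul_apply]
  refine (Finset.abs_sum_le_sum_abs _ _).trans (le_of_eq ?_)
  exact Finset.sum_congr rfl fun p _ => abs_mul _ _

theorem mul_abs_tau {Q : ℝ} (hg : Good m Q) (f g : ArithmeticFunction ℝ) (A : ℝ) (hA : 0 ≤ A) (n : ℕ) (hn : n ≠ 0) (hnm : n ≤ m)
    (hf : ∀ d, d ∣ n → |f d| ≤ A) (hgb : ∀ d, |g d| ≤ 1) : |(f * g) n| ≤ Q * A := by
  have hm16 := hg.hm
  refine (mul_abs_le f g n).trans ?_
  calc _ ≤ ∑ p ∈ n.divisorsAntidiagonal, A * 1 := by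
        refine Finset.sum_le_sum fun p hp => ?_
        rw [Nat.mem_divisorsAntidiagonal] at hp
        exact mul_le_mul (hf _ ⟨_, hp.1.symm⟩) (hgb _) (abs_nonneg _) hA
    _ = n.divisors.card * A := by
        rw [Finset.sum_const, nsmul_eq_mul, mul_one, ← Nat.map_div_right_divisors, Finset.card_map]
    _ ≤ Q * A := by
        refine mul_le_mul_of_nonneg_right (hg.tau n hn ?_) hA
        exact hnm.trans (Nat.le_self_pow (by norm_num) m)

theorem abs_moebius_real (n : ℕ) : |(ArithmeticFunction.moebius : ArithmeticFunction ℝ) n| ≤ 1 := by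
  rw [ArithmeticFunction.intCoe_apply]
  exact_mod_cast (ArithmeticFunction.abs_moebius_le_one (n := n))

theorem abs_zeta_real (n : ℕ) : |(ArithmeticFunction.zeta : ArithmeticFunction ℝ) n| ≤ 1 := by
  rw [ArithmeticFunction.natCoe_apply, ArithmeticFunction.zeta_apply]
  split_ifs <;> simp

theorem Good.log_le {Q : ℝ} (hg : Good m Q) (n : ℕ) (hnm : n ≤ m) : Real.log n ≤ Q := by
  rcases Nat.eq_zero_or_pos n with rfl | h
  · simp; linarith [hg.two_le]
  · exact (Real.log_le_log (by exact_mod_cast h) (by exact_mod_cast hnm)).trans hg.log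

theorem abs_mangoldt (n : ℕ) : |ArithmeticFunction.vonMangoldt n| ≤ Real.log n := by
  rw [abs_of_nonneg ArithmeticFunction.vonMangoldt_nonneg]
  exact ArithmeticFunction.vonMangoldt_le_log

theorem abs_c_le (Y n : ℕ) :
    |(trL (ArithmeticFunction.moebius : ArithmeticFunction ℝ) Y * trL ArithmeticFunction.vonMangoldt Y) n| ≤ Real.log n := by
  refine (mul_abs_le _ _ n).trans ?_
  calc _ ≤ ∑ p ∈ n.divisorsAntidiagonal, ArithmeticFunction.vonMangoldt p.2 := by
        refine Finset.sum_le_sum fun p hp => ?_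
        have h1 := (trL_abs (ArithmeticFunction.moebius : ArithmeticFunction ℝ) Y p.1).trans (abs_moebius_real _)
        have h2 := (trL_abs ArithmeticFunction.vonMangoldt Y p.2)
        rw [abs_of_nonneg ArithmeticFunction.vonMangoldt_nonneg] at h2
        calc _ ≤ 1 * ArithmeticFunction.vonMangoldt p.2 := mul_le_mul h1 h2 (abs_nonneg _) zero_le_one
          _ = _ := one_mul _
    _ = ∑ d ∈ n.divisors, ArithmeticFunction.vonMangoldt d := by
        rw [← Nat.map_div_left_divisors, Finset.sum_map]; rfl
    _ = _ := ArithmeticFunction.vonMangoldt_sum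

theorem c_zero (Y n : ℕ) (M V : ArithmeticFunction ℝ) (hn : Y * Y < n) : (trL M Y * trL V Y) n = 0 := by
  rw [ArithmeticFunction.mul_apply]
  refine Finset.sum_eq_zero fun p hp => ?_
  rw [Nat.mem_divisorsAntidiagonal] at hp
  rw [trL_apply, trL_apply]
  split_ifs with h1 h2
  · exfalso
    have := Nat.mul_le_mul h1 h2
    rw [hp.1] at this; omega
  all_goals simp

theorem vaughan_block {Q : ℝ} (hg : Good m Q) (X D Y : ℕ) (hX : X ≤ m) (hX1 : 1 ≤ X) (hD : D ≤ m) (hYX : Y ≤ X) (hY1 : 1 ≤ Y)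
    (a : ZMod m) (ha : IsUnit a) (E H : ℕ)
    (hE : 1 ≤ E) (hED : E ≤ D) (hH : 1 ≤ H) (hHm : H ≤ m / 2) (C : ℝ) (hC0 : 0 ≤ C)
    (hC : ∀ V : ℕ, 1 ≤ V → Y < 2 * V → V ≤ Nat.sqrt X → 81 * 40960 * Q ^ 17 * (X : ℝ) ^ 4 *
      ((E : ℝ) ^ 4 / V ^ 2 + (E : ℝ) ^ 2 / V) * (1 + V * Real.sqrt (V / m)) ≤ C ^ 4)
    (hC' : 131072 * Q ^ 18 * (((E : ℝ) * Y) ^ 4 * (m : ℝ) ^ 2 + (X : ℝ) ^ 2 * m * ((E : ℝ) * Y) ^ 2) ≤ C ^ 4) :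
    BL X D E H a lpr ≤ 8 * Q * C + 16 * Q ^ 2 * C + 16 * Q ^ 4 * X * E / Real.sqrt m +
      4 * E * (2 * Q ^ 2 * (Y : ℝ) ^ 3 + 2 * Q * Real.sqrt X) := by
  have hQ := hg.two_le
  set M : ArithmeticFunction ℝ := (ArithmeticFunction.moebius : ArithmeticFunction ℝ) with hM
  set Z : ArithmeticFunction ℝ := (ArithmeticFunction.zeta : ArithmeticFunction ℝ) with hZ
  set V := ArithmeticFunction.vonMangoldt with hV
  set c := trL M Y * trL V Y with hc
  have hMZ : M * Z = 1 := ArithmeticFunction.coe_moebius_mul_coe_zeta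
  have hVZ : V * Z = ArithmeticFunction.log := ArithmeticFunction.vonMangoldt_mul_zeta
  have key := vaughan_id Y M Z V c hMZ hc
  rw [hVZ] at key
  have logb : ∀ n ∈ Icc 1 X, Real.log n ≤ Q := fun n hn => hg.log_le n ((Finset.mem_Icc.mp hn).2.trans hX)
  have cb : ∀ n, |c n| ≤ Real.log n := fun n => abs_c_le Y n
  -- type I
  have t1 := typeI hg (trL M Y) (ArithmeticFunction.log) X D Y hX hD hYX
    (fun u hu => (trL_abs M Y u).trans ((abs_moebius_real u).trans (by linarith)))
    (fun v hv => by rw [trL_apply, if_neg (by omega)])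
    (by
      intro x y hxy
      rw [ArithmeticFunction.log_apply, ArithmeticFunction.log_apply]
      rcases Nat.eq_zero_or_pos x with rfl | hx
      · simp; exact Real.log_natCast_nonneg y
      · exact Real.log_le_log (by exact_mod_cast hx) (by exact_mod_cast hxy))
    (by simp) (by rw [ArithmeticFunction.log_apply]; exact hg.log_le X hX) a ha E H hE hED hH hHm C hC0 hC'
  have t2 := typeI hg (trL c Y) Z X D Y hX hD hYX
    (fun u hu => (trL_abs c Y u).trans ((cb u).trans (logb u hu)))
    (fun v hv => by rw [trL_apply, if_neg (by omega)])
    (by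
      intro x y hxy
      simp only [hZ, ArithmeticFunction.natCoe_apply, ArithmeticFunction.zeta_apply]
      split_ifs <;> simp; omega)
    (by simp) ((le_abs_self _).trans ((abs_zeta_real X).trans (by linarith))) a ha E H hE hED hH hHm C hC0 hC'
  have t3 := typeII hg ((M - trL M Y) * Z : ArithmeticFunction ℝ) (V - trL V Y : ArithmeticFunction ℝ) X D Y hX hD
    (fun u hu => by
      have := mul_abs_tau hg (M - trL M Y) Z 1 zero_le_one u (by have := Finset.mem_Icc.mp hu; omega)
        ((Finset.mem_Icc.mp hu).2.trans hX) (fun d _ => (trG_abs M Y d).trans (abs_moebius_real d)) (fun d => abs_zeta_real d)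
      linarith)
    (fun u hu => (trG_abs V Y u).trans ((abs_mangoldt u).trans (logb u hu)))
    (fun v hv => by
      rw [ArithmeticFunction.mul_apply]
      refine Finset.sum_eq_zero fun p hp => ?_
      rw [Nat.mem_divisorsAntidiagonal] at hp
      have : p.1 ≤ v := Nat.le_of_dvd (Nat.pos_of_ne_zero hp.2) ⟨_, hp.1.symm⟩
      rw [trG_apply, if_pos (by omega), zero_mul])
    (fun v hv => by rw [trG_apply, if_pos hv])
    a ha E H hE hED hH hHm C hC0 hC
  have t4 := typeII hg (c - trL c Y : ArithmeticFunction ℝ) (Z - trL Z Y : ArithmeticFunction ℝ) X D Y hX hD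
    (fun u hu => (trG_abs c Y u).trans ((cb u).trans (logb u hu)))
    (fun u hu => (trG_abs Z Y u).trans ((abs_zeta_real u).trans (by linarith)))
    (fun v hv => by rw [trG_apply, if_pos hv])
    (fun v hv => by rw [trG_apply, if_pos hv])
    a ha E H hE hED hH hHm C hC0 hC
  change BL X D E H a _ ≤ _ at t1
  change BL X D E H a _ ≤ _ at t2
  change BL X D E H a _ ≤ _ at t3
  change BL X D E H a _ ≤ _ at t4
  -- trivial parts
  have hE0 : (0 : ℝ) ≤ E := Nat.cast_nonneg E
  have sumY : ∀ (F : ℕ → ℝ) (B : ℝ), 0 ≤ B → (∀ n ∈ Icc 1 X, |F n| ≤ B) → (∀ n, Y ^ 3 < n → F n = 0) →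
      ∑ n ∈ Icc 1 X, |F n| ≤ B * (Y : ℝ) ^ 3 := by
    intro F B hB h1 h2
    calc _ ≤ ∑ n ∈ Icc 1 X, if n ≤ Y ^ 3 then B else 0 := by
          refine Finset.sum_le_sum fun n hn => ?_
          split_ifs with h
          · exact h1 n hn
          · rw [h2 n (by omega), abs_zero]
      _ = ∑ n ∈ (Icc 1 X).filter (fun n => n ≤ Y ^ 3), B := by rw [Finset.sum_filter]
      _ ≤ ∑ n ∈ Icc 1 (Y ^ 3), B := by
          refine Finset.sum_le_sum_of_subset_of_nonneg ?_ fun _ _ _ => hB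
          intro n hn
          simp only [Finset.mem_filter, Finset.mem_Icc] at hn ⊢
          omega
      _ = _ := by
          rw [Finset.sum_const, nsmul_eq_mul, Nat.card_Icc]; push_cast; simp [mul_comm]
  have u1 := BL_triv X D E H hH a (fun n => lpr n - V n)
  have u1' := sum_lpr_sub X hX1
  rw [← hV] at u1'
  have u2 := BL_triv X D E H hH a (fun n => trL V Y n)
  have u2' := sumY (fun n => trL V Y n) Q (by linarith)
    (fun n hn => (trL_abs V Y n).trans ((abs_mangoldt n).trans (logb n hn)))
    (fun n hn => by
      have : Y ≤ Y ^ 3 := Nat.le_self_pow (by norm_num) Y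
      rw [trL_apply, if_neg (by omega)])
  have u3 := BL_triv X D E H hH a (fun n => ((c - trL c Y) * trL Z Y) n)
  have u3' := sumY (fun n => ((c - trL c Y) * trL Z Y) n) (Q * Q) (by positivity)
    (fun n hn => by
      have hn' := Finset.mem_Icc.mp hn
      refine mul_abs_tau hg _ _ Q (by linarith) n (by omega) (hn'.2.trans hX) (fun d hd => ?_)
        (fun d => (trL_abs Z Y d).trans (abs_zeta_real d))
      have hdn := Nat.le_of_dvd (by omega) hd
      exact (trG_abs c Y d).trans ((cb d).trans (hg.log_le d (by omega))))
    (fun n hn => by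
      rw [ArithmeticFunction.mul_apply]
      refine Finset.sum_eq_zero fun p hp => ?_
      rw [Nat.mem_divisorsAntidiagonal] at hp
      by_cases h1 : p.1 ≤ Y * Y
      · have : ¬ p.2 ≤ Y := by
          intro h2
          have := Nat.mul_le_mul h1 h2
          rw [hp.1] at this
          have e : Y ^ 3 = Y * Y * Y := by ring
          omega
        rw [trL_apply, if_neg this, mul_zero]
      · have e : c p.1 = 0 := c_zero Y p.1 M V (by omega)
        rw [trG_apply, e]; simp)
  -- assemble
  have kn : ∀ n, V n = trL V Y n + (trL M Y * ArithmeticFunction.log) n - (trL c Y * Z) n - ((c - trL c Y) * trL Z Y) n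
      - ((c - trL c Y) * (Z - trL Z Y)) n + (((M - trL M Y) * Z) * (V - trL V Y)) n := by
    intro n
    conv_lhs => rw [key]
    simp only [sub_eq_add_neg, ArithmeticFunction.add_apply, ArithmeticFunction.neg_apply]
  have s0 := BL_add X D E H a (fun n => lpr n - V n) V lpr (fun n => by ring)
  have s1 := BL_add X D E H a (fun n => trL V Y n + (trL M Y * ArithmeticFunction.log) n - (trL c Y * Z) n - ((c - trL c Y) * trL Z Y) n
      - ((c - trL c Y) * (Z - trL Z Y)) n) (fun n => (((M - trL M Y) * Z) * (V - trL V Y)) n) V kn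
  have s2 := BL_sub X D E H a (fun n => trL V Y n + (trL M Y * ArithmeticFunction.log) n - (trL c Y * Z) n - ((c - trL c Y) * trL Z Y) n)
      (fun n => ((c - trL c Y) * (Z - trL Z Y)) n) _ (fun n => rfl)
  have s3 := BL_sub X D E H a (fun n => trL V Y n + (trL M Y * ArithmeticFunction.log) n - (trL c Y * Z) n)
      (fun n => ((c - trL c Y) * trL Z Y) n) _ (fun n => rfl)
  have s4 := BL_sub X D E H a (fun n => trL V Y n + (trL M Y * ArithmeticFunction.log) n)
      (fun n => (trL c Y * Z) n) _ (fun n => rfl)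
  have s5 := BL_add X D E H a (fun n => trL V Y n)
      (fun n => (trL M Y * ArithmeticFunction.log) n) _ (fun n => rfl)
  have e1 : BL X D E H a (fun n => (trL M Y * ArithmeticFunction.log) n) = BL X D E H a (cv (trL M Y) ArithmeticFunction.log) := rfl
  have e2 : BL X D E H a (fun n => (trL c Y * Z) n) = BL X D E H a (cv (trL c Y) Z) := rfl
  have e3 : BL X D E H a (fun n => (((M - trL M Y) * Z) * (V - trL V Y)) n) = BL X D E H a (cv ((M - trL M Y) * Z : ArithmeticFunction ℝ) (V - trL V Y : ArithmeticFunction ℝ)) := rfl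
  have e4 : BL X D E H a (fun n => ((c - trL c Y) * (Z - trL Z Y)) n) = BL X D E H a (cv (c - trL c Y : ArithmeticFunction ℝ) (Z - trL Z Y : ArithmeticFunction ℝ)) := rfl
  rw [e1] at s5
  rw [e2] at s4
  rw [e3] at s1
  rw [e4] at s2
  have w1 : 2 * Real.sqrt X * Real.log X ≤ 2 * Q * Real.sqrt X := by
    have := hg.log_le X hX
    nlinarith [Real.sqrt_nonneg (X : ℝ)]
  have w2 : Q * (Y : ℝ) ^ 3 + Q * Q * (Y : ℝ) ^ 3 ≤ 2 * Q ^ 2 * (Y : ℝ) ^ 3 := by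
    have h0 : (0 : ℝ) ≤ (Y : ℝ) ^ 3 := by positivity
    have h1 : Q ≤ Q ^ 2 := by nlinarith
    have h2 := mul_le_mul_of_nonneg_right h1 h0
    linarith
  have w3 : 4 * (E : ℝ) * ∑ n ∈ Icc 1 X, |lpr n - V n| + 4 * E * ∑ n ∈ Icc 1 X, |trL V Y n| + 4 * E * ∑ n ∈ Icc 1 X, |((c - trL c Y) * trL Z Y) n|
     ≤ 4 * E * (2 * Q ^ 2 * (Y : ℝ) ^ 3 + 2 * Q * Real.sqrt X) := by
    rw [← mul_add, ← mul_add]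
    refine mul_le_mul_of_nonneg_left ?_ (by positivity)
    refine le_trans (add_le_add (add_le_add u1' u2') u3') ?_
    linarith only [w1, w2]
  have w4 : 16 * Q ^ 4 * X * E / Real.sqrt m = 8 * Q ^ 4 * X * E / Real.sqrt m + 8 * Q ^ 4 * X * E / Real.sqrt m := by ring
  linarith

end part13



section part14

/-- level of distribution property -/
def LDP (α δ : ℝ) : Prop := ∃ η : ℝ, 0 < η ∧ ∃ M : ℕ, ∀ m : ℕ, M ≤ m → ∀ [NeZero m], ∀ a : ZMod m, IsUnit a →
  ∑ e ∈ (Icc 1 ⌊(m : ℝ) ^ δ⌋₊).filter (fun e => e.Coprime m), |EE lpr ⌊(m : ℝ) ^ α⌋₊ a e| ≤ (m : ℝ) ^ (2 * α - 1 - η)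

theorem typeII_num (m Q E X V β δ κ : ℝ) (hm : 1 ≤ m) (hQ : Q = m ^ (κ / 1000)) (hQ2 : 2 ≤ Q) (hκ : 0 < κ) (hδ : δ = 1 / 8 - 15 * β / 8 - κ)
    (hδ0 : 0 < δ) (hβ0 : 0 < β) (hβ : β ≤ 1 / 17)
    (hE0 : 0 ≤ E) (hE : E ≤ m ^ δ) (hX0 : 0 ≤ X) (hX : X ≤ m ^ (1 - β)) (hV0 : 0 < V) (hV : m ^ (2 * δ + 4 * β + κ) ≤ Q ^ 2 * V)
    (hVX : V ^ 2 ≤ X) : 81 * 40960 * Q ^ 17 * X ^ 4 * (E ^ 4 / V ^ 2 + E ^ 2 / V) * (1 + V * Real.sqrt (V / m)) ≤ (m ^ (1 - 2 * β - κ / 5)) ^ 4 := by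
  have hm0 : 0 < m := by linarith
  have hQ0 : 0 < Q := by linarith
  have mono : ∀ {a b : ℝ}, a ≤ b → m ^ a ≤ m ^ b := fun h => Real.rpow_le_rpow_of_exponent_le hm h
  obtain ⟨v, hv⟩ : ∃ v, v = Real.sqrt V := ⟨_, rfl⟩
  have hv0 : 0 < v := hv ▸ Real.sqrt_pos.mpr hV0
  have hVv : V = v ^ 2 := by rw [hv, Real.sq_sqrt hV0.le]
  obtain ⟨s, hs⟩ : ∃ s, s = m ^ (-(1/2) : ℝ) := ⟨_, rfl⟩
  have hs0 : 0 < s := hs ▸ Real.rpow_pos_of_pos hm0 _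
  have hss : Real.sqrt (V / m) = v * s := by
    rw [Real.sqrt_div hV0.le, ← hv, hs, Real.rpow_neg hm0.le, ← Real.sqrt_eq_rpow, div_eq_mul_inv]
  -- inverse of v
  have hvi : v⁻¹ ≤ m ^ (κ / 1000 - (2 * δ + 4 * β + κ) / 2) := by
    rw [inv_le_iff_one_le_mul₀ hv0]
    have h1 : (m ^ ((2 * δ + 4 * β + κ) / 2)) ≤ Q * v := by
      refine le_of_pow_le_pow_left₀ (n := 2) (by norm_num) (by positivity) ?_
      rw [mul_pow, ← hVv, ← Real.rpow_natCast, ← Real.rpow_mul hm0.le]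
      refine le_trans (le_of_eq ?_) hV
      congr 1; push_cast; ring
    rw [Real.rpow_sub hm0, ← hQ, div_mul_eq_mul_div, le_div_iff₀ (by positivity)]
    linarith
  have hvu : v ≤ m ^ ((1 - β) / 4) := by
    refine le_of_pow_le_pow_left₀ (n := 4) (by norm_num) (by positivity) ?_
    have h1 : v ^ 4 = V ^ 2 := by rw [hVv]; ring
    rw [h1, ← Real.rpow_natCast (m ^ _), ← Real.rpow_mul hm0.le]
    refine (hVX.trans hX).trans (le_of_eq ?_)
    congr 1; push_cast; ring
  obtain ⟨w, hw⟩ : ∃ w, w = v⁻¹ := ⟨_, rfl⟩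
  have hw0 : 0 < w := hw ▸ inv_pos.mpr hv0
  rw [← hw] at hvi
  have hc : (81 * 40960 : ℝ) ≤ Q ^ 22 := by
    calc (81 * 40960 : ℝ) ≤ 2 ^ 22 := by norm_num
      _ ≤ Q ^ 22 := by gcongr
  have hc2 : (4 : ℝ) ≤ Q ^ 2 := by nlinarith
  have expand : X ^ 4 * (E ^ 4 / V ^ 2 + E ^ 2 / V) * (1 + V * Real.sqrt (V / m)) =
      X ^ 4 * E ^ 4 * w ^ 4 + X ^ 4 * E ^ 2 * w ^ 2 + X ^ 4 * E ^ 4 * w * s + X ^ 4 * E ^ 2 * v * s := by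
    rw [hss, hVv, hw]; field_simp; ring
  set G := m ^ (4 - 8 * β - κ + 4 * (κ / 1000)) with hG
  have T1 : X ^ 4 * E ^ 4 * w ^ 4 ≤ G := by
    calc _ ≤ (m ^ (1 - β)) ^ 4 * (m ^ δ) ^ 4 * (m ^ (κ / 1000 - (2 * δ + 4 * β + κ) / 2)) ^ 4 := by gcongr
      _ ≤ G := by
        simp only [← Real.rpow_natCast, ← Real.rpow_mul hm0.le, ← Real.rpow_add hm0]
        refine mono ?_
        push_cast; linarith
  have T2 : X ^ 4 * E ^ 2 * w ^ 2 ≤ G := by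
    calc _ ≤ (m ^ (1 - β)) ^ 4 * (m ^ δ) ^ 2 * (m ^ (κ / 1000 - (2 * δ + 4 * β + κ) / 2)) ^ 2 := by gcongr
      _ ≤ G := by
        simp only [← Real.rpow_natCast, ← Real.rpow_mul hm0.le, ← Real.rpow_add hm0]
        refine mono ?_
        push_cast; linarith
  have T3 : X ^ 4 * E ^ 4 * w * s ≤ G := by
    calc _ ≤ (m ^ (1 - β)) ^ 4 * (m ^ δ) ^ 4 * (m ^ (κ / 1000 - (2 * δ + 4 * β + κ) / 2)) * s := by gcongr
      _ ≤ G := by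
        rw [hs]
        simp only [← Real.rpow_natCast, ← Real.rpow_mul hm0.le, ← Real.rpow_add hm0]
        refine mono ?_
        push_cast; linarith
  have T4 : X ^ 4 * E ^ 2 * v * s ≤ G := by
    calc _ ≤ (m ^ (1 - β)) ^ 4 * (m ^ δ) ^ 2 * (m ^ ((1 - β) / 4)) * s := by gcongr
      _ ≤ G := by
        rw [hs]
        simp only [← Real.rpow_natCast, ← Real.rpow_mul hm0.le, ← Real.rpow_add hm0]
        refine mono ?_
        push_cast; linarith
  have hG0 : 0 < G := Real.rpow_pos_of_pos hm0 _
  calc _ = 81 * 40960 * Q ^ 17 * (X ^ 4 * (E ^ 4 / V ^ 2 + E ^ 2 / V) * (1 + V * Real.sqrt (V / m))) := by ring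
    _ ≤ 81 * 40960 * Q ^ 17 * (4 * G) := by
        rw [expand]
        refine mul_le_mul_of_nonneg_left (by linarith) (by positivity)
    _ ≤ Q ^ 22 * Q ^ 17 * (Q ^ 2 * G) := by gcongr
    _ ≤ _ := by
        rw [hQ, hG]
        simp only [← Real.rpow_natCast, ← Real.rpow_mul hm0.le, ← Real.rpow_add hm0]
        refine mono ?_
        push_cast; linarith

theorem typeI_num (m Q E X Y β δ κ : ℝ) (hm : 1 ≤ m) (hQ : Q = m ^ (κ / 1000)) (hQ2 : 2 ≤ Q) (hκ : 0 < κ) (hδ : δ = 1 / 8 - 15 * β / 8 - κ)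
    (hδ0 : 0 < δ) (hβ0 : 0 < β) (hβ : β ≤ 1 / 17)
    (hE0 : 0 ≤ E) (hE : E ≤ m ^ δ) (hX0 : 0 ≤ X) (hX : X ≤ m ^ (1 - β)) (hY0 : 0 ≤ Y) (hY : Y ≤ m ^ (2 * δ + 4 * β + κ)) :
    131072 * Q ^ 18 * ((E * Y) ^ 4 * m ^ 2 + X ^ 2 * m * (E * Y) ^ 2) ≤ (m ^ (1 - 2 * β - κ / 5)) ^ 4 := by
  have hm0 : 0 < m := by linarith
  have hQ0 : 0 < Q := by linarith
  have mono : ∀ {a b : ℝ}, a ≤ b → m ^ a ≤ m ^ b := fun h => Real.rpow_le_rpow_of_exponent_le hm h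
  have hc : (131072 : ℝ) ≤ Q ^ 17 := by
    calc (131072 : ℝ) = 2 ^ 17 := by norm_num
      _ ≤ Q ^ 17 := by gcongr
  set G := m ^ (4 - 8 * β - κ) with hG
  have hG0 : 0 < G := Real.rpow_pos_of_pos hm0 _
  have em : m = m ^ (1 : ℝ) := (Real.rpow_one m).symm
  have T1 : (E * Y) ^ 4 * m ^ 2 ≤ G := by
    calc _ ≤ (m ^ δ * m ^ (2 * δ + 4 * β + κ)) ^ 4 * (m ^ (1 : ℝ)) ^ 2 := by rw [← em]; gcongr
      _ ≤ G := by
        simp only [← Real.rpow_natCast, ← Real.rpow_mul hm0.le, ← Real.rpow_add hm0]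
        refine mono ?_
        push_cast; linarith
  have T2 : X ^ 2 * m * (E * Y) ^ 2 ≤ G := by
    calc _ ≤ (m ^ (1 - β)) ^ 2 * m ^ (1 : ℝ) * (m ^ δ * m ^ (2 * δ + 4 * β + κ)) ^ 2 := by rw [← em]; gcongr
      _ ≤ G := by
        simp only [← Real.rpow_natCast, ← Real.rpow_mul hm0.le, ← Real.rpow_add hm0]
        refine mono ?_
        push_cast; linarith
  calc _ ≤ Q ^ 17 * Q ^ 18 * (2 * G) := by
        refine mul_le_mul (by gcongr) (by linarith) (by positivity) (by positivity)
    _ ≤ Q ^ 17 * Q ^ 18 * (Q * G) := by gcongr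
    _ ≤ _ := by
        rw [hQ, hG]
        simp only [← Real.rpow_natCast, ← Real.rpow_mul hm0.le, ← Real.rpow_add hm0]
        refine mono ?_
        push_cast; linarith

theorem total_num (m Q E X Y β δ κ : ℝ) (hm : 1 ≤ m) (hQ : Q = m ^ (κ / 1000)) (hQ2 : 2 ≤ Q) (hκ : 0 < κ) (hδ : δ = 1 / 8 - 15 * β / 8 - κ)
    (hδ0 : 0 < δ) (hβ0 : 0 < β) (hβ : β ≤ 1 / 17)
    (hE0 : 0 ≤ E) (hE : E ≤ m ^ δ) (hX0 : 0 ≤ X) (hX : X ≤ m ^ (1 - β)) (hY0 : 0 ≤ Y) (hY : Y ≤ m ^ (2 * δ + 4 * β + κ)) :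
    8 * Q * (m ^ (1 - 2 * β - κ / 5)) + 16 * Q ^ 2 * (m ^ (1 - 2 * β - κ / 5)) + 16 * Q ^ 4 * X * E / Real.sqrt m +
      4 * E * (2 * Q ^ 2 * Y ^ 3 + 2 * Q * Real.sqrt X) ≤ m ^ (1 - 2 * β - κ / 5 + 11 * (κ / 1000)) := by
  have hm0 : 0 < m := by linarith
  have hQ0 : 0 < Q := by linarith
  have mono : ∀ {a b : ℝ}, a ≤ b → m ^ a ≤ m ^ b := fun h => Real.rpow_le_rpow_of_exponent_le hm h
  have c3 : (8 : ℝ) ≤ Q ^ 3 := by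
    calc (8 : ℝ) = 2 ^ 3 := by norm_num
      _ ≤ Q ^ 3 := by gcongr
  have c4 : (16 : ℝ) ≤ Q ^ 4 := by
    calc (16 : ℝ) = 2 ^ 4 := by norm_num
      _ ≤ Q ^ 4 := by gcongr
  obtain ⟨G, hG⟩ : ∃ G, G = m ^ (1 - 2 * β - κ / 5 + 8 * (κ / 1000)) := ⟨_, rfl⟩
  have hG0 : 0 < G := hG ▸ Real.rpow_pos_of_pos hm0 _
  have T1 : 8 * Q * (m ^ (1 - 2 * β - κ / 5)) ≤ G := by
    calc _ ≤ Q ^ 3 * Q * (m ^ (1 - 2 * β - κ / 5)) := by gcongr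
      _ ≤ G := by
        rw [hG, hQ]
        simp only [← Real.rpow_natCast, ← Real.rpow_mul hm0.le, ← Real.rpow_add hm0]
        refine mono ?_
        push_cast; linarith
  have T2 : 16 * Q ^ 2 * (m ^ (1 - 2 * β - κ / 5)) ≤ G := by
    calc _ ≤ Q ^ 4 * Q ^ 2 * (m ^ (1 - 2 * β - κ / 5)) := by gcongr
      _ ≤ G := by
        rw [hG, hQ]
        simp only [← Real.rpow_natCast, ← Real.rpow_mul hm0.le, ← Real.rpow_add hm0]
        refine mono ?_
        push_cast; linarith
  have T3 : 16 * Q ^ 4 * X * E / Real.sqrt m ≤ G := by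
    have e : 16 * Q ^ 4 * X * E / Real.sqrt m = 16 * Q ^ 4 * X * E * m ^ (-(1/2) : ℝ) := by
      rw [Real.rpow_neg hm0.le, ← Real.sqrt_eq_rpow, div_eq_mul_inv]
    rw [e]
    calc _ ≤ Q ^ 4 * Q ^ 4 * m ^ (1 - β) * m ^ δ * m ^ (-(1/2) : ℝ) := by gcongr
      _ ≤ G := by
        rw [hG, hQ]
        simp only [← Real.rpow_natCast, ← Real.rpow_mul hm0.le, ← Real.rpow_add hm0]
        refine mono ?_
        push_cast; linarith
  have T4 : 8 * E * Q ^ 2 * Y ^ 3 ≤ G := by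
    calc _ ≤ Q ^ 3 * m ^ δ * Q ^ 2 * (m ^ (2 * δ + 4 * β + κ)) ^ 3 := by gcongr
      _ ≤ G := by
        rw [hG, hQ]
        simp only [← Real.rpow_natCast, ← Real.rpow_mul hm0.le, ← Real.rpow_add hm0]
        refine mono ?_
        push_cast; linarith
  have T5 : 8 * E * Q * Real.sqrt X ≤ G := by
    have : Real.sqrt X ≤ m ^ ((1 - β) / 2) := by
      rw [Real.sqrt_le_left (by positivity), ← Real.rpow_natCast, ← Real.rpow_mul hm0.le]
      refine hX.trans (le_of_eq ?_)
      congr 1; push_cast; ring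
    calc _ ≤ Q ^ 3 * m ^ δ * Q * (m ^ ((1 - β) / 2)) := by gcongr
      _ ≤ G := by
        rw [hG, hQ]
        simp only [← Real.rpow_natCast, ← Real.rpow_mul hm0.le, ← Real.rpow_add hm0]
        refine mono ?_
        push_cast; linarith
  calc _ ≤ 8 * G := by linarith
    _ ≤ Q ^ 3 * G := by gcongr
    _ ≤ _ := by
        rw [hG, hQ]
        simp only [← Real.rpow_natCast, ← Real.rpow_mul hm0.le, ← Real.rpow_add hm0]
        refine mono ?_
        push_cast; linarith

theorem LD_B (β δ : ℝ) (hβ0 : 0 < β) (hβ : β ≤ 1 / 17) (hδ0 : 0 < δ) (hδ : δ < 1 / 8 - 15 * β / 8) :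
    LDP (1 - β) δ := by
  obtain ⟨κ, hκ⟩ : ∃ κ, κ = 1 / 8 - 15 * β / 8 - δ := ⟨_, rfl⟩
  have hκ0 : 0 < κ := by linarith
  have hδ' : δ = 1 / 8 - 15 * β / 8 - κ := by linarith
  obtain ⟨M, hM⟩ := good_eventually (κ / 1000) (by positivity)
  refine ⟨κ / 10, by positivity, M, fun m hm inst a ha => ?_⟩
  have hg := hM m hm
  obtain ⟨Q, hQ⟩ : ∃ Q, Q = (m : ℝ) ^ (κ / 1000) := ⟨_, rfl⟩
  rw [← hQ] at hg
  have hQ2 := hg.two_le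
  have hm1 : (1 : ℝ) ≤ m := by exact_mod_cast NeZero.one_le
  have hm0 : (0 : ℝ) < m := by linarith
  have mono : ∀ {a b : ℝ}, a ≤ b → (m : ℝ) ^ a ≤ (m : ℝ) ^ b := fun h => Real.rpow_le_rpow_of_exponent_le hm1 h
  have fl : ∀ u : ℝ, (⌊(m : ℝ) ^ u⌋₊ : ℝ) ≤ (m : ℝ) ^ u := fun u => Nat.floor_le (by positivity)
  have fl1 : ∀ u : ℝ, 0 ≤ u → 1 ≤ ⌊(m : ℝ) ^ u⌋₊ := fun u hu => by
    rw [Nat.le_floor_iff (by positivity)]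
    simpa using Real.one_le_rpow hm1 hu
  have flm : ∀ u : ℝ, u ≤ 1 → ⌊(m : ℝ) ^ u⌋₊ ≤ m := fun u hu => by
    have := (fl u).trans (mono hu)
    rw [Real.rpow_one] at this
    exact_mod_cast this
  set X := ⌊(m : ℝ) ^ (1 - β)⌋₊ with hX
  set D := ⌊(m : ℝ) ^ δ⌋₊ with hD
  obtain ⟨Y, hY⟩ : ∃ Y, Y = ⌊(m : ℝ) ^ (2 * δ + 4 * β + κ)⌋₊ := ⟨_, rfl⟩
  have hYle : (Y : ℝ) ≤ (m : ℝ) ^ (2 * δ + 4 * β + κ) := hY ▸ fl _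
  have hYge : (m : ℝ) ^ (2 * δ + 4 * β + κ) < Y + 1 := hY ▸ Nat.lt_floor_add_one _
  have hB := LD_reduce hg lpr X D (flm _ (by linarith)) ((m : ℝ) ^ (1 - 2 * β - κ / 5 + 11 * (κ / 1000))) (by positivity)
    (by
      intro a ha E H hE hED hH hHm
      have hEle : (E : ℝ) ≤ (m : ℝ) ^ δ := (Nat.cast_le.mpr hED).trans (fl δ)
      have := vaughan_block hg X D Y (flm _ (by linarith)) (fl1 _ (by linarith)) (flm _ (by linarith))
        (by rw [hY]; exact Nat.floor_le_floor (mono (by linarith))) (by rw [hY]; exact fl1 _ (by linarith)) a ha E H hE hED hH hHm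
        ((m : ℝ) ^ (1 - 2 * β - κ / 5)) (by positivity)
        (by
          intro V hV1 hYV hVX
          have hV0 : (0 : ℝ) < V := by exact_mod_cast hV1
          refine typeII_num m Q E X V β δ κ hm1 hQ hQ2 hκ0 hδ' hδ0 hβ0 hβ (by positivity) hEle (by positivity) (fl _) hV0 ?_ ?_
          · have : (Y : ℝ) + 1 ≤ 2 * V := by exact_mod_cast hYV
            have h4 : 4 * (V : ℝ) ≤ Q ^ 2 * V := mul_le_mul_of_nonneg_right (by nlinarith) hV0.le
            linarith
          · have h1 := Nat.mul_le_mul hVX hVX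
            have h2 := h1.trans (Nat.sqrt_le X)
            rw [pow_two]; exact_mod_cast h2)
        (typeI_num m Q E X Y β δ κ hm1 hQ hQ2 hκ0 hδ' hδ0 hβ0 hβ (by positivity) hEle (by positivity) (fl _) (by positivity) hYle)
      exact this.trans (total_num m Q E X Y β δ κ hm1 hQ hQ2 hκ0 hδ' hδ0 hβ0 hβ (by positivity) hEle (by positivity) (fl _) (by positivity) hYle))
    a ha
  refine hB.trans ?_
  calc 8 * Q ^ 2 * (m : ℝ) ^ (1 - 2 * β - κ / 5 + 11 * (κ / 1000)) ≤ Q ^ 3 * Q ^ 2 * (m : ℝ) ^ (1 - 2 * β - κ / 5 + 11 * (κ / 1000)) := by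
        have : (8 : ℝ) ≤ Q ^ 3 := by
          calc (8 : ℝ) = 2 ^ 3 := by norm_num
            _ ≤ Q ^ 3 := by gcongr
        gcongr
    _ ≤ _ := by
        rw [hQ]
        simp only [← Real.rpow_natCast, ← Real.rpow_mul hm0.le, ← Real.rpow_add hm0]
        refine mono ?_
        push_cast; linarith

/-- case A -/
theorem LD_A (α δ : ℝ) (hα : 1 < α) (hα2 : α ≤ 2) (hδ0 : 0 < δ) (hδ1 : δ ≤ 1) (hδ : δ < α - 1 / 2) :
    LDP α δ := by
  obtain ⟨κ, hκ⟩ : ∃ κ, κ = min (α - 1) (α - 1 / 2 - δ) := ⟨_, rfl⟩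
  have hκ0 : 0 < κ := hκ ▸ lt_min (by linarith) (by linarith)
  have hκ1 : κ ≤ α - 1 := hκ ▸ min_le_left _ _
  have hκ2 : κ ≤ α - 1 / 2 - δ := hκ ▸ min_le_right _ _
  obtain ⟨M, hM⟩ := good_eventually (κ / 1000) (by positivity)
  refine ⟨κ / 10, by positivity, M, fun m hm inst a ha => ?_⟩
  have hg := hM m hm
  obtain ⟨Q, hQ⟩ : ∃ Q, Q = (m : ℝ) ^ (κ / 1000) := ⟨_, rfl⟩
  rw [← hQ] at hg
  have hQ2 := hg.two_le
  have hm1 : (1 : ℝ) ≤ m := by exact_mod_cast NeZero.one_le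
  have hm0 : (0 : ℝ) < m := by linarith
  have mono : ∀ {a b : ℝ}, a ≤ b → (m : ℝ) ^ a ≤ (m : ℝ) ^ b := fun h => Real.rpow_le_rpow_of_exponent_le hm1 h
  have fl : ∀ u : ℝ, (⌊(m : ℝ) ^ u⌋₊ : ℝ) ≤ (m : ℝ) ^ u := fun u => Nat.floor_le (by positivity)
  have flm : ∀ u : ℝ, u ≤ 1 → ⌊(m : ℝ) ^ u⌋₊ ≤ m := fun u hu => by
    have := (fl u).trans (mono hu)
    rw [Real.rpow_one] at this
    exact_mod_cast this
  have hmX : m ≤ ⌊(m : ℝ) ^ α⌋₊ := by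
    rw [Nat.le_floor_iff (by positivity)]
    calc (m : ℝ) = (m : ℝ) ^ (1 : ℝ) := (Real.rpow_one _).symm
      _ ≤ _ := mono hα.le
  set X := ⌊(m : ℝ) ^ α⌋₊ with hX
  set D := ⌊(m : ℝ) ^ δ⌋₊ with hD
  have hXle : (X : ℝ) ≤ (m : ℝ) ^ α := fl α
  have hlog : ∀ n ∈ Icc 1 X, |lpr n| ≤ 2 * Q := by
    intro n hn
    have hn' := Finset.mem_Icc.mp hn
    have h1 : Real.log n ≤ 2 * Q := by
      have hn0 : (0 : ℝ) < n := by exact_mod_cast hn'.1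
      calc Real.log n ≤ Real.log ((m : ℝ) ^ α) := Real.log_le_log hn0 ((Nat.cast_le.mpr hn'.2).trans hXle)
        _ = α * Real.log m := Real.log_rpow hm0 _
        _ ≤ 2 * Q := mul_le_mul hα2 hg.log (Real.log_nonneg hm1) (by norm_num)
    unfold lpr
    split_ifs
    · rw [abs_of_nonneg (Real.log_natCast_nonneg n)]; exact h1
    · simp; linarith
  have hB := LD_reduce hg lpr X D (flm _ hδ1) ((m : ℝ) ^ (2 * α - 1 - κ / 2 + 7 * (κ / 1000))) (by positivity)
    (by
      intro a ha E H hE hED hH hHm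
      have hEle : (E : ℝ) ≤ (m : ℝ) ^ δ := (Nat.cast_le.mpr hED).trans (fl δ)
      have := caseA_block hg lpr X D hmX hlog (flm _ hδ1) a ha E H hE hED hH hHm
      refine le_of_pow_le_pow_left₀ (n := 2) (by norm_num) (by positivity) (this.trans ?_)
      obtain ⟨G, hG⟩ : ∃ G, G = (m : ℝ) ^ (2 * α - 2 - κ) := ⟨_, rfl⟩
      have hG0 : 0 < G := hG ▸ Real.rpow_pos_of_pos hm0 _
      have e1 : (X : ℝ) / m ≤ G := by
        calc (X : ℝ) / m ≤ (m : ℝ) ^ α / (m : ℝ) ^ (1 : ℝ) := by rw [Real.rpow_one]; gcongr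
          _ ≤ G := by rw [← Real.rpow_sub hm0, hG]; exact mono (by linarith)
      have e2 : (E : ℝ) ^ 2 / m ≤ G := by
        calc (E : ℝ) ^ 2 / m ≤ ((m : ℝ) ^ δ) ^ 2 / (m : ℝ) ^ (1 : ℝ) := by rw [Real.rpow_one]; gcongr
          _ ≤ G := by
            rw [← Real.rpow_natCast, ← Real.rpow_mul hm0.le, ← Real.rpow_sub hm0, hG]
            refine mono ?_
            push_cast; linarith
      have c5 : (32 : ℝ) ≤ Q ^ 5 := by
        calc (32 : ℝ) = 2 ^ 5 := by norm_num
          _ ≤ Q ^ 5 := by gcongr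
      have c3 : (8 : ℝ) ≤ Q ^ 3 := by
        calc (8 : ℝ) = 2 ^ 3 := by norm_num
          _ ≤ Q ^ 3 := by gcongr
      calc _ ≤ Q ^ 5 * Q ^ 6 * ((m : ℝ) ^ α) ^ 2 * (8 * G) := by
            have : (X : ℝ) / m + 4 * E ^ 2 / m ≤ 8 * G := by
              have : 4 * (E : ℝ) ^ 2 / m = 4 * (E ^ 2 / m) := by ring
              linarith
            gcongr
        _ ≤ Q ^ 5 * Q ^ 6 * ((m : ℝ) ^ α) ^ 2 * (Q ^ 3 * G) := by gcongr
        _ ≤ _ := by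
          rw [hQ, hG]
          simp only [← Real.rpow_natCast, ← Real.rpow_mul hm0.le, ← Real.rpow_add hm0]
          refine mono ?_
          push_cast; linarith)
    a ha
  refine hB.trans ?_
  calc 8 * Q ^ 2 * (m : ℝ) ^ (2 * α - 1 - κ / 2 + 7 * (κ / 1000)) ≤ Q ^ 3 * Q ^ 2 * (m : ℝ) ^ (2 * α - 1 - κ / 2 + 7 * (κ / 1000)) := by
        have : (8 : ℝ) ≤ Q ^ 3 := by
          calc (8 : ℝ) = 2 ^ 3 := by norm_num
            _ ≤ Q ^ 3 := by gcongr
        gcongr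
    _ ≤ _ := by
        rw [hQ]
        simp only [← Real.rpow_natCast, ← Real.rpow_mul hm0.le, ← Real.rpow_add hm0]
        refine mono ?_
        push_cast; linarith

end part14



section part15

theorem lpr_nonneg (n : ℕ) : 0 ≤ lpr n := by
  unfold lpr; split_ifs
  · exact Real.log_natCast_nonneg n
  · exact le_rfl

theorem log_fact_eq (N : ℕ) : Real.log (N.factorial : ℝ) = ∑ p ∈ Icc 1 N, lpr p * (N.factorial.factorization p : ℝ) := by
  rw [Real.log_nat_eq_sum_factorization, Finsupp.sum]
  have hs : N.factorial.factorization.support ⊆ Icc 1 N := by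
    intro p hp
    rw [Nat.support_factorization, Nat.mem_primeFactors] at hp
    exact mem_Icc.mpr ⟨hp.1.one_le, (hp.1.dvd_factorial).mp hp.2.1⟩
  rw [← Finset.sum_subset hs]
  · refine Finset.sum_congr rfl fun p hp => ?_
    rw [Nat.support_factorization, Nat.mem_primeFactors] at hp
    rw [lpr, if_pos hp.1]; ring
  · intro p hp hp2
    rw [Finsupp.notMem_support_iff] at hp2
    rw [hp2]; simp

noncomputable def MA (N : ℕ) : ℝ := ∑ p ∈ Icc 1 N, lpr p / p
noncomputable def MB (N : ℕ) : ℝ := ∑ p ∈ Icc 1 N, lpr p / ((p : ℝ) - 1)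

theorem MA_upper (N : ℕ) (hN : 1 ≤ N) : MA N ≤ Real.log N + 2 := by
  have hN0 : (0 : ℝ) < N := by exact_mod_cast hN
  have h1 : Real.log (N.factorial : ℝ) ≤ N * Real.log N := by
    rw [← Real.log_pow]
    exact Real.log_le_log (by exact_mod_cast N.factorial_pos) (by exact_mod_cast Nat.factorial_le_pow N)
  have h2 : ∑ p ∈ Icc 1 N, lpr p ≤ Real.log 4 * N := by
    have := Chebyshev.theta_le_log4_mul_x hN0.le
    rw [Chebyshev.theta_eq_sum_Icc, Nat.floor_natCast] at this
    refine le_trans (le_of_eq ?_) this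
    rw [Finset.sum_filter]
    refine Finset.sum_subset_zero_on_sdiff (fun x hx => ?_) ?_ ?_
    · simp at hx ⊢; omega
    · intro x hx
      have : x = 0 := by simp at hx; omega
      subst this; simp
    · intro x hx; rfl
  have h3 : ∑ p ∈ Icc 1 N, lpr p * ((N : ℝ) / p - 1) ≤ Real.log (N.factorial : ℝ) := by
    rw [log_fact_eq]
    refine Finset.sum_le_sum fun p hp => ?_
    by_cases hpp : p.Prime
    · refine mul_le_mul_of_nonneg_left ?_ (lpr_nonneg p)
      have hp0 : 0 < p := hpp.pos
      have : N / p ≤ N.factorial.factorization p := by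
        rw [Nat.factorization_factorial hpp (b := Nat.log p N + 2) (by omega)]
        have : (1:ℕ) ∈ Ico 1 (Nat.log p N + 2) := by simp
        have := Finset.single_le_sum (f := fun i => N / p ^ i) (fun i _ => Nat.zero_le _) this
        simpa using this
      have h4 : (N : ℝ) / p < ((N / p : ℕ) : ℝ) + 1 := by
        rw [← Nat.floor_div_eq_div (K := ℝ)]
        exact Nat.lt_floor_add_one _
      have : ((N / p : ℕ) : ℝ) ≤ N.factorial.factorization p := by exact_mod_cast this
      linarith
    · simp [lpr, hpp]
  have h4 : ∑ p ∈ Icc 1 N, lpr p * ((N : ℝ) / p - 1) = N * MA N - ∑ p ∈ Icc 1 N, lpr p := by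
    rw [MA, Finset.mul_sum, ← Finset.sum_sub_distrib]
    refine Finset.sum_congr rfl fun p hp => by ring
  have h5 : Real.log 4 ≤ 2 := by
    have : (4:ℝ) = 2 ^ 2 := by norm_num
    rw [this, Real.log_pow]
    have := Real.log_two_lt_d9
    push_cast; linarith
  have h6 : N * MA N ≤ N * (Real.log N + 2) := by nlinarith
  exact le_of_mul_le_mul_left h6 hN0

theorem MB_lower (N : ℕ) (hN : 1 ≤ N) : Real.log N - 1 ≤ MB N := by
  have hN0 : (0 : ℝ) < N := by exact_mod_cast hN
  have h1 : N * Real.log N - N ≤ Real.log (N.factorial : ℝ) := by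
    have := Stirling.le_log_factorial_stirling (n := N) (by omega)
    have h2 : 0 ≤ Real.log N := Real.log_natCast_nonneg N
    have h3 : 0 ≤ Real.log (2 * Real.pi) := Real.log_nonneg (by have := Real.pi_gt_three; linarith)
    linarith
  have h3 : Real.log (N.factorial : ℝ) ≤ N * MB N := by
    rw [log_fact_eq, MB, Finset.mul_sum]
    refine Finset.sum_le_sum fun p hp => ?_
    by_cases hpp : p.Prime
    · have h := Nat.factorization_factorial_le_div_pred hpp N
      have hp2 := hpp.two_le
      have hp1 : (0:ℝ) < (p:ℝ) - 1 := by
        have : (2:ℝ) ≤ p := by exact_mod_cast hp2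
        linarith
      have h5 : (N.factorial.factorization p : ℝ) ≤ N / ((p:ℝ) - 1) := by
        calc (N.factorial.factorization p : ℝ) ≤ ((N / (p - 1) : ℕ) : ℝ) := by exact_mod_cast h
          _ ≤ (N : ℝ) / ((p - 1 : ℕ) : ℝ) := Nat.cast_div_le
          _ = _ := by rw [Nat.cast_sub hpp.one_le]; simp
      calc _ ≤ lpr p * (N / ((p:ℝ) - 1)) := mul_le_mul_of_nonneg_left h5 (lpr_nonneg p)
        _ = _ := by ring
    · simp [lpr, hpp]
  have h6 : N * (Real.log N - 1) ≤ N * MB N := by linarith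
  exact le_of_mul_le_mul_left h6 hN0

theorem MB_sub_MA (N : ℕ) (hN : 1 ≤ N) : MB N ≤ MA N + 2 - (Real.log N + 2) / N := by
  induction N, hN using Nat.le_induction with
  | base => simp [MA, MB, lpr, Nat.not_prime_one]
  | succ n hn ih =>
    have hn1 : (1:ℝ) ≤ n := by exact_mod_cast hn
    have e1 : MB (n+1) = MB n + lpr (n+1) / n := by
      rw [MB, Finset.sum_Icc_succ_top (by omega), ← MB]; push_cast; simp
    have e2 : MA (n+1) = MA n + lpr (n+1) / (n+1) := by
      rw [MA, Finset.sum_Icc_succ_top (by omega), ← MA]; push_cast; simp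
    have h1 : lpr (n+1) ≤ Real.log (n+1) := by
      unfold lpr; split_ifs
      · push_cast; rfl
      · exact Real.log_nonneg (by linarith)
    have h2 : Real.log (n+1) - Real.log n ≤ 1 / n := by
      rw [← Real.log_div (by linarith) (by linarith)]
      refine (Real.log_le_sub_one_of_pos (by positivity)).trans (le_of_eq ?_)
      field_simp; ring
    have h3 : lpr (n+1) / n - lpr (n+1) / (n+1) ≤ (Real.log n + 2) / n - (Real.log (n+1) + 2) / (n+1) := by
      have : lpr (n+1) / n - lpr (n+1) / (n+1) = lpr (n+1) / (n * (n+1)) := by field_simp; ring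
      rw [this]
      have : (Real.log n + 2) / n - (Real.log (n+1) + 2) / (n+1) = ((n+1) * (Real.log n + 2) - n * (Real.log (n+1) + 2)) / (n * (n+1)) := by field_simp
      rw [this]
      refine div_le_div_of_nonneg_right ?_ (by positivity)
      have h4 : (n + 1 : ℝ) * (Real.log (n+1) - Real.log n) ≤ (n+1) * (1 / n) := mul_le_mul_of_nonneg_left h2 (by positivity)
      have h5 : (n+1 : ℝ) * (1 / n) ≤ 2 := by
        rw [mul_one_div, div_le_iff₀ (by linarith)]; linarith
      linarith
    push_cast
    rw [e1, e2]; linarith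

theorem MA_lower (N : ℕ) (hN : 1 ≤ N) : Real.log N - 3 ≤ MA N := by
  have h1 := MB_lower N hN
  have h2 := MB_sub_MA N hN
  have h3 : 0 ≤ (Real.log N + 2) / N := by
    have := Real.log_natCast_nonneg N
    positivity
  linarith

theorem MB_upper (N : ℕ) (hN : 1 ≤ N) : MB N ≤ Real.log N + 4 := by
  have h1 := MA_upper N hN
  have h2 := MB_sub_MA N hN
  have h3 : 0 ≤ (Real.log N + 2) / N := by
    have := Real.log_natCast_nonneg N
    positivity
  linarith

/-- M1 -/
theorem mert1 (N : ℕ) (hN : 1 ≤ N) : ∑ q ∈ Icc 1 N, lpr q / q * Real.log q ≤ Real.log N ^ 2 / 2 + 6 * Real.log N := by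
  have key : Real.log N ^ 2 / 2 - 4 * Real.log N ≤ MA N * Real.log N - ∑ q ∈ Icc 1 N, lpr q / q * Real.log q := by
    induction N, hN using Nat.le_induction with
    | base => simp
    | succ n hn ih =>
      have hn1 : (1:ℝ) ≤ n := by exact_mod_cast hn
      have e2 : MA (n+1) = MA n + lpr (n+1) / (n+1) := by
        rw [MA, Finset.sum_Icc_succ_top (by omega), ← MA]; push_cast; simp
      rw [Finset.sum_Icc_succ_top (by omega), e2]
      push_cast
      have h1 := MA_lower n hn
      have h2 : Real.log (n+1) - Real.log n ≤ 1 := by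
        rw [← Real.log_div (by linarith) (by linarith)]
        refine (Real.log_le_sub_one_of_pos (by positivity)).trans ?_
        rw [sub_le_iff_le_add, div_le_iff₀ (by linarith)]; linarith
      have h3 : 0 ≤ Real.log (n+1) - Real.log n := by
        rw [sub_nonneg]; exact Real.log_le_log (by linarith) (by linarith)
      set a := Real.log n
      set b := Real.log ((n:ℝ)+1)
      have h4 : (a - 3) * (b - a) ≤ MA n * (b - a) := mul_le_mul_of_nonneg_right h1 h3
      nlinarith
  have h1 := MA_upper N hN
  have h2 : 0 ≤ Real.log N := Real.log_natCast_nonneg N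
  nlinarith

/-- M4b -/
theorem mert4 (N : ℕ) (hN : 1 ≤ N) (x : ℝ) (hx : (N:ℝ) ≤ x) :
    ∑ p ∈ Icc 1 N, lpr p / ((p:ℝ) - 1) * Real.log (x / p) ≤ Real.log x ^ 2 / 2 + 4 * Real.log x := by
  have hN0 : (0 : ℝ) < N := by exact_mod_cast hN
  have key : MB N * Real.log N - ∑ p ∈ Icc 1 N, lpr p / ((p:ℝ) - 1) * Real.log p ≤ Real.log N ^ 2 / 2 + 4 * Real.log N := by
    clear hx
    induction N, hN using Nat.le_induction with
    | base => simp
    | succ n hn ih =>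
      have hn1 : (1:ℝ) ≤ n := by exact_mod_cast hn
      have ih := ih (by linarith)
      have e1 : MB (n+1) = MB n + lpr (n+1) / n := by
        rw [MB, Finset.sum_Icc_succ_top (by omega), ← MB]; push_cast; simp
      rw [Finset.sum_Icc_succ_top (by omega), e1]
      push_cast
      simp only [add_sub_cancel_right]
      have h1 := MB_upper n hn
      have h3 : 0 ≤ Real.log (n+1) - Real.log n := by
        rw [sub_nonneg]; exact Real.log_le_log (by linarith) (by linarith)
      set a := Real.log n
      set b := Real.log ((n:ℝ)+1)
      have h4 : MB n * (b - a) ≤ (a + 4) * (b - a) := mul_le_mul_of_nonneg_right h1 h3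
      nlinarith
  have h0 : ∑ p ∈ Icc 1 N, lpr p / ((p:ℝ) - 1) * Real.log (x / p) = MB N * Real.log x - ∑ p ∈ Icc 1 N, lpr p / ((p:ℝ) - 1) * Real.log p := by
    rw [MB, Finset.sum_mul, ← Finset.sum_sub_distrib]
    refine Finset.sum_congr rfl fun p hp => ?_
    have : (p:ℝ) ≠ 0 := by
      have := (mem_Icc.mp hp).1
      positivity
    rw [Real.log_div (by linarith) this]; ring
  have h1 := MB_upper N hN
  have h3 : 0 ≤ Real.log x - Real.log N := by
    rw [sub_nonneg]; exact Real.log_le_log (by linarith) (by linarith)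
  rw [h0]
  have h4 : MB N * (Real.log x - Real.log N) ≤ (Real.log N + 4) * (Real.log x - Real.log N) := mul_le_mul_of_nonneg_right h1 h3
  nlinarith

/-- M2 -/
theorem mert2 (u N : ℕ) (hu : 2 ≤ u) (hN : u ≤ N) :
    ∑ q ∈ Ioc u N, lpr q / q * (1 / Real.log q - 1 / Real.log N) ≤
      Real.log (Real.log N / Real.log u) - 1 + Real.log u / Real.log N + 5 / Real.log u := by
  have hlu : 0 < Real.log u := Real.log_pos (by exact_mod_cast hu)
  have hMA : ∀ n, u ≤ n → ∑ q ∈ Ioc u n, lpr q / q = MA n - MA u := by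
    intro n hn
    have : Icc 1 n = Icc 1 u ∪ Ioc u n := by ext x; simp; omega
    rw [MA, MA, this, Finset.sum_union]
    · ring
    · rw [Finset.disjoint_left]; intro x hx; simp at hx ⊢; omega
  have key : ∑ q ∈ Ioc u N, lpr q / q * (1 / Real.log q) - (MA N - MA u) / Real.log N ≤
      Real.log (Real.log N) - Real.log (Real.log u) - Real.log u * (1 / Real.log u - 1 / Real.log N) + 5 * (1 / Real.log u - 1 / Real.log N) := by
    induction N, hN using Nat.le_induction with
    | base => simp
    | succ n hn ih =>
      have hn1 : (2:ℝ) ≤ n := by exact_mod_cast hu.trans hn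
      have e2 : MA (n+1) = MA n + lpr (n+1) / (n+1) := by
        rw [MA, Finset.sum_Icc_succ_top (by omega), ← MA]; push_cast; simp
      rw [Finset.sum_Ioc_succ_top (by omega), e2]
      push_cast
      have h1 := MA_upper n (by omega)
      have h1' := MA_lower u (by omega)
      have ha : 0 < Real.log n := Real.log_pos (by linarith)
      have hab : Real.log n ≤ Real.log (n+1) := Real.log_le_log (by linarith) (by linarith)
      set a := Real.log n
      set b := Real.log ((n:ℝ)+1)
      have hb : 0 < b := by linarith
      have h3 : 0 ≤ 1 / a - 1 / b := by
        rw [sub_nonneg]; exact one_div_le_one_div_of_le ha hab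
      have h4 : (MA n - MA u) * (1 / a - 1 / b) ≤ (a - Real.log u + 5) * (1 / a - 1 / b) := mul_le_mul_of_nonneg_right (by linarith) h3
      have h5 : a * (1 / a - 1 / b) ≤ Real.log b - Real.log a := by
        rw [← Real.log_div hb.ne' ha.ne']
        have h7 := Real.one_sub_inv_le_log_of_pos (x := b / a) (by positivity)
        refine le_trans (le_of_eq ?_) h7
        rw [inv_div]; field_simp
      have h8 : lpr (n+1) / (n+1) * (1 / b) - (MA n + lpr (n+1) / (n+1) - MA u) / b = - (MA n - MA u) / b := by ring
      have h9 : (MA n - MA u) * (1 / a - 1 / b) = (MA n - MA u) / a - (MA n - MA u) / b := by ring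
      have h10 : (a - Real.log u + 5) * (1 / a - 1 / b) = a * (1 / a - 1 / b) - Real.log u * (1 / a - 1 / b) + 5 * (1 / a - 1 / b) := by ring
      have h11 : - (MA n - MA u) / b = - ((MA n - MA u) / b) := by ring
      linarith
  have hlN : 0 < Real.log N := hlu.trans_le (Real.log_le_log (by positivity) (by exact_mod_cast hN))
  have e : ∑ q ∈ Ioc u N, lpr q / q * (1 / Real.log q - 1 / Real.log N) = ∑ q ∈ Ioc u N, lpr q / q * (1 / Real.log q) - (MA N - MA u) / Real.log N := by
    rw [← hMA N hN, Finset.sum_div, ← Finset.sum_sub_distrib]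
    refine Finset.sum_congr rfl fun p hp => by ring
  rw [e, Real.log_div hlN.ne' hlu.ne']
  have h1 : Real.log u * (1 / Real.log u - 1 / Real.log N) = 1 - Real.log u / Real.log N := by field_simp
  have h2 : 0 < 1 / Real.log N := by positivity
  have h3 : 5 / Real.log u = 5 * (1 / Real.log u) := by ring
  linarith

end part15



section part16

def KS (m R : ℕ) : Finset ℕ := (Icc 1 R).filter (fun k => Squarefree k ∧ k.Coprime m)

theorem KS_pos {m R k : ℕ} (h : k ∈ KS m R) : 1 ≤ k := (mem_Icc.mp (mem_filter.mp h).1).1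
theorem KS_le {m R k : ℕ} (h : k ∈ KS m R) : k ≤ R := (mem_Icc.mp (mem_filter.mp h).1).2
theorem KS_sq {m R k : ℕ} (h : k ∈ KS m R) : Squarefree k := (mem_filter.mp h).2.1
theorem KS_cop {m R k : ℕ} (h : k ∈ KS m R) : k.Coprime m := (mem_filter.mp h).2.2
theorem KS_mk {m R k : ℕ} (h1 : 1 ≤ k) (h2 : k ≤ R) (h3 : Squarefree k) (h4 : k.Coprime m) : k ∈ KS m R :=
  mem_filter.mpr ⟨mem_Icc.mpr ⟨h1, h2⟩, h3, h4⟩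
theorem KS_dvd {m R k d : ℕ} (h : k ∈ KS m R) (hd : d ∣ k) : d ∈ KS m R :=
  KS_mk (Nat.pos_of_dvd_of_pos hd (KS_pos h)) ((Nat.le_of_dvd (KS_pos h) hd).trans (KS_le h))
    ((KS_sq h).squarefree_of_dvd hd) ((KS_cop h).coprime_dvd_left hd)

noncomputable def muR (n : ℕ) : ℝ := ((ArithmeticFunction.moebius n : ℤ) : ℝ)
noncomputable def hh (n : ℕ) : ℝ := 1 / (n.totient : ℝ)

noncomputable def xx (m R k : ℕ) : ℝ := if k ∈ KS m R then muR k * hh k * Real.log ((R : ℝ) / k) else 0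

noncomputable def lam (m R d : ℕ) : ℝ := d * ∑ k ∈ (KS m R).filter (fun k => d ∣ k), muR (k / d) * xx m R k

theorem sum_muR (n : ℕ) (hn : n ≠ 0) : ∑ e ∈ n.divisors, muR (n / e) = if n = 1 then 1 else 0 := by
  have h1 : ∑ e ∈ n.divisors, muR (n / e) = ∑ e ∈ n.divisors, muR e := Nat.sum_div_divisors n muR
  rw [h1]
  have h2 : ((ArithmeticFunction.zeta : ArithmeticFunction ℤ) * ArithmeticFunction.moebius) n = (1 : ArithmeticFunction ℤ) n := by
    rw [ArithmeticFunction.coe_zeta_mul_moebius]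
  rw [ArithmeticFunction.coe_zeta_mul_apply, ArithmeticFunction.one_apply] at h2
  simp only [muR]
  rw [← Int.cast_sum, h2]
  split_ifs <;> simp

theorem lam_inv (m R k0 : ℕ) (hk0 : 1 ≤ k0) :
    ∑ d ∈ (KS m R).filter (fun d => k0 ∣ d), lam m R d / d = xx m R k0 := by
  have h1 : ∀ d ∈ (KS m R).filter (fun d => k0 ∣ d), lam m R d / d =
      ∑ k ∈ KS m R, if d ∣ k then muR (k / d) * xx m R k else 0 := by
    intro d hd
    have hd0 : (d : ℝ) ≠ 0 := by
      have := KS_pos (mem_filter.mp hd).1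
      positivity
    rw [lam, mul_div_cancel_left₀ _ hd0, Finset.sum_filter]
  rw [Finset.sum_congr rfl h1, Finset.sum_comm]
  have h2 : ∀ k ∈ KS m R, (∑ d ∈ (KS m R).filter (fun d => k0 ∣ d), if d ∣ k then muR (k / d) * xx m R k else 0) =
      if k = k0 then xx m R k else 0 := by
    intro k hk
    rw [← Finset.sum_filter, Finset.filter_filter, ← Finset.sum_mul]
    by_cases hkk : k0 ∣ k
    · obtain ⟨n, rfl⟩ := hkk
      have hn : n ≠ 0 := by rintro rfl; have := KS_pos hk; simp at this
      have h3 : ∑ d ∈ (KS m R).filter (fun d => k0 ∣ d ∧ d ∣ k0 * n), muR (k0 * n / d) = ∑ e ∈ n.divisors, muR (n / e) := by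
        symm
        refine Finset.sum_bij (fun e _ => k0 * e) ?_ ?_ ?_ ?_
        · intro e he
          have hd : k0 * e ∣ k0 * n := Nat.mul_dvd_mul_left k0 (Nat.dvd_of_mem_divisors he)
          exact mem_filter.mpr ⟨KS_dvd hk hd, Dvd.intro _ rfl, hd⟩
        · intro e1 _ e2 _ h; exact Nat.eq_of_mul_eq_mul_left hk0 h
        · intro d hd
          obtain ⟨hd1, ⟨e, rfl⟩, hd3⟩ := mem_filter.mp hd
          exact ⟨e, Nat.mem_divisors.mpr ⟨Nat.dvd_of_mul_dvd_mul_left hk0 hd3, hn⟩, rfl⟩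
        · intro e he
          rw [Nat.mul_div_mul_left _ _ hk0]
      rw [h3, sum_muR n hn]
      by_cases hn1 : n = 1
      · simp [hn1]
      · have : k0 * n ≠ k0 := by
          intro h
          have : n = 1 := Nat.eq_of_mul_eq_mul_left hk0 (by omega)
          exact hn1 this
        simp [hn1, this]
    · have hne : k ≠ k0 := by rintro rfl; exact hkk dvd_rfl
      rw [if_neg hne]
      have : (KS m R).filter (fun d => k0 ∣ d ∧ d ∣ k) = ∅ := by
        rw [Finset.filter_eq_empty_iff]
        rintro d _ ⟨h1, h2⟩
        exact hkk (h1.trans h2)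
      rw [this]; simp
  rw [Finset.sum_congr rfl h2, Finset.sum_ite_eq']
  split_ifs with h
  · rfl
  · rw [xx, if_neg h]

theorem sqf_cop {d q : ℕ} (hd : Squarefree d) (hq : Squarefree q) : (d / d.gcd q).Coprime q := by
  have hd0 : d ≠ 0 := hd.ne_zero
  have hg : 0 < d.gcd q := Nat.gcd_pos_of_pos_left _ (Nat.pos_of_ne_zero hd0)
  have h1 : d = d.gcd q * (d / d.gcd q) := (Nat.mul_div_cancel' (Nat.gcd_dvd_left d q)).symm
  have h2 : (d.gcd q).Coprime (d / d.gcd q) := by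
    apply Nat.coprime_of_squarefree_mul
    rw [← h1]; exact hd
  have h3 : (d / d.gcd q).Coprime (q / d.gcd q) := Nat.Coprime.symm ((Nat.coprime_div_gcd_div_gcd hg).symm)
  have h4 : q = d.gcd q * (q / d.gcd q) := (Nat.mul_div_cancel' (Nat.gcd_dvd_right d q)).symm
  rw [h4]
  have h5 := Nat.Coprime.mul_right h2.symm h3
  rw [← h4]
  rw [← h4] at h5
  exact h5

theorem lcm_formula {m R d1 d2 q : ℕ} (h1 : d1 ∈ KS m R) (h2 : d2 ∈ KS m R) (hq : Squarefree q) :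
    (1 : ℝ) / (((d1.lcm d2).lcm q : ℕ) : ℝ) = 1 / q * (((d1.gcd q : ℕ) : ℝ) / d1) * (((d2.gcd q : ℕ) : ℝ) / d2) *
      ∑ k ∈ (KS m R).filter (fun k => k.Coprime q), if k ∣ d1 ∧ k ∣ d2 then (k.totient : ℝ) else 0 := by
  obtain ⟨a1, ha1⟩ : ∃ a, a = d1.gcd q := ⟨_, rfl⟩
  obtain ⟨a2, ha2⟩ : ∃ a, a = d2.gcd q := ⟨_, rfl⟩
  obtain ⟨b1, hb1⟩ : ∃ b, b = d1 / d1.gcd q := ⟨_, rfl⟩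
  obtain ⟨b2, hb2⟩ : ∃ b, b = d2 / d2.gcd q := ⟨_, rfl⟩
  have e1 : d1 = a1 * b1 := by rw [ha1, hb1]; exact (Nat.mul_div_cancel' (Nat.gcd_dvd_left d1 q)).symm
  have e2 : d2 = a2 * b2 := by rw [ha2, hb2]; exact (Nat.mul_div_cancel' (Nat.gcd_dvd_left d2 q)).symm
  have c1 : b1.Coprime q := by rw [hb1]; exact sqf_cop (KS_sq h1) hq
  have c2 : b2.Coprime q := by rw [hb2]; exact sqf_cop (KS_sq h2) hq
  have f1 : a1 ∣ q := by rw [ha1]; exact Nat.gcd_dvd_right d1 q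
  have f2 : a2 ∣ q := by rw [ha2]; exact Nat.gcd_dvd_right d2 q
  have hq0 : 0 < q := Nat.pos_of_ne_zero hq.ne_zero
  have hd1 := KS_pos h1
  have hd2 := KS_pos h2
  have pb1 : 0 < b1 := by rcases Nat.eq_zero_or_pos b1 with h | h; · rw [h] at e1; omega
                          · exact h
  have pb2 : 0 < b2 := by rcases Nat.eq_zero_or_pos b2 with h | h; · rw [h] at e2; omega
                          · exact h
  have pa1 : 0 < a1 := Nat.pos_of_dvd_of_pos f1 hq0
  have pa2 : 0 < a2 := Nat.pos_of_dvd_of_pos f2 hq0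
  have hl : (d1.lcm d2).lcm q = q * b1.lcm b2 := by
    apply Nat.dvd_antisymm
    · refine Nat.lcm_dvd (Nat.lcm_dvd ?_ ?_) (Dvd.intro _ rfl)
      · rw [e1]; exact Nat.mul_dvd_mul f1 (Nat.dvd_lcm_left _ _)
      · rw [e2]; exact Nat.mul_dvd_mul f2 (Nat.dvd_lcm_right _ _)
    · refine Nat.Coprime.mul_dvd_of_dvd_of_dvd ?_ (Nat.dvd_lcm_right _ _) ?_
      · have : (b1 * b2).Coprime q := Nat.Coprime.mul_left c1 c2
        exact (this.coprime_dvd_left (Nat.lcm_dvd_mul b1 b2)).symm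
      · refine (Nat.lcm_dvd ?_ ?_).trans (Nat.dvd_lcm_left _ _)
        · refine Dvd.dvd.trans ?_ (Nat.dvd_lcm_left d1 d2)
          rw [e1]; exact Dvd.intro_left _ rfl
        · refine Dvd.dvd.trans ?_ (Nat.dvd_lcm_right d1 d2)
          rw [e2]; exact Dvd.intro_left _ rfl
  have hs : (∑ k ∈ (KS m R).filter (fun k => k.Coprime q), if k ∣ d1 ∧ k ∣ d2 then (k.totient : ℝ) else 0) = ((b1.gcd b2 : ℕ) : ℝ) := by
    rw [← Finset.sum_filter, ← Nat.sum_totient (b1.gcd b2)]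
    push_cast
    refine Finset.sum_congr ?_ fun _ _ => rfl
    ext k
    simp only [mem_filter, Nat.mem_divisors]
    constructor
    · rintro ⟨⟨_, hc⟩, hk1, hk2⟩
      refine ⟨Nat.dvd_gcd ?_ ?_, (Nat.gcd_pos_of_pos_left _ pb1).ne'⟩
      · rw [e1] at hk1; exact (hc.coprime_dvd_right f1).dvd_of_dvd_mul_left hk1
      · rw [e2] at hk2; exact (hc.coprime_dvd_right f2).dvd_of_dvd_mul_left hk2
    · rintro ⟨hk, _⟩
      have g1 : k ∣ b1 := hk.trans (Nat.gcd_dvd_left _ _)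
      have g2 : k ∣ b2 := hk.trans (Nat.gcd_dvd_right _ _)
      have g3 : k ∣ d1 := by rw [e1]; exact g1.mul_left _
      have g4 : k ∣ d2 := by rw [e2]; exact g2.mul_left _
      exact ⟨⟨KS_dvd h1 g3, c1.coprime_dvd_left g1⟩, g3, g4⟩
  rw [hs, hl, ← ha1, ← ha2]
  have hgl : ((b1.gcd b2 : ℕ) : ℝ) * ((b1.lcm b2 : ℕ) : ℝ) = b1 * b2 := by exact_mod_cast Nat.gcd_mul_lcm b1 b2
  have pl : (0:ℝ) < ((b1.lcm b2 : ℕ) : ℝ) := by exact_mod_cast Nat.lcm_pos pb1 pb2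
  have i1 : ((a1 : ℕ) : ℝ) / d1 = 1 / b1 := by rw [e1]; push_cast; field_simp
  have i2 : ((a2 : ℕ) : ℝ) / d2 = 1 / b2 := by rw [e2]; push_cast; field_simp
  rw [i1, i2]
  push_cast
  have hgl' : ((b1.gcd b2 : ℕ) : ℝ) = b1 * b2 / ((b1.lcm b2 : ℕ) : ℝ) := by rw [eq_div_iff pl.ne']; exact hgl
  rw [hgl']
  field_simp

noncomputable def TQ (m R q : ℕ) : ℝ := ∑ d1 ∈ KS m R, ∑ d2 ∈ KS m R, lam m R d1 * lam m R d2 / (((d1.lcm d2).lcm q : ℕ) : ℝ)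

theorem TQ_eq (m R q : ℕ) (hq : Squarefree q) : TQ m R q = 1 / q * ∑ k ∈ (KS m R).filter (fun k => k.Coprime q),
    (k.totient : ℝ) * (∑ d ∈ (KS m R).filter (fun d => k ∣ d), lam m R d / d * ((d.gcd q : ℕ) : ℝ)) ^ 2 := by
  have h1 : TQ m R q = ∑ d1 ∈ KS m R, ∑ d2 ∈ KS m R, ∑ k ∈ (KS m R).filter (fun k => k.Coprime q),
      1 / q * ((k.totient : ℝ) * ((if k ∣ d1 then lam m R d1 / d1 * ((d1.gcd q : ℕ) : ℝ) else 0) *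
        (if k ∣ d2 then lam m R d2 / d2 * ((d2.gcd q : ℕ) : ℝ) else 0))) := by
    refine Finset.sum_congr rfl fun d1 h1 => Finset.sum_congr rfl fun d2 h2 => ?_
    rw [div_eq_mul_one_div, lcm_formula h1 h2 hq, Finset.mul_sum, Finset.mul_sum]
    refine Finset.sum_congr rfl fun k hk => ?_
    by_cases ha : k ∣ d1 <;> by_cases hb : k ∣ d2 <;> simp [ha, hb]
    ring
  rw [h1, sum_comm3, Finset.mul_sum]
  refine Finset.sum_congr rfl fun k hk => ?_
  rw [sq, Finset.sum_filter, Finset.sum_mul_sum, Finset.mul_sum, Finset.mul_sum]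
  refine Finset.sum_congr rfl fun d1 h1 => ?_
  rw [Finset.mul_sum, Finset.mul_sum]

end part16



section part17

theorem hh_nonneg (n : ℕ) : 0 ≤ hh n := by unfold hh; positivity

theorem tot_hh {n : ℕ} (hn : 1 ≤ n) : (n.totient : ℝ) * hh n = 1 := by
  have : (0:ℝ) < n.totient := by exact_mod_cast Nat.totient_pos.mpr hn
  unfold hh; field_simp

theorem muR_sq {n : ℕ} (h : Squarefree n) : muR n ^ 2 = 1 := by
  unfold muR
  have := ArithmeticFunction.moebius_sq_eq_one_of_squarefree h
  exact_mod_cast this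

noncomputable def UU (m R i : ℕ) : ℝ := ∑ k ∈ KS m R, hh k * Real.log ((R : ℝ) / k) ^ i

theorem logRk_nonneg {m R k : ℕ} (hk : k ∈ KS m R) : 0 ≤ Real.log ((R : ℝ) / k) := by
  have h1 : (1:ℝ) ≤ k := by exact_mod_cast KS_pos hk
  have h2 : (k:ℝ) ≤ R := by exact_mod_cast KS_le hk
  exact Real.log_nonneg (by rw [le_div_iff₀ (by linarith)]; linarith)

theorem UU_nonneg (m R i : ℕ) : 0 ≤ UU m R i :=
  Finset.sum_nonneg fun k hk => mul_nonneg (hh_nonneg k) (pow_nonneg (logRk_nonneg hk) i)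

theorem TQ_one (m R : ℕ) : TQ m R 1 = UU m R 2 := by
  rw [TQ_eq m R 1 squarefree_one, UU]
  simp only [Nat.cast_one, Nat.gcd_one_right, mul_one, div_one, one_mul]
  rw [Finset.filter_true_of_mem (fun k _ => Nat.coprime_one_right k)]
  refine Finset.sum_congr rfl fun k hk => ?_
  rw [lam_inv m R k (KS_pos hk), xx, if_pos hk]
  have h1 := tot_hh (KS_pos hk)
  have h2 := muR_sq (KS_sq hk)
  calc (k.totient : ℝ) * (muR k * hh k * Real.log (R / k)) ^ 2 = ((k.totient : ℝ) * hh k) * (muR k ^ 2) * (hh k * Real.log (R/k) ^ 2) := by ring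
    _ = _ := by rw [h1, h2]; ring

theorem TQ_inner (m R q k : ℕ) (hq : q.Prime) (hqm : q.Coprime m) (hk : k ∈ KS m R) (hkq : k.Coprime q) :
    (∑ d ∈ (KS m R).filter (fun d => k ∣ d), lam m R d / d * ((d.gcd q : ℕ) : ℝ)) =
      muR k * hh k * (Real.log ((R:ℝ) / k) - if k * q ≤ R then Real.log ((R:ℝ) / (k * q : ℕ)) else 0) := by
  have h1 : ∀ d ∈ (KS m R).filter (fun d => k ∣ d), lam m R d / d * ((d.gcd q : ℕ) : ℝ) =
      lam m R d / d + ((q:ℝ) - 1) * (if q ∣ d then lam m R d / d else 0) := by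
    intro d hd
    by_cases h : q ∣ d
    · rw [Nat.gcd_eq_right h, if_pos h]; ring
    · rw [Nat.Coprime.gcd_eq_one (((Nat.Prime.coprime_iff_not_dvd hq).mpr h).symm), if_neg h]; simp
  rw [Finset.sum_congr rfl h1, Finset.sum_add_distrib, ← Finset.mul_sum, ← Finset.sum_filter, Finset.filter_filter,
    lam_inv m R k (KS_pos hk)]
  have h2 : (KS m R).filter (fun d => k ∣ d ∧ q ∣ d) = (KS m R).filter (fun d => k * q ∣ d) := by
    refine Finset.filter_congr fun d _ => ⟨fun h => hkq.mul_dvd_of_dvd_of_dvd h.1 h.2, fun h => ⟨(Dvd.intro _ rfl).trans h, (Dvd.intro_left _ rfl).trans h⟩⟩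
  have hkq1 : 1 ≤ k * q := Nat.mul_pos (KS_pos hk) hq.pos
  rw [h2, lam_inv m R (k * q) hkq1, xx, if_pos hk, xx]
  by_cases h : k * q ≤ R
  · have hm : k * q ∈ KS m R := KS_mk hkq1 h ((Nat.squarefree_mul hkq).mpr ⟨KS_sq hk, hq.squarefree⟩) (Nat.Coprime.mul_left (KS_cop hk) hqm)
    rw [if_pos hm, if_pos h]
    have hmu : muR (k * q) = - muR k := by
      unfold muR
      rw [ArithmeticFunction.isMultiplicative_moebius.map_mul_of_coprime hkq, ArithmeticFunction.moebius_apply_prime hq]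
      push_cast; ring
    have hq1 : (0:ℝ) < (q:ℝ) - 1 := by
      have : (2:ℝ) ≤ q := by exact_mod_cast hq.two_le
      linarith
    have hph : ((q:ℝ) - 1) * hh (k * q) = hh k := by
      unfold hh
      rw [Nat.totient_mul hkq, Nat.totient_prime hq, Nat.cast_mul, Nat.cast_sub hq.one_le, Nat.cast_one]
      have : (0:ℝ) < k.totient := by exact_mod_cast Nat.totient_pos.mpr (KS_pos hk)
      field_simp
    rw [hmu]
    calc _ = muR k * hh k * Real.log (↑R / ↑k) - muR k * (((q:ℝ) - 1) * hh (k * q)) * Real.log (↑R / ↑(k * q)) := by ring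
      _ = _ := by rw [hph]; ring
  · have hm : k * q ∉ KS m R := fun hc => h (KS_le hc)
    rw [if_neg hm, if_neg h]; ring

theorem TQ_le (m R q : ℕ) (hq : q.Prime) (hqm : q.Coprime m) :
    TQ m R q ≤ UU m R 2 / q ∧ TQ m R q ≤ UU m R 0 * Real.log q ^ 2 / q := by
  have hq0 : (0:ℝ) < q := by exact_mod_cast hq.pos
  have main : ∀ k ∈ (KS m R).filter (fun k => k.Coprime q),
      (k.totient : ℝ) * (∑ d ∈ (KS m R).filter (fun d => k ∣ d), lam m R d / d * ((d.gcd q : ℕ) : ℝ)) ^ 2 =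
        hh k * (Real.log ((R:ℝ) / k) - if k * q ≤ R then Real.log ((R:ℝ) / (k * q : ℕ)) else 0) ^ 2 := by
    intro k hk
    obtain ⟨hk, hkq⟩ := mem_filter.mp hk
    rw [TQ_inner m R q k hq hqm hk hkq]
    have h1 := tot_hh (KS_pos hk)
    have h2 := muR_sq (KS_sq hk)
    set W := (Real.log ((R:ℝ) / k) - if k * q ≤ R then Real.log ((R:ℝ) / (k * q : ℕ)) else 0)
    calc (k.totient : ℝ) * (muR k * hh k * W) ^ 2 = ((k.totient : ℝ) * hh k) * (muR k ^ 2) * (hh k * W ^ 2) := by ring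
      _ = _ := by rw [h1, h2]; ring
  have bd : ∀ k ∈ KS m R, 0 ≤ (Real.log ((R:ℝ) / k) - if k * q ≤ R then Real.log ((R:ℝ) / (k * q : ℕ)) else 0) ∧
      (Real.log ((R:ℝ) / k) - if k * q ≤ R then Real.log ((R:ℝ) / (k * q : ℕ)) else 0) ≤ Real.log ((R:ℝ) / k) ∧
      (Real.log ((R:ℝ) / k) - if k * q ≤ R then Real.log ((R:ℝ) / (k * q : ℕ)) else 0) ≤ Real.log q := by
    intro k hk
    have hk0 : (0:ℝ) < k := by exact_mod_cast KS_pos hk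
    have hR0 : (0:ℝ) < R := hk0.trans_le (by exact_mod_cast KS_le hk)
    have h0 := logRk_nonneg hk
    have hlq : 0 ≤ Real.log q := Real.log_natCast_nonneg q
    have e : Real.log ((R:ℝ) / (k * q : ℕ)) = Real.log ((R:ℝ) / k) - Real.log q := by
      push_cast
      rw [← div_div, Real.log_div (by positivity) (by positivity)]
    split_ifs with h
    · have h3 : 0 ≤ Real.log ((R:ℝ) / (k * q : ℕ)) := by
        apply Real.log_nonneg
        have : ((k * q : ℕ):ℝ) ≤ R := by exact_mod_cast h
        rw [le_div_iff₀ (by push_cast; positivity)]; linarith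
      refine ⟨?_, ?_, ?_⟩ <;> linarith
    · have h3 : Real.log ((R:ℝ) / k) ≤ Real.log q := by
        apply Real.log_le_log (by positivity)
        rw [div_le_iff₀ hk0]
        have : (R:ℝ) ≤ ((k * q : ℕ) : ℝ) := by exact_mod_cast (not_le.mp h).le
        push_cast at this; linarith
      refine ⟨?_, ?_, ?_⟩ <;> linarith
  rw [TQ_eq m R q hq.prime.squarefree, Finset.sum_congr rfl main]
  have gen : ∀ G : ℕ → ℝ, (∀ k ∈ KS m R, 0 ≤ G k) → (∀ k ∈ KS m R, (Real.log ((R:ℝ) / k) - if k * q ≤ R then Real.log ((R:ℝ) / (k * q : ℕ)) else 0) ^ 2 ≤ G k) →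
      1 / (q:ℝ) * ∑ k ∈ (KS m R).filter (fun k => k.Coprime q), hh k * (Real.log ((R:ℝ) / k) - if k * q ≤ R then Real.log ((R:ℝ) / (k * q : ℕ)) else 0) ^ 2
        ≤ (∑ k ∈ KS m R, hh k * G k) / q := by
    intro G hG0 hG
    rw [one_div, inv_mul_eq_div]
    refine div_le_div_of_nonneg_right ?_ hq0.le
    calc _ ≤ ∑ k ∈ (KS m R).filter (fun k => k.Coprime q), hh k * G k :=
          Finset.sum_le_sum fun k hk => mul_le_mul_of_nonneg_left (hG k (mem_filter.mp hk).1) (hh_nonneg k)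
      _ ≤ _ := Finset.sum_le_sum_of_subset_of_nonneg (Finset.filter_subset _ _) fun k hk _ => mul_nonneg (hh_nonneg k) (hG0 k hk)
  constructor
  · exact gen (fun k => Real.log ((R:ℝ) / k) ^ 2) (fun k _ => sq_nonneg _) (fun k hk => pow_le_pow_left₀ (bd k hk).1 (bd k hk).2.1 2)
  · have := gen (fun k => Real.log q ^ 2) (fun k _ => sq_nonneg _) (fun k hk => pow_le_pow_left₀ (bd k hk).1 (bd k hk).2.2 2)
    rw [← Finset.sum_mul] at this
    simpa [UU] using this

theorem log_sqf {R k : ℕ} (hk : Squarefree k) (hkR : k ≤ R) : Real.log k = ∑ p ∈ Icc 1 R, if p ∣ k then lpr p else 0 := by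
  rw [← Finset.sum_filter]
  have h1 : Real.log k = ∑ p ∈ k.primeFactors, Real.log p := by
    conv_lhs => rw [← Nat.prod_primeFactors_of_squarefree hk]
    rw [Nat.cast_prod, Real.log_prod]
    intro p hp
    exact_mod_cast (Nat.prime_of_mem_primeFactors hp).ne_zero
  rw [h1]
  have hs : k.primeFactors ⊆ (Icc 1 R).filter (fun p => p ∣ k) := by
    intro p hp
    have h := Nat.mem_primeFactors.mp hp
    exact mem_filter.mpr ⟨mem_Icc.mpr ⟨h.1.one_le, (Nat.le_of_dvd (Nat.pos_of_ne_zero h.2.2) h.2.1).trans hkR⟩, h.2.1⟩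
  rw [← Finset.sum_subset hs]
  · refine Finset.sum_congr rfl fun p hp => ?_
    rw [lpr, if_pos (Nat.prime_of_mem_primeFactors hp)]
  · intro p hp hp2
    rw [lpr, if_neg]
    intro hpp
    exact hp2 (Nat.mem_primeFactors.mpr ⟨hpp, (mem_filter.mp hp).2, hk.ne_zero⟩)

theorem swap_sum (m R : ℕ) (g : ℕ → ℝ) (hg : ∀ k, 1 ≤ k → k ≤ R → 0 ≤ g k) :
    ∑ k ∈ KS m R, hh k * g k * Real.log k ≤ ∑ j ∈ KS m R, hh j * ∑ p ∈ Icc 1 (R / j), lpr p / ((p:ℝ) - 1) * g (p * j) := by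
  calc ∑ k ∈ KS m R, hh k * g k * Real.log k = ∑ k ∈ KS m R, ∑ p ∈ Icc 1 R, if p ∣ k then hh k * g k * lpr p else 0 := by
        refine Finset.sum_congr rfl fun k hk => ?_
        rw [log_sqf (KS_sq hk) (KS_le hk), Finset.mul_sum]
        refine Finset.sum_congr rfl fun p hp => ?_
        split_ifs <;> simp
    _ = ∑ p ∈ Icc 1 R, ∑ k ∈ KS m R, if p ∣ k then hh k * g k * lpr p else 0 := Finset.sum_comm
    _ ≤ ∑ p ∈ Icc 1 R, ∑ j ∈ KS m R, if p * j ≤ R then hh j * (lpr p / ((p:ℝ) - 1) * g (p * j)) else 0 := by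
        refine Finset.sum_le_sum fun p hp => ?_
        by_cases hpp : p.Prime
        · have hp0 : (0:ℝ) < (p:ℝ) - 1 := by
            have : (2:ℝ) ≤ p := by exact_mod_cast hpp.two_le
            linarith
          rw [← Finset.sum_filter, ← Finset.sum_filter]
          have h1 : ∀ k ∈ (KS m R).filter (fun k => p ∣ k), hh k * g k * lpr p = hh (k / p) * (lpr p / ((p:ℝ) - 1) * g (p * (k / p))) := by
            intro k hk
            obtain ⟨hk, ⟨j, rfl⟩⟩ := mem_filter.mp hk
            rw [Nat.mul_div_cancel_left _ hpp.pos]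
            have hc : p.Coprime j := Nat.coprime_of_squarefree_mul (KS_sq hk)
            have : hh (p * j) = hh j / ((p:ℝ) - 1) := by
              unfold hh
              rw [Nat.totient_mul hc, Nat.totient_prime hpp, Nat.cast_mul, Nat.cast_sub hpp.one_le, Nat.cast_one, div_div, mul_comm]
            rw [this]; ring
          rw [Finset.sum_congr rfl h1]
          have hinj : Set.InjOn (fun k => k / p) ((KS m R).filter (fun k => p ∣ k) : Finset ℕ) := by
            intro k1 h1 k2 h2 h
            have h1 := (mem_filter.mp (Finset.mem_coe.mp h1)).2
            have h2 := (mem_filter.mp (Finset.mem_coe.mp h2)).2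
            have h : k1 / p = k2 / p := h
            rw [← Nat.mul_div_cancel' h1, ← Nat.mul_div_cancel' h2, h]
          rw [← Finset.sum_image (f := fun j => hh j * (lpr p / ((p:ℝ) - 1) * g (p * j))) hinj]
          refine Finset.sum_le_sum_of_subset_of_nonneg ?_ ?_
          · intro j hj
            obtain ⟨k, hk, rfl⟩ := mem_image.mp hj
            obtain ⟨hk, hpk⟩ := mem_filter.mp hk
            refine mem_filter.mpr ⟨KS_dvd hk (Nat.div_dvd_of_dvd hpk), ?_⟩
            rw [Nat.mul_div_cancel' hpk]; exact KS_le hk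
          · intro j hj _
            obtain ⟨hj, hjR⟩ := mem_filter.mp hj
            exact mul_nonneg (hh_nonneg j) (mul_nonneg (div_nonneg (lpr_nonneg p) hp0.le) (hg _ (Nat.mul_pos hpp.pos (KS_pos hj)) hjR))
        · simp [lpr, hpp]
    _ = ∑ j ∈ KS m R, ∑ p ∈ Icc 1 R, if p * j ≤ R then hh j * (lpr p / ((p:ℝ) - 1) * g (p * j)) else 0 := Finset.sum_comm
    _ = _ := by
        refine Finset.sum_congr rfl fun j hj => ?_
        rw [Finset.mul_sum, ← Finset.sum_filter]
        refine Finset.sum_congr ?_ fun _ _ => rfl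
        ext p
        simp only [mem_filter, mem_Icc, Nat.le_div_iff_mul_le (KS_pos hj)]
        have : p ≤ p * j := Nat.le_mul_of_pos_right p (KS_pos hj)
        constructor
        · rintro ⟨⟨h1, h2⟩, h3⟩; exact ⟨h1, h3⟩
        · rintro ⟨h1, h2⟩; exact ⟨⟨h1, by omega⟩, h2⟩

theorem UU_bound (m R : ℕ) (hL : 4 ≤ Real.log R) : (Real.log R - 4) ^ 2 * UU m R 0 ≤ 3 * UU m R 2 := by
  have hlog : ∀ k ∈ KS m R, Real.log k = Real.log R - Real.log ((R:ℝ) / k) := by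
    intro k hk
    have hk0 : (0:ℝ) < k := by exact_mod_cast KS_pos hk
    have hR0 : (0:ℝ) < R := hk0.trans_le (by exact_mod_cast KS_le hk)
    rw [Real.log_div (by positivity) (by positivity)]; ring
  have hdiv : ∀ j ∈ KS m R, 1 ≤ R / j ∧ ((R / j : ℕ) : ℝ) ≤ (R:ℝ) / j := by
    intro j hj
    exact ⟨(Nat.one_le_div_iff (KS_pos hj)).mpr (KS_le hj), Nat.cast_div_le⟩
  have h1 : Real.log R * UU m R 0 ≤ 2 * UU m R 1 + 4 * UU m R 0 := by
    have hs := swap_sum m R (fun _ => 1) (fun _ _ _ => zero_le_one)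
    have e : ∑ k ∈ KS m R, hh k * 1 * Real.log k = Real.log R * UU m R 0 - UU m R 1 := by
      rw [UU, UU, Finset.mul_sum, ← Finset.sum_sub_distrib]
      refine Finset.sum_congr rfl fun k hk => ?_
      rw [hlog k hk]; ring
    rw [e] at hs
    have e2 : ∑ j ∈ KS m R, hh j * ∑ p ∈ Icc 1 (R / j), lpr p / ((p:ℝ) - 1) * 1 ≤ UU m R 1 + 4 * UU m R 0 := by
      rw [UU, UU, Finset.mul_sum, ← Finset.sum_add_distrib]
      refine Finset.sum_le_sum fun j hj => ?_
      have h1 := MB_upper (R / j) (hdiv j hj).1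
      have h2 : Real.log ((R / j : ℕ) : ℝ) ≤ Real.log ((R:ℝ) / j) := Real.log_le_log (by exact_mod_cast (hdiv j hj).1) (hdiv j hj).2
      have h3 : ∑ p ∈ Icc 1 (R / j), lpr p / ((p:ℝ) - 1) * 1 = MB (R / j) := by simp [MB]
      rw [h3]
      calc hh j * MB (R / j) ≤ hh j * (Real.log ((R:ℝ) / j) + 4) := mul_le_mul_of_nonneg_left (by linarith) (hh_nonneg j)
        _ = _ := by ring
    linarith
  have h2 : Real.log R * UU m R 1 ≤ 3 / 2 * UU m R 2 + 4 * UU m R 1 := by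
    have hs := swap_sum m R (fun k => Real.log ((R:ℝ) / k)) (fun k h1 h2 => by
      have h1 : (1:ℝ) ≤ k := by exact_mod_cast h1
      have h2 : (k:ℝ) ≤ R := by exact_mod_cast h2
      exact Real.log_nonneg (by rw [le_div_iff₀ (by linarith)]; linarith))
    have e : ∑ k ∈ KS m R, hh k * Real.log ((R:ℝ) / k) * Real.log k = Real.log R * UU m R 1 - UU m R 2 := by
      rw [UU, UU, Finset.mul_sum, ← Finset.sum_sub_distrib]
      refine Finset.sum_congr rfl fun k hk => ?_
      rw [hlog k hk]; ring
    rw [e] at hs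
    have e2 : ∑ j ∈ KS m R, hh j * ∑ p ∈ Icc 1 (R / j), lpr p / ((p:ℝ) - 1) * Real.log ((R:ℝ) / (p * j : ℕ)) ≤ 1 / 2 * UU m R 2 + 4 * UU m R 1 := by
      rw [UU, UU, Finset.mul_sum, Finset.mul_sum, ← Finset.sum_add_distrib]
      refine Finset.sum_le_sum fun j hj => ?_
      have h1 := mert4 (R / j) (hdiv j hj).1 ((R:ℝ) / j) (hdiv j hj).2
      have h3 : ∑ p ∈ Icc 1 (R / j), lpr p / ((p:ℝ) - 1) * Real.log ((R:ℝ) / (p * j : ℕ)) = ∑ p ∈ Icc 1 (R / j), lpr p / ((p:ℝ) - 1) * Real.log ((R:ℝ) / j / p) := by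
        refine Finset.sum_congr rfl fun p hp => ?_
        push_cast
        rw [div_div, mul_comm (p:ℝ)]
      rw [h3]
      calc _ ≤ hh j * (Real.log ((R:ℝ) / j) ^ 2 / 2 + 4 * Real.log ((R:ℝ) / j)) := mul_le_mul_of_nonneg_left h1 (hh_nonneg j)
        _ = _ := by ring
    linarith
  have h3 : (Real.log R - 4) * UU m R 0 ≤ 2 * UU m R 1 := by linarith
  have h4 : (Real.log R - 4) * UU m R 1 ≤ 3 / 2 * UU m R 2 := by linarith
  have h5 : (Real.log R - 4) * ((Real.log R - 4) * UU m R 0) ≤ (Real.log R - 4) * (2 * UU m R 1) := mul_le_mul_of_nonneg_left h3 (by linarith)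
  linarith

theorem UU_two_ge (m R : ℕ) (hR : 1 ≤ R) : Real.log R ^ 2 ≤ UU m R 2 := by
  have h1 : 1 ∈ KS m R := KS_mk le_rfl hR squarefree_one (Nat.coprime_one_left m)
  have := Finset.single_le_sum (f := fun k => hh k * Real.log ((R : ℝ) / k) ^ 2) (fun k hk => mul_nonneg (hh_nonneg k) (pow_nonneg (logRk_nonneg hk) 2)) h1
  have e : hh 1 = 1 := by simp [hh]
  simp only [e, Nat.cast_one, div_one, one_mul] at this
  exact this

end part17



section part18
variable {m : ℕ} [NeZero m]

noncomputable def an (a : ZMod m) (X n : ℕ) : ℝ :=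
  ∑ p ∈ (Icc 1 X).filter (fun p => p.Coprime m), if ((p * n : ℕ) : ZMod m) = a then lpr p else 0

noncomputable def Psi (m X : ℕ) : ℝ := ∑ p ∈ (Icc 1 X).filter (fun p => p.Coprime m), lpr p

noncomputable def BB (a : ZMod m) (X e : ℕ) : ℝ := ∑ n ∈ (Icc 1 X).filter (fun n => e ∣ n), an a X n

theorem an_nonneg (a : ZMod m) (X n : ℕ) : 0 ≤ an a X n :=
  Finset.sum_nonneg fun p _ => by split_ifs; exacts [lpr_nonneg p, le_rfl]

theorem Psi_nonneg (m X : ℕ) : 0 ≤ Psi m X := Finset.sum_nonneg fun p _ => lpr_nonneg p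

theorem an_pos (a : ZMod m) (X n : ℕ) (h : 0 < an a X n) : ∃ p, p.Prime ∧ p ≤ X ∧ ((p * n : ℕ) : ZMod m) = a := by
  obtain ⟨p, hp, h0⟩ := Finset.exists_ne_zero_of_sum_ne_zero h.ne'
  rw [mem_filter, mem_Icc] at hp
  by_cases h1 : ((p * n : ℕ) : ZMod m) = a
  · rw [if_pos h1] at h0
    refine ⟨p, ?_, hp.1.2, h1⟩
    by_contra hpp
    exact h0 (by rw [lpr, if_neg hpp])
  · rw [if_neg h1] at h0; exact absurd rfl h0

theorem an_cop (a : ZMod m) (ha : IsUnit a) (X n : ℕ) (h : an a X n ≠ 0) : n.Coprime m := by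
  obtain ⟨p, _, _, h1⟩ := an_pos a X n (lt_of_le_of_ne (an_nonneg a X n) h.symm)
  rw [← h1] at ha
  have := (ZMod.isUnit_iff_coprime _ _).mp ha
  exact Nat.Coprime.coprime_mul_left this

theorem BB_eq (a : ZMod m) (X e : ℕ) (he : 1 ≤ e) (hc : e.Coprime m) :
    BB a X e = ∑ p ∈ (Icc 1 X).filter (fun p => p.Coprime m), lpr p * (cnt m (X / e) (a * (p : ZMod m)⁻¹ * (e : ZMod m)⁻¹) : ℝ) := by
  unfold BB an
  rw [Finset.sum_comm]
  refine Finset.sum_congr rfl fun p hp => ?_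
  rw [mem_filter] at hp
  rw [← Finset.sum_filter, Finset.sum_const, nsmul_eq_mul, mul_comm, cnt]
  congr 2
  rw [Finset.filter_filter]
  have up := unit_of_coprime hp.2
  have ue := unit_of_coprime hc
  symm
  refine Finset.card_bij (fun k _ => e * k) ?_ ?_ ?_
  · intro k hk
    simp only [mem_filter, mem_Icc] at hk ⊢
    refine ⟨⟨Nat.mul_pos he hk.1.1, ?_⟩, Dvd.intro _ rfl, ?_⟩
    · have := (Nat.le_div_iff_mul_le he).mp hk.1.2
      rw [mul_comm]; exact this
    · push_cast
      rw [hk.2]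
      calc (p : ZMod m) * ((e : ZMod m) * (a * (p : ZMod m)⁻¹ * (e : ZMod m)⁻¹)) = ((p : ZMod m) * (p : ZMod m)⁻¹) * ((e : ZMod m) * (e : ZMod m)⁻¹) * a := by ring
        _ = a := by rw [up, ue]; ring
  · intro k1 _ k2 _ h; exact Nat.eq_of_mul_eq_mul_left he h
  · intro n hn
    simp only [mem_filter, mem_Icc] at hn
    obtain ⟨⟨h1, h2⟩, ⟨k, rfl⟩, h4⟩ := hn
    refine ⟨k, ?_, rfl⟩
    simp only [mem_filter, mem_Icc]
    refine ⟨⟨Nat.pos_of_mul_pos_left h1, (Nat.le_div_iff_mul_le he).mpr (by rw [mul_comm]; exact h2)⟩, ?_⟩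
    rw [← h4]
    push_cast
    symm
    calc (p : ZMod m) * ((e : ZMod m) * k) * (p : ZMod m)⁻¹ * (e : ZMod m)⁻¹ = ((p : ZMod m) * (p : ZMod m)⁻¹) * ((e : ZMod m) * (e : ZMod m)⁻¹) * k := by ring
      _ = k := by rw [up, ue]; ring

theorem BB_approx (a : ZMod m) (X e : ℕ) (he : 1 ≤ e) (hc : e.Coprime m) :
    |BB a X e - Psi m X * X / m * (1 / e)| ≤ |EE lpr X a e| + Psi m X / m := by
  have hm0 : (0:ℝ) < m := by exact_mod_cast Nat.pos_of_ne_zero (NeZero.ne m)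
  have he0 : (0:ℝ) < e := by exact_mod_cast he
  have e1 : BB a X e = EE lpr X a e + Psi m X * (((X / e : ℕ) : ℝ) / m) := by
    rw [BB_eq a X e he hc, EE, Psi, Finset.sum_mul, ← Finset.sum_add_distrib]
    refine Finset.sum_congr rfl fun p hp => by ring
  have h1 : (X:ℝ) / e < ((X / e : ℕ) : ℝ) + 1 := by
    rw [← Nat.floor_div_eq_div (K := ℝ)]
    exact Nat.lt_floor_add_one _
  have h2 : ((X / e : ℕ) : ℝ) ≤ (X:ℝ) / e := Nat.cast_div_le
  have hP := Psi_nonneg m X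
  have e2 : BB a X e - Psi m X * X / m * (1 / e) = EE lpr X a e + (- (Psi m X / m * ((X:ℝ) / e - ((X / e : ℕ) : ℝ)))) := by
    rw [e1]; ring
  rw [e2]
  refine (abs_add_le _ _).trans ?_
  have h3 : 0 ≤ Psi m X / m := by positivity
  have h4 : |- (Psi m X / m * ((X:ℝ) / e - ((X / e : ℕ) : ℝ)))| ≤ Psi m X / m := by
    rw [abs_neg, abs_mul, abs_of_nonneg h3, abs_of_nonneg (by linarith)]
    calc _ ≤ Psi m X / m * 1 := mul_le_mul_of_nonneg_left (by linarith) h3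
      _ = _ := mul_one _
  linarith

theorem sieve_expand (a : ZMod m) (X R : ℕ) (P : Finset ℕ) (c : ℕ → ℝ) :
    ∑ n ∈ Icc 1 X, an a X n * (∑ t ∈ P.filter (fun t => t ∣ n), c t) * (∑ d ∈ (KS m R).filter (fun d => d ∣ n), lam m R d) ^ 2 =
      ∑ t ∈ P, c t * ∑ d1 ∈ KS m R, ∑ d2 ∈ KS m R, lam m R d1 * lam m R d2 * BB a X ((d1.lcm d2).lcm t) := by
  have h1 : ∀ n ∈ Icc 1 X, an a X n * (∑ t ∈ P.filter (fun t => t ∣ n), c t) * (∑ d ∈ (KS m R).filter (fun d => d ∣ n), lam m R d) ^ 2 =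
      ∑ t ∈ P, c t * ∑ d1 ∈ KS m R, ∑ d2 ∈ KS m R, lam m R d1 * lam m R d2 * (if (d1.lcm d2).lcm t ∣ n then an a X n else 0) := by
    intro n hn
    rw [sq, Finset.sum_filter, Finset.sum_filter, Finset.sum_mul_sum, Finset.mul_sum P, Finset.sum_mul P]
    refine Finset.sum_congr rfl fun t ht => ?_
    rw [Finset.mul_sum, Finset.mul_sum]
    refine Finset.sum_congr rfl fun d1 h1 => ?_
    rw [Finset.mul_sum, Finset.mul_sum]
    refine Finset.sum_congr rfl fun d2 h2 => ?_
    simp only [Nat.lcm_dvd_iff]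
    by_cases ht : t ∣ n <;> by_cases hd1 : d1 ∣ n <;> by_cases hd2 : d2 ∣ n <;> simp [ht, hd1, hd2]
    ring
  rw [Finset.sum_congr rfl h1, Finset.sum_comm]
  refine Finset.sum_congr rfl fun t ht => ?_
  rw [← Finset.mul_sum, Finset.sum_comm]
  congr 1
  refine Finset.sum_congr rfl fun d1 h1 => ?_
  rw [Finset.sum_comm]
  refine Finset.sum_congr rfl fun d2 h2 => ?_
  rw [← Finset.mul_sum, BB, Finset.sum_filter]

theorem lcm_fibre {Q : ℝ} (hg : Good m Q) (R D : ℕ) (P : Finset ℕ) (r : ℕ → ℝ) (hr : ∀ e, 0 ≤ r e)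
    (hP : ∀ t ∈ P, 1 ≤ t ∧ t.Coprime m ∧ R * R * t ≤ D) (hD : D ≤ m ^ 12) :
    ∑ t ∈ P, ∑ d1 ∈ KS m R, ∑ d2 ∈ KS m R, r ((d1.lcm d2).lcm t) ≤
      Q ^ 3 * ∑ e ∈ (Icc 1 D).filter (fun e => e.Coprime m), r e := by
  have e1 : ∑ t ∈ P, ∑ d1 ∈ KS m R, ∑ d2 ∈ KS m R, r ((d1.lcm d2).lcm t) =
      ∑ x ∈ P ×ˢ (KS m R ×ˢ KS m R), r ((x.2.1.lcm x.2.2).lcm x.1) := by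
    rw [Finset.sum_product]
    refine Finset.sum_congr rfl fun t _ => ?_
    rw [Finset.sum_product]
  have hmap : ∀ x ∈ P ×ˢ (KS m R ×ˢ KS m R), (x.2.1.lcm x.2.2).lcm x.1 ∈ (Icc 1 D).filter (fun e => e.Coprime m) := by
    intro x hx
    simp only [mem_product] at hx
    obtain ⟨ht, h1, h2⟩ := hx
    obtain ⟨p1, p2, p3⟩ := hP _ ht
    have q1 := KS_pos h1
    have q2 := KS_pos h2
    have hdv : (x.2.1.lcm x.2.2).lcm x.1 ∣ x.2.1 * x.2.2 * x.1 :=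
      (Nat.lcm_dvd_mul _ _).trans (Nat.mul_dvd_mul_right (Nat.lcm_dvd_mul _ _) _)
    refine mem_filter.mpr ⟨mem_Icc.mpr ⟨Nat.lcm_pos (Nat.lcm_pos q1 q2) p1, ?_⟩, ?_⟩
    · refine (Nat.le_of_dvd (by positivity) hdv).trans (le_trans ?_ p3)
      exact Nat.mul_le_mul_right _ (Nat.mul_le_mul (KS_le h1) (KS_le h2))
    · exact (Nat.Coprime.mul_left (Nat.Coprime.mul_left (KS_cop h1) (KS_cop h2)) p2).coprime_dvd_left hdv
  rw [e1, ← Finset.sum_fiberwise_of_maps_to hmap, Finset.mul_sum]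
  refine Finset.sum_le_sum fun e he => ?_
  obtain ⟨he1, he2⟩ := mem_Icc.mp (mem_filter.mp he).1
  have h2 : ∑ x ∈ (P ×ˢ (KS m R ×ˢ KS m R)).filter (fun x => (x.2.1.lcm x.2.2).lcm x.1 = e), r ((x.2.1.lcm x.2.2).lcm x.1) =
      (((P ×ˢ (KS m R ×ˢ KS m R)).filter (fun x => (x.2.1.lcm x.2.2).lcm x.1 = e)).card : ℝ) * r e := by
    rw [← nsmul_eq_mul, ← Finset.sum_const]
    refine Finset.sum_congr rfl fun x hx => ?_
    rw [(mem_filter.mp hx).2]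
  rw [h2]
  refine mul_le_mul_of_nonneg_right ?_ (hr e)
  have h3 : ((P ×ˢ (KS m R ×ˢ KS m R)).filter (fun x => (x.2.1.lcm x.2.2).lcm x.1 = e)).card ≤ (e.divisors ×ˢ (e.divisors ×ˢ e.divisors)).card := by
    refine Finset.card_le_card fun x hx => ?_
    have hx := (mem_filter.mp hx).2
    simp only [mem_product, Nat.mem_divisors]
    have h0 : e ≠ 0 := by omega
    refine ⟨⟨?_, h0⟩, ⟨?_, h0⟩, ?_, h0⟩
    · rw [← hx]; exact Nat.dvd_lcm_right _ _
    · rw [← hx]; exact (Nat.dvd_lcm_left _ _).trans (Nat.dvd_lcm_left _ _)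
    · rw [← hx]; exact (Nat.dvd_lcm_right _ _).trans (Nat.dvd_lcm_left _ _)
  have h4 : (e.divisors.card : ℝ) ≤ Q := hg.tau e (by omega) (he2.trans hD)
  calc (((P ×ˢ (KS m R ×ˢ KS m R)).filter (fun x => (x.2.1.lcm x.2.2).lcm x.1 = e)).card : ℝ)
      ≤ (((e.divisors ×ˢ (e.divisors ×ˢ e.divisors)).card : ℕ) : ℝ) := by exact_mod_cast h3
    _ = (e.divisors.card : ℝ) ^ 3 := by rw [Finset.card_product, Finset.card_product]; push_cast; ring
    _ ≤ Q ^ 3 := pow_le_pow_left₀ (by positivity) h4 3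

theorem hh_le {Q : ℝ} (hg : Good m Q) (k : ℕ) (hk : 1 ≤ k) (hkm : k ≤ m ^ 12) : hh k ≤ Q / k := by
  have h1 : k ≤ k.totient * k.divisors.card := by
    calc k = ∑ d ∈ k.divisors, d.totient := (Nat.sum_totient k).symm
      _ ≤ ∑ d ∈ k.divisors, k.totient := by
        refine Finset.sum_le_sum fun d hd => ?_
        exact Nat.le_of_dvd (Nat.totient_pos.mpr (by omega)) (Nat.totient_dvd_of_dvd (Nat.dvd_of_mem_divisors hd))
      _ = _ := by simp [mul_comm]
  have h2 := hg.tau k (by omega) hkm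
  have h3 : (k:ℝ) ≤ k.totient * k.divisors.card := by exact_mod_cast h1
  have h4 : (0:ℝ) < k.totient := by exact_mod_cast Nat.totient_pos.mpr hk
  have h5 : (0:ℝ) < k := by exact_mod_cast hk
  unfold hh
  rw [div_le_div_iff₀ h4 h5]
  calc 1 * (k:ℝ) ≤ k.totient * k.divisors.card := by linarith
    _ ≤ k.totient * Q := mul_le_mul_of_nonneg_left h2 h4.le
    _ = _ := mul_comm _ _

theorem muR_abs (n : ℕ) : |muR n| ≤ 1 := by
  unfold muR
  have := ArithmeticFunction.abs_moebius_le_one (n := n)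
  exact_mod_cast this

theorem lam_abs {Q : ℝ} (hg : Good m Q) (R d : ℕ) (hR : R ≤ m) (hd : 1 ≤ d) : |lam m R d| ≤ Q ^ 4 := by
  have hQ := hg.two_le
  have hm := hg.hm
  have hd0 : (0:ℝ) < d := by exact_mod_cast hd
  have hb : ∀ k ∈ (KS m R).filter (fun k => d ∣ k), |muR (k / d) * xx m R k| ≤ Q ^ 2 / d * ((k / d : ℕ) : ℝ)⁻¹ := by
    intro k hk
    obtain ⟨hk, j, rfl⟩ := mem_filter.mp hk
    have hkR := KS_le hk
    have hk1 := KS_pos hk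
    rw [Nat.mul_div_cancel_left _ hd, xx, if_pos hk, abs_mul, abs_mul, abs_mul, abs_of_nonneg (hh_nonneg _), abs_of_nonneg (logRk_nonneg hk)]
    have h1 : hh (d * j) ≤ Q / ((d * j : ℕ) : ℝ) := hh_le hg _ hk1 (by
      calc d * j ≤ m := hkR.trans hR
        _ ≤ m ^ 12 := Nat.le_self_pow (by norm_num) m)
    have hk0 : (1:ℝ) ≤ ((d * j : ℕ) : ℝ) := by exact_mod_cast hk1
    have h2 : Real.log ((R:ℝ) / ((d * j : ℕ) : ℝ)) ≤ Q := by
      refine le_trans (Real.log_le_log ?_ ?_) (hg.log_le R hR)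
      · have : 0 < R := by omega
        positivity
      · exact div_le_self (by positivity) hk0
    have h3 : |muR j| * (|muR (d * j)| * hh (d * j) * Real.log ((R:ℝ) / ((d * j : ℕ) : ℝ))) ≤ 1 * (1 * (Q / ((d * j : ℕ) : ℝ)) * Q) := by
      refine mul_le_mul (muR_abs j) ?_ ?_ zero_le_one
      · refine mul_le_mul ?_ h2 (logRk_nonneg hk) (by positivity)
        exact mul_le_mul (muR_abs _) h1 (hh_nonneg _) zero_le_one
      · exact mul_nonneg (mul_nonneg (abs_nonneg _) (hh_nonneg _)) (logRk_nonneg hk)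
    refine h3.trans (le_of_eq ?_)
    have : (0:ℝ) < j := by
      have : 0 < j := Nat.pos_of_mul_pos_left hk1
      exact_mod_cast this
    push_cast
    field_simp
  have hinj : Set.InjOn (fun k => k / d) ((KS m R).filter (fun k => d ∣ k) : Finset ℕ) := by
    intro k1 h1 k2 h2 h
    have h1 := (mem_filter.mp (Finset.mem_coe.mp h1)).2
    have h2 := (mem_filter.mp (Finset.mem_coe.mp h2)).2
    have h : k1 / d = k2 / d := h
    rw [← Nat.mul_div_cancel' h1, ← Nat.mul_div_cancel' h2, h]
  have hs : ∑ k ∈ (KS m R).filter (fun k => d ∣ k), ((k / d : ℕ) : ℝ)⁻¹ ≤ 2 * Q := by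
    rw [← Finset.sum_image (f := fun j : ℕ => (j:ℝ)⁻¹) hinj]
    refine le_trans (Finset.sum_le_sum_of_subset_of_nonneg ?_ (fun j _ _ => by positivity)) (sum_inv_le hg R hR)
    intro j hj
    obtain ⟨k, hk, rfl⟩ := mem_image.mp hj
    obtain ⟨hk, hpk⟩ := mem_filter.mp hk
    have := KS_dvd hk (Nat.div_dvd_of_dvd hpk)
    exact mem_Icc.mpr ⟨KS_pos this, KS_le this⟩
  rw [lam, abs_mul, abs_of_pos hd0]
  calc (d:ℝ) * |∑ k ∈ (KS m R).filter (fun k => d ∣ k), muR (k / d) * xx m R k|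
      ≤ d * ∑ k ∈ (KS m R).filter (fun k => d ∣ k), Q ^ 2 / d * ((k / d : ℕ) : ℝ)⁻¹ :=
        mul_le_mul_of_nonneg_left ((Finset.abs_sum_le_sum_abs _ _).trans (Finset.sum_le_sum hb)) hd0.le
    _ = Q ^ 2 * ∑ k ∈ (KS m R).filter (fun k => d ∣ k), ((k / d : ℕ) : ℝ)⁻¹ := by
        rw [← Finset.mul_sum]; field_simp
    _ ≤ Q ^ 2 * (2 * Q) := mul_le_mul_of_nonneg_left hs (by positivity)
    _ ≤ Q ^ 2 * (Q * Q) := mul_le_mul_of_nonneg_left (mul_le_mul_of_nonneg_right hQ (by linarith)) (by positivity)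
    _ = Q ^ 4 := by ring

theorem Lam_sq {Q : ℝ} (hg : Good m Q) (R n : ℕ) (hR : R ≤ m) (hn : 1 ≤ n) (hnm : n ≤ m ^ 12) :
    (∑ d ∈ (KS m R).filter (fun d => d ∣ n), lam m R d) ^ 2 ≤ Q ^ 10 := by
  have hQ := hg.two_le
  have h1 : |∑ d ∈ (KS m R).filter (fun d => d ∣ n), lam m R d| ≤ Q ^ 5 := by
    calc |∑ d ∈ (KS m R).filter (fun d => d ∣ n), lam m R d| ≤ ∑ d ∈ (KS m R).filter (fun d => d ∣ n), Q ^ 4 :=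
          (Finset.abs_sum_le_sum_abs _ _).trans (Finset.sum_le_sum fun d hd => lam_abs hg R d hR (KS_pos (mem_filter.mp hd).1))
      _ = (((KS m R).filter (fun d => d ∣ n)).card : ℝ) * Q ^ 4 := by rw [Finset.sum_const, nsmul_eq_mul]
      _ ≤ Q * Q ^ 4 := by
          refine mul_le_mul_of_nonneg_right ?_ (by positivity)
          refine le_trans ?_ (hg.tau n (by omega) hnm)
          have : ((KS m R).filter (fun d => d ∣ n)).card ≤ n.divisors.card := by
            refine Finset.card_le_card fun d hd => ?_
            exact Nat.mem_divisors.mpr ⟨(mem_filter.mp hd).2, by omega⟩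
          exact_mod_cast this
      _ = Q ^ 5 := by ring
  calc _ = |∑ d ∈ (KS m R).filter (fun d => d ∣ n), lam m R d| ^ 2 := (sq_abs _).symm
    _ ≤ (Q ^ 5) ^ 2 := pow_le_pow_left₀ (abs_nonneg _) h1 2
    _ = _ := by ring

/-- main sieve lower bound -/
theorem sieve_lower {Q : ℝ} (hg : Good m Q) (a : ZMod m) (X R D : ℕ) (P : Finset ℕ) (c : ℕ → ℝ) (C E : ℝ) (hR : R ≤ m)
    (hC : ∀ t ∈ P, |c t| ≤ C) (hP : ∀ t ∈ P, 1 ≤ t ∧ t.Coprime m ∧ R * R * t ≤ D) (hD : D ≤ m ^ 12) (hC0 : 0 ≤ C)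
    (hE : ∑ e ∈ (Icc 1 D).filter (fun e => e.Coprime m), |EE lpr X a e| ≤ E) :
    Psi m X * X / m * ∑ t ∈ P, c t * TQ m R t - C * Q ^ 11 * (E + D * (Psi m X / m)) ≤
      ∑ n ∈ Icc 1 X, an a X n * (∑ t ∈ P.filter (fun t => t ∣ n), c t) * (∑ d ∈ (KS m R).filter (fun d => d ∣ n), lam m R d) ^ 2 := by
  rw [sieve_expand]
  have hQ := hg.two_le
  have hm0 : (0:ℝ) < m := by exact_mod_cast Nat.pos_of_ne_zero (NeZero.ne m)
  have hPs := Psi_nonneg m X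
  set r : ℕ → ℝ := fun e => |EE lpr X a e| + Psi m X / m with hrdef
  have hr : ∀ e, 0 ≤ r e := fun e => by simp only [hrdef]; positivity
  have e1 : Psi m X * X / m * ∑ t ∈ P, c t * TQ m R t = ∑ t ∈ P, c t * ∑ d1 ∈ KS m R, ∑ d2 ∈ KS m R, lam m R d1 * lam m R d2 * (Psi m X * X / m * (1 / (((d1.lcm d2).lcm t : ℕ) : ℝ))) := by
    rw [Finset.mul_sum]
    refine Finset.sum_congr rfl fun t ht => ?_
    rw [TQ, mul_left_comm, Finset.mul_sum]
    congr 1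
    refine Finset.sum_congr rfl fun d1 h1 => ?_
    rw [Finset.mul_sum]
    refine Finset.sum_congr rfl fun d2 h2 => by ring
  have key : |Psi m X * X / m * ∑ t ∈ P, c t * TQ m R t - ∑ t ∈ P, c t * ∑ d1 ∈ KS m R, ∑ d2 ∈ KS m R, lam m R d1 * lam m R d2 * BB a X ((d1.lcm d2).lcm t)| ≤
      ∑ t ∈ P, ∑ d1 ∈ KS m R, ∑ d2 ∈ KS m R, C * Q ^ 8 * r ((d1.lcm d2).lcm t) := by
    rw [e1, ← Finset.sum_sub_distrib]
    refine (Finset.abs_sum_le_sum_abs _ _).trans (Finset.sum_le_sum fun t ht => ?_)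
    rw [← mul_sub, ← Finset.sum_sub_distrib, abs_mul]
    calc _ ≤ C * ∑ d1 ∈ KS m R, ∑ d2 ∈ KS m R, Q ^ 8 * r ((d1.lcm d2).lcm t) := by
          refine mul_le_mul (hC t ht) ?_ (abs_nonneg _) hC0
          refine (Finset.abs_sum_le_sum_abs _ _).trans (Finset.sum_le_sum fun d1 h1 => ?_)
          rw [← Finset.sum_sub_distrib]
          refine (Finset.abs_sum_le_sum_abs _ _).trans (Finset.sum_le_sum fun d2 h2 => ?_)
          rw [← mul_sub, abs_mul, abs_mul, abs_sub_comm]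
          obtain ⟨p1, p2, p3⟩ := hP t ht
          have hdv : (d1.lcm d2).lcm t ∣ d1 * d2 * t :=
            (Nat.lcm_dvd_mul _ _).trans (Nat.mul_dvd_mul_right (Nat.lcm_dvd_mul _ _) _)
          have hcop : ((d1.lcm d2).lcm t).Coprime m :=
            (Nat.Coprime.mul_left (Nat.Coprime.mul_left (KS_cop h1) (KS_cop h2)) p2).coprime_dvd_left hdv
          have hb := BB_approx a X ((d1.lcm d2).lcm t) (Nat.lcm_pos (Nat.lcm_pos (KS_pos h1) (KS_pos h2)) p1) hcop
          refine mul_le_mul ?_ hb (abs_nonneg _) (by positivity)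
          calc |lam m R d1| * |lam m R d2| ≤ Q ^ 4 * Q ^ 4 :=
                mul_le_mul (lam_abs hg R d1 hR (KS_pos h1)) (lam_abs hg R d2 hR (KS_pos h2)) (abs_nonneg _) (by positivity)
            _ = Q ^ 8 := by ring
      _ = _ := by simp only [Finset.mul_sum, mul_assoc]
  have h2 : ∑ t ∈ P, ∑ d1 ∈ KS m R, ∑ d2 ∈ KS m R, C * Q ^ 8 * r ((d1.lcm d2).lcm t) ≤ C * Q ^ 11 * (E + D * (Psi m X / m)) := by
    have h3 := lcm_fibre hg R D P r hr hP hD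
    have h4 : ∑ e ∈ (Icc 1 D).filter (fun e => e.Coprime m), r e ≤ E + D * (Psi m X / m) := by
      simp only [hrdef]
      rw [Finset.sum_add_distrib]
      refine add_le_add hE ?_
      rw [Finset.sum_const, nsmul_eq_mul]
      refine mul_le_mul_of_nonneg_right ?_ (by positivity)
      have : ((Icc 1 D).filter (fun e => e.Coprime m)).card ≤ D := (Finset.card_filter_le _ _).trans (by simp)
      exact_mod_cast this
    simp only [← Finset.mul_sum]
    calc C * Q ^ 8 * ∑ t ∈ P, ∑ d1 ∈ KS m R, ∑ d2 ∈ KS m R, r ((d1.lcm d2).lcm t) ≤ C * Q ^ 8 * (Q ^ 3 * (E + D * (Psi m X / m))) := by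
          refine mul_le_mul_of_nonneg_left (h3.trans (mul_le_mul_of_nonneg_left h4 (by positivity))) (by positivity)
      _ = _ := by ring
  have := (abs_le.mp (key.trans h2)).2
  linarith

end part18



section part19
variable {m : ℕ} [NeZero m]

theorem lpr_le (p X : ℕ) (hp : 1 ≤ p) (h : p ≤ X) : lpr p ≤ Real.log X := by
  unfold lpr; split_ifs
  · exact Real.log_le_log (by exact_mod_cast hp) (by exact_mod_cast h)
  · exact Real.log_natCast_nonneg X

theorem logX_le {Q : ℝ} (hg : Good m Q) (X : ℕ) (hX : X ≤ m ^ 2) : Real.log X ≤ 2 * Q := by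
  rcases Nat.eq_zero_or_pos X with h | h
  · subst h; have := hg.two_le; simp; linarith
  · have h1 : Real.log X ≤ Real.log ((m:ℝ) ^ 2) := Real.log_le_log (by exact_mod_cast h) (by exact_mod_cast hX)
    rw [Real.log_pow] at h1
    have := hg.log
    push_cast at h1; linarith

theorem BB_upper {Q : ℝ} (hg : Good m Q) (a : ZMod m) (X e : ℕ) (he : 1 ≤ e) (hc : e.Coprime m) (hX : X ≤ m ^ 2) :
    BB a X e ≤ 2 * Q ^ 2 * ((X:ℝ) ^ 2 / (e * m) + 1) := by
  have hQ := hg.two_le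
  have hm := hg.hm
  have hm0 : (0:ℝ) < m := by exact_mod_cast (show 0 < m by omega)
  rw [BB_eq a X e he hc]
  set P := (Icc 1 X).filter (fun p => p.Coprime m) with hP
  set s := (P ×ˢ Icc 1 (X / e)).filter (fun x => (x.2 : ZMod m) = a * (x.1 : ZMod m)⁻¹ * (e : ZMod m)⁻¹) with hs
  have h1 : ∑ p ∈ P, (cnt m (X / e) (a * (p : ZMod m)⁻¹ * (e : ZMod m)⁻¹) : ℝ) = (s.card : ℝ) := by
    rw [hs, Finset.card_filter, Finset.sum_product]
    push_cast
    refine Finset.sum_congr rfl fun p hp => ?_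
    rw [cnt, Finset.card_filter]; push_cast; rfl
  have h2 : s.card ≤ ⌊Q⌋₊ * cnt m (X * (X / e)) (a * (e : ZMod m)⁻¹) := by
    rw [cnt]
    refine Finset.card_le_mul_card_image_of_maps_to (f := fun x : ℕ × ℕ => x.1 * x.2) ?_ _ ?_
    · intro x hx
      simp only [hs, hP, mem_filter, mem_product, mem_Icc] at hx ⊢
      obtain ⟨⟨⟨⟨p1, p2⟩, p3⟩, k1, k2⟩, h⟩ := hx
      refine ⟨⟨Nat.mul_pos p1 k1, Nat.mul_le_mul p2 k2⟩, ?_⟩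
      push_cast
      rw [h]
      have := unit_of_coprime p3
      calc (x.1 : ZMod m) * (a * (x.1 : ZMod m)⁻¹ * (e : ZMod m)⁻¹) = ((x.1 : ZMod m) * (x.1 : ZMod m)⁻¹) * (a * (e : ZMod m)⁻¹) := by ring
        _ = _ := by rw [this, one_mul]
    · intro v hv
      simp only [mem_filter, mem_Icc] at hv
      have hv12 : v ≤ m ^ 12 := by
        calc v ≤ X * (X / e) := hv.1.2
          _ ≤ m ^ 2 * m ^ 2 := Nat.mul_le_mul hX ((Nat.div_le_self X e).trans hX)
          _ = m ^ 4 := by ring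
          _ ≤ m ^ 12 := Nat.pow_le_pow_right (by omega) (by norm_num)
      refine le_trans ?_ (hg.tauN (n := v) (by omega) hv12)
      refine Finset.card_le_card_of_injOn (fun x => x.1) ?_ ?_
      · intro x hx
        have hx := Finset.mem_coe.mp hx
        have hx2 := (mem_filter.mp hx).2
        refine Finset.mem_coe.mpr (Nat.mem_divisors.mpr ⟨?_, by omega⟩)
        exact ⟨x.2, hx2.symm⟩
      · intro x hx y hy hxy
        have hx := mem_filter.mp (Finset.mem_coe.mp hx)
        have hy := (mem_filter.mp (Finset.mem_coe.mp hy)).2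
        have hx1 : 1 ≤ x.1 := by
          have := hx.1
          simp only [hs, hP, mem_filter, mem_product, mem_Icc] at this
          exact this.1.1.1.1
        have hxy : x.1 = y.1 := hxy
        have h3 : x.1 * x.2 = x.1 * y.2 := by rw [hx.2, hxy, hy]
        exact Prod.ext hxy (Nat.eq_of_mul_eq_mul_left hx1 h3)
  have h3 := cnt_le_real (X * (X / e)) (a * (e : ZMod m)⁻¹)
  have h4 : (((X * (X / e) : ℕ)) : ℝ) / m ≤ (X:ℝ) ^ 2 / (e * m) := by
    rw [← div_div]
    refine div_le_div_of_nonneg_right ?_ hm0.le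
    have : ((X / e : ℕ) : ℝ) ≤ (X:ℝ) / e := Nat.cast_div_le
    push_cast
    calc (X:ℝ) * ((X / e : ℕ) : ℝ) ≤ X * (X / e) := mul_le_mul_of_nonneg_left this (by positivity)
      _ = _ := by ring
  have h5 : (s.card : ℝ) ≤ Q * ((X:ℝ) ^ 2 / (e * m) + 1) := by
    calc (s.card : ℝ) ≤ ((⌊Q⌋₊ * cnt m (X * (X / e)) (a * (e : ZMod m)⁻¹) : ℕ) : ℝ) := by exact_mod_cast h2
      _ = (⌊Q⌋₊ : ℝ) * (cnt m (X * (X / e)) (a * (e : ZMod m)⁻¹) : ℝ) := by push_cast; ring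
      _ ≤ Q * ((X:ℝ) ^ 2 / (e * m) + 1) := by
          refine mul_le_mul (Nat.floor_le (by linarith)) (h3.trans (by linarith)) (by positivity) (by linarith)
  calc _ ≤ ∑ p ∈ P, 2 * Q * (cnt m (X / e) (a * (p : ZMod m)⁻¹ * (e : ZMod m)⁻¹) : ℝ) := by
        refine Finset.sum_le_sum fun p hp => mul_le_mul_of_nonneg_right ?_ (by positivity)
        have hp := mem_Icc.mp (mem_filter.mp hp).1
        exact (lpr_le p X hp.1 hp.2).trans (logX_le hg X hX)
    _ = 2 * Q * (s.card : ℝ) := by rw [← Finset.mul_sum, h1]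
    _ ≤ 2 * Q * (Q * ((X:ℝ) ^ 2 / (e * m) + 1)) := mul_le_mul_of_nonneg_left h5 (by linarith)
    _ = _ := by ring

open Classical in
theorem sq_bound {Q : ℝ} (hg : Good m Q) (a : ZMod m) (ha : IsUnit a) (X z : ℕ) (hz : 1 ≤ z) (hX : X ≤ m ^ 2) :
    ∑ n ∈ (Icc 1 X).filter (fun n => ∃ q, z < q ∧ q * q ∣ n), an a X n ≤ 2 * Q ^ 2 * ((X:ℝ) ^ 2 / (z * m) + Real.sqrt X) := by
  classical
  have hQ := hg.two_le
  have hm := hg.hm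
  have hm0 : (0:ℝ) < m := by exact_mod_cast (show 0 < m by omega)
  have hz0 : (0:ℝ) < z := by exact_mod_cast hz
  have h1 : ∑ n ∈ (Icc 1 X).filter (fun n => ∃ q, z < q ∧ q * q ∣ n), an a X n ≤ ∑ q ∈ Ioc z (Nat.sqrt X), BB a X (q * q) := by
    calc _ ≤ ∑ n ∈ Icc 1 X, ∑ q ∈ Ioc z (Nat.sqrt X), if q * q ∣ n then an a X n else 0 := by
          rw [Finset.sum_filter]
          refine Finset.sum_le_sum fun n hn => ?_
          have hn := mem_Icc.mp hn
          have hnn : ∀ q ∈ Ioc z (Nat.sqrt X), 0 ≤ if q * q ∣ n then an a X n else 0 := fun q _ => by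
            split_ifs; exacts [an_nonneg a X n, le_rfl]
          by_cases h : ∃ q, z < q ∧ q * q ∣ n
          · rw [if_pos h]
            obtain ⟨q, hq1, hq2⟩ := h
            have hmem : q ∈ Ioc z (Nat.sqrt X) := by
              refine mem_Ioc.mpr ⟨hq1, Nat.le_sqrt.mpr ((Nat.le_of_dvd (by omega) hq2).trans hn.2)⟩
            have := Finset.single_le_sum hnn hmem
            rwa [if_pos hq2] at this
          · rw [if_neg h]; exact Finset.sum_nonneg hnn
      _ = _ := by
          rw [Finset.sum_comm]
          refine Finset.sum_congr rfl fun q hq => ?_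
          rw [BB, Finset.sum_filter]
  have h2 : ∀ q ∈ Ioc z (Nat.sqrt X), BB a X (q * q) ≤ 2 * Q ^ 2 * ((X:ℝ) ^ 2 / m * ((q:ℝ) ^ 2)⁻¹ + 1) := by
    intro q hq
    have hq1 := (mem_Ioc.mp hq).1
    have hq0 : 0 < q := by omega
    by_cases hc : q.Coprime m
    · have := BB_upper hg a X (q * q) (Nat.mul_pos hq0 hq0) (Nat.Coprime.mul_left hc hc) hX
      refine this.trans (le_of_eq ?_)
      push_cast
      have : (0:ℝ) < q := by exact_mod_cast hq0
      field_simp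
    · have h0 : BB a X (q * q) = 0 := by
        refine Finset.sum_eq_zero fun n hn => ?_
        by_contra hne
        have := an_cop a ha X n hne
        exact hc (this.coprime_dvd_left ((Dvd.intro _ rfl).trans (mem_filter.mp hn).2))
      rw [h0]; positivity
  refine h1.trans ((Finset.sum_le_sum h2).trans ?_)
  rw [← Finset.mul_sum]
  refine mul_le_mul_of_nonneg_left ?_ (by positivity)
  rw [Finset.sum_add_distrib, ← Finset.mul_sum]
  refine add_le_add ?_ ?_
  · have h3 : ∑ q ∈ Ioc z (Nat.sqrt X), ((q:ℝ) ^ 2)⁻¹ ≤ (z:ℝ)⁻¹ := by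
      by_cases hzs : z ≤ Nat.sqrt X
      · have := sum_Ioc_inv_sq_le_sub (α := ℝ) (k := z) (n := Nat.sqrt X) (by omega) hzs
        have h4 : (0:ℝ) ≤ ((Nat.sqrt X : ℕ) : ℝ)⁻¹ := by positivity
        linarith
      · rw [Finset.Ioc_eq_empty_of_le (by omega)]; simp
    calc _ ≤ (X:ℝ) ^ 2 / m * (z:ℝ)⁻¹ := mul_le_mul_of_nonneg_left h3 (by positivity)
      _ = _ := by field_simp
  · rw [Finset.sum_const, nsmul_eq_mul, mul_one]
    have : (Ioc z (Nat.sqrt X)).card ≤ Nat.sqrt X := by simp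
    calc ((Ioc z (Nat.sqrt X)).card : ℝ) ≤ ((Nat.sqrt X : ℕ) : ℝ) := by exact_mod_cast this
      _ ≤ Real.sqrt X := Real.nat_sqrt_le_real_sqrt

noncomputable def wq (l v Y q : ℕ) : ℝ := if q ≤ v then (l:ℝ) + 1 else 1 - Real.log q / Real.log Y

theorem wq_nonneg (l v Y q : ℕ) (hq1 : 1 ≤ q) (hq : q ≤ Y) : 0 ≤ wq l v Y q := by
  unfold wq; split_ifs
  · positivity
  · rw [sub_nonneg]
    exact div_le_one_of_le₀ (Real.log_le_log (by exact_mod_cast hq1) (by exact_mod_cast hq)) (Real.log_natCast_nonneg Y)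

def PRM (m Y : ℕ) : Finset ℕ := (Icc 1 Y).filter (fun q => q.Prime ∧ q.Coprime m)

theorem coef (l v J T : ℕ) (hv : 2 ≤ v) (hJ : 1 ≤ J) (hT : 1 ≤ T) (hlog : 4 < 2 * J * Real.log v) :
    ∑ q ∈ PRM m (v ^ (2 * J * T)), wq l v (v ^ (2 * J * T)) q * TQ m (v ^ (2 * J)) q ≤
      UU m (v ^ (2 * J)) 2 * (3 * ((J:ℝ) ^ 2 / 2 + 6 * J * (1 / Real.log v) + l * (1 / 2 + 6 * (1 / Real.log v))) / (2 * J - 4 * (1 / Real.log v)) ^ 2 +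
        (Real.log (2 * T) - 1 + 1 / (2 * T) + 5 / J * (1 / Real.log v))) := by
  obtain ⟨u, hu⟩ : ∃ u, u = v ^ J := ⟨_, rfl⟩
  obtain ⟨R, hR⟩ : ∃ R, R = v ^ (2 * J) := ⟨_, rfl⟩
  obtain ⟨Y, hY⟩ : ∃ Y, Y = v ^ (2 * J * T) := ⟨_, rfl⟩
  rw [← hR, ← hY]
  set x := Real.log v with hx
  have hx0 : 0 < x := Real.log_pos (by exact_mod_cast hv)
  have lu : Real.log u = J * x := by rw [hu]; push_cast; rw [Real.log_pow]
  have lR : Real.log R = 2 * J * x := by rw [hR]; push_cast; rw [Real.log_pow]; push_cast; ring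
  have lY : Real.log Y = 2 * J * T * x := by rw [hY]; push_cast; rw [Real.log_pow]; push_cast; ring
  have hJ0 : (0:ℝ) < J := by exact_mod_cast hJ
  have hT0 : (0:ℝ) < T := by exact_mod_cast hT
  have hvu : v ≤ u := by rw [hu]; exact Nat.le_self_pow (by omega) v
  have huY : u ≤ Y := by
    rw [hu, hY]; refine Nat.pow_le_pow_right (by omega) ?_
    calc J ≤ J * (2 * T) := Nat.le_mul_of_pos_right J (by omega)
      _ = _ := by ring
  have hlY : 0 < Real.log Y := by rw [lY]; positivity
  set S := UU m R 0 with hS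
  set U := UU m R 2 with hU
  have hS0 : 0 ≤ S := UU_nonneg m R 0
  have hU0 : 0 ≤ U := UU_nonneg m R 2
  have step1 : ∑ q ∈ PRM m Y, wq l v Y q * TQ m R q ≤
      S * (∑ q ∈ Icc 1 u, lpr q / q * Real.log q + l * ∑ q ∈ Icc 1 v, lpr q / q * Real.log q) +
      U * ∑ q ∈ Ioc u Y, lpr q / q * (1 / Real.log q - 1 / Real.log Y) := by
    have hsplit : Icc 1 Y = Icc 1 u ∪ Ioc u Y := by ext x; simp; omega
    have hdisj : Disjoint (Icc 1 u) (Ioc u Y) := by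
      rw [Finset.disjoint_left]; intro x hx; simp at hx ⊢; omega
    rw [PRM, Finset.sum_filter, hsplit, Finset.sum_union hdisj]
    refine add_le_add ?_ ?_
    · have e : ∑ q ∈ Icc 1 v, lpr q / q * Real.log q = ∑ q ∈ Icc 1 u, if q ≤ v then lpr q / q * Real.log q else 0 := by
        rw [← Finset.sum_filter]
        refine Finset.sum_congr ?_ fun _ _ => rfl
        ext q; simp; omega
      rw [e, Finset.mul_sum, ← Finset.sum_add_distrib, Finset.mul_sum]
      refine Finset.sum_le_sum fun q hq => ?_
      have hq := mem_Icc.mp hq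
      have hlq : 0 ≤ Real.log q := Real.log_natCast_nonneg q
      split_ifs with h1 h2 h2
      · have hT := (TQ_le m R q h1.1 h1.2).2
        rw [wq, if_pos h2]
        calc ((l:ℝ) + 1) * TQ m R q ≤ (l + 1) * (S * Real.log q ^ 2 / q) := mul_le_mul_of_nonneg_left hT (by positivity)
          _ = _ := by rw [lpr, if_pos h1.1]; ring
      · have hT := (TQ_le m R q h1.1 h1.2).2
        have hw0 := wq_nonneg l v Y q hq.1 (hq.2.trans huY)
        have hw1 : wq l v Y q ≤ 1 := by
          rw [wq, if_neg h2]
          have : 0 ≤ Real.log q / Real.log Y := by positivity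
          linarith
        calc wq l v Y q * TQ m R q ≤ wq l v Y q * (S * Real.log q ^ 2 / q) := mul_le_mul_of_nonneg_left hT hw0
          _ ≤ 1 * (S * Real.log q ^ 2 / q) := mul_le_mul_of_nonneg_right hw1 (by positivity)
          _ = _ := by rw [lpr, if_pos h1.1]; ring
      · have := lpr_nonneg q; positivity
      · have := lpr_nonneg q; positivity
    · rw [Finset.mul_sum]
      refine Finset.sum_le_sum fun q hq => ?_
      have hq := mem_Ioc.mp hq
      have hq2 : 2 ≤ q := by omega
      have hlq : 0 < Real.log q := Real.log_pos (by exact_mod_cast hq2)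
      have hqle : Real.log q ≤ Real.log Y := Real.log_le_log (by positivity) (by exact_mod_cast hq.2)
      split_ifs with h1
      · have hT := (TQ_le m R q h1.1 h1.2).1
        have hw0 := wq_nonneg l v Y q (by omega) hq.2
        calc wq l v Y q * TQ m R q ≤ wq l v Y q * (U / q) := mul_le_mul_of_nonneg_left hT hw0
          _ = _ := by rw [wq, if_neg (by omega), lpr, if_pos h1.1]; field_simp
      · have h3 := lpr_nonneg q
        have h4 : 0 ≤ 1 / Real.log q - 1 / Real.log Y := by
          rw [sub_nonneg]; exact one_div_le_one_div_of_le hlq hqle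
        positivity
  have m1 := mert1 u (by omega)
  have m2 := mert1 v (by omega)
  have m3 := mert2 u Y (by omega) huY
  have hUS := UU_bound m R (by rw [lR]; linarith)
  rw [lR] at hUS
  rw [lu] at m1
  rw [← hx] at m2
  have e3 : Real.log Y / Real.log u = 2 * T := by rw [lY, lu]; field_simp
  have e4 : Real.log u / Real.log Y = 1 / (2 * T) := by rw [lY, lu]; field_simp
  have e5 : 5 / Real.log u = 5 / J * (1 / x) := by rw [lu]; field_simp
  rw [e3, e4, e5] at m3
  have hden : 0 < 2 * J - 4 * (1 / x) := by
    rw [sub_pos, mul_one_div, div_lt_iff₀ hx0]; exact hlog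
  have step2 : S * (∑ q ∈ Icc 1 u, lpr q / q * Real.log q + l * ∑ q ∈ Icc 1 v, lpr q / q * Real.log q) ≤
      U * (3 * ((J:ℝ) ^ 2 / 2 + 6 * J * (1 / x) + l * (1 / 2 + 6 * (1 / x))) / (2 * J - 4 * (1 / x)) ^ 2) := by
    have h1 : ∑ q ∈ Icc 1 u, lpr q / q * Real.log q + l * ∑ q ∈ Icc 1 v, lpr q / q * Real.log q ≤ x ^ 2 * ((J:ℝ) ^ 2 / 2 + 6 * J * (1 / x) + l * (1 / 2 + 6 * (1 / x))) := by
      have : (l:ℝ) * ∑ q ∈ Icc 1 v, lpr q / q * Real.log q ≤ l * (x ^ 2 / 2 + 6 * x) := mul_le_mul_of_nonneg_left m2 (by positivity)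
      refine (add_le_add m1 this).trans (le_of_eq ?_)
      field_simp
    have h2 : S * x ^ 2 ≤ 3 * U / (2 * J - 4 * (1 / x)) ^ 2 := by
      rw [le_div_iff₀ (by positivity)]
      refine le_trans (le_of_eq ?_) hUS
      field_simp
      exact mul_comm _ _
    calc _ ≤ S * (x ^ 2 * ((J:ℝ) ^ 2 / 2 + 6 * J * (1 / x) + l * (1 / 2 + 6 * (1 / x)))) := mul_le_mul_of_nonneg_left h1 hS0
      _ = S * x ^ 2 * ((J:ℝ) ^ 2 / 2 + 6 * J * (1 / x) + l * (1 / 2 + 6 * (1 / x))) := by ring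
      _ ≤ 3 * U / (2 * J - 4 * (1 / x)) ^ 2 * ((J:ℝ) ^ 2 / 2 + 6 * J * (1 / x) + l * (1 / 2 + 6 * (1 / x))) := mul_le_mul_of_nonneg_right h2 (by positivity)
      _ = _ := by ring
  have step3 := mul_le_mul_of_nonneg_left m3 hU0
  rw [mul_add U]
  linarith

end part19



section part20
variable {m : ℕ} [NeZero m]

theorem pos_analysis (l v Y X n : ℕ) (hv : 2 ≤ v) (hvY : v ≤ Y) (hn1 : 1 ≤ n) (hnX : n ≤ X) (hnm : n.Coprime m)
    (hno : ¬ ∃ q, v < q ∧ q * q ∣ n)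
    (hZ : 0 < ((l:ℝ) + 1 - Real.log X / Real.log Y) - ∑ q ∈ (PRM m Y).filter (fun q => q ∣ n), wq l v Y q) :
    n.primeFactorsList.length ≤ l := by
  have hlY : 0 < Real.log Y := Real.log_pos (by exact_mod_cast (show 1 < Y by omega))
  have hlX : 0 ≤ Real.log X := Real.log_natCast_nonneg X
  have hwn : ∀ q ∈ (PRM m Y).filter (fun q => q ∣ n), 0 ≤ wq l v Y q := by
    intro q hq
    have hq := mem_Icc.mp (mem_filter.mp (mem_filter.mp hq).1).1
    exact wq_nonneg l v Y q hq.1 hq.2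
  have hmem : ∀ q, q.Prime → q ∣ n → q ≤ Y → q ∈ (PRM m Y).filter (fun q => q ∣ n) := by
    intro q hq hqn hqY
    exact mem_filter.mpr ⟨mem_filter.mpr ⟨mem_Icc.mpr ⟨hq.one_lt.le, hqY⟩, hq, Nat.Coprime.coprime_dvd_left hqn hnm⟩, hqn⟩
  have hd0 : 0 ≤ Real.log X / Real.log Y := by positivity
  have h1 : ∀ q, q.Prime → q ∣ n → v < q := by
    intro q hq hqn
    by_contra hc
    have hc : q ≤ v := by omega
    have := Finset.single_le_sum hwn (hmem q hq hqn (hc.trans hvY))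
    rw [show wq l v Y q = (l:ℝ) + 1 by rw [wq, if_pos hc]] at this
    linarith
  have hsq : Squarefree n := by
    rw [Nat.squarefree_iff_prime_squarefree]
    intro p hp hpn
    exact hno ⟨p, h1 p hp ((Dvd.intro _ rfl).trans hpn), hpn⟩
  have hcard : n.primeFactorsList.length = n.primeFactors.card := by
    rw [Nat.primeFactors, List.card_toFinset, List.Nodup.dedup]
    exact (Nat.squarefree_iff_nodup_primeFactorsList (by omega)).mp hsq
  have hlog : Real.log n = ∑ p ∈ n.primeFactors, Real.log p := by
    conv_lhs => rw [← Nat.prod_primeFactors_of_squarefree hsq]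
    rw [Nat.cast_prod, Real.log_prod]
    intro p hp
    exact_mod_cast (Nat.prime_of_mem_primeFactors hp).ne_zero
  have h2 : ∑ q ∈ n.primeFactors, (1 - Real.log q / Real.log Y) ≤ ∑ q ∈ (PRM m Y).filter (fun q => q ∣ n), wq l v Y q := by
    calc _ ≤ ∑ q ∈ n.primeFactors.filter (fun q => q ≤ Y), (1 - Real.log q / Real.log Y) := by
          rw [Finset.sum_filter]
          refine Finset.sum_le_sum fun q hq => ?_
          split_ifs with h
          · exact le_rfl
          · rw [sub_nonpos, one_le_div hlY]
            exact Real.log_le_log (by exact_mod_cast (show 0 < Y by omega)) (by exact_mod_cast (show Y ≤ q by omega))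
      _ = ∑ q ∈ n.primeFactors.filter (fun q => q ≤ Y), wq l v Y q := by
          refine Finset.sum_congr rfl fun q hq => ?_
          have hq := Nat.mem_primeFactors.mp (mem_filter.mp hq).1
          have := h1 q hq.1 hq.2.1
          rw [wq, if_neg (by omega)]
      _ ≤ _ := by
          refine Finset.sum_le_sum_of_subset_of_nonneg ?_ fun q hq _ => hwn q hq
          intro q hq
          have hq' := mem_filter.mp hq
          have hq2 := Nat.mem_primeFactors.mp hq'.1
          exact hmem q hq2.1 hq2.2.1 hq'.2
  rw [Finset.sum_sub_distrib, ← Finset.sum_div, ← hlog] at h2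
  simp only [Finset.sum_const, nsmul_eq_mul, mul_one] at h2
  have h3 : Real.log n / Real.log Y ≤ Real.log X / Real.log Y := by
    refine div_le_div_of_nonneg_right (Real.log_le_log (by exact_mod_cast hn1) (by exact_mod_cast hnX)) hlY.le
  have h4 : (n.primeFactors.card : ℝ) < l + 1 := by linarith
  have h5 : n.primeFactors.card < l + 1 := by exact_mod_cast h4
  omega

theorem Psi_le (m X : ℕ) : Psi m X ≤ 2 * X := by
  have h1 : Psi m X ≤ Chebyshev.theta X := by
    rw [Psi, Chebyshev.theta, Nat.floor_natCast, Finset.sum_filter, Finset.sum_filter]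
    have : Icc 1 X = Ioc 0 X := by ext; simp [Nat.succ_le_iff]
    rw [this]
    refine Finset.sum_le_sum fun p hp => ?_
    by_cases h : p.Prime
    · by_cases h' : p.Coprime m
      · rw [if_pos h, if_pos h', lpr, if_pos h]
      · rw [if_pos h, if_neg h']; exact Real.log_natCast_nonneg p
    · rw [if_neg h]; simp [lpr, h]
  have h2 := Chebyshev.theta_le_log4_mul_x (x := X) (by positivity)
  have h3 : Real.log 4 ≤ 2 := by
    rw [show (4:ℝ) = 2 ^ 2 by norm_num, Real.log_pow]
    have := Real.log_two_lt_d9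
    push_cast; linarith
  have : Real.log 4 * X ≤ 2 * X := mul_le_mul_of_nonneg_right h3 (by positivity)
  linarith

theorem Psi_ge {Q : ℝ} (hg : Good m Q) (X : ℕ) (hX2 : X ≤ m ^ 2) (hX : 10000 * Q ^ 2 ≤ X) : (X:ℝ) / 2 ≤ Psi m X := by
  have hQ := hg.two_le
  have hm := hg.hm
  have hX1 : (1:ℝ) ≤ X := by nlinarith
  have hX1' : 1 ≤ X := by exact_mod_cast hX1
  have h1 : Chebyshev.theta X - Real.log m ≤ Psi m X := by
    have e : Icc 1 X = Ioc 0 X := by ext; simp [Nat.succ_le_iff]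
    have h2 : Chebyshev.theta X ≤ Psi m X + ∑ p ∈ m.primeFactors, Real.log p := by
      have h3 : Chebyshev.theta X = ∑ p ∈ Icc 1 X, lpr p := by
        rw [Chebyshev.theta, Nat.floor_natCast, e, Finset.sum_filter]; rfl
      rw [h3, Psi, ← Finset.sum_filter_add_sum_filter_not (s := Icc 1 X) (p := fun p => p.Coprime m)]
      refine add_le_add le_rfl ?_
      calc _ ≤ ∑ p ∈ ((Icc 1 X).filter (fun p => ¬ p.Coprime m)).filter (fun p => p.Prime), Real.log p := by
            exact (Finset.sum_filter _ _).ge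
        _ ≤ _ := by
            refine Finset.sum_le_sum_of_subset_of_nonneg ?_ fun p _ _ => Real.log_natCast_nonneg p
            intro p hp
            have hp := mem_filter.mp hp
            have hp2 := (mem_filter.mp hp.1).2
            rw [hp.2.coprime_iff_not_dvd, not_not] at hp2
            exact Nat.mem_primeFactors.mpr ⟨hp.2, hp2, by omega⟩
    have h4 : ∑ p ∈ m.primeFactors, Real.log p ≤ Real.log m := by
      rw [← Real.log_prod (fun p hp => by exact_mod_cast (Nat.prime_of_mem_primeFactors hp).ne_zero), ← Nat.cast_prod]
      have := Nat.le_of_dvd (by omega) (Nat.prod_primeFactors_dvd m)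
      exact Real.log_le_log (by exact_mod_cast Finset.prod_pos fun p hp => (Nat.prime_of_mem_primeFactors hp).pos) (by exact_mod_cast this)
    linarith
  have h2 := Chebyshev.theta_ge X
  have h3 := logX_le hg X hX2
  have h4 := hg.log
  have h5 : Real.log (X + 1) ≤ 2 * Q + 1 := by
    have : Real.log ((X:ℝ) + 1) ≤ Real.log (2 * X) := Real.log_le_log (by positivity) (by linarith)
    rw [Real.log_mul (by norm_num) (by positivity)] at this
    have := Real.log_two_lt_d9
    linarith
  have h6 := Real.log_two_gt_d9
  have hs : 100 * Q ≤ Real.sqrt X := Real.le_sqrt_of_sq_le (by nlinarith)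
  have hs2 : Real.sqrt X * Real.sqrt X = X := Real.mul_self_sqrt (by positivity)
  have h7 : 2 * Real.sqrt X * Real.log X ≤ 2 * Real.sqrt X * (2 * (Real.sqrt X / 100)) := by
    refine mul_le_mul_of_nonneg_left ?_ (by positivity)
    linarith
  have h8 : (X:ℝ) * 0.69 ≤ X * Real.log 2 := mul_le_mul_of_nonneg_left (by linarith) (by positivity)
  nlinarith

theorem sieve_upper {Q : ℝ} (hg : Good m Q) (a : ZMod m) (ha : IsUnit a) (l v Y X R : ℕ) (hv : 2 ≤ v) (hvY : v ≤ Y)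
    (hR : R ≤ m) (hX : X ≤ m ^ 2)
    (hno : ¬ ∃ p n, p.Prime ∧ p ≤ X ∧ 1 ≤ n ∧ n ≤ X ∧ n.primeFactorsList.length ≤ l ∧ ((p * n : ℕ) : ZMod m) = a)
    (c : ℕ → ℝ) (hc1 : c 1 = (l:ℝ) + 1 - Real.log X / Real.log Y) (hcq : ∀ q ∈ PRM m Y, c q = - wq l v Y q) :
    ∑ n ∈ Icc 1 X, an a X n * (∑ t ∈ (insert 1 (PRM m Y)).filter (fun t => t ∣ n), c t) * (∑ d ∈ (KS m R).filter (fun d => d ∣ n), lam m R d) ^ 2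
      ≤ ((l:ℝ) + 1) * Q ^ 10 * (2 * Q ^ 2 * ((X:ℝ) ^ 2 / (v * m) + Real.sqrt X)) := by
  classical
  have hQ := hg.two_le
  have hlY : 0 < Real.log Y := Real.log_pos (by exact_mod_cast (show 1 < Y by omega))
  have hd0 : 0 ≤ Real.log X / Real.log Y := div_nonneg (Real.log_natCast_nonneg X) hlY.le
  have h1P : 1 ∉ PRM m Y := by
    intro h; exact Nat.not_prime_one (mem_filter.mp h).2.1
  refine le_trans ?_ (mul_le_mul_of_nonneg_left (sq_bound hg a ha X v (by omega) hX) (by positivity))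
  rw [Finset.mul_sum, Finset.sum_filter]
  refine Finset.sum_le_sum fun n hn => ?_
  have hn := mem_Icc.mp hn
  have hZ : ∑ t ∈ (insert 1 (PRM m Y)).filter (fun t => t ∣ n), c t = ((l:ℝ) + 1 - Real.log X / Real.log Y) - ∑ q ∈ (PRM m Y).filter (fun q => q ∣ n), wq l v Y q := by
    rw [Finset.filter_insert, if_pos (one_dvd n), Finset.sum_insert (fun h => h1P (mem_filter.mp h).1), hc1]
    have e : ∑ q ∈ (PRM m Y).filter (fun q => q ∣ n), c q = - ∑ q ∈ (PRM m Y).filter (fun q => q ∣ n), wq l v Y q := by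
      rw [← Finset.sum_neg_distrib]
      exact Finset.sum_congr rfl fun q hq => hcq q (mem_filter.mp hq).1
    rw [e]; ring
  rw [hZ]
  have hw : 0 ≤ ∑ q ∈ (PRM m Y).filter (fun q => q ∣ n), wq l v Y q := by
    refine Finset.sum_nonneg fun q hq => ?_
    have hq := mem_Icc.mp (mem_filter.mp (mem_filter.mp hq).1).1
    exact wq_nonneg l v Y q hq.1 hq.2
  have han := an_nonneg a X n
  have hL := Lam_sq hg R n hR hn.1 (hn.2.trans (hX.trans (Nat.pow_le_pow_right (by have := hg.hm; omega) (by norm_num))))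
  have hL0 : 0 ≤ (∑ d ∈ (KS m R).filter (fun d => d ∣ n), lam m R d) ^ 2 := sq_nonneg _
  generalize (∑ d ∈ (KS m R).filter (fun d => d ∣ n), lam m R d) ^ 2 = Lq at hL hL0
  split_ifs with hb
  · calc _ ≤ an a X n * ((l:ℝ) + 1) * Lq := by
          refine mul_le_mul_of_nonneg_right (mul_le_mul_of_nonneg_left (by linarith) han) hL0
      _ ≤ an a X n * ((l:ℝ) + 1) * Q ^ 10 := mul_le_mul_of_nonneg_left hL (by positivity)
      _ = _ := by ring
  · rcases eq_or_lt_of_le han with h0 | h0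
    · rw [← h0]; simp
    · have hcop := an_cop a ha X n h0.ne'
      obtain ⟨p, hp, hpX, hpa⟩ := an_pos a X n h0
      have : ¬ (0 < ((l:ℝ) + 1 - Real.log X / Real.log Y) - ∑ q ∈ (PRM m Y).filter (fun q => q ∣ n), wq l v Y q) := by
        intro hpos
        exact hno ⟨p, n, hp, hpX, hn.1, hn.2, pos_analysis l v Y X n hv hvY hn.1 hn.2 hcop hb hpos, hpa⟩
      push Not at this
      exact mul_nonpos_of_nonpos_of_nonneg (mul_nonpos_of_nonneg_of_nonpos han this) hL0

end part20



section part21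

theorem main_fix {m : ℕ} [NeZero m] {Q : ℝ} (hg : Good m Q) (a : ZMod m) (ha : IsUnit a) (l v J T X D : ℕ) (κ E : ℝ)
    (hv : 2 ≤ v) (hJ : 1 ≤ J) (hT : 1 ≤ T) (hlog : 4 < 2 * J * Real.log v) (hvD : v ^ (2 * J * (2 + T)) ≤ D) (hD : D ≤ m)
    (hX2 : X ≤ m ^ 2) (hXQ : 10000 * Q ^ 2 ≤ X) (hκ : 0 < κ)
    (hcond : Real.log X / Real.log (v ^ (2 * J * T) : ℕ) +
      (3 * ((J:ℝ) ^ 2 / 2 + 6 * J * (1 / Real.log v) + l * (1 / 2 + 6 * (1 / Real.log v))) / (2 * J - 4 * (1 / Real.log v)) ^ 2 +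
        (Real.log (2 * T) - 1 + 1 / (2 * T) + 5 / J * (1 / Real.log v))) ≤ l + 1 - κ)
    (hE : ∑ e ∈ (Icc 1 D).filter (fun e => e.Coprime m), |EE lpr X a e| ≤ E)
    (hnum : ((l:ℝ) + 1) * Q ^ 11 * (E + D * (2 * X / m)) + ((l:ℝ) + 1) * Q ^ 10 * (2 * Q ^ 2 * ((X:ℝ) ^ 2 / (v * m) + Real.sqrt X)) < κ * ((X:ℝ) ^ 2 / (2 * m))) :
    ∃ p n, p.Prime ∧ p ≤ X ∧ 1 ≤ n ∧ n ≤ X ∧ n.primeFactorsList.length ≤ l ∧ ((p * n : ℕ) : ZMod m) = a := by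
  by_contra hno
  have hcoef := coef (m := m) l v J T hv hJ hT hlog
  have hQ := hg.two_le
  have hm := hg.hm
  have hm0 : (0:ℝ) < m := by exact_mod_cast (show 0 < m by omega)
  obtain ⟨Y, hY⟩ : ∃ Y, Y = v ^ (2 * J * T) := ⟨_, rfl⟩
  obtain ⟨R, hR⟩ : ∃ R, R = v ^ (2 * J) := ⟨_, rfl⟩
  have hx0 : 0 < Real.log v := Real.log_pos (by exact_mod_cast (show 1 < v by omega))
  have hlR : 4 < Real.log R := by
    rw [hR]; push_cast; rw [Real.log_pow]; push_cast; exact hlog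
  rw [← hY] at hcond
  rw [← hY, ← hR] at hcoef
  have hvY : v ≤ Y := by
    rw [hY]; exact Nat.le_self_pow (by positivity) v
  have hR1 : 1 ≤ R := by rw [hR]; exact Nat.one_le_pow _ _ (by omega)
  have hRRY : R * R * Y = v ^ (2 * J * (2 + T)) := by rw [hR, hY]; ring
  have hY1 : 1 ≤ Y := by omega
  have hRm : R ≤ m := by
    calc R = R * 1 * 1 := by ring
      _ ≤ R * R * Y := Nat.mul_le_mul (Nat.mul_le_mul_left _ hR1) hY1
      _ ≤ m := by rw [hRRY]; exact hvD.trans hD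
  have hlY : 0 < Real.log Y := Real.log_pos (by exact_mod_cast (show 1 < Y by omega))
  have hU : 1 ≤ UU m R 2 := by
    have := UU_two_ge m R hR1
    nlinarith
  have hd0 : 0 ≤ Real.log X / Real.log Y := div_nonneg (Real.log_natCast_nonneg X) hlY.le
  set G : ℝ := 3 * ((J:ℝ) ^ 2 / 2 + 6 * J * (1 / Real.log v) + l * (1 / 2 + 6 * (1 / Real.log v))) / (2 * J - 4 * (1 / Real.log v)) ^ 2 +
        (Real.log (2 * T) - 1 + 1 / (2 * T) + 5 / J * (1 / Real.log v)) with hG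
  have hG0 : 0 ≤ G := by
    have h1 : 1 - (2 * (T:ℝ))⁻¹ ≤ Real.log (2 * T) := Real.one_sub_inv_le_log_of_pos (by positivity)
    have h2 : 0 ≤ 5 / (J:ℝ) * (1 / Real.log v) := by positivity
    have h3 : 0 ≤ 3 * ((J:ℝ) ^ 2 / 2 + 6 * J * (1 / Real.log v) + l * (1 / 2 + 6 * (1 / Real.log v))) / (2 * J - 4 * (1 / Real.log v)) ^ 2 := by positivity
    have h4 : 1 / (2 * (T:ℝ)) = (2 * (T:ℝ))⁻¹ := one_div _
    rw [hG]; linarith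
  have h1P : 1 ∉ PRM m Y := by
    intro h; exact Nat.not_prime_one (mem_filter.mp h).2.1
  obtain ⟨c, hc⟩ : ∃ c : ℕ → ℝ, c = fun t => if t = 1 then (l:ℝ) + 1 - Real.log X / Real.log Y else - wq l v Y t := ⟨_, rfl⟩
  have hc1 : c 1 = (l:ℝ) + 1 - Real.log X / Real.log Y := by rw [hc]; simp
  have hcq : ∀ q ∈ PRM m Y, c q = - wq l v Y q := by
    intro q hq
    have : q ≠ 1 := fun h => h1P (h ▸ hq)
    rw [hc]; simp only; rw [if_neg this]
  have hup := sieve_upper hg a ha l v Y X R hv hvY hRm hX2 hno c hc1 hcq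
  have hlow := sieve_lower hg a X R D (insert 1 (PRM m Y)) c ((l:ℝ) + 1) E hRm ?_ ?_ (hD.trans (Nat.le_self_pow (by norm_num) m)) (by positivity) hE
  · have hs : κ ≤ ∑ t ∈ insert 1 (PRM m Y), c t * TQ m R t := by
      rw [Finset.sum_insert h1P, hc1, TQ_one]
      have e : ∑ q ∈ PRM m Y, c q * TQ m R q = - ∑ q ∈ PRM m Y, wq l v Y q * TQ m R q := by
        rw [← Finset.sum_neg_distrib]
        exact Finset.sum_congr rfl fun q hq => by rw [hcq q hq]; ring
      rw [e]
      have h1 : UU m R 2 * κ ≤ UU m R 2 * ((l:ℝ) + 1 - Real.log X / Real.log Y - G) := mul_le_mul_of_nonneg_left (by linarith) (by linarith)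
      have h2 : 1 * κ ≤ UU m R 2 * κ := mul_le_mul_of_nonneg_right hU hκ.le
      nlinarith
    have hP1 := Psi_le m X
    have hP2 := Psi_ge hg X hX2 hXQ
    have hX0 : (0:ℝ) ≤ X := by positivity
    have h3 : κ * ((X:ℝ) ^ 2 / (2 * m)) ≤ Psi m X * X / m * ∑ t ∈ insert 1 (PRM m Y), c t * TQ m R t := by
      have : (X:ℝ) ^ 2 / (2 * m) ≤ Psi m X * X / m := by
        rw [show (X:ℝ) ^ 2 / (2 * m) = X / 2 * X / m by field_simp]
        exact div_le_div_of_nonneg_right (mul_le_mul_of_nonneg_right hP2 hX0) hm0.le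
      rw [mul_comm]
      exact mul_le_mul this hs hκ.le (by have := Psi_nonneg m X; positivity)
    have h4 : ((l:ℝ) + 1) * Q ^ 11 * (E + D * (Psi m X / m)) ≤ ((l:ℝ) + 1) * Q ^ 11 * (E + D * (2 * X / m)) := by
      refine mul_le_mul_of_nonneg_left (add_le_add le_rfl ?_) (by positivity)
      exact mul_le_mul_of_nonneg_left (div_le_div_of_nonneg_right hP1 hm0.le) (by positivity)
    linarith
  · intro t ht
    rcases mem_insert.mp ht with rfl | ht
    · rw [hc1, abs_le]; constructor <;> linarith
    · have hq := mem_Icc.mp (mem_filter.mp ht).1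
      have h0 := wq_nonneg l v Y t hq.1 hq.2
      rw [hcq t ht, abs_neg, abs_of_nonneg h0, wq]
      have : (0:ℝ) ≤ l := by positivity
      split_ifs
      · exact le_rfl
      · have : 0 ≤ Real.log t / Real.log Y := div_nonneg (Real.log_natCast_nonneg t) hlY.le
        linarith
  · intro t ht
    rcases mem_insert.mp ht with rfl | ht
    · exact ⟨le_rfl, Nat.coprime_one_left m, le_trans (Nat.mul_le_mul_left _ hY1) (by rw [hRRY]; exact hvD)⟩
    · have hq := mem_filter.mp ht
      have hq1 := mem_Icc.mp hq.1
      exact ⟨hq1.1, hq.2.2, le_trans (Nat.mul_le_mul_left _ hq1.2) (by rw [hRRY]; exact hvD)⟩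

theorem choose_J (A B : ℝ) (l : ℕ) (h : A + 3 / 8 + B < l + 1) : ∃ J : ℕ, 1 ≤ J ∧ ∃ κ : ℝ, 0 < κ ∧ ∃ t0 : ℝ, 0 < t0 ∧ ∀ t : ℝ, 0 < t → t < t0 →
    4 * t < 2 * J ∧ A * (1 + t * Real.log 2) + (3 * ((J:ℝ) ^ 2 / 2 + 6 * J * t + l * (1 / 2 + 6 * t)) / (2 * J - 4 * t) ^ 2 + (B + 5 / J * t)) ≤ l + 1 - κ := by
  obtain ⟨g, hg⟩ : ∃ g : ℝ, g = l + 1 - (A + 3 / 8 + B) := ⟨_, rfl⟩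
  have hg0 : 0 < g := by linarith
  obtain ⟨J, hJ⟩ := exists_nat_gt ((l:ℝ) / g + 1)
  have hJ1 : (1:ℝ) < J := by
    have : 0 ≤ (l:ℝ) / g := by positivity
    linarith
  have hJ0 : (0:ℝ) < J := by linarith
  have hlg : (l:ℝ) < g * J := by
    have : (l:ℝ) / g < J := by linarith
    rw [div_lt_iff₀ hg0] at this; linarith
  obtain ⟨F, hF⟩ : ∃ F : ℝ → ℝ, F = fun t => A * (1 + t * Real.log 2) + (3 * ((J:ℝ) ^ 2 / 2 + 6 * J * t + l * (1 / 2 + 6 * t)) / (2 * J - 4 * t) ^ 2 + (B + 5 / J * t)) := ⟨_, rfl⟩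
  have hc : ContinuousAt F 0 := by
    rw [hF]
    have : (2 * (J:ℝ) - 4 * 0) ^ 2 ≠ 0 := by rw [mul_zero, sub_zero]; positivity
    refine ContinuousAt.add (by fun_prop) (ContinuousAt.add (ContinuousAt.div (by fun_prop) (by fun_prop) this) (by fun_prop))
  have hF0 : F 0 < l + 1 := by
    have e : F 0 = A + 3 / 8 + B + 3 / 8 * (l / (J:ℝ) ^ 2) := by
      rw [hF]; simp only; field_simp; ring
    have : (l:ℝ) / (J:ℝ) ^ 2 < g := by
      rw [div_lt_iff₀ (by positivity)]
      nlinarith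
    have h0 : 0 ≤ (l:ℝ) / (J:ℝ) ^ 2 := by positivity
    rw [e]; linarith
  have hev := hc.eventually (gt_mem_nhds (show F 0 < (F 0 + (l + 1)) / 2 by linarith))
  obtain ⟨t0, ht0, hb⟩ := Metric.eventually_nhds_iff.mp hev
  refine ⟨J, by exact_mod_cast hJ1.le, (l + 1 - F 0) / 2, by linarith, min t0 (1/2), by positivity, fun t ht htt => ⟨?_, ?_⟩⟩
  · have := htt.trans_le (min_le_right _ _); linarith
  · have h1 := hb (show dist t 0 < t0 by rw [Real.dist_eq, sub_zero, abs_of_pos ht]; exact htt.trans_le (min_le_left _ _))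
    rw [hF] at h1 ⊢
    simp only at h1 ⊢
    linarith

theorem ev_rpow (ρ K : ℝ) (hρ : 0 < ρ) : ∃ M : ℕ, ∀ m : ℕ, M ≤ m → K ≤ (m:ℝ) ^ ρ := by
  have := ((tendsto_rpow_atTop hρ).comp (tendsto_natCast_atTop_atTop (R := ℝ))).eventually_ge_atTop K
  obtain ⟨M, hM⟩ := Filter.eventually_atTop.mp this
  exact ⟨M, fun m hm => hM m hm⟩

end part21



section part22

theorem numerics (α δ ρ η η' κ : ℝ) (l m v X D : ℕ) (hm : 1 ≤ m) (hη : η' ≤ η) (hη1 : η' ≤ α - δ) (hη2 : η' ≤ ρ) (hη3 : η' ≤ 3 * α / 2 - 1)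
    (hκ : 0 < κ) (hv : (m:ℝ) ^ ρ / 2 ≤ v) (hX : (X:ℝ) ≤ (m:ℝ) ^ α) (hX' : (m:ℝ) ^ α / 2 ≤ X) (hD : (D:ℝ) ≤ (m:ℝ) ^ δ)
    (hbig : 80 * ((l:ℝ) + 1) / κ ≤ (m:ℝ) ^ (η' / 2)) (hQ : 1 ≤ (m:ℝ) ^ (η' / 24)) :
    ((l:ℝ) + 1) * ((m:ℝ) ^ (η' / 24)) ^ 11 * ((m:ℝ) ^ (2 * α - 1 - η) + D * (2 * X / m)) +
      ((l:ℝ) + 1) * ((m:ℝ) ^ (η' / 24)) ^ 10 * (2 * ((m:ℝ) ^ (η' / 24)) ^ 2 * ((X:ℝ) ^ 2 / (v * m) + Real.sqrt X)) < κ * ((X:ℝ) ^ 2 / (2 * m)) := by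
  have hm1 : (1:ℝ) ≤ m := by exact_mod_cast hm
  have hm0 : (0:ℝ) < m := by linarith
  have mono : ∀ {x y : ℝ}, x ≤ y → (m:ℝ) ^ x ≤ (m:ℝ) ^ y := fun h => Real.rpow_le_rpow_of_exponent_le hm1 h
  obtain ⟨q, hq⟩ : ∃ q, q = (m:ℝ) ^ (η' / 24) := ⟨_, rfl⟩
  obtain ⟨y, hy⟩ : ∃ y, y = (m:ℝ) ^ (2 * α - 1 - η') := ⟨_, rfl⟩
  have hy0 : 0 < y := by rw [hy]; positivity
  have hX0 : (0:ℝ) ≤ X := by positivity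
  have hv0 : (0:ℝ) < v := lt_of_lt_of_le (by positivity) hv
  have t1 : (m:ℝ) ^ (2 * α - 1 - η) ≤ y := by rw [hy]; exact mono (by linarith)
  have t2 : (D:ℝ) * (2 * X / m) ≤ 2 * y := by
    calc (D:ℝ) * (2 * X / m) ≤ (m:ℝ) ^ δ * (2 * (m:ℝ) ^ α / m) := by
          refine mul_le_mul hD ?_ (by positivity) (by positivity)
          exact div_le_div_of_nonneg_right (by linarith) hm0.le
      _ = 2 * (m:ℝ) ^ (δ + α - 1) := by
          rw [Real.rpow_sub hm0, Real.rpow_add hm0, Real.rpow_one]; ring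
      _ ≤ 2 * y := by
          rw [hy]; exact mul_le_mul_of_nonneg_left (mono (by linarith)) (by norm_num)
  have t3 : (X:ℝ) ^ 2 / (v * m) ≤ 2 * y := by
    calc (X:ℝ) ^ 2 / (v * m) ≤ ((m:ℝ) ^ α) ^ 2 / ((m:ℝ) ^ ρ / 2 * m) := by
          refine div_le_div₀ (by positivity) (pow_le_pow_left₀ hX0 hX 2) (by positivity) ?_
          exact mul_le_mul_of_nonneg_right hv hm0.le
      _ = 2 * (m:ℝ) ^ (2 * α - 1 - ρ) := by
          rw [Real.rpow_sub hm0, Real.rpow_sub hm0, Real.rpow_one, show 2 * α = α * (2:ℕ) by push_cast; ring, Real.rpow_mul_natCast hm0.le]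
          field_simp
      _ ≤ 2 * y := by
          rw [hy]; exact mul_le_mul_of_nonneg_left (mono (by linarith)) (by norm_num)
  have t4 : Real.sqrt X ≤ y := by
    calc Real.sqrt X ≤ Real.sqrt ((m:ℝ) ^ α) := Real.sqrt_le_sqrt hX
      _ = (m:ℝ) ^ (α / 2) := by rw [Real.sqrt_eq_rpow, ← Real.rpow_mul hm0.le]; congr 1; ring
      _ ≤ y := by rw [hy]; exact mono (by linarith)
  have hq12 : q ^ 12 * y = (m:ℝ) ^ (2 * α - 1 - η' / 2) := by
    rw [hq, hy, ← Real.rpow_mul_natCast hm0.le, ← Real.rpow_add hm0]; congr 1; push_cast; ring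
  have hq12' : (m:ℝ) ^ (2 * α - 1) = (m:ℝ) ^ (η' / 2) * (q ^ 12 * y) := by
    rw [hq12, ← Real.rpow_add hm0]; congr 1; ring
  rw [← hq] at hQ ⊢
  have e1 : ((l:ℝ) + 1) * q ^ 11 * ((m:ℝ) ^ (2 * α - 1 - η) + D * (2 * X / m)) ≤ ((l:ℝ) + 1) * q ^ 12 * (3 * y) := by
    refine mul_le_mul (mul_le_mul_of_nonneg_left (pow_le_pow_right₀ hQ (by norm_num)) (by positivity)) (by linarith) (by positivity) (by positivity)
  have e2 : ((l:ℝ) + 1) * q ^ 10 * (2 * q ^ 2 * ((X:ℝ) ^ 2 / (v * m) + Real.sqrt X)) ≤ ((l:ℝ) + 1) * q ^ 12 * (6 * y) := by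
    rw [show ((l:ℝ) + 1) * q ^ 10 * (2 * q ^ 2 * ((X:ℝ) ^ 2 / (v * m) + Real.sqrt X)) = ((l:ℝ) + 1) * q ^ 12 * (2 * ((X:ℝ) ^ 2 / (v * m) + Real.sqrt X)) by ring]
    exact mul_le_mul_of_nonneg_left (by linarith) (by positivity)
  have e3 : κ * ((m:ℝ) ^ (2 * α - 1) / 8) ≤ κ * ((X:ℝ) ^ 2 / (2 * m)) := by
    refine mul_le_mul_of_nonneg_left ?_ hκ.le
    calc (m:ℝ) ^ (2 * α - 1) / 8 = ((m:ℝ) ^ α / 2) ^ 2 / (2 * m) := by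
          rw [Real.rpow_sub hm0, Real.rpow_one, show 2 * α = α * (2:ℕ) by push_cast; ring, Real.rpow_mul_natCast hm0.le]
          field_simp; ring
      _ ≤ _ := div_le_div_of_nonneg_right (pow_le_pow_left₀ (by positivity) hX' 2) (by positivity)
  rw [div_le_iff₀ hκ] at hbig
  have hz0 : 0 < q ^ 12 * y := by positivity
  have e4 : 80 * ((l:ℝ) + 1) * (q ^ 12 * y) ≤ (m:ℝ) ^ (η' / 2) * κ * (q ^ 12 * y) := mul_le_mul_of_nonneg_right hbig hz0.le
  rw [hq12'] at e3
  have : 0 < ((l:ℝ) + 1) * (q ^ 12 * y) := by positivity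
  nlinarith

theorem main_sieve (α δ : ℝ) (l T : ℕ) (hT : 1 ≤ T) (hα : 2 / 3 < α) (hα2 : α ≤ 2) (hδ : 0 < δ) (hδ1 : δ ≤ 1) (hδα : δ < α)
    (hLD : LDP α δ) (hC : α * (2 + T) / (δ * T) + 3 / 8 + (Real.log (2 * T) - 1 + 1 / (2 * T)) < l + 1) :
    ∃ M : ℕ, ∀ m : ℕ, M ≤ m → ∀ [NeZero m], ∀ a : ZMod m, IsUnit a →
      ∃ p n : ℕ, p.Prime ∧ p ≤ ⌊(m:ℝ) ^ α⌋₊ ∧ 1 ≤ n ∧ n ≤ ⌊(m:ℝ) ^ α⌋₊ ∧ n.primeFactorsList.length ≤ l ∧ ((p * n : ℕ) : ZMod m) = a := by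
  obtain ⟨J, hJ, κ, hκ, t0, ht0, hF⟩ := choose_J _ _ l hC
  obtain ⟨η, hη, M1, hM1⟩ := hLD
  have hT0 : (0:ℝ) < T := by exact_mod_cast hT
  have hJ0 : (0:ℝ) < J := by exact_mod_cast hJ
  obtain ⟨ρ, hρ⟩ : ∃ ρ : ℝ, ρ = δ / (2 * J * (2 + T)) := ⟨_, rfl⟩
  have hρ0 : 0 < ρ := by rw [hρ]; positivity
  obtain ⟨η', hη'⟩ : ∃ η' : ℝ, η' = min (min η (α - δ)) (min ρ (3 * α / 2 - 1)) := ⟨_, rfl⟩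
  have hη0 : 0 < η' := by
    rw [hη']; refine lt_min (lt_min hη (by linarith)) (lt_min hρ0 (by linarith))
  have b1 : η' ≤ η := by rw [hη']; exact (min_le_left _ _).trans (min_le_left _ _)
  have b2 : η' ≤ α - δ := by rw [hη']; exact (min_le_left _ _).trans (min_le_right _ _)
  have b3 : η' ≤ ρ := by rw [hη']; exact (min_le_right _ _).trans (min_le_left _ _)
  have b4 : η' ≤ 3 * α / 2 - 1 := by rw [hη']; exact (min_le_right _ _).trans (min_le_right _ _)
  obtain ⟨M2, hM2⟩ := good_eventually (η' / 24) (by positivity)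
  obtain ⟨M3, hM3⟩ := ev_rpow (η' / 2) (80 * ((l:ℝ) + 1) / κ) (by positivity)
  obtain ⟨M4, hM4⟩ := ev_rpow ρ (Real.exp (1 / t0 + 1) + 4) hρ0
  obtain ⟨M5, hM5⟩ := ev_rpow (α / 2) 20000 (by linarith)
  refine ⟨max (max M1 M2) (max M3 (max M4 M5)), fun m hmM _ a ha => ?_⟩
  have g1 := hM1 m (by omega) a ha
  have hg := hM2 m (by omega)
  have g3 := hM3 m (by omega)
  have g4 := hM4 m (by omega)
  have g5 := hM5 m (by omega)
  have hm := hg.hm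
  have hm1 : (1:ℝ) ≤ m := by exact_mod_cast (show 1 ≤ m by omega)
  have hm0 : (0:ℝ) < m := by linarith
  have hQ := hg.two_le
  have mono : ∀ {x y : ℝ}, x ≤ y → (m:ℝ) ^ x ≤ (m:ℝ) ^ y := fun h => Real.rpow_le_rpow_of_exponent_le hm1 h
  obtain ⟨X, hX⟩ : ∃ X, X = ⌊(m:ℝ) ^ α⌋₊ := ⟨_, rfl⟩
  obtain ⟨D, hD⟩ : ∃ D, D = ⌊(m:ℝ) ^ δ⌋₊ := ⟨_, rfl⟩
  obtain ⟨v, hv⟩ : ∃ v, v = ⌊(m:ℝ) ^ ρ⌋₊ := ⟨_, rfl⟩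
  rw [← hX] at g1 ⊢
  rw [← hD] at g1
  have hXle : (X:ℝ) ≤ (m:ℝ) ^ α := by rw [hX]; exact Nat.floor_le (by positivity)
  have hDle : (D:ℝ) ≤ (m:ℝ) ^ δ := by rw [hD]; exact Nat.floor_le (by positivity)
  have hvle : (v:ℝ) ≤ (m:ℝ) ^ ρ := by rw [hv]; exact Nat.floor_le (by positivity)
  have hXgt : (m:ℝ) ^ α < X + 1 := by rw [hX]; exact Nat.lt_floor_add_one _
  have hvgt : (m:ℝ) ^ ρ < v + 1 := by rw [hv]; exact Nat.lt_floor_add_one _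
  have hexp := Real.exp_pos (1 / t0 + 1)
  have hv3 : (3:ℝ) ≤ v := by linarith
  have hv3' : 3 ≤ v := by exact_mod_cast hv3
  have hlv : 1 / t0 < Real.log v := by
    have : 1 / t0 + 1 ≤ Real.log v := by
      rw [Real.le_log_iff_exp_le (by linarith)]; linarith
    linarith
  have hlv0 : 0 < Real.log v := lt_trans (by positivity) hlv
  have ht : 1 / Real.log v < t0 := by
    rw [div_lt_iff₀ hlv0]; rw [div_lt_iff₀ ht0] at hlv; linarith
  obtain ⟨hF1, hF2⟩ := hF (1 / Real.log v) (by positivity) ht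
  have hαbig : 20000 * (m:ℝ) ^ (η' / 24 * 2) ≤ (m:ℝ) ^ α := by
    calc 20000 * (m:ℝ) ^ (η' / 24 * 2) ≤ (m:ℝ) ^ (α / 2) * (m:ℝ) ^ (α / 2) := by
          refine mul_le_mul g5 (mono ?_) (by positivity) (by positivity)
          linarith
      _ = _ := by rw [← Real.rpow_add hm0]; congr 1; ring
  have hQ2 : ((m:ℝ) ^ (η' / 24)) ^ 2 = (m:ℝ) ^ (η' / 24 * 2) := by
    rw [show η' / 24 * 2 = η' / 24 * (2:ℕ) by push_cast; ring, Real.rpow_mul_natCast hm0.le]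
  have hQ4 : 4 ≤ (m:ℝ) ^ (η' / 24 * 2) := by rw [← hQ2]; nlinarith
  have hX' : (m:ℝ) ^ α / 2 ≤ X := by linarith
  refine main_fix hg a ha l v J T X D κ _ (by omega) hJ hT ?_ ?_ ?_ ?_ ?_ hκ ?_ g1 ?_
  · rw [mul_one_div, div_lt_iff₀ hlv0] at hF1; exact hF1
  · rw [hD]
    refine Nat.le_floor ?_
    push_cast
    calc (v:ℝ) ^ (2 * J * (2 + T)) ≤ ((m:ℝ) ^ ρ) ^ (2 * J * (2 + T)) := pow_le_pow_left₀ (by positivity) hvle _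
      _ = (m:ℝ) ^ δ := by
          rw [← Real.rpow_mul_natCast hm0.le, hρ]; congr 1; push_cast; field_simp
  · have : (D:ℝ) ≤ m := hDle.trans ((mono hδ1).trans (by rw [Real.rpow_one]))
    exact_mod_cast this
  · have : (X:ℝ) ≤ (m:ℝ) ^ 2 := hXle.trans ((mono hα2).trans (by norm_cast))
    exact_mod_cast this
  · rw [hQ2]; linarith
  · refine le_trans (add_le_add ?_ le_rfl) hF2
    have hX0 : (0:ℝ) < X := by linarith
    have h1 : Real.log X ≤ α * Real.log m := by
      rw [← Real.log_rpow hm0]; exact Real.log_le_log hX0 hXle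
    have h2 : ρ * Real.log m ≤ Real.log v + Real.log 2 := by
      rw [← Real.log_rpow hm0, ← Real.log_mul (by linarith) (by norm_num)]
      exact Real.log_le_log (by positivity) (by linarith)
    push_cast
    rw [Real.log_pow]
    push_cast
    rw [div_le_iff₀ (by positivity)]
    have e : α * (2 + T) / (δ * T) * (1 + 1 / Real.log v * Real.log 2) * (2 * J * T * Real.log v) = α / ρ * (Real.log v + Real.log 2) := by
      rw [hρ]; field_simp
    rw [e]
    calc Real.log X ≤ α * Real.log m := h1
      _ = α / ρ * (ρ * Real.log m) := by field_simp
      _ ≤ _ := mul_le_mul_of_nonneg_left h2 (by positivity)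
  · exact numerics α δ ρ η η' κ l m v X D (by omega) b1 b2 b3 b4 hκ (by linarith) hXle hX' hDle g3 (by linarith)

end part22



section part23

theorem transfer (α' δ : ℝ) (l' T : ℕ) (hT : 1 ≤ T) (hα' : 2 / 3 < α') (hα2 : α' ≤ 2) (hδ : 0 < δ) (hδ1 : δ ≤ 1) (hδα : δ < α')
    (hLD : LDP α' δ) (hC : α' * (2 + T) / (δ * T) + 3 / 8 + (Real.log (2 * T) - 1 + 1 / (2 * T)) < l' + 1)
    (l : ℕ) (hl : l' ≤ l) (α : ℝ) (hα : α' ≤ α) (ε : ℝ) (hε : 0 < ε) :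
    ∃ M : ℕ, ∀ m : ℕ, M ≤ m → ∀ a : ℤ, Int.gcd a m = 1 →
      ∃ p s : ℕ, p.Prime ∧ (p : ℝ) ≤ (m : ℝ) ^ (α + ε) ∧
        0 < s ∧ (s : ℝ) ≤ (m : ℝ) ^ (α + ε) ∧ s.primeFactorsList.length ≤ l ∧
        ((p * s : ℕ) : ℤ) ≡ a [ZMOD (m : ℤ)] := by
  obtain ⟨M, hM⟩ := main_sieve α' δ l' T hT hα' hα2 hδ hδ1 hδα hLD hC
  refine ⟨max M 1, fun m hm a ha => ?_⟩
  have hm1 : 1 ≤ m := by omega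
  haveI : NeZero m := ⟨by omega⟩
  have hu : IsUnit (a : ZMod m) := by
    rw [ZMod.coe_int_isUnit_iff_isCoprime, Int.isCoprime_iff_gcd_eq_one, Int.gcd_comm]
    exact ha
  obtain ⟨p, n, hp, hpX, hn, hnX, hlen, heq⟩ := hM m (by omega) (a : ZMod m) hu
  have hb : ∀ k : ℕ, k ≤ ⌊(m:ℝ) ^ α'⌋₊ → (k:ℝ) ≤ (m:ℝ) ^ (α + ε) := by
    intro k hk
    have h1 : (k:ℝ) ≤ (m:ℝ) ^ α' := (Nat.le_floor_iff (by positivity)).mp hk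
    exact h1.trans (Real.rpow_le_rpow_of_exponent_le (by exact_mod_cast hm1) (by linarith))
  refine ⟨p, n, hp, hb p hpX, hn, hb n hnX, hlen.trans hl, ?_⟩
  rw [← ZMod.intCast_eq_intCast_iff]
  rw [← heq]
  push_cast
  rfl

theorem log_two_mul_pow (T k : ℕ) (h : T = 2 ^ k) : Real.log (2 * T) = (k + 1) * Real.log 2 := by
  rw [h, show (2:ℝ) * ((2 ^ k : ℕ) : ℝ) = 2 ^ (k + 1) by push_cast; ring, Real.log_pow]; push_cast; ring

end part23

theorem stmt_4 (l : ℕ) (hl : 3 ≤ l) (α : ℝ)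
    (hα : α = 16 * greavesTheta l / (17 * greavesTheta l - 16)) :
    ∀ ε : ℝ, 0 < ε → ∃ M : ℕ, ∀ m : ℕ, M ≤ m → ∀ a : ℤ, Int.gcd a m = 1 →
      ∃ p s : ℕ, p.Prime ∧ (p : ℝ) ≤ (m : ℝ) ^ (α + ε) ∧
        0 < s ∧ (s : ℝ) ≤ (m : ℝ) ^ (α + ε) ∧ s.primeFactorsList.length ≤ l ∧
        ((p * s : ℕ) : ℤ) ≡ a [ZMOD (m : ℤ)] := by
  intro ε hε
  have hlr : (3:ℝ) ≤ l := by exact_mod_cast hl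
  have hd : 0.074267 ≤ greavesDelta l := by
    unfold greavesDelta
    rw [if_neg (by omega)]; split_ifs <;> norm_num
  have hd2 : greavesDelta l ≤ 0.124821 := by
    unfold greavesDelta
    rw [if_neg (by omega)]; split_ifs <;> norm_num
  have hθ : greavesTheta l = l - greavesDelta l := rfl
  have hden : 0 < 17 * greavesTheta l - 16 := by rw [hθ]; linarith
  have key : ∀ c : ℝ, c * (17 * greavesTheta l - 16) ≤ 16 * greavesTheta l → c ≤ α := by
    intro c h; rw [hα, le_div_iff₀ hden]; exact h
  have l2 := Real.log_two_lt_d9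
  have L4 := log_two_mul_pow 4 2 (by norm_num)
  have L16 := log_two_mul_pow 16 4 (by norm_num)
  have L32 := log_two_mul_pow 32 5 (by norm_num)
  have L64 := log_two_mul_pow 64 6 (by norm_num)
  have L128 := log_two_mul_pow 128 7 (by norm_num)
  by_cases h3 : l = 3
  · refine transfer 1.387 0.886 3 4 (by norm_num) (by norm_num) (by norm_num) (by norm_num) (by norm_num) (by norm_num)
      (LD_A _ _ (by norm_num) (by norm_num) (by norm_num) (by norm_num) (by norm_num)) ?_ l hl α (key _ ?_) ε hε
    · rw [L4]; push_cast; linarith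
    · have : (l:ℝ) = 3 := by exact_mod_cast h3
      rw [hθ]; linarith
  by_cases h16 : l ≤ 16
  · refine transfer 1.0004 0.5003 4 4 (by norm_num) (by norm_num) (by norm_num) (by norm_num) (by norm_num) (by norm_num)
      (LD_A _ _ (by norm_num) (by norm_num) (by norm_num) (by norm_num) (by norm_num)) ?_ l (by omega) α (key _ ?_) ε hε
    · rw [L4]; push_cast; linarith
    · have : greavesTheta l ≤ 15.8752 := by
        by_cases h15 : l ≤ 15
        · have : (l:ℝ) ≤ 15 := by exact_mod_cast h15
          rw [hθ]; linarith
        · have e : l = 16 := by omega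
          have : (l:ℝ) = 16 := by exact_mod_cast e
          have hd3 : greavesDelta l = 0.124821 := by
            unfold greavesDelta
            rw [if_neg (by omega), if_neg (by omega), if_neg (by omega)]
          rw [hθ, hd3, this]; norm_num
      linarith
  have hd3 : greavesDelta l = 0.124821 := by
    unfold greavesDelta
    rw [if_neg (by omega), if_neg (by omega), if_neg (by omega)]
  rw [hd3] at hθ
  by_cases h18 : l ≤ 18
  · refine transfer (1 - 0.0066) 0.112 17 16 (by norm_num) (by norm_num) (by norm_num) (by norm_num) (by norm_num) (by norm_num)
      (LD_B _ _ (by norm_num) (by norm_num) (by norm_num) (by norm_num)) ?_ l (by omega) α (key _ ?_) ε hε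
    · rw [L16]; push_cast; linarith
    · have : (l:ℝ) ≤ 18 := by exact_mod_cast h18
      rw [hθ]; linarith
  by_cases h33 : l ≤ 33
  · refine transfer (1 - 0.0312) 0.0639 19 32 (by norm_num) (by norm_num) (by norm_num) (by norm_num) (by norm_num) (by norm_num)
      (LD_B _ _ (by norm_num) (by norm_num) (by norm_num) (by norm_num)) ?_ l (by omega) α (key _ ?_) ε hε
    · rw [L32]; push_cast; linarith
    · have : (l:ℝ) ≤ 33 := by exact_mod_cast h33
      rw [hθ]; linarith
  by_cases h79 : l ≤ 79
  · refine transfer (1 - 0.0475) 0.0338 34 64 (by norm_num) (by norm_num) (by norm_num) (by norm_num) (by norm_num) (by norm_num)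
      (LD_B _ _ (by norm_num) (by norm_num) (by norm_num) (by norm_num)) ?_ l (by omega) α (key _ ?_) ε hε
    · rw [L64]; push_cast; linarith
    · have : (l:ℝ) ≤ 79 := by exact_mod_cast h79
      rw [hθ]; linarith
  refine transfer (1 - 1 / 17) 0.0129 80 128 (by norm_num) (by norm_num) (by norm_num) (by norm_num) (by norm_num) (by norm_num)
      (LD_B _ _ (by norm_num) (by norm_num) (by norm_num) (by norm_num)) ?_ l (by omega) α (key _ ?_) ε hε
  · rw [L128]; push_cast; linarith
  · linarith
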